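/- Let n ≥ 1, let ν ∈ ℂ^n be regular and let y ∈ (ℝ_{>0})^n. Then W̃^n_ν(y) = Σ_{w ∈ W_n} Γ_n(wν) · M̃^n_{wν}(y), where the sum runs over the Weyl group W_n of type B_n. -/

import Mathlib

noncomputable section

open MeasureTheory Finset

namespace SO

/-- Extend a `Fin n`-indexed real tuple to a `1`-based function on `ℕ` (default value `0`). -/
def extR (n : ℕ) (t : Fin n → ℝ) : ℕ → ℝ :=
  fun i => if h : 1 ≤ i ∧ i ≤ n then t ⟨i - 1, by omega⟩ else 0

/-- Extend a `Fin n`-indexed tuple of naturals to a `1`-based function on `ℕ` (default `0`). -/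
def extN (n : ℕ) (t : Fin n → ℕ) : ℕ → ℕ :=
  fun i => if h : 1 ≤ i ∧ i ≤ n then t ⟨i - 1, by omega⟩ else 0

/-- The quadratic form `q_n(m, ν)`. -/
def qB (n : ℕ) (m : ℕ → ℕ) (ν : ℕ → ℂ) : ℂ :=
  (∑ i ∈ Finset.Icc 1 (n - 1), ((m i : ℂ)) ^ 2) + (1 / 2) * (m n : ℂ) ^ 2
    - (∑ i ∈ Finset.Icc 1 (n - 1), (m i : ℂ) * (m (i + 1) : ℂ))
    + (∑ i ∈ Finset.Icc 1 (n - 1), (ν i - ν (i + 1)) * (m i : ℂ))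
    + ν n * (m n : ℂ)

/-- Decrement the `i`-th coordinate by one. -/
def dec (m : ℕ → ℕ) (i : ℕ) : ℕ → ℕ := Function.update m i (m i - 1)

/-- Auxiliary (fuel-indexed) recursion computing the coefficients `c_{n,m}(ν)`. -/
def cAux (n : ℕ) (ν : ℕ → ℂ) : ℕ → (ℕ → ℕ) → ℂ
  | 0, _ => 1
  | d + 1, m =>
      ((∑ i ∈ Finset.Icc 1 (n - 1), if m i = 0 then 0 else cAux n ν d (dec m i))
        + (1 / 2) * (if m n = 0 then 0 else cAux n ν d (dec m n))) / qB n m ν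

/-- The coefficients `c_{n,m}(ν)`, determined by `c_{n,0} = 1` and the recurrence
`q_n(m,ν) c_{n,m}(ν) = ∑_{i=1}^{n-1} c_{n,m-e_i}(ν) + (1/2) c_{n,m-e_n}(ν)`. -/
def cB (n : ℕ) (ν : ℕ → ℂ) (m : ℕ → ℕ) : ℂ :=
  cAux n ν (∑ i ∈ Finset.Icc 1 n, m i) m

/-- Pochhammer symbol `(a)_k = Γ(a+k)/Γ(a)` for `k ∈ ℤ`. -/
def poch (a : ℂ) (k : ℤ) : ℂ := Complex.Gamma (a + k) / Complex.Gamma a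

/-- `z! ∈ ℂ` for `z ∈ ℤ`, with value `0` at negative integers (so that a factor `1/zfact z`
kills a summand containing the factorial of a negative integer). -/
def zfact (z : ℤ) : ℂ := if 0 ≤ z then (Nat.factorial z.toNat : ℂ) else 0

/-- `Γ_n(ν) = ∏_{1≤i<j≤n} Γ(-ν_i-ν_j)Γ(-ν_i+ν_j) ∏_{i=1}^n Γ(-2ν_i)`. -/
def GammaN (n : ℕ) (ν : ℕ → ℂ) : ℂ :=
  (∏ i ∈ Finset.Icc 1 n, ∏ j ∈ Finset.Icc (i + 1) n,
      Complex.Gamma (-ν i - ν j) * Complex.Gamma (-ν i + ν j)) *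
    ∏ i ∈ Finset.Icc 1 n, Complex.Gamma (-(2 * ν i))

/-- The Weyl group of type `B_n`: pairs of a permutation and a sign change. -/
abbrev SignedPerm (n : ℕ) := Equiv.Perm (Fin n) × (Fin n → Bool)

/-- Action of a signed permutation on `ν ∈ ℂ^n` (1-based indexing). -/
def wAct (n : ℕ) (w : SignedPerm n) (ν : ℕ → ℂ) : ℕ → ℂ :=
  fun i =>
    if h : 1 ≤ i ∧ i ≤ n then
      (if w.2 ⟨i - 1, by omega⟩ then -1 else 1) * ν ((w.1 ⟨i - 1, by omega⟩ : Fin n).val + 1)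
    else ν i

/-- Regularity of `ν ∈ ℂ^n`. -/
def Regular (n : ℕ) (ν : ℕ → ℂ) : Prop :=
  (∀ w : SignedPerm n, ∀ m : ℕ → ℕ,
      0 < ∑ i ∈ Finset.Icc 1 n, m i → qB n m (wAct n w ν) ≠ 0) ∧
    ∀ w w' : SignedPerm n, w ≠ w' →
      ¬ ∀ i ∈ Finset.Icc 1 n, ∃ k : ℤ, wAct n w ν i - wAct n w' ν i = (k : ℂ)

/-- The fundamental Whittaker power series `M̃^n_ν(y)`. -/
def Mt (n : ℕ) (ν : ℕ → ℂ) (y : ℕ → ℝ) : ℂ :=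
  ∑' m : Fin n → ℕ,
    cB n ν (extN n m) *
      ∏ i ∈ Finset.Icc 1 n,
        ((Real.pi * y i : ℝ) : ℂ) ^ (2 * ((extN n m i : ℂ) + ∑ j ∈ Finset.Icc 1 i, ν j))

/-- The modified Bessel function `K_s(z)` (for `Re z > 0`). -/
def besselK (s z : ℂ) : ℂ :=
  (1 / 2) * ∫ t in Set.Ioi (0 : ℝ),
    Complex.exp (-(z / 2) * ((t : ℂ) + 1 / (t : ℂ))) * (t : ℂ) ^ s / (t : ℂ)

/-- The positive orthant in `(ℝ)^n`. -/
def posSet (n : ℕ) : Set (Fin n → ℝ) := {t | ∀ i, 0 < t i}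

/-- The integrand in the recursive definition of `W̃^N_ν(y)`; `W` stands for `W̃^{N-1}_ν̃`. -/
def WtKernel (N : ℕ) (ν : ℕ → ℂ) (y : ℕ → ℝ) (W : (ℕ → ℝ) → ℂ)
    (t : Fin N → ℝ) (u : Fin (N - 1) → ℝ) : ℂ :=
  ((∏ i ∈ Finset.Icc 1 N,
      Real.exp (-(Real.pi * y i) ^ 2 * extR N t i - 1 / extR N t i) : ℝ) : ℂ) *
    (∏ i ∈ Finset.Icc 1 N, ((Real.pi * y i : ℝ) : ℂ) ^ (2 * ν N)) *
    ((∏ i ∈ Finset.Icc 1 (N - 1),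
        Real.exp (-(Real.pi * y i) ^ 2 * (extR N t i / extR N t (i + 1)) * extR (N - 1) u i
          - 1 / extR (N - 1) u i) : ℝ) : ℂ) *
    ((extR N t 1 : ℝ) : ℂ) ^ (2 * ν N) *
    (∏ i ∈ Finset.Icc 1 (N - 1),
      ((extR N t (i + 1) * extR (N - 1) u i : ℝ) : ℂ) ^ (ν N)) *
    W (fun j => if j = N - 1 then y N * Real.sqrt (extR N t N / extR (N - 1) u (N - 1))
        else y (j + 1) * Real.sqrt (extR N t (j + 1) * extR (N - 1) u (j + 1) /
          (extR N t (j + 2) * extR (N - 1) u j))) *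
    (((∏ i ∈ Finset.Icc 1 (N - 1), extR (N - 1) u i)⁻¹ : ℝ) : ℂ) *
    (((∏ i ∈ Finset.Icc 1 N, extR N t i)⁻¹ : ℝ) : ℂ)

/-- The class one Whittaker function `W̃^n_ν(y)`, defined recursively. -/
def Wt : ℕ → (ℕ → ℂ) → (ℕ → ℝ) → ℂ
  | 0, _, _ => 0
  | 1, ν, y => 2 * besselK (2 * ν 1) (2 * Real.pi * y 1)
  | n + 2, ν, y =>
      ∫ t in posSet (n + 2), ∫ u in posSet (n + 1),
        WtKernel (n + 2) ν y (fun z => Wt (n + 1) ν z) t u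

/-- The auxiliary function `V_ν(x)`. -/
def Vnu (n : ℕ) (ν : ℕ → ℂ) (x : ℕ → ℝ) : ℂ :=
  ∫ u in posSet (n - 1),
    ((∏ i ∈ Finset.Icc 1 (n - 1),
        Real.exp (-(Real.pi * x i) ^ 2 * extR (n - 1) u i - 1 / extR (n - 1) u i) : ℝ) : ℂ) *
      (∏ i ∈ Finset.Icc 1 n, ((Real.pi * x i : ℝ) : ℂ) ^ (2 * ν n)) *
      (∏ i ∈ Finset.Icc 1 (n - 1), ((extR (n - 1) u i : ℝ) : ℂ) ^ (ν n)) *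
      Wt (n - 1) ν (fun j => if j = n - 1 then x n * Real.sqrt (1 / extR (n - 1) u (n - 1))
          else x (j + 1) * Real.sqrt (extR (n - 1) u (j + 1) / extR (n - 1) u j)) *
      (((∏ i ∈ Finset.Icc 1 (n - 1), extR (n - 1) u i)⁻¹ : ℝ) : ℂ)

/-- The coefficients `b_l(ν)` (zero unless all `l_i ≥ 0` and `l_{n-1} ≥ l_n`). -/
def bB (n : ℕ) (ν : ℕ → ℂ) (l : ℕ → ℤ) : ℂ :=
  if (∀ i ∈ Finset.Icc 1 n, 0 ≤ l i) ∧ l n ≤ l (n - 1) then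
    (-1 : ℂ) ^ (l n) *
      ∑' k : Fin (n - 2) → ℕ,
        cB (n - 1) ν (fun i => if i = n - 1 then (l n).toNat else extN (n - 2) k i) /
          ((∏ i ∈ Finset.Icc 1 (n - 2), zfact (l i - (extN (n - 2) k i : ℤ))) *
            zfact (l (n - 1) - l n) *
            ∏ i ∈ Finset.Icc 1 (n - 1),
              poch (ν i - ν n + 1) (l i - (extN (n - 2) k (i - 1) : ℤ)))
  else 0

/-- The coefficients `b^P_l(ν)` (zero unless all `l_i ≥ 0` and `l_{n-1} ≥ l_n`). -/
def bP (n : ℕ) (P : Finset ℕ) (ν : ℕ → ℂ) (l : ℕ → ℤ) : ℂ :=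
  if (∀ i ∈ Finset.Icc 1 n, 0 ≤ l i) ∧ l n ≤ l (n - 1) then
    (-1 : ℂ) ^ (l n) *
      ∑' k : Fin (n - 2) → ℕ,
        cB (n - 1) ν (fun i => if i = n - 1 then (l n).toNat else extN (n - 2) k i) /
          ((∏ i ∈ (Finset.Icc 1 (n - 2)).filter (· ∈ P),
              zfact (l i - (extN (n - 2) k i : ℤ)) *
                poch (ν i - ν n + 1) (l i - (extN (n - 2) k (i - 1) : ℤ))) *
            (∏ i ∈ (Finset.Icc 1 (n - 2)).filter (· ∉ P),
              zfact (l i - (extN (n - 2) k (i - 1) : ℤ)) *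
                poch (-ν i + ν n + 1) (l i - (extN (n - 2) k i : ℤ))) *
            (if n - 1 ∈ P then
                zfact (l (n - 1) - l n) *
                  poch (ν (n - 1) - ν n + 1) (l (n - 1) - (extN (n - 2) k (n - 2) : ℤ))
              else
                zfact (l (n - 1) - (extN (n - 2) k (n - 2) : ℤ)) *
                  poch (-ν (n - 1) + ν n + 1) (l (n - 1) - l n)))
  else 0

/-- `ν^{(p)} = (ν_1, …, ν_{p-1}, ν_n, ν_p, …, ν_{n-1})`. -/
def nuP (n p : ℕ) (ν : ℕ → ℂ) : ℕ → ℂ :=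
  fun i => if i < p then ν i else if i = p then ν n else ν (i - 1)

/-- `ν̄^{(q)} = (ν_1, …, ν_{q-1}, -ν_n, ν_q, …, ν_{n-1})`. -/
def nuBar (n q : ℕ) (ν : ℕ → ℂ) : ℕ → ℂ :=
  fun i => if i < q then ν i else if i = q then -ν n else ν (i - 1)

/-- `Γ^P(ν)`. -/
def GammaP (n : ℕ) (P : Finset ℕ) (ν : ℕ → ℂ) : ℂ :=
  GammaN (n - 1) ν *
    (∏ i ∈ (Finset.Icc 1 (n - 1)).filter (· ∈ P), Complex.Gamma (-ν i + ν n)) *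
    ∏ i ∈ (Finset.Icc 1 (n - 1)).filter (· ∉ P), Complex.Gamma (ν i - ν n)

/-- `Γ^p(ν) = Γ^P(ν)` with `P = {1, …, p-1}`. -/
def Gammap (n p : ℕ) (ν : ℕ → ℂ) : ℂ := GammaP n (Finset.Icc 1 (p - 1)) ν

/-- `b^p_l(ν) = b^P_l(ν)` with `P = {1, …, p-1}`. -/
def bp (n p : ℕ) (ν : ℕ → ℂ) (l : ℕ → ℤ) : ℂ := bP n (Finset.Icc 1 (p - 1)) ν l

/-- `Γ^{p,Q}(ν)`. -/
def GammaPQ (n p : ℕ) (Q : Finset ℕ) (ν : ℕ → ℂ) : ℂ :=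
  Gammap n p ν *
    (∏ i ∈ (Finset.Icc 1 n).filter (· ∈ Q), Complex.Gamma (-(nuP n p ν i) - ν n)) *
    ∏ i ∈ (Finset.Icc 1 n).filter (· ∉ Q), Complex.Gamma (nuP n p ν i + ν n)

/-- The coefficients `c^{p,Q}_m(ν)` (zero if some `m_i < 0`). -/
def cPQ (n p : ℕ) (Q : Finset ℕ) (ν : ℕ → ℂ) (m : ℕ → ℤ) : ℂ :=
  if ∀ i ∈ Finset.Icc 1 n, 0 ≤ m i then
    ∑' l : Fin n → ℕ,
      (-1 : ℂ) ^ ((extN n l n : ℤ)) * bp n p ν (fun i => (extN n l i : ℤ)) /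
        ((∏ i ∈ (Finset.Icc 1 n).filter (· ∈ Q),
            zfact (m i - (extN n l i : ℤ)) *
              poch (nuP n p ν i + ν n + 1) (m i - (extN n l (i - 1) : ℤ))) *
          ∏ i ∈ (Finset.Icc 1 n).filter (· ∉ Q),
            zfact (m i - (extN n l (i - 1) : ℤ)) *
              poch (-(nuP n p ν i) - ν n + 1) (m i - (extN n l i : ℤ)))
  else 0

/-- The power series `M̃^{p,Q}_ν(y)`. -/
def MPQ (n p : ℕ) (Q : Finset ℕ) (ν : ℕ → ℂ) (y : ℕ → ℝ) : ℂ :=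
  ∑' m : Fin n → ℕ,
    cPQ n p Q ν (fun i => (extN n m i : ℤ)) *
      (∏ i ∈ (Finset.Icc 1 n).filter (· ∈ Q),
        ((Real.pi * y i : ℝ) : ℂ) ^
          (2 * ((extN n m i : ℂ) + ∑ j ∈ Finset.Icc 1 i, nuP n p ν j))) *
      ∏ i ∈ (Finset.Icc 1 n).filter (· ∉ Q),
        ((Real.pi * y i : ℝ) : ℂ) ^
          (2 * ((extN n m i : ℂ) + ∑ j ∈ Finset.Icc 1 (i - 1), nuP n p ν j - ν n))

/-- The Mellin-transform integrand. -/
def Tintegrand (n : ℕ) (ν : ℕ → ℂ) (s : ℕ → ℂ) (y : Fin n → ℝ) : ℂ :=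
  Wt n ν (extR n y) *
    (∏ i ∈ Finset.Icc 1 n, ((Real.pi * extR n y i : ℝ) : ℂ) ^ (2 * s i)) *
    (((∏ i ∈ Finset.Icc 1 n, extR n y i)⁻¹ : ℝ) : ℂ)

/-- The multiple Mellin transform `T^n_ν(s)` of the class one Whittaker function. -/
def Tn (n : ℕ) (ν : ℕ → ℂ) (s : ℕ → ℂ) : ℂ := ∫ y in posSet n, Tintegrand n ν s y


/-- Cauchy estimate for the Frechet derivative. -/
lemma norm_fderiv_le_of_bound {E : Type*} [NormedAddCommGroup E] [NormedSpace ℂ E]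
    {f : E → ℂ} (hf : Differentiable ℂ f) {e : E} {C : ℝ} (hC : 0 ≤ C)
    (hb : ∀ e', ‖e' - e‖ ≤ 1 → ‖f e'‖ ≤ C) : ‖fderiv ℂ f e‖ ≤ C := by
  refine ContinuousLinearMap.opNorm_le_of_unit_norm hC fun v hv => ?_
  have h1 : HasDerivAt (fun z : ℂ => f (e + z • v)) (fderiv ℂ f e v) 0 := by
    have h2 : HasDerivAt (fun z : ℂ => e + z • v) v 0 := by
      simpa using ((hasDerivAt_id (0 : ℂ)).smul_const v).const_add e
    have h3 : HasFDerivAt f (fderiv ℂ f e) (e + (0 : ℂ) • v) := by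
      simpa using (hf e).hasFDerivAt
    exact h3.comp_hasDerivAt (0 : ℂ) h2
  have h4 := Complex.norm_deriv_le_of_forall_mem_sphere_norm_le (c := (0 : ℂ)) (R := 1) (C := C)
    (f := fun z : ℂ => f (e + z • v)) one_pos
    (Differentiable.diffContOnCl (by fun_prop)) (by
      intro z hz
      apply hb
      have : ‖z‖ = 1 := by simpa using hz
      simp [norm_smul, hv, this])
  rw [h1.deriv] at h4
  simpa using h4

/-- Holomorphic dependence of integrals on parameters. -/
lemma diff_param {E : Type*} [NormedAddCommGroup E] [NormedSpace ℂ E] [FiniteDimensional ℂ E]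
    {α : Type*} [TopologicalSpace α] [MeasurableSpace α] [BorelSpace α]
    [SecondCountableTopologyEither α ℂ]
    (μ : Measure α) (f : E → α → ℂ) (hc : Continuous fun p : α × E => f p.2 p.1)
    (hd : ∀ s, Differentiable ℂ fun e => f e s)
    (hb : ∀ R : ℝ, ∃ g : α → ℝ, Integrable g μ ∧ ∀ᵐ s ∂μ, ∀ e, ‖e‖ ≤ R → ‖f e s‖ ≤ g s) :
    Differentiable ℂ fun e => ∫ s, f e s ∂μ := by
  intro e0
  obtain ⟨g, hg, hgb⟩ := hb (‖e0‖ + 2)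
  have hcs : ∀ e, AEStronglyMeasurable (fun s => f e s) μ := fun e =>
    (hc.comp (by fun_prop : Continuous fun s : α => (s, e))).aestronglyMeasurable
  refine (hasFDerivAt_integral_of_dominated_of_fderiv_le (𝕜 := ℂ) (F := f)
    (F' := fun e s => fderiv ℂ (fun e => f e s) e)
    (Metric.ball_mem_nhds e0 one_pos) (bound := g) (.of_forall hcs) ?_ ?_ ?_ hg
    (.of_forall fun s e _ => (hd s e).hasFDerivAt)).differentiableAt
  · exact hg.mono' (hcs e0) (hgb.mono fun s hs => hs e0 (by linarith))
  · haveI : ProperSpace E := FiniteDimensional.proper ℂ E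
    borelize E
    have := measurable_fderiv_with_param ℂ (f := fun s e => f e s) hc
    have h2 : Measurable fun s : α => fderiv ℂ (fun e => f e s) e0 :=
      this.comp (by fun_prop : Measurable fun s : α => (s, e0))
    have : SecondCountableTopology (E →L[ℂ] ℂ) := by
      haveI : FiniteDimensional ℂ (E →L[ℂ] ℂ) := inferInstance
      haveI : ProperSpace (E →L[ℂ] ℂ) := FiniteDimensional.proper ℂ _
      infer_instance
    exact h2.aestronglyMeasurable
  · filter_upwards [hgb] with s hs e he
    refine norm_fderiv_le_of_bound (hd s) ((norm_nonneg _).trans (hs e0 (by linarith))) ?_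
    intro e' he'
    apply hs
    have h1 : ‖e - e0‖ < 1 := by simpa [dist_eq_norm] using he
    calc ‖e'‖ = ‖(e' - e) + (e - e0) + e0‖ := by congr 1; abel
      _ ≤ ‖e' - e‖ + ‖e - e0‖ + ‖e0‖ := norm_add₃_le
      _ ≤ _ := by linarith

/-- growth exponents -/
def dcE (C : ℝ) (z : ℂ) : ℝ :=
  C * |z.re| + if z.im = 0 then -(Real.exp z.re / 2) else C * Real.exp z.re
def hfE (C : ℝ) (z : ℂ) : ℝ :=
  C * |z.re| + if z.im = 0 then 0 else C * Real.exp (z.re / 2)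

def tailB (h : ℂ → ℂ → ℂ) (c : ℝ) (η : ℂ) : ℂ := ∫ s in Set.Ioi c, h (s : ℂ) (η - s)
def tailA (h : ℂ → ℂ → ℂ) (c : ℝ) (η : ℂ) : ℂ := ∫ s in Set.Ioi c, h (η - s) (s : ℂ)
def midI (h : ℂ → ℂ → ℂ) (η : ℂ) : ℂ := η * ∫ s in (0:ℝ)..1, h (s * η) ((1 - s) * η)

def conv1 (h : ℂ → ℂ → ℂ) (η : ℂ) : ℂ := tailB h 0 η + tailA h 0 η - midI h η

/-- the class of admissible functions of two variables -/
def DecB (h : ℂ → ℂ → ℂ) (T A C : ℝ) : Prop :=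
  ∀ ξ ω : ℂ, |ξ.im| ≤ T → |ω.im| ≤ T → ‖h ξ ω‖ ≤ A * Real.exp (dcE C ξ + dcE C ω)

structure Adm (h : ℂ → ℂ → ℂ) : Prop where
  diff : Differentiable ℂ fun p : ℂ × ℂ => h p.1 p.2
  bd : ∀ T : ℝ, ∃ A C : ℝ, 0 ≤ A ∧ 0 ≤ C ∧ DecB h T A C

lemma integrable_dd (D : ℝ) (hD : 0 < D) :
    Integrable fun s : ℝ => Real.exp (D * s - Real.exp s / 2) := by
  have h := Real.GammaIntegral_convergent hD
  have h0 : IntegrableOn (fun x : ℝ => Real.exp (-(1/2) * x) * x ^ (D - 1)) (Set.Ioi 0) := by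
    have := (integrableOn_Ioi_comp_mul_left_iff (fun x => Real.exp (-x) * x ^ (D - 1)) 0
      (a := 1/2) (by norm_num)).2 (by simpa using h)
    have h3 := this.const_mul (((1/2 : ℝ)^(D-1))⁻¹)
    refine h3.congr ?_
    refine (ae_restrict_mem measurableSet_Ioi).mono fun x hx => ?_
    have hx : 0 < x := hx
    dsimp only
    rw [Real.mul_rpow (by norm_num) hx.le]
    have : ((1/2 : ℝ)^(D-1)) ≠ 0 := by positivity
    field_simp
  have h2 := (integrableOn_image_iff_integrableOn_abs_deriv_smul (s := Set.univ)
    (f := Real.exp) (f' := Real.exp) MeasurableSet.univ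
    (fun x _ => (Real.hasDerivAt_exp x).hasDerivWithinAt) Real.exp_injective.injOn
    (fun x : ℝ => Real.exp (-(1/2) * x) * x ^ (D - 1))).1 (by
      simpa [Set.image_univ, Real.range_exp] using h0)
  rw [integrableOn_univ] at h2
  refine h2.congr (.of_forall fun s => ?_)
  simp only [smul_eq_mul, abs_of_pos (Real.exp_pos s), ← Real.exp_mul]
  rw [← Real.exp_add, ← Real.exp_add]
  congr 1; ring

lemma Adm.flip {h : ℂ → ℂ → ℂ} (hh : Adm h) : Adm (fun a b => h b a) := by
  refine ⟨hh.diff.comp (by fun_prop : Differentiable ℂ fun p : ℂ × ℂ => (p.2, p.1)), fun T => ?_⟩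
  obtain ⟨A, C, hA, hC, hb⟩ := hh.bd T
  exact ⟨A, C, hA, hC, fun ξ ω h1 h2 => by rw [add_comm]; exact hb ω ξ h2 h1⟩

lemma DecB.flip {h : ℂ → ℂ → ℂ} {T A C : ℝ} (hb : DecB h T A C) : DecB (fun a b => h b a) T A C :=
  fun ξ ω h1 h2 => by rw [add_comm]; exact hb ω ξ h2 h1

lemma tail_pt {h : ℂ → ℂ → ℂ} {T A C : ℝ} (hA : 0 ≤ A) (hC : 0 ≤ C) (hb : DecB h T A C)
    {η : ℂ} (hη : |η.im| ≤ T) {c s : ℝ} (hs : c ≤ s) :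
    ‖h (s : ℂ) (η - s)‖ ≤ A * Real.exp (C * |η.re| + (2 * C + 1) * (2 * |c|) +
      if η.im = 0 then 0 else C * Real.exp (η.re - c)) *
      Real.exp ((2 * C + 1) * s - Real.exp s / 2) := by
  refine (hb s (η - s) (by simpa using (abs_nonneg _).trans hη) (by simpa using hη)).trans ?_
  rw [mul_assoc, ← Real.exp_add]
  refine mul_le_mul_of_nonneg_left (Real.exp_le_exp.2 ?_) hA
  have h1 : |s| ≤ s + 2 * |c| := by
    rcases le_or_gt 0 s with h | h
    · rw [abs_of_nonneg h]; linarith [abs_nonneg c]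
    · rw [abs_of_neg h, abs_of_nonpos (by linarith)]; linarith
  have h2 : |η.re - s| ≤ |η.re| + |s| := abs_sub _ _
  have h3 : Real.exp (η.re - s) ≤ Real.exp (η.re - c) := Real.exp_le_exp.2 (by linarith)
  have h5 : C * |η.re - s| ≤ C * |η.re| + C * |s| := by nlinarith
  have h6 : (2 * C + 1) * |s| ≤ (2 * C + 1) * s + (2 * C + 1) * (2 * |c|) := by nlinarith
  have h7 : 0 ≤ |s| := abs_nonneg s
  have h8 := Real.exp_pos (η.re - s)
  have h9 : C * Real.exp (η.re - s) ≤ C * Real.exp (η.re - c) := by nlinarith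
  simp only [dcE, Complex.ofReal_re, Complex.ofReal_im, Complex.sub_re, Complex.sub_im, sub_zero,
    if_true]
  split_ifs
  · linarith
  · linarith

lemma Adm.cont {h : ℂ → ℂ → ℂ} (hh : Adm h) : Continuous fun p : ℂ × ℂ => h p.1 p.2 :=
  hh.diff.continuous

lemma Adm.integrableB {h : ℂ → ℂ → ℂ} (hh : Adm h) (c : ℝ) (η : ℂ) :
    IntegrableOn (fun s : ℝ => h (s : ℂ) (η - s)) (Set.Ioi c) := by
  obtain ⟨A, C, hA, hC, hb⟩ := hh.bd |η.im|
  refine Integrable.mono' (((integrable_dd (2 * C + 1) (by linarith)).integrableOn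
    (s := Set.Ioi c)).const_mul (A * Real.exp (C * |η.re| + (2 * C + 1) * (2 * |c|) +
      if η.im = 0 then 0 else C * Real.exp (η.re - c)))) ?_ ?_
  · exact (hh.cont.comp (by fun_prop : Continuous fun s : ℝ => ((s : ℂ), η - s))).aestronglyMeasurable
  · exact (ae_restrict_mem measurableSet_Ioi).mono fun s hs => tail_pt hA hC hb le_rfl (le_of_lt hs)

lemma Adm.integrableA {h : ℂ → ℂ → ℂ} (hh : Adm h) (c : ℝ) (η : ℂ) :
    IntegrableOn (fun s : ℝ => h (η - s) (s : ℂ)) (Set.Ioi c) := hh.flip.integrableB c η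

lemma seg_integral {Φ g : ℂ → ℂ} (hg : Continuous g) (hΦ : ∀ z, HasDerivAt Φ (g z) z)
    (a b : ℂ) (p q : ℝ) :
    b * ∫ s in p..q, g (a + s * b) = Φ (a + q * b) - Φ (a + p * b) := by
  rw [← intervalIntegral.integral_const_mul]
  refine intervalIntegral.integral_eq_sub_of_hasDerivAt (f := fun s : ℝ => Φ (a + s * b)) ?_ ?_
  · intro s _
    have h1 : HasDerivAt (fun s : ℝ => a + (s : ℂ) * b) b s := by
      simpa using ((Complex.ofRealCLM.hasDerivAt (x := s)).mul_const b).const_add a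
    have := (hΦ (a + s * b)).comp s h1
    rw [mul_comm]
    exact this
  · exact (by fun_prop : Continuous _).intervalIntegrable _ _

/-- primitive description of the tails -/
lemma conv1_base {h : ℂ → ℂ → ℂ} (hh : Adm h) (η : ℂ) (c : ℝ) :
    conv1 h η = tailB h c η + tailA h c η -
      (η - 2 * c) * ∫ s in (0:ℝ)..1, h (c + s * (η - 2 * c)) (η - (c + s * (η - 2 * c))) := by
  set g : ℂ → ℂ := fun z => h z (η - z) with hgdef
  have hgd : Differentiable ℂ g :=
    hh.diff.comp (by fun_prop : Differentiable ℂ fun z : ℂ => (z, η - z))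
  obtain ⟨Φ, hΦ⟩ := hgd.isExactOn_univ
  have hΦ : ∀ z, HasDerivAt Φ (g z) z := fun z => hΦ z trivial
  have hB : ∀ c : ℝ, Filter.Tendsto (fun R : ℝ => Φ R) Filter.atTop (nhds (tailB h c η + Φ c)) := by
    intro c
    have h1 := intervalIntegral_tendsto_integral_Ioi c (hh.integrableB c η) Filter.tendsto_id
    have h2 := h1.add_const (Φ c)
    refine h2.congr fun R => ?_
    have := seg_integral hgd.continuous hΦ 0 1 c R
    simp only [zero_add, mul_one, one_mul] at this
    simp only [id]
    change (∫ s in c..R, g s) + _ = _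
    rw [this]; ring
  have hA : ∀ c : ℝ, Filter.Tendsto (fun R : ℝ => Φ (η - R)) Filter.atTop
      (nhds (Φ (η - c) - tailA h c η)) := by
    intro c
    have h1 := intervalIntegral_tendsto_integral_Ioi c (hh.integrableA c η) Filter.tendsto_id
    have h2 := (h1.const_sub (Φ (η - c)))
    refine h2.congr fun R => ?_
    have := seg_integral hgd.continuous hΦ η (-1) c R
    simp only [hgdef, mul_neg, mul_one, ← sub_eq_add_neg, sub_sub_cancel, neg_one_mul] at this
    simp only [id]
    linear_combination this
  have e1 := tendsto_nhds_unique (hB 0) (hB c)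
  have e2 := tendsto_nhds_unique (hA 0) (hA c)
  have e3 := seg_integral hgd.continuous hΦ 0 η 0 1
  have e4 := seg_integral hgd.continuous hΦ c (η - 2 * c) 0 1
  have e5 : (∫ s in (0:ℝ)..1, g (0 + s * η)) = ∫ s in (0:ℝ)..1, h (s * η) ((1 - s) * η) := by
    congr 1; ext s; simp only [hgdef]; congr 1 <;> ring
  rw [e5] at e3
  have e6 : ((c : ℂ) + ((1 : ℝ) : ℂ) * (η - 2 * c)) = η - c := by push_cast; ring
  rw [e6] at e4
  simp only [conv1, midI]
  change _ = tailB h c η + tailA h c η - (η - 2 * c) * ∫ s in (0:ℝ)..1, g (c + s * (η - 2 * c))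
  rw [e4]
  simp only [Complex.ofReal_zero, zero_mul, add_zero, zero_add, Complex.ofReal_one, one_mul,
    sub_zero] at e1 e2 e3 ⊢
  rw [e3]
  linear_combination e1 - e2

lemma conv1_real {h : ℂ → ℂ → ℂ} (hh : Adm h) (η : ℝ) :
    Integrable (fun s : ℝ => h (s : ℂ) ((η : ℂ) - s)) ∧
    conv1 h η = ∫ s : ℝ, h (s : ℂ) ((η : ℂ) - s) := by
  have h1 := hh.integrableB (η / 2) η
  have h2 := hh.integrableA (η / 2) η
  have h3 : IntegrableOn (fun s : ℝ => h (s : ℂ) ((η : ℂ) - s)) (Set.Iic (η / 2)) := by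
    have e := (Measure.measurePreserving_sub_left volume η).integrableOn_comp_preimage
      (MeasurableEquiv.subLeft η).measurableEmbedding
      (f := fun s : ℝ => h (s : ℂ) ((η : ℂ) - s)) (s := Set.Iio (η / 2))
    have e' : ((fun s : ℝ => η - s) ⁻¹' Set.Iio (η / 2)) = Set.Ioi (η / 2) := by
      ext s; simp only [Set.mem_preimage, Set.mem_Iio, Set.mem_Ioi]; constructor <;> intro h <;> linarith
    rw [integrableOn_Iic_iff_integrableOn_Iio]
    refine e.1 ?_
    rw [e']
    refine h2.congr_fun (fun s _ => ?_) measurableSet_Ioi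
    simp
  have hintg : Integrable (fun s : ℝ => h (s : ℂ) ((η : ℂ) - s)) := by
    rw [← integrableOn_univ, ← Set.Iic_union_Ioi (a := η / 2)]
    exact h3.union h1
  refine ⟨hintg, ?_⟩
  rw [conv1_base hh (η : ℂ) (η / 2)]
  have e0 : ((η : ℂ) - 2 * ((η / 2 : ℝ) : ℂ)) = 0 := by push_cast; ring
  rw [e0, zero_mul, sub_zero, ← intervalIntegral.integral_Iic_add_Ioi h3 h1, add_comm]
  congr 1
  simp only [tailA]
  have e := (Measure.measurePreserving_sub_left volume η).setIntegral_preimage_emb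
      (MeasurableEquiv.subLeft η).measurableEmbedding
      (fun s : ℝ => h (s : ℂ) ((η : ℂ) - s)) (Set.Iio (η / 2))
  have e' : ((fun s : ℝ => η - s) ⁻¹' Set.Iio (η / 2)) = Set.Ioi (η / 2) := by
      ext s; simp only [Set.mem_preimage, Set.mem_Iio, Set.mem_Ioi]; constructor <;> intro h <;> linarith
  rw [e'] at e
  rw [integral_Iic_eq_integral_Iio, ← e]
  refine setIntegral_congr_fun measurableSet_Ioi fun s _ => ?_
  simp

lemma conv1_bound {T C : ℝ} (hC : 0 ≤ C) (hT : 0 ≤ T) :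
    ∃ K : ℝ, 1 ≤ K ∧ ∀ (h : ℂ → ℂ → ℂ) (A : ℝ), Adm h → 0 ≤ A → DecB h T A C → ∀ η : ℂ, |η.im| ≤ T →
      ‖conv1 h η‖ ≤ A * K * Real.exp (hfE K η) := by
  set I := ∫ s : ℝ, Real.exp ((2 * C + 1) * s - Real.exp s / 2) with hI
  have hI0 : 0 ≤ I := integral_nonneg fun s => (Real.exp_pos _).le
  set K := 3 * C + 1 + 2 * I + T with hKd
  have hK : 1 ≤ K := by linarith
  refine ⟨K, hK, fun h A hh hA hb η hη => ?_⟩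
  have hx : 2 * |η.re / 2| = |η.re| := by rw [abs_div]; norm_num; ring
  have key : ∀ h : ℂ → ℂ → ℂ, Adm h → DecB h T A C →
      ‖tailB h (η.re / 2) η‖ ≤ A * I * Real.exp (hfE K η) := by
    intro h hh hb
    have h1 : ‖tailB h (η.re / 2) η‖ ≤ ∫ s in Set.Ioi (η.re / 2), A * Real.exp (hfE K η) *
        Real.exp ((2 * C + 1) * s - Real.exp s / 2) := by
      refine norm_integral_le_of_norm_le
        (((integrable_dd (2 * C + 1) (by linarith)).integrableOn).const_mul _) ?_
      refine (ae_restrict_mem measurableSet_Ioi).mono fun s hs => ?_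
      refine (tail_pt hA hC hb hη (le_of_lt hs)).trans ?_
      refine mul_le_mul_of_nonneg_right (mul_le_mul_of_nonneg_left (Real.exp_le_exp.2 ?_) hA)
        (Real.exp_pos _).le
      rw [hx, hfE]
      have e : η.re - η.re / 2 = η.re / 2 := by ring
      rw [e]
      have h2 := abs_nonneg η.re
      have h3 := Real.exp_pos (η.re / 2)
      split_ifs <;> nlinarith
    refine h1.trans ?_
    rw [integral_const_mul]
    have h2 : ∫ s in Set.Ioi (η.re / 2), Real.exp ((2 * C + 1) * s - Real.exp s / 2) ≤ I :=
      setIntegral_le_integral (integrable_dd (2 * C + 1) (by linarith))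
        (.of_forall fun s => (Real.exp_pos _).le)
    calc _ ≤ A * Real.exp (hfE K η) * I := mul_le_mul_of_nonneg_left h2 (by positivity)
      _ = _ := by ring
  rw [conv1_base hh η (η.re / 2)]
  have h1 := key h hh hb
  have h2 : ‖tailA h (η.re / 2) η‖ ≤ A * I * Real.exp (hfE K η) := key _ hh.flip hb.flip
  have e0 : (η - 2 * ((η.re / 2 : ℝ) : ℂ)) = η.im * Complex.I := by
    apply Complex.ext <;> simp
    ring
  rw [e0]
  have h3 : ‖(η.im * Complex.I) * ∫ s in (0:ℝ)..1, h ((η.re / 2 : ℝ) + s * (η.im * Complex.I))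
      (η - ((η.re / 2 : ℝ) + s * (η.im * Complex.I)))‖ ≤ A * T * Real.exp (hfE K η) := by
    by_cases him : η.im = 0
    · rw [him]; simp; positivity
    have h4 : ‖∫ s in (0:ℝ)..1, h ((η.re / 2 : ℝ) + s * (η.im * Complex.I))
      (η - ((η.re / 2 : ℝ) + s * (η.im * Complex.I)))‖ ≤ A * Real.exp (hfE K η) * |1 - 0| := by
      refine intervalIntegral.norm_integral_le_of_norm_le_const fun s hs => ?_
      rw [Set.uIoc_of_le zero_le_one] at hs
      have hs0 := hs.1.le
      have hs1 := hs.2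
      have r1 : (((η.re / 2 : ℝ) : ℂ) + s * (η.im * Complex.I)).re = η.re / 2 := by simp
      have i1 : (((η.re / 2 : ℝ) : ℂ) + s * (η.im * Complex.I)).im = s * η.im := by simp
      refine (hb _ _ ?_ ?_).trans (mul_le_mul_of_nonneg_left (Real.exp_le_exp.2 ?_) hA)
      · rw [i1, abs_mul, abs_of_nonneg hs0]; nlinarith [abs_nonneg η.im]
      · rw [Complex.sub_im, i1, show η.im - s * η.im = (1 - s) * η.im by ring, abs_mul,
          abs_of_nonneg (by linarith : 0 ≤ 1 - s)]; nlinarith [abs_nonneg η.im]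
      · have hle : ∀ z : ℂ, z.re = η.re / 2 → dcE C z ≤ C * |η.re| / 2 + C * Real.exp (η.re / 2) := by
          intro z hz
          rw [dcE, hz]
          have := Real.exp_pos (η.re / 2)
          have e2 : |η.re / 2| = |η.re| / 2 := by linarith
          rw [e2]
          split_ifs <;> nlinarith
        refine (add_le_add (hle _ r1) (hle _ (by rw [Complex.sub_re, r1]; ring))).trans ?_
        rw [hfE, if_neg him]
        have h2 := abs_nonneg η.re
        have h3 := Real.exp_pos (η.re / 2)
        nlinarith
    rw [norm_mul]
    have h5 : ‖(η.im * Complex.I : ℂ)‖ ≤ T := by simpa using hη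
    calc _ ≤ T * (A * Real.exp (hfE K η) * |1 - 0|) :=
          mul_le_mul h5 h4 (norm_nonneg _) hT
      _ = _ := by simp; ring
  refine (norm_sub_le _ _).trans ((add_le_add (norm_add_le _ _) le_rfl).trans ?_)
  have := Real.exp_pos (hfE K η)
  calc _ ≤ A * I * Real.exp (hfE K η) + A * I * Real.exp (hfE K η) + A * T * Real.exp (hfE K η) := by
        linarith
    _ = A * Real.exp (hfE K η) * (2 * I + T) := by ring
    _ ≤ A * Real.exp (hfE K η) * K := by
        apply mul_le_mul_of_nonneg_left _ (by positivity); linarith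
    _ = _ := by ring

lemma conv1_diff {E : Type*} [NormedAddCommGroup E] [NormedSpace ℂ E] [FiniteDimensional ℂ E]
    (H : E → ℂ → ℂ → ℂ) (hd : Differentiable ℂ fun p : E × ℂ × ℂ => H p.1 p.2.1 p.2.2)
    (hb : ∀ R : ℝ, ∃ A C : ℝ, 0 ≤ A ∧ 0 ≤ C ∧ ∀ e, ‖e‖ ≤ R → DecB (H e) R A C) :
    Differentiable ℂ fun p : E × ℂ => conv1 (H p.1) p.2 := by
  have key : ∀ H : E → ℂ → ℂ → ℂ, (Differentiable ℂ fun p : E × ℂ × ℂ => H p.1 p.2.1 p.2.2) →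
      (∀ R : ℝ, ∃ A C : ℝ, 0 ≤ A ∧ 0 ≤ C ∧ ∀ e, ‖e‖ ≤ R → DecB (H e) R A C) →
      Differentiable ℂ fun p : E × ℂ => tailB (H p.1) 0 p.2 := by
    intro H hd hb
    refine diff_param (volume.restrict (Set.Ioi 0)) (fun (p : E × ℂ) (s : ℝ) => H p.1 s (p.2 - s)) ?_ ?_ ?_
    · exact hd.continuous.comp (by fun_prop :
        Continuous fun q : ℝ × E × ℂ => (q.2.1, (q.1 : ℂ), q.2.2 - (q.1 : ℂ)))
    · intro s
      exact hd.comp (by fun_prop : Differentiable ℂ fun q : E × ℂ => (q.1, (s : ℂ), q.2 - (s : ℂ)))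
    · intro R
      obtain ⟨A, C, hA, hC, hAC⟩ := hb R
      refine ⟨fun s => A * Real.exp (C * R + C * Real.exp R) *
        Real.exp ((2 * C + 1) * s - Real.exp s / 2),
        ((integrable_dd (2 * C + 1) (by linarith)).integrableOn).const_mul _, ?_⟩
      refine (ae_restrict_mem measurableSet_Ioi).mono fun s hs p hp => ?_
      have h1 : ‖p.1‖ ≤ R := (norm_fst_le p).trans hp
      have h2 : ‖p.2‖ ≤ R := (norm_snd_le p).trans hp
      refine (tail_pt hA hC (hAC p.1 h1) ((Complex.abs_im_le_norm p.2).trans h2) (c := 0)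
        (le_of_lt hs)).trans ?_
      refine mul_le_mul_of_nonneg_right (mul_le_mul_of_nonneg_left (Real.exp_le_exp.2 ?_) hA)
        (Real.exp_pos _).le
      have h3 : |p.2.re| ≤ R := (Complex.abs_re_le_norm p.2).trans h2
      have h4 : Real.exp (p.2.re - 0) ≤ Real.exp R :=
        Real.exp_le_exp.2 (by linarith [le_abs_self p.2.re])
      have h5 := Real.exp_pos R
      have h6 : C * |p.2.re| ≤ C * R := mul_le_mul_of_nonneg_left h3 hC
      have h7 : C * Real.exp (p.2.re - 0) ≤ C * Real.exp R := mul_le_mul_of_nonneg_left h4 hC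
      have h8 : 0 ≤ C * Real.exp R := by positivity
      simp only [abs_zero, mul_zero, add_zero]
      split_ifs <;> linarith
  have hB := key H hd hb
  have hA : Differentiable ℂ fun p : E × ℂ => tailA (H p.1) 0 p.2 := by
    refine key (fun e a b => H e b a) ?_ ?_
    · exact hd.comp (by fun_prop : Differentiable ℂ fun p : E × ℂ × ℂ => (p.1, p.2.2, p.2.1))
    · intro R
      obtain ⟨A, C, hA, hC, hAC⟩ := hb R
      exact ⟨A, C, hA, hC, fun e he => (hAC e he).flip⟩
  have hM : Differentiable ℂ fun p : E × ℂ => midI (H p.1) p.2 := by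
    have : ProperSpace E := FiniteDimensional.proper ℂ E
    simp only [midI, intervalIntegral.integral_of_le (zero_le_one' ℝ)]
    refine differentiable_snd.mul ?_
    have hc : Continuous fun q : ℝ × E × ℂ => H q.2.1 (q.1 * q.2.2) ((1 - (q.1 : ℂ)) * q.2.2) :=
      hd.continuous.comp (by fun_prop :
        Continuous fun q : ℝ × E × ℂ => (q.2.1, (q.1 : ℂ) * q.2.2, (1 - (q.1 : ℂ)) * q.2.2))
    refine diff_param (volume.restrict (Set.Ioc 0 1))
      (fun (p : E × ℂ) (s : ℝ) => H p.1 (s * p.2) ((1 - s) * p.2)) hc ?_ ?_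
    · intro s
      exact hd.comp (by fun_prop :
        Differentiable ℂ fun q : E × ℂ => (q.1, (s : ℂ) * q.2, (1 - (s : ℂ)) * q.2))
    · intro R
      obtain ⟨M, hM⟩ := ((isCompact_Icc (a := (0:ℝ)) (b := 1)).prod
        (isCompact_closedBall (0 : E × ℂ) R)).exists_bound_of_continuousOn hc.continuousOn
      refine ⟨fun _ => M, integrable_const _, ?_⟩
      refine (ae_restrict_mem measurableSet_Ioc).mono fun s hs p hp => ?_
      exact hM (s, p) ⟨⟨hs.1.le, hs.2⟩, by simpa using hp⟩
  exact (hB.add hA).sub hM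

lemma dcE_mono {C C' : ℝ} (h : C ≤ C') (z : ℂ) : dcE C z ≤ dcE C' z := by
  have h1 := mul_le_mul_of_nonneg_right h (abs_nonneg z.re)
  have h2 := mul_le_mul_of_nonneg_right h (Real.exp_pos z.re).le
  simp only [dcE]; split_ifs <;> linarith

lemma hfE_mono {C C' : ℝ} (h : C ≤ C') (z : ℂ) : hfE C z ≤ hfE C' z := by
  have h1 := mul_le_mul_of_nonneg_right h (abs_nonneg z.re)
  have h2 := mul_le_mul_of_nonneg_right h (Real.exp_pos (z.re / 2)).le
  simp only [hfE]; split_ifs <;> linarith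

lemma dcE_le_of_norm {C R : ℝ} (hC : 0 ≤ C) {z : ℂ} (hz : ‖z‖ ≤ R) :
    dcE C z ≤ C * R + C * Real.exp R := by
  have h1 := mul_le_mul_of_nonneg_left ((Complex.abs_re_le_norm z).trans hz) hC
  have h2 := mul_le_mul_of_nonneg_left (Real.exp_le_exp.2
    ((le_abs_self z.re).trans ((Complex.abs_re_le_norm z).trans hz))) hC
  have h3 := Real.exp_pos z.re
  have h4 := Real.exp_pos R
  have h5 : 0 ≤ C * Real.exp R := by positivity
  simp only [dcE]; split_ifs <;> linarith

lemma hfE_le_of_norm {C R : ℝ} (hC : 0 ≤ C) {z : ℂ} (hz : ‖z‖ ≤ R) :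
    hfE C z ≤ C * R + C * Real.exp R := by
  have h1 := mul_le_mul_of_nonneg_left ((Complex.abs_re_le_norm z).trans hz) hC
  have h0 : z.re / 2 ≤ R := by
    have := (le_abs_self z.re).trans ((Complex.abs_re_le_norm z).trans hz)
    have := (norm_nonneg z).trans hz
    linarith
  have h2 := mul_le_mul_of_nonneg_left (Real.exp_le_exp.2 h0) hC
  have h4 := Real.exp_pos R
  have h5 : 0 ≤ C * Real.exp R := by positivity
  simp only [hfE]; split_ifs <;> linarith

def DecN (N : ℕ) (h : (Fin N → ℂ × ℂ) → ℂ) (T A C : ℝ) : Prop :=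
  ∀ z : Fin N → ℂ × ℂ, (∀ i, |(z i).1.im| ≤ T ∧ |(z i).2.im| ≤ T) →
    ‖h z‖ ≤ A * Real.exp (∑ i, (dcE C (z i).1 + dcE C (z i).2))

structure AdmN (N : ℕ) (h : (Fin N → ℂ × ℂ) → ℂ) : Prop where
  diff : Differentiable ℂ h
  bd : ∀ T : ℝ, ∃ A C : ℝ, 0 ≤ A ∧ 0 ≤ C ∧ DecN N h T A C

lemma DecN.mono {N : ℕ} {h : (Fin N → ℂ × ℂ) → ℂ} {T A A' C C' : ℝ} (hb : DecN N h T A C) (h0 : 0 ≤ A)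
    (hA : A ≤ A') (hC : C ≤ C') : DecN N h T A' C' := fun z hz =>
  (hb z hz).trans (mul_le_mul hA (Real.exp_le_exp.2 (sum_le_sum fun i _ =>
    add_le_add (dcE_mono hC _) (dcE_mono hC _))) (Real.exp_pos _).le (h0.trans hA))

lemma DecN.monoT {N : ℕ} {h : (Fin N → ℂ × ℂ) → ℂ} {T T' A C : ℝ} (hb : DecN N h T' A C)
    (hT : T ≤ T') : DecN N h T A C := fun z hz =>
  hb z fun i => ⟨(hz i).1.trans hT, (hz i).2.trans hT⟩

/-- slice in the zeroth pair of variables -/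
def slc {N : ℕ} (h : (Fin (N + 1) → ℂ × ℂ) → ℂ) (ξ ω : ℂ) : (Fin N → ℂ × ℂ) → ℂ :=
  fun z => h (Fin.cons (ξ, ω) z)

def Conv : (N : ℕ) → ((Fin N → ℂ × ℂ) → ℂ) → (Fin N → ℂ) → ℂ
  | 0, h, _ => h (fun i => i.elim0)
  | N + 1, h, η => conv1 (fun ξ ω => Conv N (slc h ξ ω) (Fin.tail η)) (η 0)

lemma DecN.slc {N : ℕ} {h : (Fin (N + 1) → ℂ × ℂ) → ℂ} {T A C : ℝ} (hb : DecN (N + 1) h T A C)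
    {ξ ω : ℂ} (h1 : |ξ.im| ≤ T) (h2 : |ω.im| ≤ T) :
    DecN N (slc h ξ ω) T (A * Real.exp (dcE C ξ + dcE C ω)) C := fun z hz => by
  refine (hb (Fin.cons (ξ, ω) z) (Fin.cases ⟨h1, h2⟩ hz)).trans (le_of_eq ?_)
  rw [Fin.sum_univ_succ]
  simp only [Fin.cons_zero, Fin.cons_succ]
  rw [Real.exp_add]; ring

lemma cons_diff {E : Type*} [NormedAddCommGroup E] [NormedSpace ℂ E] {N : ℕ} {f : E → ℂ × ℂ}
    {g : E → Fin N → ℂ × ℂ} (hf : Differentiable ℂ f) (hg : Differentiable ℂ g) :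
    Differentiable ℂ fun e => (Fin.cons (f e) (g e) : Fin (N + 1) → ℂ × ℂ) := by
  rw [differentiable_pi]
  refine Fin.cases ?_ ?_
  · simpa using hf
  · intro i
    simpa using (differentiable_pi.1 hg i)

lemma AdmN.slc {N : ℕ} {h : (Fin (N + 1) → ℂ × ℂ) → ℂ} (hh : AdmN (N + 1) h) (ξ ω : ℂ) :
    AdmN N (slc h ξ ω) := by
  refine ⟨hh.diff.comp (cons_diff (differentiable_const _) differentiable_id), fun T => ?_⟩
  obtain ⟨A, C, hA, hC, hb⟩ := hh.bd (max T (max |ξ.im| |ω.im|))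
  exact ⟨A * Real.exp (dcE C ξ + dcE C ω), C, by positivity, hC,
    (hb.slc (by simp) (by simp)).monoT (le_max_left _ _)⟩

lemma Conv_main (N : ℕ) :
    (∀ (E : Type) [NormedAddCommGroup E] [NormedSpace ℂ E] [FiniteDimensional ℂ E]
      (H : E → (Fin N → ℂ × ℂ) → ℂ), (Differentiable ℂ fun p : E × (Fin N → ℂ × ℂ) => H p.1 p.2) →
      (∀ R : ℝ, ∃ A C : ℝ, 0 ≤ A ∧ 0 ≤ C ∧ ∀ e, ‖e‖ ≤ R → DecN N (H e) R A C) →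
      Differentiable ℂ fun p : E × (Fin N → ℂ) => Conv N (H p.1) p.2) ∧
    (∀ T C : ℝ, 0 ≤ T → 0 ≤ C → ∃ K : ℝ, 1 ≤ K ∧ ∀ (h : (Fin N → ℂ × ℂ) → ℂ) (A : ℝ), AdmN N h → 0 ≤ A →
      DecN N h T A C → ∀ η : Fin N → ℂ, (∀ i, |(η i).im| ≤ T) →
      ‖Conv N h η‖ ≤ A * K * Real.exp (∑ i, hfE K (η i))) := by
  induction N with
  | zero =>
    refine ⟨fun E _ _ _ H hd hb => ?_, fun T C hT hC => ⟨1, le_rfl, fun h A hh hA hb η _ => ?_⟩⟩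
    · exact hd.comp (by fun_prop : Differentiable ℂ fun p : E × (Fin 0 → ℂ) =>
        ((p.1, fun i => i.elim0) : E × (Fin 0 → ℂ × ℂ)))
    · have := hb (fun i => i.elim0) (fun i => i.elim0)
      simpa [Conv] using this
  | succ N ih =>
    obtain ⟨ihd, ihb⟩ := ih
    have hadm : ∀ h : (Fin (N + 1) → ℂ × ℂ) → ℂ, AdmN (N + 1) h → ∀ ηt : Fin N → ℂ,
        Adm (fun ξ ω => Conv N (slc h ξ ω) ηt) := by
      intro h hh ηt
      constructor
      · have := ihd (ℂ × ℂ) (fun p => slc h p.1 p.2) ?_ ?_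
        · exact this.comp (by fun_prop : Differentiable ℂ fun p : ℂ × ℂ => (p, ηt))
        · exact hh.diff.comp (cons_diff (by fun_prop) (by fun_prop))
        · intro R
          obtain ⟨A, C, hA, hC, hb⟩ := hh.bd R
          refine ⟨A * Real.exp (C * R + C * Real.exp R + (C * R + C * Real.exp R)), C, by positivity, hC,
            fun e he => ?_⟩
          have n1 := (norm_fst_le e).trans he
          have n2 := (norm_snd_le e).trans he
          refine (hb.slc ((Complex.abs_im_le_norm _).trans n1)
            ((Complex.abs_im_le_norm _).trans n2)).mono (by positivity) ?_ le_rfl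
          exact mul_le_mul_of_nonneg_left (Real.exp_le_exp.2
            (add_le_add (dcE_le_of_norm hC n1) (dcE_le_of_norm hC n2))) hA
      · intro T
        obtain ⟨T', hT, hT0, hTη⟩ : ∃ T', T ≤ T' ∧ 0 ≤ T' ∧ ∀ i, |(ηt i).im| ≤ T' := by
          refine ⟨|T| + ∑ i, |(ηt i).im|, ?_, by positivity, fun i => ?_⟩
          · have : 0 ≤ ∑ i, |(ηt i).im| := by positivity
            linarith [le_abs_self T]
          · have := single_le_sum (f := fun i => |(ηt i).im|) (fun _ _ => abs_nonneg _)
              (mem_univ i)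
            linarith [abs_nonneg T]
        obtain ⟨A, C, hA, hC, hb⟩ := hh.bd T'
        obtain ⟨K, hK, hKb⟩ := ihb T' C hT0 hC
        refine ⟨A * (K * Real.exp (∑ i, hfE K (ηt i))), C, by positivity, hC, fun ξ ω h1 h2 => ?_⟩
        refine (hKb _ _ (hh.slc ξ ω) (by positivity) (hb.slc (h1.trans hT) (h2.trans hT)) ηt hTη).trans
          (le_of_eq (by ring))
    refine ⟨fun E _ _ _ H hd hb => ?_, fun T C hT hC => ?_⟩
    · -- differentiability
      have hH : ∀ e, AdmN (N + 1) (H e) := by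
        intro e
        refine ⟨hd.comp (by fun_prop : Differentiable ℂ fun z : Fin (N+1) → ℂ × ℂ => (e, z)), fun T => ?_⟩
        obtain ⟨A, C, hA, hC, hb⟩ := hb (max T ‖e‖)
        exact ⟨A, C, hA, hC, (hb e (le_max_right _ _)).monoT (le_max_left _ _)⟩
      have h1 := ihd (E × ℂ × ℂ) (fun p => slc (H p.1) p.2.1 p.2.2) ?_ ?_
      · have h2 := conv1_diff (E := E × (Fin N → ℂ))
          (fun q ξ ω => Conv N (slc (H q.1) ξ ω) q.2) ?_ ?_
        · refine h2.comp (?_ : Differentiable ℂ fun p : E × (Fin (N + 1) → ℂ) =>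
            ((p.1, Fin.tail p.2), p.2 0))
          unfold Fin.tail
          fun_prop
        · exact h1.comp (by fun_prop : Differentiable ℂ fun p : (E × (Fin N → ℂ)) × ℂ × ℂ =>
            ((p.1.1, p.2.1, p.2.2), p.1.2))
        · intro R
          obtain ⟨A, C, hA, hC, hb⟩ := hb (max R 0)
          obtain ⟨K, hK, hKb⟩ := ihb (max R 0) C (le_max_right _ _) hC
          refine ⟨A * (K * Real.exp (N • (K * R + K * Real.exp R))), C, by positivity, hC,
            fun q hq ξ ω h1 h2 => ?_⟩
          have n1 := (norm_fst_le q).trans hq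
          have n2 := (norm_snd_le q).trans hq
          have n3 : ∀ i, ‖q.2 i‖ ≤ R := fun i => (norm_le_pi_norm q.2 i).trans n2
          refine (hKb _ _ ((hH q.1).slc ξ ω) (by positivity)
            ((hb q.1 (n1.trans (le_max_left _ _))).slc (h1.trans (le_max_left _ _))
              (h2.trans (le_max_left _ _))) q.2
            fun i => (Complex.abs_im_le_norm _).trans ((n3 i).trans (le_max_left _ _))).trans ?_
          have : ∑ i, hfE K (q.2 i) ≤ N • (K * R + K * Real.exp R) := by
            have := sum_le_card_nsmul univ (fun i => hfE K (q.2 i)) (K * R + K * Real.exp R)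
              fun i _ => hfE_le_of_norm (by linarith) (n3 i)
            simpa using this
          have := Real.exp_le_exp.2 this
          have h3 := Real.exp_pos (dcE C ξ + dcE C ω)
          calc _ ≤ A * Real.exp (dcE C ξ + dcE C ω) * K * Real.exp (N • (K * R + K * Real.exp R)) :=
                mul_le_mul_of_nonneg_left this (by positivity)
            _ = _ := by ring
      · refine hd.comp (?_ : Differentiable ℂ fun p : (E × ℂ × ℂ) × (Fin N → ℂ × ℂ) =>
          ((p.1.1, Fin.cons (p.1.2.1, p.1.2.2) p.2) : E × (Fin (N + 1) → ℂ × ℂ)))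
        exact (by fun_prop : Differentiable ℂ fun p : (E × ℂ × ℂ) × (Fin N → ℂ × ℂ) => p.1.1).prodMk
          (cons_diff (by fun_prop) (by fun_prop))
      · intro R
        obtain ⟨A, C, hA, hC, hb⟩ := hb R
        refine ⟨A * Real.exp (C * R + C * Real.exp R + (C * R + C * Real.exp R)), C, by positivity, hC,
          fun e he => ?_⟩
        have n0 := (norm_fst_le e).trans he
        have n1 := (norm_fst_le e.2).trans ((norm_snd_le e).trans he)
        have n2 := (norm_snd_le e.2).trans ((norm_snd_le e).trans he)
        refine ((hb e.1 n0).slc ((Complex.abs_im_le_norm _).trans n1)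
          ((Complex.abs_im_le_norm _).trans n2)).mono (by positivity) ?_ le_rfl
        exact mul_le_mul_of_nonneg_left (Real.exp_le_exp.2
          (add_le_add (dcE_le_of_norm hC n1) (dcE_le_of_norm hC n2))) hA
    · -- bound
      obtain ⟨K, hK, hKb⟩ := ihb T C hT hC
      obtain ⟨K1, hK1, hKb1⟩ := conv1_bound hC hT
      refine ⟨K * K1, by nlinarith, fun h A hh hA hb η hη => ?_⟩
      set B := A * (K * Real.exp (∑ i : Fin N, hfE K (η i.succ))) with hB
      have h1 := hKb1 (fun ξ ω => Conv N (slc h ξ ω) (Fin.tail η)) B (hadm h hh _) (by positivity) (by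
        intro ξ ω h1 h2
        refine (hKb _ _ (hh.slc ξ ω) (by positivity) (hb.slc h1 h2) (Fin.tail η)
          (fun i => hη i.succ)).trans (le_of_eq ?_)
        simp only [hB, Fin.tail]; ring) (η 0) (hη 0)
      refine h1.trans ?_
      rw [Fin.sum_univ_succ, hB]
      have e1 : ∑ i : Fin N, hfE K (η i.succ) ≤ ∑ i : Fin N, hfE (K * K1) (η i.succ) :=
        sum_le_sum fun i _ => hfE_mono (by nlinarith) _
      have e2 : hfE K1 (η 0) ≤ hfE (K * K1) (η 0) := hfE_mono (by nlinarith) _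
      have e3 := Real.exp_le_exp.2 (add_le_add e2 e1)
      calc _ = A * (K * K1) * Real.exp (hfE K1 (η 0) + ∑ i : Fin N, hfE K (η i.succ)) := by
            rw [Real.exp_add]; ring
        _ ≤ _ := mul_le_mul_of_nonneg_left e3 (by positivity)

lemma admN_conv_adm {N : ℕ} {h : (Fin (N + 1) → ℂ × ℂ) → ℂ} (hh : AdmN (N + 1) h) (ηt : Fin N → ℂ) :
    Adm (fun ξ ω => Conv N (slc h ξ ω) ηt) := by
  obtain ⟨ihd, ihb⟩ := Conv_main N
  constructor
  · have := ihd (ℂ × ℂ) (fun p => slc h p.1 p.2) ?_ ?_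
    · exact this.comp (by fun_prop : Differentiable ℂ fun p : ℂ × ℂ => (p, ηt))
    · exact hh.diff.comp (cons_diff (by fun_prop) (by fun_prop))
    · intro R
      obtain ⟨A, C, hA, hC, hb⟩ := hh.bd R
      refine ⟨A * Real.exp (C * R + C * Real.exp R + (C * R + C * Real.exp R)), C, by positivity, hC,
        fun e he => ?_⟩
      have n1 := (norm_fst_le e).trans he
      have n2 := (norm_snd_le e).trans he
      refine (hb.slc ((Complex.abs_im_le_norm _).trans n1)
        ((Complex.abs_im_le_norm _).trans n2)).mono (by positivity) ?_ le_rfl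
      exact mul_le_mul_of_nonneg_left (Real.exp_le_exp.2
        (add_le_add (dcE_le_of_norm hC n1) (dcE_le_of_norm hC n2))) hA
  · intro T
    obtain ⟨T', hT, hT0, hTη⟩ : ∃ T', T ≤ T' ∧ 0 ≤ T' ∧ ∀ i, |(ηt i).im| ≤ T' := by
      refine ⟨|T| + ∑ i, |(ηt i).im|, ?_, by positivity, fun i => ?_⟩
      · have : 0 ≤ ∑ i, |(ηt i).im| := by positivity
        linarith [le_abs_self T]
      · have := single_le_sum (f := fun i => |(ηt i).im|) (fun _ _ => abs_nonneg _)
          (mem_univ i)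
        linarith [abs_nonneg T]
    obtain ⟨A, C, hA, hC, hb⟩ := hh.bd T'
    obtain ⟨K, hK, hKb⟩ := ihb T' C hT0 hC
    refine ⟨A * (K * Real.exp (∑ i, hfE K (ηt i))), C, by positivity, hC, fun ξ ω h1 h2 => ?_⟩
    refine (hKb _ _ (hh.slc ξ ω) (by positivity) (hb.slc (h1.trans hT) (h2.trans hT)) ηt hTη).trans
      (le_of_eq (by ring))

lemma integrable_dc1 (C η : ℝ) (hC : 0 ≤ C) :
    Integrable fun s : ℝ => Real.exp (dcE C (s : ℂ) + dcE C ((η - s : ℝ) : ℂ)) := by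
  have h1 := integrable_dd (2 * C + 1) (by positivity)
  have h2 := (h1.comp_sub_left η)
  have h3 := (h1.const_mul (Real.exp (C * |η|))).add (h2.const_mul (Real.exp (C * |η| + (2 * C + 1) * |η|)))
  refine h3.mono' ?_ (Filter.Eventually.of_forall fun s => ?_)
  · refine Continuous.aestronglyMeasurable ?_
    simp only [dcE, Complex.ofReal_re, Complex.ofReal_im, if_true]
    fun_prop
  · rw [Real.norm_of_nonneg (Real.exp_pos _).le]
    simp only [dcE, Complex.ofReal_re, Complex.ofReal_im, if_true, Pi.add_apply, ← Real.exp_add]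
    have e1 := Real.exp_pos s
    have e2 := Real.exp_pos (η - s)
    have a1 : |η - s| ≤ |η| + |s| := abs_sub _ _
    have a2 := mul_le_mul_of_nonneg_left a1 hC
    have a3 := le_abs_self η
    have a4 : -|η| ≤ η := neg_abs_le η
    have a5 := mul_nonneg hC (abs_nonneg η)
    rcases le_total 0 s with h | h
    · rw [abs_of_nonneg h] at *
      refine le_add_of_le_of_nonneg (Real.exp_le_exp.2 ?_) (Real.exp_pos _).le
      nlinarith
    · rw [abs_of_nonpos h] at *
      refine le_add_of_nonneg_of_le (Real.exp_pos _).le (Real.exp_le_exp.2 ?_)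
      have : -(2 * C + 1) * |η| ≤ (2 * C + 1) * η := by nlinarith
      nlinarith

lemma integrable_dcN (N : ℕ) (C : ℝ) (hC : 0 ≤ C) (η : Fin N → ℝ) :
    Integrable fun ξ : Fin N → ℝ => Real.exp (∑ i, (dcE C (ξ i : ℂ) + dcE C ((η i - ξ i : ℝ) : ℂ))) := by
  simp only [Real.exp_sum]
  exact Integrable.fintype_prod (f := fun (i : Fin N) (s : ℝ) => Real.exp (dcE C (s : ℂ) + dcE C ((η i - s : ℝ) : ℂ)))
    fun i => integrable_dc1 C (η i) hC

lemma AdmN.integrable {N : ℕ} {h : (Fin N → ℂ × ℂ) → ℂ} (hh : AdmN N h) (η : Fin N → ℝ) :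
    Integrable fun ξ : Fin N → ℝ => h fun i => ((ξ i : ℂ), (η i : ℂ) - ξ i) := by
  obtain ⟨A, C, hA, hC, hb⟩ := hh.bd 0
  refine ((integrable_dcN N C hC η).const_mul A).mono' ?_ (Filter.Eventually.of_forall fun ξ => ?_)
  · refine Continuous.aestronglyMeasurable (hh.diff.continuous.comp ?_)
    fun_prop
  · have := hb (fun i => ((ξ i : ℂ), (η i : ℂ) - ξ i)) (by simp)
    simpa using this

lemma integral_fin_succ {N : ℕ} {f : (Fin (N + 1) → ℝ) → ℂ} (hf : Integrable f) :
    ∫ ξ, f ξ = ∫ s : ℝ, ∫ ξ : Fin N → ℝ, f (Fin.cons s ξ) := by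
  have hmp := (volume_preserving_piFinSuccAbove (fun _ : Fin (N + 1) => ℝ) 0).symm
  rw [← hmp.integral_comp' (g := f)]
  have h2 := (hmp.integrable_comp_emb (MeasurableEquiv.measurableEmbedding _)).2 hf
  refine (integral_prod _ h2).trans ?_
  refine integral_congr_ae (.of_forall fun s => ?_)
  refine integral_congr_ae (.of_forall fun ξ => ?_)
  simp only [MeasurableEquiv.piFinSuccAbove, Fin.insertNthEquiv]
  show f _ = f _
  congr 1
  exact Fin.insertNth_zero' s ξ

lemma Conv_real {N : ℕ} : ∀ {h : (Fin N → ℂ × ℂ) → ℂ} (_ : AdmN N h) (η : Fin N → ℝ),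
    Conv N h (fun i => (η i : ℂ)) = ∫ ξ : Fin N → ℝ, h fun i => ((ξ i : ℂ), (η i : ℂ) - ξ i) := by
  induction N with
  | zero =>
    intro h hh η
    simp only [Conv]
    rw [Measure.volume_pi_eq_dirac, integral_dirac]
    congr 1
    ext i
    exact i.elim0
    exact i.elim0
  | succ N ih =>
    intro h hh η
    rw [integral_fin_succ (hh.integrable η)]
    show conv1 (fun ξ ω => Conv N (slc h ξ ω) (fun i => ((η i.succ : ℝ) : ℂ))) (η 0) = _
    rw [(conv1_real (admN_conv_adm hh _) (η 0)).2]
    refine integral_congr_ae (.of_forall fun s => ?_)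
    simp only
    rw [ih (hh.slc _ _) (fun i => η i.succ)]
    refine integral_congr_ae (.of_forall fun ξ => ?_)
    simp only [slc]
    congr 1
    ext i
    · refine Fin.cases ?_ (fun i => ?_) i <;> simp
    · refine Fin.cases ?_ (fun i => ?_) i <;> simp

/-- sum of entire functions, locally uniformly summable -/
lemma diff_tsum {ι E : Type*} [NormedAddCommGroup E] [NormedSpace ℂ E]
    {G : ι → E → ℂ} (hG : ∀ k, Differentiable ℂ (G k))
    (hb : ∀ R : ℝ, ∃ u : ι → ℝ, Summable u ∧ ∀ k η, ‖η‖ ≤ R → ‖G k η‖ ≤ u k) :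
    Differentiable ℂ fun η => ∑' k, G k η := by
  intro x
  obtain ⟨u, hu, hbu⟩ := hb (‖x‖ + 2)
  refine (hasFDerivAt_tsum_of_isPreconnected (u := fun k => u k) (f' := fun k => fderiv ℂ (G k)) hu
    Metric.isOpen_ball (convex_ball x 1).isPreconnected (x₀ := x)
    (fun k y _ => (hG k y).hasFDerivAt) ?_ (Metric.mem_ball_self one_pos) ?_
    (Metric.mem_ball_self one_pos)).differentiableAt
  · intro k y hy
    rw [mem_ball_iff_norm] at hy
    refine norm_fderiv_le_of_bound (hG k)
      ((norm_nonneg _).trans (hbu k 0 (by simp; positivity))) fun z hz => hbu k z ?_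
    have : z = (z - y) + (y - x) + x := by abel
    rw [this]
    refine (norm_add₃_le).trans ?_
    linarith
  · exact Summable.of_norm_bounded hu fun k => hbu k x (by linarith [norm_nonneg x])

/-- exponents lying in finitely many classes, bounded below -/
def InC (S : Finset ℂ) {M : ℕ} (B : Fin M → ℂ) : Prop := ∀ i, ∃ σ ∈ S, ∃ k : ℕ, B i = σ + k

def nodes (S : Finset ℂ) : Finset ℂ := S.image fun σ => Complex.exp (2 * Real.pi * Complex.I * σ)

def lagc (S : Finset ℂ) (b : ℂ) (j : ℕ) : ℂ :=
  (Lagrange.basis (nodes S) id (Complex.exp (2 * Real.pi * Complex.I * b))).coeff j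

def FnC (S : Finset ℂ) (M : ℕ) (B : Fin M → ℂ) (u : (Fin M → ℝ) → ℂ) : ℂ :=
  ∑ j : Fin M → Fin (nodes S).card, (∏ i, lagc S (B i) (j i)) *
    ∫ s in Set.Icc (0 : Fin M → ℝ) 1,
      Complex.exp (∑ i, -(2 * Real.pi * Complex.I * B i * s i)) * u (fun i => s i + j i)

lemma exp_class {S : Finset ℂ} {M : ℕ} {B : Fin M → ℂ} (hB : InC S B) (i : Fin M) :
    Complex.exp (2 * Real.pi * Complex.I * B i) ∈ nodes S := by
  obtain ⟨σ, hσ, k, hk⟩ := hB i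
  refine Finset.mem_image.2 ⟨σ, hσ, ?_⟩
  rw [hk, mul_add, Complex.exp_add, mul_comm (2 * Real.pi * Complex.I) (k : ℂ), Complex.exp_nat_mul_two_pi_mul_I, mul_one]

lemma lag_sum {S : Finset ℂ} {b b' : ℂ} (hb : Complex.exp (2 * Real.pi * Complex.I * b) ∈ nodes S)
    (hb' : Complex.exp (2 * Real.pi * Complex.I * b') ∈ nodes S) :
    ∑ j : Fin (nodes S).card, lagc S b j * Complex.exp (2 * Real.pi * Complex.I * b' * j) =
      if Complex.exp (2 * Real.pi * Complex.I * b) = Complex.exp (2 * Real.pi * Complex.I * b') then 1 else 0 := by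
  set x := Complex.exp (2 * Real.pi * Complex.I * b) with hx
  set x' := Complex.exp (2 * Real.pi * Complex.I * b') with hx'
  have hdeg : (Lagrange.basis (nodes S) id x).natDegree < (nodes S).card := by
    have h1 := Lagrange.degree_basis (v := id) (Set.injOn_id _) hb
    have h2 := Polynomial.natDegree_eq_of_degree_eq_some h1
    rw [h2]
    have := Finset.card_pos.2 ⟨_, hb⟩
    omega
  have h3 := Polynomial.eval_eq_sum_range' hdeg x'
  have h4 : (Lagrange.basis (nodes S) id x).eval x' = if x = x' then 1 else 0 := by
    split_ifs with h
    · rw [← h]; exact Lagrange.eval_basis_self (v := id) (Set.injOn_id _) hb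
    · exact Lagrange.eval_basis_of_ne (v := id) h hb'
  rw [← h4, h3, sum_range]
  refine sum_congr rfl fun j _ => ?_
  rw [hx', ← Complex.exp_nat_mul]
  simp only [lagc]
  rw [← hx]
  congr 2
  ring

lemma int_unit (c : ℂ) (hc : Complex.exp (2 * Real.pi * Complex.I * c) = 1) :
    ∫ s in Set.Icc (0 : ℝ) 1, Complex.exp (2 * Real.pi * Complex.I * c * s) = if c = 0 then 1 else 0 := by
  rw [integral_Icc_eq_integral_Ioc, ← intervalIntegral.integral_of_le zero_le_one]
  split_ifs with h
  · simp [h]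
  · rw [integral_exp_mul_complex]
    · simp [hc]
    · simp [h, Real.pi_ne_zero]

lemma vol_box (M : ℕ) : (volume : Measure (Fin M → ℝ)).restrict (Set.Icc 0 1) =
    Measure.pi fun _ : Fin M => (volume : Measure ℝ).restrict (Set.Icc 0 1) := by
  rw [← Set.pi_univ_Icc, volume_pi, Measure.restrict_pi_pi]
  rfl

lemma FnC_exp {S : Finset ℂ} {M : ℕ} {B B' : Fin M → ℂ} (hB : InC S B) (hB' : InC S B') :
    FnC S M B (fun τ => Complex.exp (∑ i, B' i * (2 * Real.pi * Complex.I * τ i))) = if B = B' then 1 else 0 := by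
  simp only [FnC]
  have key : ∀ j : Fin M → Fin (nodes S).card, (∏ i, lagc S (B i) (j i)) *
      ∫ s in Set.Icc (0 : Fin M → ℝ) 1,
      Complex.exp (∑ i, -(2 * Real.pi * Complex.I * B i * s i)) *
        Complex.exp (∑ i, B' i * (2 * Real.pi * Complex.I * ((s i + j i : ℝ) : ℂ))) =
      ∏ i, (lagc S (B i) (j i) * Complex.exp (2 * Real.pi * Complex.I * B' i * (j i : ℕ))) *
        ∫ s in Set.Icc (0 : ℝ) 1, Complex.exp (2 * Real.pi * Complex.I * (B' i - B i) * s) := by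
    intro j
    have : ∀ s : Fin M → ℝ, Complex.exp (∑ i, -(2 * Real.pi * Complex.I * B i * s i)) *
        Complex.exp (∑ i, B' i * (2 * Real.pi * Complex.I * ((s i + j i : ℝ) : ℂ))) =
        (∏ i, Complex.exp (2 * Real.pi * Complex.I * B' i * (j i : ℕ))) *
        ∏ i, Complex.exp (2 * Real.pi * Complex.I * (B' i - B i) * s i) := by
      intro s
      rw [← Complex.exp_add, ← Complex.exp_sum, ← Complex.exp_sum, ← Complex.exp_add,
        ← sum_add_distrib, ← sum_add_distrib]
      congr 1
      refine sum_congr rfl fun i _ => ?_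
      push_cast
      ring
    simp only [this]
    rw [integral_const_mul, vol_box,
      integral_fintype_prod_eq_prod (fun i (s : ℝ) => Complex.exp (2 * Real.pi * Complex.I * (B' i - B i) * s)),
      prod_mul_distrib, prod_mul_distrib]
    ring
  have key2 := sum_congr (rfl : (univ : Finset (Fin M → Fin (nodes S).card)) = univ) fun j _ => key j
  refine key2.trans ?_
  have h3 := (prod_univ_sum (fun _ : Fin M => (univ : Finset (Fin (nodes S).card)))
    (fun i j => (lagc S (B i) j * Complex.exp (2 * Real.pi * Complex.I * B' i * (j : ℕ))) *
        ∫ s in Set.Icc (0 : ℝ) 1, Complex.exp (2 * Real.pi * Complex.I * (B' i - B i) * s)))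
  rw [Fintype.piFinset_univ] at h3
  rw [← h3]
  have h4 : ∀ i, ∑ j : Fin (nodes S).card, (lagc S (B i) j * Complex.exp (2 * Real.pi * Complex.I * B' i * (j : ℕ))) *
        ∫ s in Set.Icc (0 : ℝ) 1, Complex.exp (2 * Real.pi * Complex.I * (B' i - B i) * s) =
        if B i = B' i then 1 else 0 := by
    intro i
    rw [← sum_mul, lag_sum (exp_class hB i) (exp_class hB' i)]
    split_ifs with h1 h2 h2
    · rw [one_mul, int_unit]
      · simp [h2]
      · rw [h2]; simp
    · rw [one_mul, int_unit]
      · rw [if_neg]; exact fun h => h2 (sub_eq_zero.1 h).symm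
      · rw [mul_sub, Complex.exp_sub, h1, div_self (Complex.exp_ne_zero _)]
    · exact absurd (by rw [h2]) h1
    · simp
  simp only [h4]
  split_ifs with h
  · simp [h]
  · rw [funext_iff, not_forall] at h
    obtain ⟨i, hi⟩ := h
    exact prod_eq_zero (mem_univ i) (by simp [hi])

lemma FnC_bound (S : Finset ℂ) (M : ℕ) : ∃ C : ℝ, 0 ≤ C ∧ ∀ B : Fin M → ℂ, InC S B →
    ∀ (u : (Fin M → ℝ) → ℂ) (K : ℝ), (∀ τ, (∀ i, 0 ≤ τ i ∧ τ i ≤ ((nodes S).card : ℝ)) → ‖u τ‖ ≤ K) →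
    ‖FnC S M B u‖ ≤ C * K := by
  set I := ∑ σ ∈ S, |σ.im| with hI
  set P := ∑ x ∈ nodes S, ∑ j : Fin (nodes S).card, ‖(Lagrange.basis (nodes S) id x).coeff j‖ with hP
  have hP0 : 0 ≤ P := by positivity
  refine ⟨∑ j : Fin M → Fin (nodes S).card, P ^ M * (Real.exp (2 * Real.pi * I)) ^ M, by positivity, ?_⟩
  intro B hB u K hu
  rw [sum_mul]
  refine (norm_sum_le _ _).trans (sum_le_sum fun j _ => ?_)
  rw [norm_mul, mul_assoc (P ^ M)]
  have h1 : ‖∏ i, lagc S (B i) (j i)‖ ≤ P ^ M := by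
    rw [norm_prod]
    refine (prod_le_prod (g := fun _ => P) (fun _ _ => norm_nonneg _) fun i _ => ?_).trans_eq (by simp)
    have := single_le_sum (f := fun j : Fin (nodes S).card => ‖lagc S (B i) j‖)
      (fun _ _ => norm_nonneg _) (mem_univ (j i))
    refine this.trans ?_
    exact single_le_sum (f := fun x => ∑ j : Fin (nodes S).card, ‖(Lagrange.basis (nodes S) id x).coeff j‖)
      (fun _ _ => by positivity) (exp_class hB i)
  refine mul_le_mul h1 ?_ (norm_nonneg _) (by positivity)
  have h2 : ∀ s ∈ Set.Icc (0 : Fin M → ℝ) 1, ‖Complex.exp (∑ i, -(2 * Real.pi * Complex.I * B i * s i)) *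
      u (fun i => s i + j i)‖ ≤ (Real.exp (2 * Real.pi * I)) ^ M * K := by
    intro s hs
    rw [norm_mul, Complex.exp_sum, norm_prod]
    refine mul_le_mul ?_ (hu _ fun i => ?_) (norm_nonneg _) (by positivity)
    · refine (prod_le_prod (g := fun _ => Real.exp (2 * Real.pi * I)) (fun _ _ => norm_nonneg _)
        fun i _ => ?_).trans_eq (by simp)
      rw [Complex.norm_exp, Real.exp_le_exp]
      obtain ⟨σ, hσ, k, hk⟩ := hB i
      have e1 : (-(2 * Real.pi * Complex.I * B i * s i) : ℂ).re = 2 * Real.pi * (σ.im * s i) := by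
        simp [hk]; ring
      rw [e1]
      have e2 := single_le_sum (f := fun σ : ℂ => |σ.im|) (fun _ _ => abs_nonneg _) hσ
      have e3 := hs.1 i
      have e4 := hs.2 i
      simp only [Pi.zero_apply, Pi.one_apply] at e3 e4
      have e5 : σ.im * s i ≤ |σ.im| := by
        have := le_abs_self (σ.im * s i)
        rw [abs_mul, abs_of_nonneg e3] at this
        nlinarith [abs_nonneg σ.im]
      have := Real.pi_pos
      nlinarith
    · have e3 := hs.1 i
      have e4 := hs.2 i
      simp only [Pi.zero_apply, Pi.one_apply] at e3 e4
      have e5 : ((j i : ℕ) : ℝ) + 1 ≤ (nodes S).card := by exact_mod_cast (j i).2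
      have e6 : (0 : ℝ) ≤ (j i : ℕ) := by positivity
      constructor <;> linarith
  have h3 := norm_setIntegral_le_of_norm_le_const (μ := volume) (s := Set.Icc (0 : Fin M → ℝ) 1)
    (isCompact_Icc.measure_lt_top) h2
  have h4 : volume.real (Set.Icc (0 : Fin M → ℝ) 1) = 1 := by
    rw [Measure.real, ← Set.pi_univ_Icc, volume_pi_pi]; simp
  rwa [h4, mul_one] at h3

lemma FnC_sum (S : Finset ℂ) {M : ℕ} (B : Fin M → ℂ) {ι : Type*} (t : Finset ι) {u : ι → (Fin M → ℝ) → ℂ}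
    (hu : ∀ k, Continuous (u k)) :
    FnC S M B (fun τ => ∑ k ∈ t, u k τ) = ∑ k ∈ t, FnC S M B (u k) := by
  simp only [FnC]
  rw [sum_comm]
  refine sum_congr rfl fun j _ => ?_
  rw [← mul_sum]
  congr 1
  simp only [mul_sum]
  rw [integral_finsetSum]
  intro k _
  have := hu k
  refine Continuous.integrableOn_Icc ?_
  fun_prop

lemma FnC_sub (S : Finset ℂ) {M : ℕ} (B : Fin M → ℂ) {u v : (Fin M → ℝ) → ℂ}
    (hu : Continuous u) (hv : Continuous v) :
    FnC S M B (fun τ => u τ - v τ) = FnC S M B u - FnC S M B v := by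
  simp only [FnC]
  rw [← sum_sub_distrib]
  refine sum_congr rfl fun j _ => ?_
  rw [← mul_sub]
  congr 1
  simp only [mul_sub]
  rw [integral_sub]
  · refine Continuous.integrableOn_Icc ?_
    fun_prop
  · refine Continuous.integrableOn_Icc ?_
    fun_prop

lemma FnC_const_mul (S : Finset ℂ) {M : ℕ} (B : Fin M → ℂ) (u : (Fin M → ℝ) → ℂ) (c : ℂ) :
    FnC S M B (fun τ => c * u τ) = c * FnC S M B u := by
  simp only [FnC]
  rw [mul_sum]
  refine sum_congr rfl fun j _ => ?_
  simp only [mul_left_comm _ c, integral_const_mul]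

lemma FnC_hasSum {S : Finset ℂ} {M : ℕ} {B : Fin M → ℂ} (hB : InC S B) {ι : Type*}
    {u : ι → (Fin M → ℝ) → ℂ} (hu : ∀ k, Continuous (u k)) {w : (Fin M → ℝ) → ℂ} (hw : Continuous w)
    {v : ι → ℝ} (hv : Summable v)
    (hb : ∀ k τ, (∀ i, 0 ≤ τ i ∧ τ i ≤ ((nodes S).card : ℝ)) → ‖u k τ‖ ≤ v k)
    (hs : ∀ τ, (∀ i, 0 ≤ τ i ∧ τ i ≤ ((nodes S).card : ℝ)) → HasSum (fun k => u k τ) (w τ)) :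
    HasSum (fun k => FnC S M B (u k)) (FnC S M B w) := by
  obtain ⟨C, hC, hbd⟩ := FnC_bound S M
  have h0 := (tendsto_tsum_compl_atTop_zero v).const_mul C
  rw [mul_zero] at h0
  have : Filter.Tendsto (fun t : Finset ι => FnC S M B w - ∑ k ∈ t, FnC S M B (u k)) Filter.atTop (nhds 0) := by
    refine squeeze_zero_norm (fun t => ?_) h0
    rw [← FnC_sum S B t hu, ← FnC_sub S B hw (by fun_prop)]
    refine hbd B hB _ _ fun τ hτ => ?_
    have h1 := hs τ hτ
    have h2 : w τ - ∑ k ∈ t, u k τ = ∑' k : {k // k ∉ t}, u k τ := by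
      rw [← h1.tsum_eq, ← h1.summable.sum_add_tsum_subtype_compl t]; ring
    rw [h2]
    exact tsum_of_norm_bounded (hv.subtype _).hasSum fun k => hb k τ hτ
  have h3 := (tendsto_const_nhds (x := FnC S M B w)).sub this
  simpa [HasSum] using h3

lemma sum_pi {ι : Type*} {M : ℕ} : ∀ (r : Fin M → ι → ℂ), (∀ i, Summable fun b => ‖r i b‖) →
    (Summable fun B : Fin M → ι => ‖∏ i, r i (B i)‖) ∧
    HasSum (fun B : Fin M → ι => ∏ i, r i (B i)) (∏ i, ∑' b, r i b) := by
  induction M with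
  | zero =>
    intro r _
    have h1 := hasSum_fintype fun B : Fin 0 → ι => ∏ i, r i (B i)
    have h2 := hasSum_fintype fun B : Fin 0 → ι => ‖∏ i, r i (B i)‖
    exact ⟨h2.summable, by simpa using h1⟩
  | succ M ih =>
    intro r hr
    obtain ⟨h1, h2⟩ := ih (fun i => r i.succ) (fun i => hr i.succ)
    have h3' : Summable fun x : ι × (Fin M → ι) => ‖r 0 x.1 * ∏ i : Fin M, r i.succ (x.2 i)‖ :=
      Summable.mul_norm (f := r 0) (g := fun x : Fin M → ι => ∏ i : Fin M, r i.succ (x i)) (hr 0) h1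
    have h4 := (hr 0).of_norm.hasSum.mul h2 h3'.of_norm
    let e := Fin.consEquiv (fun _ : Fin (M + 1) => ι)
    have he : ∀ x : ι × (Fin M → ι), ∏ i, r i (e x i) = r 0 x.1 * ∏ i : Fin M, r i.succ (x.2 i) := by
      intro x
      rw [Fin.prod_univ_succ]
      rfl
    constructor
    · rw [← e.summable_iff]
      refine h3'.congr fun x => ?_
      simp only [Function.comp, he]
    · rw [← e.hasSum_iff, Fin.prod_univ_succ]
      refine h4.congr_fun fun x => ?_
      simp only [Function.comp, he]

open Classical in
lemma sum_class (S : Finset ℂ) {v : ℂ → ℝ} (hv : ∀ σ ∈ S, Summable fun k : ℕ => v (σ + k)) :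
    Summable fun b : ℂ => if ∃ σ ∈ S, ∃ k : ℕ, b = σ + k then v b else 0 := by
  have h : ∀ σ ∈ S, Summable fun b : ℂ => if ∃ k : ℕ, b = σ + k then ‖v b‖ else 0 := by
    intro σ hσ
    have inj : Function.Injective fun k : ℕ => σ + (k : ℂ) := fun a b h => by simpa using h
    rw [← inj.summable_iff]
    · refine (hv σ hσ).norm.congr fun k => ?_
      simp
    · intro b hb
      rw [if_neg]
      rintro ⟨k, hk⟩
      exact hb ⟨k, hk.symm⟩
  refine Summable.of_norm_bounded (summable_sum h) fun b => ?_
  split_ifs with hb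
  · obtain ⟨σ, hσ, hk⟩ := hb
    have := single_le_sum (f := fun σ => if ∃ k : ℕ, b = σ + k then ‖v b‖ else 0)
      (fun σ _ => by split_ifs <;> positivity) hσ
    simpa [hk] using this
  · simp
    refine sum_nonneg fun σ _ => by split_ifs <;> positivity

open Classical in
lemma sum_InC (S : Finset ℂ) (M : ℕ) {v : Fin M → ℂ → ℝ} (hv : ∀ i, ∀ σ ∈ S, Summable fun k : ℕ => v i (σ + k)) :
    Summable fun B : Fin M → ℂ => if InC S B then ∏ i, v i (B i) else 0 := by
  have h := (sum_pi (fun i (b : ℂ) => ((if ∃ σ ∈ S, ∃ k : ℕ, b = σ + k then v i b else 0 : ℝ) : ℂ))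
    (fun i => by simpa using (sum_class S (hv i)).norm)).1
  rw [← summable_norm_iff]
  refine h.congr fun B => ?_
  by_cases hB : InC S B
  · rw [if_pos hB, ← Complex.ofReal_prod, Complex.norm_real]
    congr 1
    refine prod_congr rfl fun i _ => ?_
    rw [if_pos (hB i)]
  · rw [if_neg hB]
    simp only [InC, not_forall] at hB
    obtain ⟨i, hi⟩ := hB
    rw [prod_eq_zero (mem_univ i)]
    · simp
    · rw [if_neg hi]; simp

structure Expn (S : Finset ℂ) {M : ℕ} (f G : (Fin M → ℂ) → ℂ) : Prop where
  supp : ∀ B, f B ≠ 0 → InC S B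
  hs : ∀ η : Fin M → ℂ, HasSum (fun B => f B * Complex.exp (∑ i, B i * η i)) (G η)

lemma InC.im_bound {S : Finset ℂ} {M : ℕ} {B : Fin M → ℂ} (hB : InC S B) (i : Fin M) :
    |(B i).im| ≤ ∑ σ ∈ S, |σ.im| := by
  obtain ⟨σ, hσ, k, hk⟩ := hB i
  rw [hk]
  simpa using single_le_sum (f := fun σ : ℂ => |σ.im|) (fun _ _ => abs_nonneg _) hσ

lemma Expn.coef {S : Finset ℂ} {M : ℕ} {f G : (Fin M → ℂ) → ℂ} (h : Expn S f G) (hG : Continuous G)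
    {B : Fin M → ℂ} (hB : InC S B) (ζ : Fin M → ℝ) :
    f B * Complex.exp (∑ i, B i * ζ i) =
      FnC S M B (fun τ => G fun i => (ζ i : ℂ) + 2 * Real.pi * Complex.I * τ i) := by
  classical
  have hn := (h.hs fun i => (ζ i : ℂ)).summable.norm
  set I := ∑ σ ∈ S, |σ.im| with hI
  have hI0 : 0 ≤ I := by positivity
  have e1 : ∀ (B' : Fin M → ℂ) (τ : Fin M → ℝ), f B' * Complex.exp (∑ i, B' i * ((ζ i : ℂ) + 2 * Real.pi * Complex.I * τ i))
      = f B' * Complex.exp (∑ i, B' i * ζ i) * Complex.exp (∑ i, B' i * (2 * Real.pi * Complex.I * τ i)) := by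
    intro B' τ
    rw [mul_assoc (f B'), ← Complex.exp_add, ← sum_add_distrib]
    simp only [mul_add]
  have key := FnC_hasSum (S := S) (B := B) hB (ι := Fin M → ℂ)
    (u := fun B' τ => f B' * Complex.exp (∑ i, B' i * ((ζ i : ℂ) + 2 * Real.pi * Complex.I * τ i)))
    (w := fun τ => G fun i => (ζ i : ℂ) + 2 * Real.pi * Complex.I * τ i)
    (fun B' => by fun_prop) (by fun_prop)
    (hn.mul_right (Real.exp (M * (2 * Real.pi * I * (nodes S).card)))) ?_ (fun τ _ => h.hs _)
  · refine HasSum.unique ?_ key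
    have e2 : (fun B' => FnC S M B (fun τ => f B' * Complex.exp (∑ i, B' i * ((ζ i : ℂ) + 2 * Real.pi * Complex.I * τ i))))
        = fun B' => if B' = B then f B * Complex.exp (∑ i, B i * ζ i) else 0 := by
      funext B'
      by_cases h0 : f B' = 0
      · simp only [h0, zero_mul]
        have := FnC_const_mul S B (fun _ => 0) 0
        simp only [zero_mul] at this
        rw [this]
        split_ifs with hh
        · rw [← hh, h0]; simp
        · rfl
      · simp only [e1]
        rw [FnC_const_mul, FnC_exp hB (h.supp _ h0)]
        by_cases hh : B' = B
        · simp [hh]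
        · rw [if_neg (fun h => hh h.symm), if_neg hh, mul_zero]
    rw [e2]
    exact hasSum_ite_eq B _
  · intro B' τ hτ
    by_cases h0 : f B' = 0
    · simp [h0]
    rw [e1, norm_mul]
    refine mul_le_mul_of_nonneg_left ?_ (norm_nonneg _)
    rw [Complex.norm_exp, Real.exp_le_exp, Complex.re_sum]
    have : ∀ i ∈ (univ : Finset (Fin M)), (B' i * (2 * Real.pi * Complex.I * τ i)).re ≤ 2 * Real.pi * I * (nodes S).card := by
      intro i _
      have e3 : (B' i * (2 * Real.pi * Complex.I * τ i)).re = 2 * Real.pi * (-(B' i).im * τ i) := by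
        simp; ring
      rw [e3, mul_assoc (2 * Real.pi)]
      refine mul_le_mul_of_nonneg_left ?_ (by positivity)
      have e4 := (h.supp _ h0).im_bound i
      have e5 := neg_abs_le (B' i).im
      exact mul_le_mul (by linarith) (hτ i).2 (hτ i).1 hI0
    refine (sum_le_sum this).trans ?_
    simp

lemma ident {r δ : ℝ} (hδ : 0 < δ) (hr : δ ≤ r) {f h : ℂ → ℂ} (hf : DifferentiableOn ℂ f (Metric.ball 0 r))
    (hh : DifferentiableOn ℂ h (Metric.ball 0 r)) (he : ∀ x : ℝ, 0 < x → x < δ → f x = h x) :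
    ∀ z ∈ Metric.ball (0 : ℂ) r, f z = h z := by
  have hf' := hf.analyticOnNhd Metric.isOpen_ball
  have hh' := hh.analyticOnNhd Metric.isOpen_ball
  refine hf'.eqOn_of_preconnected_of_frequently_eq hh' (convex_ball _ _).isPreconnected
    (z₀ := ((δ / 2 : ℝ) : ℂ)) ?_ ?_
  · rw [mem_ball_zero_iff, Complex.norm_real, Real.norm_of_nonneg (by positivity)]; linarith
  · have h1 : Filter.Tendsto (fun x : ℝ => (x : ℂ)) (nhdsWithin (δ / 2) {δ / 2}ᶜ)
        (nhdsWithin ((δ / 2 : ℝ) : ℂ) {((δ / 2 : ℝ) : ℂ)}ᶜ) := by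
      refine tendsto_nhdsWithin_of_tendsto_nhds_of_eventually_within _ ?_ ?_
      · exact (Complex.continuous_ofReal.tendsto _).mono_left nhdsWithin_le_nhds
      · filter_upwards [self_mem_nhdsWithin] with x hx
        rw [Set.mem_compl_singleton_iff, Ne, Complex.ofReal_inj]
        exact hx
    refine h1.frequently (Filter.Eventually.frequently ?_)
    refine Filter.Eventually.filter_mono nhdsWithin_le_nhds ?_
    filter_upwards [Ioo_mem_nhds (half_pos hδ) (half_lt_self hδ)] with x hx
    exact he x hx.1 hx.2

lemma geo_bound {r : ℝ} {a : ℕ → ℂ} {A : ℝ} (ha : ∀ k, ‖a k‖ ≤ A * r⁻¹ ^ k) {z : ℂ} {ρ : ℝ}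
    (hz : ‖z‖ ≤ ρ) (k : ℕ) : ‖z ^ k * a k‖ ≤ A * (ρ / r) ^ k := by
  rw [norm_mul, norm_pow, div_eq_mul_inv, mul_pow, ← mul_assoc, mul_comm A, mul_assoc]
  exact mul_le_mul (pow_le_pow_left₀ (norm_nonneg _) hz k) (ha k) (norm_nonneg _)
    (pow_nonneg ((norm_nonneg _).trans hz) _)

lemma geo_summable {r ρ : ℝ} (A : ℝ) (hr : 0 < r) (h0 : 0 ≤ ρ) (h : ρ < r) :
    Summable fun k : ℕ => A * (ρ / r) ^ k :=
  (summable_geometric_of_lt_one (by positivity) ((div_lt_one hr).2 h)).mul_left A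

lemma geo_diff {r : ℝ} (hr : 0 < r) {a : ℕ → ℂ} {A : ℝ} (ha : ∀ k, ‖a k‖ ≤ A * r⁻¹ ^ k) :
    DifferentiableOn ℂ (fun z => ∑' k, z ^ k * a k) (Metric.ball 0 r) := by
  intro z hz
  rw [mem_ball_zero_iff] at hz
  obtain ⟨ρ, h1, h2⟩ := exists_between hz
  have := Complex.differentiableOn_tsum_of_summable_norm (F := fun k z => z ^ k * a k) (u := fun k => A * (ρ / r) ^ k)
    (geo_summable A hr ((norm_nonneg z).trans h1.le) h2) (fun k => by fun_prop) (Metric.isOpen_ball (x := (0 : ℂ)) (ε := ρ))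
    (fun k w hw => geo_bound ha (mem_ball_zero_iff.1 hw).le k)
  exact ((this z (by simpa using h1)).differentiableAt (Metric.isOpen_ball.mem_nhds (by simpa using h1))).differentiableWithinAt

open Classical in
def cont (S : Finset ℂ) {M : ℕ} (G : ℕ → (Fin M → ℂ) → ℂ) (z : ℂ) (B : Fin M → ℂ) : ℂ :=
  if InC S B then ∑' k, z ^ k * FnC S M B (fun τ => G k fun i => 2 * Real.pi * Complex.I * τ i) else 0

open Classical in
lemma sum_InC_exp (S : Finset ℂ) (M : ℕ) :
    Summable fun B : Fin M → ℂ => if InC S B then ∏ i, Real.exp (-(B i).re) else 0 := by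
  refine sum_InC S M (v := fun _ b => Real.exp (-b.re)) fun i σ _ => ?_
  have := (Real.summable_exp_neg_nat).mul_left (Real.exp (-σ.re))
  refine this.congr fun k => ?_
  rw [← Real.exp_add]
  simp [add_comm]

lemma pt_norm {S : Finset ℂ} {M : ℕ} (ζ : Fin M → ℝ) (τ : Fin M → ℝ)
    (hτ : ∀ i, 0 ≤ τ i ∧ τ i ≤ ((nodes S).card : ℝ)) :
    ‖(fun i => (ζ i : ℂ) + 2 * Real.pi * Complex.I * τ i : Fin M → ℂ)‖ ≤ ‖ζ‖ + 2 * Real.pi * (nodes S).card := by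
  rw [pi_norm_le_iff_of_nonneg (by positivity)]
  intro i
  refine (norm_add_le _ _).trans (add_le_add ?_ ?_)
  · rw [Complex.norm_real]; exact norm_le_pi_norm ζ i
  · rw [norm_mul, norm_mul, norm_mul, Complex.norm_real, Complex.norm_real, Complex.norm_I, Real.norm_of_nonneg (hτ i).1,
      Real.norm_of_nonneg Real.pi_pos.le]
    simp only [RCLike.norm_ofNat, mul_one]
    exact mul_le_mul_of_nonneg_left (hτ i).2 (by positivity)

set_option maxHeartbeats 800000 in
lemma cont_spec {S : Finset ℂ} {M : ℕ} {G : ℕ → (Fin M → ℂ) → ℂ} (hc : ∀ k, Differentiable ℂ (G k)) {r δ : ℝ}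
    (hδ : 0 < δ) (hr : δ ≤ r)
    (hbd : ∀ R : ℝ, ∃ A : ℝ, 0 ≤ A ∧ ∀ k η, ‖η‖ ≤ R → ‖G k η‖ ≤ A * r⁻¹ ^ k)
    {g : ℝ → (Fin M → ℂ) → ℂ}
    (hg : ∀ x : ℝ, 0 < x → x < δ → Expn S (g x) (fun η => ∑' k, (x : ℂ) ^ k * G k η)) :
    (∀ B, DifferentiableOn ℂ (fun z => cont S G z B) (Metric.ball 0 r)) ∧
    (∀ x : ℝ, 0 < x → x < δ → cont S G x = g x) ∧
    (∀ z ∈ Metric.ball (0 : ℂ) r, Expn S (cont S G z) (fun η => ∑' k, z ^ k * G k η)) := by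
  classical
  have hr0 : 0 < r := hδ.trans_le hr
  obtain ⟨C, hC, hF⟩ := FnC_bound S M
  set L : ℝ := 2 * Real.pi * (nodes S).card with hL
  have gdiff : ∀ z ∈ Metric.ball (0 : ℂ) r, Differentiable ℂ (fun η => ∑' k, z ^ k * G k η) := by
    intro z hz
    rw [mem_ball_zero_iff] at hz
    refine diff_tsum (fun k => (hc k).const_mul _) fun R => ?_
    obtain ⟨A, hA, hb⟩ := hbd R
    exact ⟨_, geo_summable A hr0 (norm_nonneg z) hz, fun k η hη => geo_bound (a := fun k => G k η)
      (fun k => hb k η hη) le_rfl k⟩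
  -- functional at height `ζ`
  have fk : ∀ (ζ : Fin M → ℝ), ∃ A, 0 ≤ A ∧ ∀ B, InC S B → ∀ k,
      ‖FnC S M B (fun τ => G k fun i => (ζ i : ℂ) + 2 * Real.pi * Complex.I * τ i)‖ ≤ A * r⁻¹ ^ k := by
    intro ζ
    obtain ⟨A, hA, hb⟩ := hbd (‖ζ‖ + L)
    refine ⟨C * A, by positivity, fun B hB k => ?_⟩
    rw [mul_assoc C]
    exact hF B hB _ _ fun τ hτ => hb k _ (pt_norm ζ τ hτ)
  have fz : ∀ (ζ : Fin M → ℝ) B, InC S B → ∀ z ∈ Metric.ball (0 : ℂ) r,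
      HasSum (fun k => z ^ k * FnC S M B (fun τ => G k fun i => (ζ i : ℂ) + 2 * Real.pi * Complex.I * τ i))
        (FnC S M B (fun τ => ∑' k, z ^ k * G k fun i => (ζ i : ℂ) + 2 * Real.pi * Complex.I * τ i)) := by
    intro ζ B hB z hz
    obtain ⟨A, hA, hb⟩ := hbd (‖ζ‖ + L)
    have hcg := (gdiff z hz).continuous
    rw [mem_ball_zero_iff] at hz
    have := FnC_hasSum (S := S) (B := B) hB
      (u := fun k τ => z ^ k * G k fun i => (ζ i : ℂ) + 2 * Real.pi * Complex.I * τ i)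
      (w := fun τ => ∑' k, z ^ k * G k fun i => (ζ i : ℂ) + 2 * Real.pi * Complex.I * τ i)
      (fun k => by have := (hc k).continuous; fun_prop)
      (hcg.comp (by fun_prop : Continuous fun τ : Fin M → ℝ => fun i => (ζ i : ℂ) + 2 * Real.pi * Complex.I * τ i))
      (geo_summable A hr0 (norm_nonneg z) hz)
      (fun k τ hτ => geo_bound (a := fun k => G k _) (fun k => hb k _ (pt_norm ζ τ hτ)) le_rfl k)
      (fun τ hτ => (Summable.of_norm_bounded (geo_summable A hr0 (norm_nonneg z) hz)
        (fun k => geo_bound (a := fun k => G k _) (fun k => hb k _ (pt_norm ζ τ hτ)) le_rfl k)).hasSum)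
    refine this.congr_fun fun k => ?_
    rw [FnC_const_mul]
  have z0 : ∀ (k : ℕ) (B : Fin M → ℂ), FnC S M B (fun τ => G k fun i => 2 * Real.pi * Complex.I * τ i)
      = FnC S M B (fun τ => G k fun i => (((0 : Fin M → ℝ) i : ℝ) : ℂ) + 2 * Real.pi * Complex.I * τ i) := by
    intro k B
    simp
  have hd : ∀ B, DifferentiableOn ℂ (fun z => cont S G z B) (Metric.ball 0 r) := by
    intro B
    by_cases hB : InC S B
    · obtain ⟨A, hA, hb⟩ := fk 0
      simp only [cont, if_pos hB, z0]
      exact geo_diff hr0 (hb B hB)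
    · simp only [cont, if_neg hB]
      exact differentiableOn_const _
  have hagree : ∀ x : ℝ, 0 < x → x < δ → cont S G x = g x := by
    intro x h0 h1
    have hx : (x : ℂ) ∈ Metric.ball (0 : ℂ) r := by
      rw [mem_ball_zero_iff, Complex.norm_real, Real.norm_of_nonneg h0.le]; linarith
    funext B
    by_cases hB : InC S B
    · simp only [cont, if_pos hB, z0]
      rw [(fz 0 B hB x hx).tsum_eq]
      have := (hg x h0 h1).coef (gdiff x hx).continuous hB 0
      rw [← this]
      simp
    · simp only [cont, if_neg hB]
      by_contra h
      exact hB ((hg x h0 h1).supp B (fun h' => h h'.symm))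
  have hgen : ∀ (ζ : Fin M → ℝ) B, InC S B → ∀ z ∈ Metric.ball (0 : ℂ) r,
      cont S G z B * Complex.exp (∑ i, B i * ζ i) =
      ∑' k, z ^ k * FnC S M B (fun τ => G k fun i => (ζ i : ℂ) + 2 * Real.pi * Complex.I * τ i) := by
    intro ζ B hB
    obtain ⟨A, hA, hb⟩ := fk ζ
    refine ident hδ hr ((hd B).mul_const _) (geo_diff hr0 (hb B hB)) ?_
    intro x h0 h1
    have hx : (x : ℂ) ∈ Metric.ball (0 : ℂ) r := by
      rw [mem_ball_zero_iff, Complex.norm_real, Real.norm_of_nonneg h0.le]; linarith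
    rw [hagree x h0 h1, (fz ζ B hB x hx).tsum_eq]
    exact (hg x h0 h1).coef (gdiff x hx).continuous hB ζ
  refine ⟨hd, hagree, fun z hz => ⟨fun B h => ?_, fun η => ?_⟩⟩
  · by_contra hB
    exact h (by simp [cont, hB])
  -- convergence
  set I := ∑ σ ∈ S, |σ.im| with hI
  obtain ⟨A, hA, hb⟩ := fk (fun i => (η i).re + 1)
  have bnd : ∀ (ρ : ℝ), ρ < r → 0 ≤ ρ → ∃ D, 0 ≤ D ∧ ∀ w : ℂ, ‖w‖ ≤ ρ → ∀ B, InC S B →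
      ‖cont S G w B * Complex.exp (∑ i, B i * η i)‖ ≤ D * ∏ i, Real.exp (-(B i).re) := by
    intro ρ h1 h0
    refine ⟨(∑' k : ℕ, A * (ρ / r) ^ k) * Real.exp (∑ i, I * |(η i).im|), ?_, fun w hw B hB => ?_⟩
    · refine mul_nonneg (tsum_nonneg fun k => by positivity) (Real.exp_pos _).le
    have hwb : w ∈ Metric.ball (0 : ℂ) r := by rw [mem_ball_zero_iff]; linarith
    have h2 := hgen (fun i => (η i).re + 1) B hB w hwb
    have h3 : ‖cont S G w B * Complex.exp (∑ i, B i * (((η i).re + 1 : ℝ) : ℂ))‖ ≤ ∑' k : ℕ, A * (ρ / r) ^ k := by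
      rw [h2]
      exact tsum_of_norm_bounded (geo_summable A hr0 h0 h1).hasSum fun k => geo_bound (hb B hB) hw k
    have h4 : Complex.exp (∑ i, B i * η i) = Complex.exp (∑ i, B i * (((η i).re + 1 : ℝ) : ℂ)) *
        Complex.exp (∑ i, B i * ((η i).im * Complex.I - 1)) := by
      rw [← Complex.exp_add, ← sum_add_distrib]
      congr 1
      refine sum_congr rfl fun i _ => ?_
      conv_lhs => rw [← Complex.re_add_im (η i)]
      push_cast; ring
    rw [h4, ← mul_assoc, norm_mul, mul_assoc]
    refine mul_le_mul h3 ?_ (norm_nonneg _) (tsum_nonneg fun k => by positivity)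
    rw [Complex.norm_exp, ← Real.exp_sum, ← Real.exp_add, Real.exp_le_exp, Complex.re_sum, ← sum_add_distrib]
    refine sum_le_sum fun i _ => ?_
    have h5 : (B i * ((η i).im * Complex.I - 1)).re = -(B i).im * (η i).im - (B i).re := by simp; ring
    rw [h5]
    have h6 := neg_abs_le ((B i).im * (η i).im)
    rw [abs_mul] at h6
    have h7 := mul_le_mul_of_nonneg_right (hB.im_bound i) (abs_nonneg (η i).im)
    linarith
  have hsum := sum_InC_exp S M
  have bnd' : ∀ (ρ : ℝ), ρ < r → 0 ≤ ρ → ∃ D, 0 ≤ D ∧ ∀ w : ℂ, ‖w‖ ≤ ρ → ∀ B,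
      ‖cont S G w B * Complex.exp (∑ i, B i * η i)‖ ≤ D * (if InC S B then ∏ i, Real.exp (-(B i).re) else 0) := by
    intro ρ h1 h0
    obtain ⟨D, hD, h⟩ := bnd ρ h1 h0
    refine ⟨D, hD, fun w hw B => ?_⟩
    split_ifs with hB
    · exact h w hw B hB
    · simp [cont, hB]
  have hS : ∀ w ∈ Metric.ball (0 : ℂ) r, Summable fun B => cont S G w B * Complex.exp (∑ i, B i * η i) := by
    intro w hw
    rw [mem_ball_zero_iff] at hw
    obtain ⟨D, hD, h⟩ := bnd' ‖w‖ hw (norm_nonneg _)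
    exact Summable.of_norm_bounded (hsum.mul_left D) (h w le_rfl)
  have hdT : DifferentiableOn ℂ (fun w => ∑' B, cont S G w B * Complex.exp (∑ i, B i * η i)) (Metric.ball 0 r) := by
    intro w hw
    rw [mem_ball_zero_iff] at hw
    obtain ⟨ρ, h1, h2⟩ := exists_between hw
    obtain ⟨D, hD, h⟩ := bnd' ρ h2 ((norm_nonneg w).trans h1.le)
    have := Complex.differentiableOn_tsum_of_summable_norm
      (F := fun B w => cont S G w B * Complex.exp (∑ i, B i * η i)) (hsum.mul_left D)
      (fun B => ((hd B).mono (Metric.ball_subset_ball h2.le)).mul_const _) (Metric.isOpen_ball (x := (0 : ℂ)) (ε := ρ))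
      (fun B w hw => h w (mem_ball_zero_iff.1 hw).le B)
    exact ((this w (by simpa using h1)).differentiableAt (Metric.isOpen_ball.mem_nhds (by simpa using h1))).differentiableWithinAt
  have hfin : ∀ w ∈ Metric.ball (0 : ℂ) r, ∑' B, cont S G w B * Complex.exp (∑ i, B i * η i) = ∑' k, w ^ k * G k η := by
    obtain ⟨A', hA', hb'⟩ := hbd ‖η‖
    refine ident hδ hr hdT (geo_diff hr0 fun k => hb' k η le_rfl) ?_
    intro x h0 h1
    rw [hagree x h0 h1]
    exact ((hg x h0 h1).hs η).tsum_eq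
  have := (hS z hz).hasSum
  rwa [hfin z hz] at this

def preE (C : ℝ) (z : ℂ) : ℝ :=
  C * |z.re| + if z.im = 0 then Real.exp z.re / 4 else C * Real.exp z.re

/-- growth type: order one half in all variables but the last, order one in the last -/
def gE (N : ℕ) (C : ℝ) (i : Fin N) (z : ℂ) : ℝ := if i.val + 1 = N then preE C z else hfE C z

def th (N : ℕ) (i : Fin N) : ℕ := if i.val + 1 = N then 1 else 2

def GrO (N : ℕ) (F : (Fin N → ℂ) → ℂ) : Prop :=
  ∀ T : ℝ, ∃ A C : ℝ, 0 ≤ A ∧ 0 ≤ C ∧ ∀ ζ : Fin N → ℂ, (∀ i, |(ζ i).im| ≤ T) →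
    ‖F ζ‖ ≤ A * Real.exp (∑ i, gE N C i (ζ i))

def GrH (N : ℕ) (F : (Fin N → ℂ) → ℂ) : Prop :=
  ∀ T : ℝ, ∃ A C : ℝ, 0 ≤ A ∧ 0 ≤ C ∧ ∀ ζ : Fin N → ℂ, (∀ i, |(ζ i).im| ≤ T) →
    ‖F ζ‖ ≤ A * Real.exp (∑ i, hfE C (ζ i))

lemma preE_mono {C C' : ℝ} (h : C ≤ C') (z : ℂ) : preE C z ≤ preE C' z := by
  have h1 := mul_le_mul_of_nonneg_right h (abs_nonneg z.re)
  have h2 := mul_le_mul_of_nonneg_right h (Real.exp_pos z.re).le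
  simp only [preE]; split_ifs <;> linarith

lemma preE_nonneg {C : ℝ} (h : 0 ≤ C) (z : ℂ) : 0 ≤ preE C z := by
  have := Real.exp_pos z.re
  have := abs_nonneg z.re
  simp only [preE]; split_ifs <;> positivity

lemma gE_crude {N : ℕ} {C : ℝ} (hC : 0 ≤ C) (i : Fin N) (z : ℂ) :
    gE N C i z ≤ (C + 1) * |z.re| + (C + 1) * Real.exp (z.re / th N i) := by
  have h1 := abs_nonneg z.re
  simp only [gE, th]
  split_ifs with h
  · simp only [preE, Nat.cast_one, div_one]
    have := Real.exp_pos z.re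
    split_ifs <;> nlinarith
  · simp only [hfE, Nat.cast_ofNat]
    have := Real.exp_pos (z.re / 2)
    split_ifs <;> nlinarith

lemma Expn.decay' {S : Finset ℂ} {N : ℕ} {f F : (Fin N → ℂ) → ℂ} (h : Expn S f F) (hF : Continuous F)
    (tt : Fin N → ℕ) (hτ12 : ∀ i, 1 ≤ tt i ∧ tt i ≤ 2)
    (hg : ∀ T : ℝ, ∃ A C : ℝ, 0 ≤ A ∧ 0 ≤ C ∧ ∀ ζ : Fin N → ℂ, (∀ i, |(ζ i).im| ≤ T) →
      ‖F ζ‖ ≤ A * Real.exp (∑ i, ((C + 1) * |(ζ i).re| + (C + 1) * Real.exp ((ζ i).re / tt i)))) : ∃ C0 K : ℝ, 0 ≤ C0 ∧ 1 ≤ K ∧ ∀ (σ : Fin N → ℂ) (k : Fin N → ℕ), (∀ i, σ i ∈ S) →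
      ‖f (fun i => σ i + k i)‖ ≤ C0 * ∏ i, (K ^ (k i) / (Nat.factorial (k i) : ℝ) ^ tt i) := by
  obtain ⟨A, C, hA, hC, hb⟩ := hg (2 * Real.pi * (nodes S).card)
  obtain ⟨Cf, hCf, hf⟩ := FnC_bound S N
  set R := ∑ σ ∈ S, |σ.re| with hR
  have hR0 : 0 ≤ R := by positivity
  set c : ℝ := 2 * (C + 1) + 2 * R + (C + 1) with hc
  have hc0 : 0 ≤ c := by positivity
  refine ⟨Cf * A * Real.exp c ^ N, Real.exp c, by positivity, Real.one_le_exp hc0, fun σ k hσ => ?_⟩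
  set B : Fin N → ℂ := fun i => σ i + k i with hBd
  have hB : InC S B := fun i => ⟨σ i, hσ i, k i, rfl⟩
  let κ : Fin N → ℝ := fun i => max (k i) 1
  have hκ1 : ∀ i, 1 ≤ κ i := fun i => le_max_right _ _
  have hκk : ∀ i, (k i : ℝ) ≤ κ i := fun i => le_max_left _ _
  let ζ : Fin N → ℝ := fun i => tt i * Real.log (κ i)
  have e1 := h.coef hF hB ζ
  have th1 : ∀ i, (1 : ℝ) ≤ tt i ∧ (tt i : ℝ) ≤ 2 := fun i => by
    exact ⟨by exact_mod_cast (hτ12 i).1, by exact_mod_cast (hτ12 i).2⟩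
  have hζ0 : ∀ i, 0 ≤ ζ i := fun i => mul_nonneg (by linarith [th1 i]) (Real.log_nonneg (hκ1 i))
  have e2 : ‖FnC S N B (fun τ => F fun i => (ζ i : ℂ) + 2 * Real.pi * Complex.I * τ i)‖ ≤
      Cf * (A * Real.exp (∑ i, ((C + 1) * ζ i + (C + 1) * κ i))) := by
    refine hf B hB _ _ fun τ hτ => ?_
    refine (hb _ fun i => ?_).trans ?_
    · simp only [Complex.add_im, Complex.ofReal_im, Complex.mul_im, Complex.mul_re, Complex.I_re, Complex.I_im,
        Complex.ofReal_re, zero_add]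
      simp
      rw [abs_of_nonneg (hτ i).1, abs_of_nonneg Real.pi_pos.le]
      exact mul_le_mul_of_nonneg_left (hτ i).2 (by positivity)
    · refine mul_le_mul_of_nonneg_left (Real.exp_le_exp.2 (sum_le_sum fun i _ => ?_)) hA
      have e3 : ((ζ i : ℂ) + 2 * Real.pi * Complex.I * τ i).re = ζ i := by simp
      rw [e3, abs_of_nonneg (hζ0 i)]
      have e4 : Real.exp (ζ i / tt i) = κ i := by
        simp only [ζ]
        rw [mul_div_cancel_left₀ _ (by linarith [th1 i]), Real.exp_log (by linarith [hκ1 i])]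
      rw [e4]
  have e5 : ‖f B‖ * Real.exp (∑ i, (B i).re * ζ i) ≤ Cf * (A * Real.exp (∑ i, ((C + 1) * ζ i + (C + 1) * κ i))) := by
    refine le_trans (le_of_eq ?_) e2
    rw [← e1, norm_mul, Complex.norm_exp, Complex.re_sum]
    simp
  have e6 : ‖f B‖ ≤ Cf * A * Real.exp (∑ i, ((C + 1) * ζ i + (C + 1) * κ i - (B i).re * ζ i)) := by
    rw [sum_sub_distrib, Real.exp_sub, mul_div_assoc', le_div_iff₀ (Real.exp_pos _)]
    linarith
  refine e6.trans ?_
  rw [mul_assoc (Cf * A)]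
  refine mul_le_mul_of_nonneg_left ?_ (by positivity)
  have e7 : Real.exp c ^ N = ∏ _i : Fin N, Real.exp c := by simp
  rw [Real.exp_sum, e7, ← prod_mul_distrib]
  refine prod_le_prod (fun _ _ => (Real.exp_pos _).le) fun i _ => ?_
  have f1 : (Nat.factorial (k i) : ℝ) ^ tt i ≤ Real.exp (k i * ζ i) := by
    have : (Nat.factorial (k i) : ℝ) ≤ κ i ^ k i := by
      refine le_trans (by exact_mod_cast Nat.factorial_le_pow (k i)) (pow_le_pow_left₀ (by positivity) (hκk i) _)
    refine (pow_le_pow_left₀ (by positivity) this _).trans (le_of_eq ?_)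
    conv_lhs => rw [← Real.exp_log (show 0 < κ i by linarith [hκ1 i])]
    rw [← Real.exp_nat_mul, ← Real.exp_nat_mul]
    simp only [ζ]; congr 1; ring
  have f2 : ζ i ≤ 2 * κ i := by
    have a1 := Real.log_le_sub_one_of_pos (show 0 < κ i by linarith [hκ1 i])
    have a2 := th1 i
    have a3 := Real.log_nonneg (hκ1 i)
    simp only [ζ]
    nlinarith
  have f3 : κ i ≤ k i + 1 := max_le (by linarith) (by linarith [(Nat.cast_nonneg (k i) : (0 : ℝ) ≤ k i)])
  have f4 : (B i).re = (σ i).re + k i := by simp [hBd]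
  have f5 : |(σ i).re| ≤ R := single_le_sum (f := fun σ : ℂ => |σ.re|) (fun _ _ => abs_nonneg _) (hσ i)
  have f6 := neg_abs_le (σ i).re
  have f7 : (C + 1) * ζ i + (C + 1) * κ i - (B i).re * ζ i ≤ c * (k i + 1) - k i * ζ i := by
    rw [f4]
    have g1 : -(σ i).re * ζ i ≤ R * (2 * (k i + 1)) :=
      mul_le_mul (by linarith) (by linarith) (hζ0 i) hR0
    have g2 : (C + 1) * ζ i ≤ (C + 1) * (2 * (k i + 1)) := mul_le_mul_of_nonneg_left (by linarith) (by positivity)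
    have g3 : (C + 1) * κ i ≤ (C + 1) * (k i + 1) := mul_le_mul_of_nonneg_left f3 (by positivity)
    rw [hc]; nlinarith
  refine (Real.exp_le_exp.2 f7).trans ?_
  rw [Real.exp_sub, mul_div_assoc', ← Real.exp_nat_mul, ← Real.exp_add]
  have f8 : c + (k i : ℝ) * c = c * (k i + 1) := by ring
  rw [f8]
  refine div_le_div_of_nonneg_left (Real.exp_pos _).le (by positivity) f1

lemma Expn.decay {S : Finset ℂ} {N : ℕ} {f F : (Fin N → ℂ) → ℂ} (h : Expn S f F) (hF : Continuous F)
    (hg : GrO N F) : ∃ C0 K : ℝ, 0 ≤ C0 ∧ 1 ≤ K ∧ ∀ (σ : Fin N → ℂ) (k : Fin N → ℕ), (∀ i, σ i ∈ S) →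
      ‖f (fun i => σ i + k i)‖ ≤ C0 * ∏ i, (K ^ (k i) / (Nat.factorial (k i) : ℝ) ^ th N i) := by
  refine h.decay' hF (th N) (fun i => by simp only [th]; split_ifs <;> norm_num) fun T => ?_
  obtain ⟨A, C, hA, hC, hb⟩ := hg T
  refine ⟨A, C, hA, hC, fun ζ hζ => (hb ζ hζ).trans ?_⟩
  exact mul_le_mul_of_nonneg_left (Real.exp_le_exp.2 (sum_le_sum fun i _ => gE_crude hC i _)) hA

lemma Expn.decayH {S : Finset ℂ} {N : ℕ} {f F : (Fin N → ℂ) → ℂ} (h : Expn S f F) (hF : Continuous F)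
    (hg : GrH N F) : ∃ C0 K : ℝ, 0 ≤ C0 ∧ 1 ≤ K ∧ ∀ (σ : Fin N → ℂ) (k : Fin N → ℕ), (∀ i, σ i ∈ S) →
      ‖f (fun i => σ i + k i)‖ ≤ C0 * ∏ i, (K ^ (k i) / (Nat.factorial (k i) : ℝ) ^ 2) := by
  refine h.decay' hF (fun _ => 2) (fun i => by norm_num) fun T => ?_
  obtain ⟨A, C, hA, hC, hb⟩ := hg T
  refine ⟨A, C, hA, hC, fun ζ hζ => (hb ζ hζ).trans ?_⟩
  refine mul_le_mul_of_nonneg_left (Real.exp_le_exp.2 (sum_le_sum fun i _ => ?_)) hA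
  have h1 := abs_nonneg (ζ i).re
  simp only [hfE, Nat.cast_ofNat]
  have := Real.exp_pos ((ζ i).re / 2)
  split_ifs <;> nlinarith

lemma hfE_add {C : ℝ} (hC : 0 ≤ C) (a b : ℂ) : hfE C (a + b) ≤ preE (C + C ^ 2) a + preE (C + C ^ 2) b := by
  have h0 : C * |a.re + b.re| ≤ C * |a.re| + C * |b.re| := by
    rw [← mul_add]; exact mul_le_mul_of_nonneg_left (abs_add_le _ _) hC
  have h1 := mul_nonneg (sq_nonneg C) (abs_nonneg a.re)
  have h2 := mul_nonneg (sq_nonneg C) (abs_nonneg b.re)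
  have e1 : Real.exp a.re = Real.exp (a.re / 2) ^ 2 := by rw [← Real.exp_nat_mul]; ring_nf
  have e2 : Real.exp b.re = Real.exp (b.re / 2) ^ 2 := by rw [← Real.exp_nat_mul]; ring_nf
  have e3 : Real.exp ((a.re + b.re) / 2) = Real.exp (a.re / 2) * Real.exp (b.re / 2) := by
    rw [← Real.exp_add]; ring_nf
  have p := Real.exp_pos (a.re / 2)
  have q := Real.exp_pos (b.re / 2)
  simp only [hfE, preE, Complex.add_re, e1, e2, e3]
  generalize Real.exp (a.re / 2) = u at *
  generalize Real.exp (b.re / 2) = v at *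
  have k0 : 0 ≤ C * u ^ 2 := by positivity
  have k1 : 0 ≤ C * v ^ 2 := by positivity
  have k2 : 0 ≤ C ^ 2 * u ^ 2 := by positivity
  have k3 : 0 ≤ C ^ 2 * v ^ 2 := by positivity
  have j1 : C * (u * v) ≤ u ^ 2 / 4 + C ^ 2 * v ^ 2 := by nlinarith [sq_nonneg (u / 2 - C * v)]
  have j2 : C * (u * v) ≤ v ^ 2 / 4 + C ^ 2 * u ^ 2 := by nlinarith [sq_nonneg (v / 2 - C * u)]
  have j3 : C * (u * v) ≤ C * u ^ 2 + C * v ^ 2 := by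
    nlinarith [mul_nonneg hC (sq_nonneg (u - v)), mul_nonneg hC (sq_nonneg (u + v))]
  have j4 := sq_nonneg u
  have j5 := sq_nonneg v
  by_cases ha : a.im = 0
  · by_cases hb : b.im = 0
    · have : (a + b).im = 0 := by simp [ha, hb]
      simp only [ha, hb, this, if_true]; linarith
    · have : (a + b).im ≠ 0 := by simp [ha, hb]
      simp only [ha, hb, this, if_true, if_false]; linarith
  · by_cases hb : b.im = 0
    · have : (a + b).im ≠ 0 := by simp [ha, hb]
      simp only [ha, hb, this, if_true, if_false]; linarith
    · simp only [ha, hb, if_false]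
      split_ifs <;> linarith

/-- shifted vector -/
def sh {N : ℕ} (ξ : Fin N → ℂ) (t : ℂ) : Fin N → ℂ := fun i => (Fin.snoc ξ t : Fin (N + 1) → ℂ) i.succ

def Psi (N : ℕ) (ν : ℂ) (F : (Fin N → ℂ) → ℂ) (c t : ℂ) (z : Fin N → ℂ × ℂ) : ℂ :=
  Complex.exp (ν * ∑ i, (z i).1) * F fun i => (z i).2 + sh (fun i => (z i).1) (c * t) i

def XX {N : ℕ} (z : Fin N → ℂ × ℂ) : ℂ := ∑ i, (Complex.exp (z i).1 + Complex.exp (z i).2)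

def Hk (N : ℕ) (ν : ℂ) (F : (Fin N → ℂ) → ℂ) (c : ℂ) (l0 : ℝ) (k : ℕ) (t : ℂ) (z : Fin N → ℂ × ℂ) : ℂ :=
  XX z ^ k / (k.factorial : ℂ) * Complex.exp (-(l0 : ℂ) * XX z) * Psi N ν F c t z

def PsiB (N : ℕ) (ν : ℂ) (F : (Fin N → ℂ) → ℂ) (c : ℂ) : Prop :=
  ∀ T : ℝ, ∃ A C : ℝ, 0 ≤ A ∧ 0 ≤ C ∧ ∀ (t : ℂ) (z : Fin N → ℂ × ℂ), |t.im| ≤ T →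
    (∀ i, |(z i).1.im| ≤ T ∧ |(z i).2.im| ≤ T) →
    ‖Psi N ν F c t z‖ ≤ A * Real.exp (preE C t + ∑ i, (preE C (z i).1 + preE C (z i).2))

lemma sh_lt {N : ℕ} (ξ : Fin N → ℂ) (t : ℂ) (i : Fin N) (h : i.val + 1 < N) : sh ξ t i = ξ ⟨i.val + 1, h⟩ := by
  simp [sh, Fin.snoc, h]; rfl

lemma sh_last {N : ℕ} (ξ : Fin N → ℂ) (t : ℂ) (i : Fin N) (h : i.val + 1 = N) : sh ξ t i = t := by
  simp [sh, Fin.snoc, h]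

lemma sum_sh_le {N : ℕ} (φ : ℂ → ℝ) (hφ : ∀ z, 0 ≤ φ z) (ξ : Fin N → ℂ) (t : ℂ) :
    ∑ i, φ (sh ξ t i) ≤ φ t + ∑ i, φ (ξ i) := by
  have h1 := Fin.sum_univ_succ (fun i => φ ((Fin.snoc ξ t : Fin (N + 1) → ℂ) i))
  have h2 := Fin.sum_univ_castSucc (fun i => φ ((Fin.snoc ξ t : Fin (N + 1) → ℂ) i))
  simp only [Fin.snoc_castSucc, Fin.snoc_last] at h2
  have h3 := hφ ((Fin.snoc ξ t : Fin (N + 1) → ℂ) 0)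
  have : ∑ i, φ (sh ξ t i) = ∑ i : Fin N, φ ((Fin.snoc ξ t : Fin (N + 1) → ℂ) i.succ) := rfl
  linarith

lemma norm_exp_sum_le {N : ℕ} (ν : ℂ) {T : ℝ} (ξ : Fin N → ℂ) (h : ∀ i, |(ξ i).im| ≤ T) :
    ‖Complex.exp (ν * ∑ i, ξ i)‖ ≤ Real.exp (N * (‖ν‖ * T)) * Real.exp (∑ i, ‖ν‖ * |(ξ i).re|) := by
  rw [Complex.norm_exp, ← Real.exp_add]
  refine Real.exp_le_exp.2 ?_
  rw [mul_sum, Complex.re_sum]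
  have : (N : ℝ) * (‖ν‖ * T) = ∑ _i : Fin N, ‖ν‖ * T := by simp
  rw [this, ← sum_add_distrib]
  refine sum_le_sum fun i _ => ?_
  refine (Complex.re_le_norm _).trans ?_
  rw [norm_mul, ← mul_add]
  refine mul_le_mul_of_nonneg_left ?_ (norm_nonneg _)
  linarith [Complex.norm_le_abs_re_add_abs_im (ξ i), h i]

lemma preE_add_abs {C D : ℝ} (hC : 0 ≤ C) (hD : 0 ≤ D) (z : ℂ) :
    D * |z.re| + preE C z ≤ preE (C + D) z := by
  simp only [preE]
  have := Real.exp_pos z.re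
  split_ifs <;> nlinarith

/-- from a bound of the argument function to a bound of Psi -/
lemma PsiB_of {N : ℕ} {ν c : ℂ} {F : (Fin N → ℂ) → ℂ}
    (h : ∀ T : ℝ, ∃ A C : ℝ, 0 ≤ A ∧ 0 ≤ C ∧ ∀ (t : ℂ) (z : Fin N → ℂ × ℂ), |t.im| ≤ T →
    (∀ i, |(z i).1.im| ≤ T ∧ |(z i).2.im| ≤ T) → ‖F fun i => (z i).2 + sh (fun i => (z i).1) (c * t) i‖ ≤
      A * Real.exp (preE C t + ∑ i, (preE C (z i).1 + preE C (z i).2))) : PsiB N ν F c := by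
  intro T
  obtain ⟨A, C, hA, hC, hb⟩ := h T
  refine ⟨Real.exp (N * (‖ν‖ * T)) * A, C + ‖ν‖, by positivity, by positivity, fun t z ht hz => ?_⟩
  rw [Psi, norm_mul]
  have e1 := norm_exp_sum_le ν (fun i => (z i).1) (fun i => (hz i).1)
  refine (mul_le_mul e1 (hb t z ht hz) (norm_nonneg _) (by positivity)).trans ?_
  rw [show ∀ a b c d : ℝ, a * b * (c * d) = a * c * (b * d) by intros; ring, ← Real.exp_add]
  refine mul_le_mul_of_nonneg_left (Real.exp_le_exp.2 ?_) (by positivity)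
  have e2 := preE_mono (show C ≤ C + ‖ν‖ by linarith [norm_nonneg ν]) t
  have e3 : ∑ i, ‖ν‖ * |(z i).1.re| + ∑ i, (preE C (z i).1 + preE C (z i).2) ≤
      ∑ i, (preE (C + ‖ν‖) (z i).1 + preE (C + ‖ν‖) (z i).2) := by
    rw [← sum_add_distrib]
    refine sum_le_sum fun i _ => ?_
    have := preE_add_abs hC (norm_nonneg ν) (z i).1
    have := preE_mono (show C ≤ C + ‖ν‖ by linarith [norm_nonneg ν]) (z i).2
    linarith
  linarith

lemma GrH.psiB {N : ℕ} {F : (Fin N → ℂ) → ℂ} (h : GrH N F) (ν : ℂ) : PsiB N ν F 1 := by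
  refine PsiB_of fun T => ?_
  obtain ⟨A, C, hA, hC, hb⟩ := h (T + T)
  refine ⟨A, C + C ^ 2, hA, by positivity, fun t z ht hz => ?_⟩
  refine (hb _ fun i => ?_).trans (mul_le_mul_of_nonneg_left (Real.exp_le_exp.2 ?_) hA)
  · rw [Complex.add_im]
    refine (abs_add_le _ _).trans (add_le_add (hz i).2 ?_)
    by_cases hi : i.val + 1 < N
    · rw [sh_lt _ _ _ hi]; exact (hz _).1
    · rw [sh_last _ _ _ (by omega)]; simpa using ht
  · refine (sum_le_sum fun i _ => hfE_add hC (z i).2 _).trans ?_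
    rw [sum_add_distrib, sum_add_distrib]
    have := sum_sh_le (preE (C + C ^ 2)) (preE_nonneg (by positivity)) (fun i => (z i).1) (1 * t)
    rw [one_mul] at this ⊢
    linarith

lemma GrO.psiB {N : ℕ} {F : (Fin N → ℂ) → ℂ} (h : GrO N F) (ν : ℂ) : PsiB N ν F 0 := by
  refine PsiB_of fun T => ?_
  obtain ⟨A, C, hA, hC, hb⟩ := h (T + T)
  refine ⟨A * Real.exp (preE (C + C ^ 2) 0), C + C ^ 2, by positivity, by positivity, fun t z ht hz => ?_⟩
  have hT : 0 ≤ T := (abs_nonneg _).trans ht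
  refine (hb _ fun i => ?_).trans ?_
  · rw [Complex.add_im]
    refine (abs_add_le _ _).trans (add_le_add (hz i).2 ?_)
    by_cases hi : i.val + 1 < N
    · rw [sh_lt _ _ _ hi]; exact (hz _).1
    · rw [sh_last _ _ _ (by omega)]; simpa using hT
  · rw [mul_assoc, ← Real.exp_add]
    refine mul_le_mul_of_nonneg_left (Real.exp_le_exp.2 ?_) hA
    have e1 : ∀ i ∈ univ, gE N C i ((z i).2 + sh (fun i => (z i).1) (0 * t) i) ≤
        preE (C + C ^ 2) (z i).2 + preE (C + C ^ 2) (sh (fun i => (z i).1) (0 * t) i) := fun i _ => by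
      simp only [gE]
      split_ifs with hi
      · rw [sh_last _ _ _ hi, zero_mul, add_zero]
        have := preE_mono (show C ≤ C + C ^ 2 by nlinarith) (z i).2
        have := preE_nonneg (show 0 ≤ C + C ^ 2 by positivity) 0
        linarith
      · exact hfE_add hC _ _
    refine (sum_le_sum e1).trans ?_
    rw [sum_add_distrib, sum_add_distrib]
    have := sum_sh_le (preE (C + C ^ 2)) (preE_nonneg (by positivity)) (fun i => (z i).1) (0 * t)
    have := preE_nonneg (show 0 ≤ C + C ^ 2 by positivity) t
    rw [zero_mul] at *
    linarith

lemma pow_div_fact_le {r x : ℝ} (hr : 0 < r) (hx : 0 ≤ x) (k : ℕ) :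
    x ^ k / (k.factorial : ℝ) ≤ r⁻¹ ^ k * Real.exp (r * x) := by
  have h := Real.pow_div_factorial_le_exp (r * x) (by positivity) k
  have : x ^ k / (k.factorial : ℝ) = r⁻¹ ^ k * ((r * x) ^ k / (k.factorial : ℝ)) := by
    rw [mul_pow, inv_pow]; field_simp
  rw [this]; exact mul_le_mul_of_nonneg_left h (by positivity)

lemma Hk_dec {N : ℕ} {ν c : ℂ} {F : (Fin N → ℂ) → ℂ} (h : PsiB N ν F c) {l0 : ℝ} (hl : 3 / 4 < l0) (T : ℝ) :
    ∃ A C : ℝ, 0 ≤ A ∧ 0 ≤ C ∧ ∀ (k : ℕ) (t : ℂ), |t.im| ≤ T →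
      DecN N (Hk N ν F c l0 k t) T (A * Real.exp (preE C t) * (l0 - 3 / 4)⁻¹ ^ k) C := by
  obtain ⟨A, C, hA, hC, hb⟩ := h T
  set r := l0 - 3 / 4 with hr
  have hr0 : 0 < r := by linarith
  refine ⟨A, C + r + l0, hA, by positivity, fun k t ht z hz => ?_⟩
  have e0 : ‖XX z‖ ≤ ∑ i, (Real.exp (z i).1.re + Real.exp (z i).2.re) := by
    refine (norm_sum_le _ _).trans (sum_le_sum fun i _ => (norm_add_le _ _).trans (le_of_eq ?_))
    rw [Complex.norm_exp, Complex.norm_exp]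
  have e1 : ‖XX z ^ k / (k.factorial : ℂ)‖ ≤ r⁻¹ ^ k * Real.exp (∑ i, (r * Real.exp (z i).1.re + r * Real.exp (z i).2.re)) := by
    rw [norm_div, norm_pow, Complex.norm_natCast]
    refine (pow_div_fact_le hr0 (norm_nonneg _) k).trans ?_
    refine mul_le_mul_of_nonneg_left (Real.exp_le_exp.2 ?_) (by positivity)
    refine (mul_le_mul_of_nonneg_left e0 hr0.le).trans (le_of_eq ?_)
    rw [mul_sum]; simp only [mul_add]
  have e2 : ‖Complex.exp (-(l0 : ℂ) * XX z)‖ = Real.exp (∑ i, (-l0 * (Complex.exp (z i).1).re + -l0 * (Complex.exp (z i).2).re)) := by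
    rw [Complex.norm_exp, XX, ← Complex.ofReal_neg, Complex.re_ofReal_mul, Complex.re_sum, mul_sum]
    simp only [Complex.add_re, mul_add]
  rw [Hk, norm_mul, norm_mul, e2]
  refine (mul_le_mul (mul_le_mul_of_nonneg_right e1 (Real.exp_pos _).le) (hb t z ht hz) (norm_nonneg _) (by positivity)).trans ?_
  rw [Real.exp_add, show ∀ a b c d e f : ℝ, a * b * c * (d * (e * f)) = d * e * a * (b * c * f) by intros; ring,
    ← Real.exp_add, ← Real.exp_add, ← sum_add_distrib, ← sum_add_distrib]
  have key : ∀ w : ℂ, r * Real.exp w.re + -l0 * (Complex.exp w).re + preE C w ≤ dcE (C + r + l0) w := by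
    intro w
    have p := Real.exp_pos w.re
    have q := abs_nonneg w.re
    simp only [preE, dcE]
    split_ifs with hw
    · have : (Complex.exp w).re = Real.exp w.re := by rw [Complex.exp_re, hw]; simp
      rw [this]
      have : r * Real.exp w.re = l0 * Real.exp w.re - 3 / 4 * Real.exp w.re := by rw [hr]; ring
      nlinarith [mul_nonneg hr0.le q, mul_nonneg (show (0:ℝ) ≤ l0 by linarith) q]
    · have : -(Complex.exp w).re ≤ Real.exp w.re := by
        have := Complex.abs_re_le_norm (Complex.exp w)
        rw [Complex.norm_exp] at this
        linarith [neg_abs_le (Complex.exp w).re]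
      nlinarith [mul_nonneg hr0.le q, mul_nonneg (show (0:ℝ) ≤ l0 by linarith) q]
  refine mul_le_mul (mul_le_mul_of_nonneg_right (mul_le_mul_of_nonneg_left (Real.exp_le_exp.2 (preE_mono (by linarith) t)) hA)
    (by positivity)) (Real.exp_le_exp.2 (sum_le_sum fun i _ => ?_)) (by positivity) (by positivity)
  linarith [key (z i).1, key (z i).2]

lemma sh_diff {E : Type*} [NormedAddCommGroup E] [NormedSpace ℂ E] {N : ℕ} {f : E → Fin N → ℂ} {g : E → ℂ}
    (hf : Differentiable ℂ f) (hg : Differentiable ℂ g) : Differentiable ℂ fun e => sh (f e) (g e) := by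
  rw [differentiable_pi]
  intro i
  by_cases hi : i.val + 1 < N
  · simp only [sh_lt _ _ _ hi]; exact differentiable_pi.1 hf _
  · have : i.val + 1 = N := by omega
    simp only [sh_last _ _ _ this]; exact hg

lemma XX_diff {N : ℕ} : Differentiable ℂ (XX : (Fin N → ℂ × ℂ) → ℂ) := by
  unfold XX; fun_prop

lemma Psi_diff {N : ℕ} {ν c : ℂ} {F : (Fin N → ℂ) → ℂ} (hF : Differentiable ℂ F) :
    Differentiable ℂ fun p : ℂ × (Fin N → ℂ × ℂ) => Psi N ν F c p.1 p.2 := by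
  unfold Psi
  refine Differentiable.mul (by fun_prop) (hF.comp ?_)
  exact Differentiable.add (by fun_prop) (sh_diff (by fun_prop) (by fun_prop))

lemma Hk_diff {N : ℕ} {ν c : ℂ} {F : (Fin N → ℂ) → ℂ} (hF : Differentiable ℂ F) (l0 : ℝ) (k : ℕ) :
    Differentiable ℂ fun p : ℂ × (Fin N → ℂ × ℂ) => Hk N ν F c l0 k p.1 p.2 := by
  unfold Hk
  have := XX_diff (N := N)
  refine Differentiable.mul ?_ (Psi_diff hF)
  fun_prop

lemma Hk_adm {N : ℕ} {ν c : ℂ} {F : (Fin N → ℂ) → ℂ} (hF : Differentiable ℂ F) (h : PsiB N ν F c) {l0 : ℝ}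
    (hl : 3 / 4 < l0) (k : ℕ) (t : ℂ) : AdmN N (Hk N ν F c l0 k t) := by
  have hd : Differentiable ℂ fun z : Fin N → ℂ × ℂ => (t, z) := by fun_prop
  have hd2 := Differentiable.comp (g := fun p : ℂ × (Fin N → ℂ × ℂ) => Hk N ν F c l0 k p.1 p.2) (Hk_diff hF l0 k) hd
  refine ⟨hd2, fun T => ?_⟩
  obtain ⟨A, C, hA, hC, hb⟩ := Hk_dec h hl (max T |t.im|)
  have hr : 0 < l0 - 3 / 4 := by linarith
  exact ⟨_, C, by positivity, hC, (hb k t (le_max_right _ _)).monoT (le_max_left _ _)⟩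

def Gk (N : ℕ) (ν : ℂ) (F : (Fin N → ℂ) → ℂ) (c : ℂ) (l0 : ℝ) (k : ℕ) (η : Fin (N + 1) → ℂ) : ℂ :=
  Complex.exp (ν * (c * η (Fin.last N))) * Conv N (Hk N ν F c l0 k (η (Fin.last N))) (fun i => η i.castSucc)

lemma Gk_diff {N : ℕ} {ν c : ℂ} {F : (Fin N → ℂ) → ℂ} (hF : Differentiable ℂ F) (h : PsiB N ν F c) {l0 : ℝ}
    (hl : 3 / 4 < l0) (k : ℕ) : Differentiable ℂ (Gk N ν F c l0 k) := by
  have h1 := (Conv_main N).1 ℂ (Hk N ν F c l0 k) (Hk_diff hF l0 k) (fun R => by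
    obtain ⟨A, C, hA, hC, hb⟩ := Hk_dec h hl R
    have hr : 0 < l0 - 3 / 4 := by linarith
    refine ⟨A * Real.exp (C * R + Real.exp R + C * Real.exp R) * (l0 - 3 / 4)⁻¹ ^ k, C, by positivity, hC, fun e he => ?_⟩
    refine (hb k e ((Complex.abs_im_le_norm e).trans he)).mono (by positivity) ?_ le_rfl
    refine mul_le_mul_of_nonneg_right (mul_le_mul_of_nonneg_left (Real.exp_le_exp.2 ?_) hA) (by positivity)
    have e1 := (Complex.abs_re_le_norm e).trans he
    have e2 : Real.exp e.re ≤ Real.exp R := Real.exp_le_exp.2 ((le_abs_self _).trans e1)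
    have e3 := Real.exp_pos e.re
    simp only [preE]
    split_ifs <;> nlinarith)
  have hd : Differentiable ℂ fun η : Fin (N + 1) → ℂ => (η (Fin.last N), fun i : Fin N => η i.castSucc) := by fun_prop
  have hd2 := Differentiable.comp (g := fun p : ℂ × (Fin N → ℂ) => Conv N (Hk N ν F c l0 k p.1) p.2) h1 hd
  have hd3 : Differentiable ℂ fun η : Fin (N + 1) → ℂ => Complex.exp (ν * (c * η (Fin.last N))) := by fun_prop
  exact hd3.mul hd2

lemma Gk_bd {N : ℕ} {ν c : ℂ} (hc : ‖c‖ ≤ 1) {F : (Fin N → ℂ) → ℂ} (hF : Differentiable ℂ F) (h : PsiB N ν F c) {l0 : ℝ}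
    (hl : 3 / 4 < l0) {T : ℝ} (hT : 0 ≤ T) : ∃ A C : ℝ, 0 ≤ A ∧ 0 ≤ C ∧ ∀ (k : ℕ) (η : Fin (N + 1) → ℂ), (∀ i, |(η i).im| ≤ T) →
      ‖Gk N ν F c l0 k η‖ ≤ A * Real.exp (preE C (η (Fin.last N)) + ∑ i : Fin N, hfE C (η i.castSucc)) * (l0 - 3 / 4)⁻¹ ^ k := by
  obtain ⟨A, C, hA, hC, hb⟩ := Hk_dec h hl T
  obtain ⟨K, hK, hcv⟩ := (Conv_main N).2 T C hT hC
  have hr : 0 < l0 - 3 / 4 := by linarith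
  refine ⟨Real.exp (‖ν‖ * T) * A * K, K + (C + ‖ν‖), by positivity, by positivity, fun k η hη => ?_⟩
  have e1 := hcv _ _ (Hk_adm hF h hl k (η (Fin.last N))) (by positivity) (hb k _ (hη _)) (fun i => η i.castSucc) (fun i => hη _)
  rw [Gk, norm_mul]
  have e2 : ‖Complex.exp (ν * (c * η (Fin.last N)))‖ ≤ Real.exp (‖ν‖ * T) * Real.exp (‖ν‖ * |(η (Fin.last N)).re|) := by
    rw [Complex.norm_exp, ← Real.exp_add]
    refine Real.exp_le_exp.2 ((Complex.re_le_norm _).trans ?_)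
    rw [norm_mul, norm_mul, ← mul_add]
    refine mul_le_mul_of_nonneg_left ?_ (norm_nonneg _)
    have := Complex.norm_le_abs_re_add_abs_im (η (Fin.last N))
    have := hη (Fin.last N)
    nlinarith [norm_nonneg (η (Fin.last N))]
  refine (mul_le_mul e2 e1 (norm_nonneg _) (by positivity)).trans ?_
  rw [show ∀ a b c d e f g : ℝ, a * b * (c * d * e * f * g) = a * c * f * (b * d * g) * e by intros; ring, ← Real.exp_add, ← Real.exp_add]
  refine mul_le_mul_of_nonneg_right (mul_le_mul_of_nonneg_left (Real.exp_le_exp.2 ?_) (by positivity)) (by positivity)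
  refine add_le_add ((preE_add_abs hC (norm_nonneg ν) _).trans (preE_mono (by linarith) _))
    (sum_le_sum fun i _ => hfE_mono (by have := norm_nonneg ν; linarith) _)

/-- crude local bound -/
lemma Gk_loc {N : ℕ} {ν c : ℂ} (hc : ‖c‖ ≤ 1) {F : (Fin N → ℂ) → ℂ} (hF : Differentiable ℂ F) (h : PsiB N ν F c) {l0 : ℝ}
    (hl : 3 / 4 < l0) (R : ℝ) : ∃ A : ℝ, 0 ≤ A ∧ ∀ (k : ℕ) (η : Fin (N + 1) → ℂ), ‖η‖ ≤ R →
      ‖Gk N ν F c l0 k η‖ ≤ A * (l0 - 3 / 4)⁻¹ ^ k := by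
  obtain ⟨A, C, hA, hC, hb⟩ := Gk_bd hc hF h hl (le_max_right R 0)
  have hr : 0 < l0 - 3 / 4 := by linarith
  set D := C * R + Real.exp R + C * Real.exp R with hD
  refine ⟨A * Real.exp (D + ∑ _i : Fin N, (C * R + C * Real.exp (|R| / 2) + D)), by positivity, fun k η hη => ?_⟩
  have hn : ∀ i, ‖η i‖ ≤ R := fun i => (norm_le_pi_norm η i).trans hη
  refine (hb k η fun i => ((Complex.abs_im_le_norm _).trans (hn i)).trans (le_max_left _ _)).trans ?_
  refine mul_le_mul_of_nonneg_right (mul_le_mul_of_nonneg_left (Real.exp_le_exp.2 ?_) hA) (by positivity)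
  have hR0 : 0 ≤ R := (norm_nonneg _).trans hη
  have p1 : ∀ e : ℂ, ‖e‖ ≤ R → preE C e ≤ D := fun e he => by
    have e1 := (Complex.abs_re_le_norm e).trans he
    have e2 : Real.exp e.re ≤ Real.exp R := Real.exp_le_exp.2 ((le_abs_self _).trans e1)
    have e3 := Real.exp_pos e.re
    simp only [preE, hD]
    split_ifs <;> nlinarith
  refine add_le_add (p1 _ (hn _)) (sum_le_sum fun i _ => ?_)
  have e1 := (Complex.abs_re_le_norm _).trans (hn i.castSucc)
  have e2 : Real.exp ((η i.castSucc).re / 2) ≤ Real.exp (|R| / 2) := Real.exp_le_exp.2 (by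
    rw [abs_of_nonneg hR0]; linarith [le_abs_self (η i.castSucc).re])
  have e3 := Real.exp_pos R
  have e4 : 0 ≤ D := by positivity
  have e5 := Real.exp_pos (|R| / 2)
  simp only [hfE]
  split_ifs <;> nlinarith

/-- value at real points -/
lemma Gk_hasSum_real {N : ℕ} {ν c : ℂ} {F : (Fin N → ℂ) → ℂ} (hF : Differentiable ℂ F) (h : PsiB N ν F c) {l0 : ℝ}
    (hl : 3 / 4 < l0) {l : ℝ} (hll : |l0 - l| < l0 - 3 / 4) (η : Fin (N + 1) → ℝ) :
    HasSum (fun k => ((l0 - l : ℝ) : ℂ) ^ k * Gk N ν F c l0 k (fun i => (η i : ℂ)))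
      (Complex.exp (ν * (c * η (Fin.last N))) * ∫ ξ : Fin N → ℝ,
        Complex.exp (-(l : ℂ) * XX fun i => ((ξ i : ℂ), (η i.castSucc : ℂ) - ξ i)) *
          Psi N ν F c (η (Fin.last N)) fun i => ((ξ i : ℂ), (η i.castSucc : ℂ) - ξ i)) := by
  have hr : 0 < l0 - 3 / 4 := by linarith
  obtain ⟨A, C, hA, hC, hb⟩ := Hk_dec h hl 0
  set A' := A * Real.exp (preE C (η (Fin.last N))) with hA'
  have hA0 : 0 ≤ A' := by positivity
  set P : (Fin N → ℝ) → Fin N → ℂ × ℂ := fun ξ i => ((ξ i : ℂ), (η i.castSucc : ℂ) - ξ i) with hP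
  set q := |l0 - l| * (l0 - 3 / 4)⁻¹ with hq
  have hq0 : 0 ≤ q := by positivity
  have hq1 : q < 1 := by rw [hq, ← div_eq_mul_inv, div_lt_one hr]; exact hll
  have hintg := integrable_dcN N C hC (fun i => η i.castSucc)
  have hbd : ∀ k ξ, ‖((l0 - l : ℝ) : ℂ) ^ k * Hk N ν F c l0 k (η (Fin.last N)) (P ξ)‖ ≤
      q ^ k * (A' * Real.exp (∑ i, (dcE C (ξ i : ℂ) + dcE C ((η i.castSucc - ξ i : ℝ) : ℂ)))) := by
    intro k ξ
    have := hb k (η (Fin.last N)) (by simp) (P ξ) (by simp [hP])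
    rw [norm_mul, norm_pow, Complex.norm_real, Real.norm_eq_abs]
    refine (mul_le_mul_of_nonneg_left this (by positivity)).trans (le_of_eq ?_)
    rw [hq, mul_pow]; simp only [hP, Complex.ofReal_sub]; ring
  have hI : ∀ k, Integrable fun ξ => ((l0 - l : ℝ) : ℂ) ^ k * Hk N ν F c l0 k (η (Fin.last N)) (P ξ) := fun k =>
    ((Hk_adm hF h hl k _).integrable (fun i => η i.castSucc)).const_mul _
  have hsum := hasSum_integral_of_summable_integral_norm hI (by
    refine Summable.of_nonneg_of_le (fun k => integral_nonneg fun _ => norm_nonneg _)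
      (fun k => integral_mono (hI k).norm ((hintg.const_mul A').const_mul (q ^ k)) (hbd k)) ?_
    simp only [integral_const_mul]
    exact (summable_geometric_of_lt_one hq0 hq1).mul_right _)
  have e1 : ∀ ξ, ∑' k, ((l0 - l : ℝ) : ℂ) ^ k * Hk N ν F c l0 k (η (Fin.last N)) (P ξ) =
      Complex.exp (-(l : ℂ) * XX (P ξ)) * Psi N ν F c (η (Fin.last N)) (P ξ) := by
    intro ξ
    have e2 : HasSum (fun k : ℕ => (((l0 - l : ℝ) : ℂ) * XX (P ξ)) ^ k / (k.factorial : ℂ)) (Complex.exp (((l0 - l : ℝ) : ℂ) * XX (P ξ))) := by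
      rw [Complex.exp_eq_exp_ℂ]
      exact NormedSpace.expSeries_div_hasSum_exp (𝔸 := ℂ) _
    have e3 := (e2.mul_right (Complex.exp (-(l0 : ℂ) * XX (P ξ)) * Psi N ν F c (η (Fin.last N)) (P ξ))).tsum_eq
    rw [← mul_assoc, ← Complex.exp_add] at e3
    rw [show -(l : ℂ) * XX (P ξ) = ((l0 - l : ℝ) : ℂ) * XX (P ξ) + -(l0 : ℂ) * XX (P ξ) by push_cast; ring, ← e3]
    refine tsum_congr fun k => ?_
    rw [Hk, mul_pow]; ring
  simp only [e1] at hsum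
  have h3 := hsum.mul_left (Complex.exp (ν * (c * η (Fin.last N))))
  have e4 : (fun k => ((l0 - l : ℝ) : ℂ) ^ k * Gk N ν F c l0 k (fun i => (η i : ℂ))) = fun k =>
      Complex.exp (ν * (c * η (Fin.last N))) * ∫ ξ, ((l0 - l : ℝ) : ℂ) ^ k * Hk N ν F c l0 k (η (Fin.last N)) (P ξ) := by
    funext k
    rw [Gk, integral_const_mul, Conv_real (Hk_adm hF h hl k _) (fun i => η i.castSucc)]
    ring
  rw [e4]
  exact h3

/-- not an integer -/
def NI (z : ℂ) : Prop := ∀ k : ℤ, z ≠ k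

lemma NI.add_int {z : ℂ} (h : NI z) (m : ℤ) : NI (z + m) := fun k hk => h (k - m) (by
  push_cast; rw [← hk]; ring)

lemma NI.neg {z : ℂ} (h : NI z) : NI (-z) := fun k hk => h (-k) (by push_cast; rw [← hk]; ring)

lemma NI.ne_zero {z : ℂ} (h : NI z) : z ≠ 0 := by simpa using h 0

lemma NI.add_nat_ne {z : ℂ} (h : NI z) (m : ℕ) : z + m ≠ 0 := by
  have := (h.add_int m).ne_zero
  simpa using this

lemma NI.dist {z : ℂ} (h : NI z) : ∃ δ : ℝ, 0 < δ ∧ δ ≤ 1 ∧ ∀ m : ℤ, δ * (1 + |(m : ℝ)|) ≤ ‖z + m‖ := by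
  obtain ⟨M, hM⟩ := exists_nat_ge (2 * ‖z‖ + 1)
  obtain ⟨m0, hm0, hmin⟩ := Finset.exists_min_image (Icc (-(M : ℤ)) M) (fun m : ℤ => ‖z + m‖ / (1 + |(m : ℝ)|))
    ⟨0, by simp⟩
  have hp : ∀ m : ℤ, 0 < 1 + |(m : ℝ)| := fun m => by positivity
  have h0 : 0 < ‖z + m0‖ / (1 + |(m0 : ℝ)|) := div_pos (norm_pos_iff.2 (h.add_int m0).ne_zero) (hp _)
  refine ⟨min (‖z + m0‖ / (1 + |(m0 : ℝ)|)) (1 / 4), lt_min h0 (by norm_num), (min_le_right _ _).trans (by norm_num), fun m => ?_⟩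
  by_cases hm : m ∈ Icc (-(M : ℤ)) M
  · have := hmin m hm
    rw [le_div_iff₀ (hp m)] at this
    exact (mul_le_mul_of_nonneg_right (min_le_left _ _) (hp m).le).trans this
  · have h1 : (M : ℝ) < |(m : ℝ)| := by
      rw [Finset.mem_Icc, ← abs_le, not_le] at hm
      exact_mod_cast hm
    have h2 : |(m : ℝ)| ≤ ‖z + m‖ + ‖z‖ := by
      have : ‖(m : ℂ)‖ ≤ ‖z + m‖ + ‖z‖ := by
        calc ‖(m : ℂ)‖ = ‖(z + m) - z‖ := by congr 1; ring
          _ ≤ _ := norm_sub_le _ _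
      rwa [Complex.norm_intCast] at this
    have h3 := mul_le_mul_of_nonneg_right (min_le_right (‖z + m0‖ / (1 + |(m0 : ℝ)|)) (1 / 4)) (hp m).le
    linarith [norm_nonneg z]

lemma NI.gamma_up {z : ℂ} (h : NI z) (p : ℕ) :
    ‖Complex.Gamma (z + p)‖ ≤ ‖Complex.Gamma z‖ * (‖z‖ + 1) ^ p * p.factorial := by
  induction p with
  | zero => simp
  | succ p ih =>
    have e1 : Complex.Gamma (z + (p + 1 : ℕ)) = (z + p) * Complex.Gamma (z + p) := by
      rw [← Complex.Gamma_add_one _ (h.add_nat_ne p)]; push_cast; ring_nf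
    rw [e1, norm_mul]
    have e2 : ‖z + p‖ ≤ (‖z‖ + 1) * (p + 1) := by
      refine (norm_add_le _ _).trans ?_
      rw [Complex.norm_natCast]
      nlinarith [norm_nonneg z, (Nat.cast_nonneg p : (0 : ℝ) ≤ p)]
    refine (mul_le_mul e2 ih (norm_nonneg _) (by positivity)).trans (le_of_eq ?_)
    rw [Nat.factorial_succ]; push_cast; ring

lemma NI.gamma_down {z : ℂ} (h : NI z) {δ : ℝ} (hδ : 0 < δ) (hd : ∀ m : ℤ, δ * (1 + |(m : ℝ)|) ≤ ‖z + m‖) (p : ℕ) :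
    ‖Complex.Gamma (z - p)‖ ≤ ‖Complex.Gamma z‖ * δ⁻¹ ^ p / p.factorial := by
  induction p with
  | zero => simp
  | succ p ih =>
    have hne : z - (p + 1 : ℕ) ≠ 0 := by
      have := (h.add_int (-(p + 1 : ℕ))).ne_zero
      simpa [sub_eq_add_neg] using this
    have e1 : Complex.Gamma (z - p) = (z - (p + 1 : ℕ)) * Complex.Gamma (z - (p + 1 : ℕ)) := by
      rw [← Complex.Gamma_add_one _ hne]; push_cast; ring_nf
    have e2 := hd (-(p + 1 : ℕ))
    have e3 : ‖z - (p + 1 : ℕ)‖ ≥ δ * (p + 1) := by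
      refine le_trans ?_ (le_of_le_of_eq e2 (by push_cast; congr 1))
      push_cast
      rw [abs_neg, abs_of_nonneg (by positivity)]
      nlinarith
    rw [e1, norm_mul] at ih
    have e4 : δ * (p + 1) * ‖Complex.Gamma (z - (p + 1 : ℕ))‖ ≤ ‖Complex.Gamma z‖ * δ⁻¹ ^ p / p.factorial :=
      (mul_le_mul_of_nonneg_right e3 (norm_nonneg _)).trans ih
    rw [Nat.factorial_succ, pow_succ]
    have hp : (0 : ℝ) < p.factorial := by positivity
    push_cast
    rw [le_div_iff₀ hp] at e4
    rw [le_div_iff₀ (by positivity)]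
    have : ‖Complex.Gamma z‖ * (δ⁻¹ ^ p * δ⁻¹) = δ⁻¹ * (‖Complex.Gamma z‖ * δ⁻¹ ^ p) := by ring
    rw [this]
    have := mul_le_mul_of_nonneg_left e4 (inv_nonneg.2 hδ.le)
    refine le_trans (le_of_eq ?_) this
    push_cast
    field_simp

/-- growth of Gamma along integer translates -/
lemma NI.gamma_bd {z : ℂ} (h : NI z) : ∃ K : ℝ, 1 ≤ K ∧ ∀ p q : ℕ,
    ‖Complex.Gamma (z + p - q)‖ * q.factorial ≤ K ^ (p + q + 1) * p.factorial := by
  obtain ⟨δ, hδ, hδ1, hd⟩ := h.dist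
  set K := 2 * (‖Complex.Gamma z‖ + ‖z‖ + δ⁻¹ + 1) with hK
  have k0 := norm_nonneg (Complex.Gamma z)
  have k1 := norm_nonneg z
  have k2 : 0 < δ⁻¹ := inv_pos.2 hδ
  have hK1 : 1 ≤ K := by linarith
  refine ⟨K, hK1, fun p q => ?_⟩
  rcases le_total q p with hqp | hqp
  · obtain ⟨m, rfl⟩ := Nat.exists_eq_add_of_le hqp
    have e1 := h.gamma_up m
    rw [show z + ((q + m : ℕ) : ℂ) - q = z + m by push_cast; ring]
    have e2 : (m.factorial * q.factorial : ℝ) ≤ (q + m).factorial := by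
      have := Nat.factorial_mul_factorial_dvd_factorial_add q m
      have := Nat.le_of_dvd (Nat.factorial_pos _) this
      rw [mul_comm]; exact_mod_cast this
    calc ‖Complex.Gamma (z + m)‖ * q.factorial ≤ ‖Complex.Gamma z‖ * (‖z‖ + 1) ^ m * m.factorial * q.factorial :=
          mul_le_mul_of_nonneg_right e1 (by positivity)
      _ = ‖Complex.Gamma z‖ * (‖z‖ + 1) ^ m * (m.factorial * q.factorial) := by ring
      _ ≤ K * K ^ m * (q + m).factorial := by
          refine mul_le_mul (mul_le_mul (by linarith) (pow_le_pow_left₀ (by positivity) (by linarith) _) (by positivity) (by positivity)) e2 (by positivity) (by positivity)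
      _ ≤ K ^ (q + m + q + 1) * (q + m).factorial := by
          refine mul_le_mul_of_nonneg_right ?_ (by positivity)
          rw [← pow_succ']
          exact pow_le_pow_right₀ hK1 (by omega)
  · obtain ⟨m, rfl⟩ := Nat.exists_eq_add_of_le hqp
    have e1 := h.gamma_down hδ hd m
    rw [show z + p - ((p + m : ℕ) : ℂ) = z - m by push_cast; ring]
    have e2 : ((p + m).factorial : ℝ) ≤ 2 ^ (p + m) * m.factorial * p.factorial := by
      have h1 := Nat.add_choose_mul_factorial_mul_factorial p m
      have h3 : (p + m).factorial ≤ 2 ^ (p + m) * m.factorial * p.factorial := by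
        rw [← h1]
        calc _ ≤ 2 ^ (p + m) * p.factorial * m.factorial := Nat.mul_le_mul_right _ (Nat.mul_le_mul_right _ (Nat.choose_le_two_pow _ _))
          _ = _ := by ring
      exact_mod_cast h3
    have hm : (0 : ℝ) < m.factorial := by positivity
    calc ‖Complex.Gamma (z - m)‖ * (p + m).factorial ≤ ‖Complex.Gamma z‖ * δ⁻¹ ^ m / m.factorial * (2 ^ (p + m) * m.factorial * p.factorial) :=
          mul_le_mul e1 e2 (by positivity) (by positivity)
      _ = ‖Complex.Gamma z‖ * (2 ^ p * (2 * δ⁻¹) ^ m) * p.factorial := by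
          rw [mul_pow, pow_add]; field_simp
      _ ≤ K * (K ^ p * K ^ m) * p.factorial := by
          refine mul_le_mul_of_nonneg_right ?_ (by positivity)
          refine mul_le_mul (by linarith) (mul_le_mul (pow_le_pow_left₀ (by norm_num) (by linarith) _)
            (pow_le_pow_left₀ (by positivity) (by linarith) _) (by positivity) (by positivity)) (by positivity) (by positivity)
      _ ≤ K ^ (p + (p + m) + 1) * p.factorial := by
          refine mul_le_mul_of_nonneg_right ?_ (by positivity)
          rw [← pow_add, ← pow_succ']
          exact pow_le_pow_right₀ hK1 (by omega)

lemma HasSum.cg {ι : Type*} {f g : ι → ℂ} {a : ℂ} (h : HasSum f a) (e : ∀ k, g k = f k) : HasSum g a := by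
  rwa [show g = f from funext e]

def Ui (h : ℝ) (z : ℂ) : ℂ := ∫ ξ in Set.Ioi h, Complex.exp (z * ξ - Real.exp ξ)

lemma integrable_bes (s : ℂ) (η : ℝ) :
    Integrable fun ξ : ℝ => Complex.exp (s * ξ - Real.exp ξ - Real.exp (η - ξ)) := by
  refine (integrable_dc1 |s.re| η (abs_nonneg _)).mono' (by
    refine Continuous.aestronglyMeasurable ?_; fun_prop) (Filter.Eventually.of_forall fun ξ => ?_)
  rw [Complex.norm_exp]
  refine Real.exp_le_exp.2 ?_
  simp only [dcE, Complex.ofReal_re, Complex.ofReal_im, if_true]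
  have e1 := Real.exp_pos ξ
  have e2 := Real.exp_pos (η - ξ)
  have e3 : s.re * ξ ≤ |s.re| * |ξ| := by rw [← abs_mul]; exact le_abs_self _
  have e4 := mul_nonneg (abs_nonneg s.re) (abs_nonneg (η - ξ))
  simp only [Complex.sub_re, Complex.mul_re, Complex.ofReal_re, Complex.ofReal_im]
  linarith

lemma integrable_Ui (h : ℝ) (z : ℂ) :
    IntegrableOn (fun ξ : ℝ => Complex.exp (z * ξ - Real.exp ξ)) (Set.Ioi h) := by
  have h1 := ((integrable_bes z (2 * h)).norm.const_mul (Real.exp (Real.exp h))).integrableOn (s := Set.Ioi h)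
  refine h1.mono' (by refine Continuous.aestronglyMeasurable ?_; fun_prop) ?_
  refine (ae_restrict_mem measurableSet_Ioi).mono fun ξ hξ => ?_
  rw [Complex.norm_exp, Complex.norm_exp, ← Real.exp_add]
  refine Real.exp_le_exp.2 ?_
  have : Real.exp (2 * h - ξ) ≤ Real.exp h := Real.exp_le_exp.2 (by have := Set.mem_Ioi.1 hξ; linarith)
  simp only [Complex.sub_re, Complex.mul_re, Complex.ofReal_re, Complex.ofReal_im]
  linarith

lemma tendsto_Ui (z : ℂ) : Filter.Tendsto (fun ξ : ℝ => Complex.exp (z * ξ - Real.exp ξ)) Filter.atTop (nhds 0) := by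
  rw [tendsto_zero_iff_norm_tendsto_zero]
  simp only [Complex.norm_exp]
  refine Real.tendsto_exp_atBot.comp ?_
  simp only [Complex.sub_re, Complex.mul_re, Complex.ofReal_re, Complex.ofReal_im, mul_zero, sub_zero]
  have h1 : Filter.Tendsto (fun ξ : ℝ => Real.exp ξ / ξ) Filter.atTop Filter.atTop := by
    simpa using Real.tendsto_exp_div_pow_atTop 1
  have h2 : Filter.Tendsto (fun ξ : ℝ => (z.re - Real.exp ξ / ξ)) Filter.atTop Filter.atBot := by
    simpa [sub_eq_add_neg] using Filter.tendsto_atBot_add_const_left _ z.re (Filter.tendsto_neg_atTop_atBot.comp h1)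
  have h3 := h2.atBot_mul_atTop₀ Filter.tendsto_id
  refine h3.congr' ?_
  filter_upwards [Filter.eventually_gt_atTop 0] with ξ hξ
  simp only [id]; field_simp

lemma Ui_rec (h : ℝ) (z : ℂ) : z * Ui h z = Ui h (z + 1) - Complex.exp (z * h - Real.exp h) := by
  have hd : ∀ ξ ∈ Set.Ici h, HasDerivAt (fun ξ : ℝ => Complex.exp (z * ξ - Real.exp ξ))
      (z * Complex.exp (z * ξ - Real.exp ξ) - Complex.exp ((z + 1) * ξ - Real.exp ξ)) ξ := by
    intro ξ _
    have h1 : HasDerivAt (fun ξ : ℝ => z * ξ - Real.exp ξ) (z * (1 : ℝ) - (Real.exp ξ : ℝ)) ξ :=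
      ((hasDerivAt_id ξ).ofReal_comp.const_mul z).sub (Real.hasDerivAt_exp ξ).ofReal_comp
    convert h1.cexp using 1
    rw [show (z + 1) * ξ - Real.exp ξ = (z * ξ - Real.exp ξ) + ξ by push_cast; ring, Complex.exp_add]
    push_cast; ring
  have hI := integral_Ioi_of_hasDerivAt_of_tendsto' hd
    (((integrable_Ui h z).const_mul z).sub (integrable_Ui h (z + 1))) (tendsto_Ui z)
  rw [integral_sub ((integrable_Ui h z).const_mul z) (integrable_Ui h (z + 1)), integral_const_mul] at hI
  simp only [Ui]
  linear_combination hI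

lemma gamma_exp {z : ℂ} (hz : 0 < z.re) : IntegrableOn (fun ξ : ℝ => Complex.exp (z * ξ - Real.exp ξ)) Set.univ ∧
    Complex.Gamma z = ∫ ξ : ℝ, Complex.exp (z * ξ - Real.exp ξ) := by
  have hinj : Set.InjOn Real.exp Set.univ := Real.exp_injective.injOn
  have him : Real.exp '' Set.univ = Set.Ioi 0 := by rw [Set.image_univ, Real.range_exp]
  have e : ∀ ξ : ℝ, |Real.exp ξ| • (↑(Real.exp (-(Real.exp ξ))) * (↑(Real.exp ξ) : ℂ) ^ (z - 1)) = Complex.exp (z * ξ - Real.exp ξ) := by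
    intro ξ
    rw [abs_of_pos (Real.exp_pos ξ), Complex.real_smul, Complex.cpow_def_of_ne_zero (by simp), ← Complex.ofReal_log (Real.exp_pos _).le,
      Real.log_exp, Complex.ofReal_exp, Complex.ofReal_exp, ← Complex.exp_add, ← Complex.exp_add]
    congr 1; push_cast; ring
  have h1 := integrableOn_image_iff_integrableOn_abs_deriv_smul (f := Real.exp) (f' := Real.exp) MeasurableSet.univ
    (fun x _ => (Real.hasDerivAt_exp x).hasDerivWithinAt) hinj (fun t : ℝ => (↑(Real.exp (-t)) * (t : ℂ) ^ (z - 1) : ℂ))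
  have h2 := integral_image_eq_integral_abs_deriv_smul (f := Real.exp) (f' := Real.exp) MeasurableSet.univ
    (fun x _ => (Real.hasDerivAt_exp x).hasDerivWithinAt) hinj (fun t : ℝ => (↑(Real.exp (-t)) * (t : ℂ) ^ (z - 1) : ℂ))
  rw [him] at h1 h2
  simp only [e] at h1 h2
  refine ⟨h1.1 (Complex.GammaIntegral_convergent hz), ?_⟩
  rw [Complex.Gamma_eq_integral hz, Complex.GammaIntegral, h2, setIntegral_univ]

lemma low_gamma {z : ℂ} (hz : 0 < z.re) (h : ℝ) :
    HasSum (fun i : ℕ => (-1 : ℂ) ^ i / (i.factorial : ℂ) * (Complex.exp ((z + i) * h) / (z + i)))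
      (∫ ξ in Set.Iic h, Complex.exp (z * ξ - Real.exp ξ)) := by
  have hre : ∀ i : ℕ, 0 < (z + i).re := fun i => by simp; positivity
  have hI : ∀ i : ℕ, IntegrableOn (fun ξ : ℝ => (-1 : ℂ) ^ i / (i.factorial : ℂ) * Complex.exp ((z + i) * ξ)) (Set.Iic h) :=
    fun i => (integrableOn_exp_mul_complex_Iic (hre i) h).const_mul _
  have hs := hasSum_integral_of_summable_integral_norm hI (by
    have hn : ∀ i : ℕ, ∫ ξ in Set.Iic h, ‖(-1 : ℂ) ^ i / (i.factorial : ℂ) * Complex.exp ((z + i) * ξ)‖ =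
        1 / (i.factorial : ℝ) * (Real.exp ((z + i).re * h) / (z + i).re) := by
      intro i
      rw [← integral_exp_mul_Iic (hre i), ← integral_const_mul]
      refine integral_congr_ae (.of_forall fun ξ => ?_)
      simp [Complex.norm_exp]
    simp only [hn]
    have h1 := (Real.summable_pow_div_factorial (Real.exp h)).mul_left (Real.exp (z.re * h) / z.re)
    refine Summable.of_nonneg_of_le (fun i => by have := hre i; positivity) (fun i => ?_) h1
    have e1 : Real.exp ((z + i).re * h) = Real.exp (z.re * h) * Real.exp h ^ i := by
      rw [← Real.exp_nat_mul, ← Real.exp_add]; congr 1; simp; ring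
    have e2 : z.re ≤ (z + i).re := by simp
    rw [e1]
    have : Real.exp (z.re * h) * Real.exp h ^ i / (z + i).re ≤ Real.exp (z.re * h) * Real.exp h ^ i / z.re :=
      div_le_div_of_nonneg_left (by positivity) hz e2
    calc _ ≤ 1 / (i.factorial : ℝ) * (Real.exp (z.re * h) * Real.exp h ^ i / z.re) := mul_le_mul_of_nonneg_left this (by positivity)
      _ = _ := by ring)
  have e1 : ∀ ξ : ℝ, ∑' i : ℕ, (-1 : ℂ) ^ i / (i.factorial : ℂ) * Complex.exp ((z + i) * ξ) = Complex.exp (z * ξ - Real.exp ξ) := by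
    intro ξ
    have e2 : HasSum (fun k : ℕ => (-(Real.exp ξ : ℂ)) ^ k / (k.factorial : ℂ)) (Complex.exp (-(Real.exp ξ : ℂ))) := by
      rw [Complex.exp_eq_exp_ℂ]
      exact NormedSpace.expSeries_div_hasSum_exp (𝔸 := ℂ) _
    have e3 := (e2.mul_left (Complex.exp (z * ξ))).tsum_eq
    rw [sub_eq_add_neg, Complex.exp_add, ← e3]
    refine tsum_congr fun i => ?_
    rw [add_mul, Complex.exp_add, neg_pow (Real.exp ξ : ℂ), Complex.ofReal_exp, ← Complex.exp_nat_mul]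
    ring
  simp only [e1] at hs
  refine HasSum.cg hs fun i => ?_
  rw [integral_const_mul, integral_exp_mul_complex_Iic (hre i)]

lemma exp_series (x : ℂ) : HasSum (fun k : ℕ => x ^ k / (k.factorial : ℂ)) (Complex.exp x) := by
  rw [Complex.exp_eq_exp_ℂ]
  exact NormedSpace.expSeries_div_hasSum_exp (𝔸 := ℂ) _

def Ut (h : ℝ) (z : ℂ) (i : ℕ) : ℂ := (-1 : ℂ) ^ i / (i.factorial : ℂ) * (Complex.exp ((z + i) * h) / (z + i))

lemma Ui_sum (h : ℝ) (n : ℕ) : ∀ z : ℂ, NI z → 0 < (z + n).re →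
    HasSum (Ut h z) (Complex.Gamma z - Ui h z) := by
  induction n with
  | zero =>
    intro z hz hp
    simp only [Nat.cast_zero, add_zero] at hp
    have h1 := low_gamma hp h
    obtain ⟨h2, h3⟩ := gamma_exp hp
    rw [integrableOn_univ] at h2
    have h4 := integral_add_compl (measurableSet_Iic (a := h)) h2
    rw [Set.compl_Iic] at h4
    rw [h3, ← h4, Ui, add_sub_cancel_right]
    exact h1
  | succ n ih =>
    intro z hz hp
    have h1 := ih (z + 1) (by simpa using hz.add_int 1) (by
      refine lt_of_lt_of_eq hp ?_; push_cast; congr 1; ring)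
    have hz0 := hz.ne_zero
    let sft : ℕ → ℂ := fun i => i * ((-1 : ℂ) ^ i / (i.factorial : ℂ) * (Complex.exp ((z + i) * h) / (z + i)))
    have h2 : HasSum sft (-(Complex.Gamma (z + 1) - Ui h (z + 1))) := by
      have h3 : HasSum (fun i => sft (i + 1)) (-(Complex.Gamma (z + 1) - Ui h (z + 1))) := by
        refine HasSum.cg h1.neg fun i => ?_
        simp only [sft, Ut]
        have : ((i + 1).factorial : ℂ) = (i + 1) * i.factorial := by rw [Nat.factorial_succ]; push_cast; ring
        rw [this, pow_succ]
        have h5 : (i : ℂ) + 1 ≠ 0 := by exact_mod_cast Nat.succ_ne_zero i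
        push_cast
        rw [show z + 1 + i = z + (i + 1) by ring]
        field_simp
      have := (hasSum_nat_add_iff 1).1 h3
      simpa [sft] using this
    have h4 := (exp_series (-(Real.exp h : ℂ))).mul_left (Complex.exp (z * h))
    rw [← Complex.exp_add, ← sub_eq_add_neg] at h4
    have h5 := (h4.sub h2).mul_left z⁻¹
    have h6 : z⁻¹ * (Complex.exp (z * h - Real.exp h) - -(Complex.Gamma (z + 1) - Ui h (z + 1))) = Complex.Gamma z - Ui h z := by
      have a1 := Ui_rec h z
      have a2 := Complex.Gamma_add_one z hz0
      rw [a2]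
      field_simp
      linear_combination a1
    rw [← h6]
    refine HasSum.cg h5 fun i => ?_
    simp only [sft, Ut]
    have a3 := hz.add_nat_ne i
    rw [neg_pow (Real.exp h : ℂ), Complex.ofReal_exp, ← Complex.exp_nat_mul, add_mul, Complex.exp_add]
    field_simp
    ring

lemma Ui_sum' (h : ℝ) {z : ℂ} (hz : NI z) : HasSum (Ut h z) (Complex.Gamma z - Ui h z) := by
  obtain ⟨n, hn⟩ := exists_nat_gt (-z.re)
  exact Ui_sum h n z hz (by simp; linarith)

/-- half of the Bessel integral -/
lemma half_sum (h : ℝ) (s : ℂ) : HasSum (fun k : ℕ => (-1 : ℂ) ^ k / (k.factorial : ℂ) * Complex.exp (2 * h * k) * Ui h (s - k))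
    (∫ ξ in Set.Ioi h, Complex.exp (s * ξ - Real.exp ξ - Real.exp (2 * h - ξ))) := by
  have hI : ∀ k : ℕ, IntegrableOn (fun ξ : ℝ => (-1 : ℂ) ^ k / (k.factorial : ℂ) * Complex.exp (2 * h * k) *
      Complex.exp ((s - k) * ξ - Real.exp ξ)) (Set.Ioi h) := fun k => (integrable_Ui h _).const_mul _
  have hs := hasSum_integral_of_summable_integral_norm hI (by
    set D := ∫ ξ in Set.Ioi h, ‖Complex.exp (s * ξ - Real.exp ξ)‖ with hD
    have h1 := (Real.summable_pow_div_factorial (Real.exp h)).mul_right D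
    refine Summable.of_nonneg_of_le (fun k => integral_nonneg fun _ => norm_nonneg _) (fun k => ?_) h1
    rw [hD, ← integral_const_mul]
    refine setIntegral_mono_on (hI k).norm ((integrable_Ui h s).norm.const_mul _) measurableSet_Ioi fun ξ hξ => ?_
    have hξ' : h < ξ := hξ
    rw [norm_mul, norm_mul, norm_div, norm_pow, norm_neg, norm_one, one_pow, Complex.norm_natCast, Complex.norm_exp, Complex.norm_exp,
      Complex.norm_exp, ← Real.exp_nat_mul, one_div_mul_eq_div, div_mul_eq_mul_div, div_mul_eq_mul_div, ← Real.exp_add, ← Real.exp_add]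
    refine div_le_div_of_nonneg_right (Real.exp_le_exp.2 ?_) (by positivity)
    have : (k : ℝ) * h ≤ k * ξ := mul_le_mul_of_nonneg_left hξ'.le (by positivity)
    simp
    nlinarith)
  have e1 : ∀ ξ : ℝ, ∑' k : ℕ, (-1 : ℂ) ^ k / (k.factorial : ℂ) * Complex.exp (2 * h * k) *
      Complex.exp ((s - k) * ξ - Real.exp ξ) = Complex.exp (s * ξ - Real.exp ξ - Real.exp (2 * h - ξ)) := by
    intro ξ
    have e3 := ((exp_series (-(Real.exp (2 * h - ξ) : ℂ))).mul_left (Complex.exp (s * ξ - Real.exp ξ))).tsum_eq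
    rw [sub_eq_add_neg _ (Real.exp (2 * h - ξ) : ℂ), Complex.exp_add, ← e3]
    refine tsum_congr fun k => ?_
    rw [neg_pow (Real.exp (2 * h - ξ) : ℂ), Complex.ofReal_exp (2 * h - ξ), ← Complex.exp_nat_mul, mul_assoc ((-1 : ℂ) ^ k / (k.factorial : ℂ)), ← Complex.exp_add]
    have : 2 * (h : ℂ) * k + ((s - k) * ξ - Real.exp ξ) = (s * ξ - Real.exp ξ) + k * ((2 * h - ξ : ℝ) : ℂ) := by push_cast; ring
    rw [this, Complex.exp_add]; ring
  simp only [e1] at hs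
  refine HasSum.cg hs fun k => ?_
  rw [integral_const_mul, Ui]

def bdd (h : ℝ) (s : ℂ) (p : ℕ × ℕ) : ℂ :=
  (-1 : ℂ) ^ p.1 / (p.1.factorial : ℂ) * ((-1 : ℂ) ^ p.2 / (p.2.factorial : ℂ)) * Complex.exp ((s + p.1 + p.2) * h) / (s - p.1 + p.2)

lemma bdd_summable (h : ℝ) {s : ℂ} (hs : NI s) : Summable (bdd h s) := by
  obtain ⟨δ, hδ, -, hd⟩ := hs.dist
  have h1 := (Real.summable_pow_div_factorial (Real.exp h)).mul_of_nonneg (Real.summable_pow_div_factorial (Real.exp h))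
    (fun k => by positivity) (fun k => by positivity)
  refine Summable.of_norm_bounded (h1.mul_left (Real.exp (s.re * h) / δ)) fun p => ?_
  have e1 : δ ≤ ‖s - p.1 + p.2‖ := by
    have := hd (-(p.1 : ℤ) + p.2)
    rw [show s + ((-(p.1 : ℤ) + p.2 : ℤ) : ℂ) = s - p.1 + p.2 by push_cast; ring] at this
    refine le_trans ?_ this
    nlinarith [abs_nonneg (((-(p.1 : ℤ) + p.2 : ℤ)) : ℝ)]
  have e2 : ‖Complex.exp ((s + p.1 + p.2) * h)‖ = Real.exp (s.re * h) * (Real.exp h ^ p.1 * Real.exp h ^ p.2) := by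
    rw [Complex.norm_exp, ← Real.exp_nat_mul, ← Real.exp_nat_mul, ← Real.exp_add, ← Real.exp_add]
    congr 1; simp; ring
  simp only [bdd]
  rw [norm_div, norm_mul, e2]
  simp only [norm_mul, norm_div, norm_pow, norm_neg, norm_one, one_pow, Complex.norm_natCast]
  have : ∀ a b c d e : ℝ, 1 / a * (1 / b) * (c * (d * e)) = c * (d / a * (e / b)) := by
    intros; ring
  rw [this]
  refine (div_le_div_of_nonneg_left (by positivity) hδ e1).trans (le_of_eq (by ring))

lemma half_sum' (h : ℝ) {s : ℂ} (hs : NI s) :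
    HasSum (fun k : ℕ => (-1 : ℂ) ^ k / (k.factorial : ℂ) * Complex.exp (2 * h * k) * Complex.Gamma (s - k))
    ((∫ ξ in Set.Ioi h, Complex.exp (s * ξ - Real.exp ξ - Real.exp (2 * h - ξ))) + ∑' p, bdd h s p) := by
  have h1 := half_sum h s
  have hn : ∀ k : ℕ, NI (s - k) := fun k => by simpa [sub_eq_add_neg] using hs.add_int (-(k : ℤ))
  have h2 : HasSum (fun k : ℕ => (-1 : ℂ) ^ k / (k.factorial : ℂ) * Complex.exp (2 * h * k) * (Complex.Gamma (s - k) - Ui h (s - k)))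
      (∑' p, bdd h s p) := by
    refine (bdd_summable h hs).hasSum.prod_fiberwise fun k => ?_
    refine HasSum.cg ((Ui_sum' h (hn k)).mul_left _) fun i => ?_
    simp only [bdd, Ut]
    rw [show (s + k + i) * (h : ℂ) = 2 * h * k + (s - k + i) * h by ring, Complex.exp_add]
    ring
  refine HasSum.cg (h1.add h2) fun k => ?_
  ring

/-- the Bessel expansion -/
lemma bessel (s : ℂ) (hs : NI s) (η : ℝ) :
    HasSum (fun k : ℕ => (-1 : ℂ) ^ k / (k.factorial : ℂ) * Complex.Gamma (s - k) * Complex.exp (k * η) +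
      (-1 : ℂ) ^ k / (k.factorial : ℂ) * Complex.Gamma (-s - k) * Complex.exp ((s + k) * η))
    (∫ ξ : ℝ, Complex.exp (s * ξ - Real.exp ξ - Real.exp (η - ξ))) := by
  obtain ⟨h, rfl⟩ : ∃ h : ℝ, η = 2 * h := ⟨η / 2, by ring⟩
  have h1 := half_sum' h hs
  have h2 := (half_sum' h hs.neg).mul_left (Complex.exp (2 * h * s))
  have h3 : ∑' p, bdd h s p + Complex.exp (2 * h * s) * ∑' p, bdd h (-s) p = 0 := by
    rw [← tsum_mul_left, ← (Equiv.prodComm ℕ ℕ).tsum_eq (fun p => Complex.exp (2 * h * s) * bdd h (-s) p), ← (bdd_summable h hs).tsum_add]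
    · have : ∀ p, bdd h s p + Complex.exp (2 * h * s) * bdd h (-s) ((Equiv.prodComm ℕ ℕ) p) = 0 := by
        intro p
        simp only [bdd, Equiv.prodComm_apply, Prod.fst_swap, Prod.snd_swap]
        have n1 : s - p.1 + p.2 ≠ 0 := by
          have := (hs.add_int (-(p.1 : ℤ) + p.2)).ne_zero
          rw [show s + ((-(p.1 : ℤ) + p.2 : ℤ) : ℂ) = s - p.1 + p.2 by push_cast; ring] at this
          exact this
        rw [show -s - (p.2 : ℂ) + p.1 = -(s - p.1 + p.2) by ring,
          show (s + p.1 + p.2) * (h : ℂ) = 2 * h * s + (-s + p.2 + p.1) * h by ring, Complex.exp_add]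
        field_simp
        ring
      rw [tsum_congr this]; exact tsum_zero
    · have := ((bdd_summable h hs.neg).mul_left (Complex.exp (2 * h * s)))
      exact (Equiv.prodComm ℕ ℕ).summable_iff.2 this
  have hintg := integrable_bes s (2 * h)
  have h4 := integral_add_compl (measurableSet_Ioi (a := h)) hintg
  have h5 : ∫ ξ in (Set.Ioi h)ᶜ, Complex.exp (s * ξ - Real.exp ξ - Real.exp (2 * h - ξ)) =
      Complex.exp (2 * h * s) * ∫ ξ in Set.Ioi h, Complex.exp (-s * ξ - Real.exp ξ - Real.exp (2 * h - ξ)) := by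
    rw [Set.compl_Ioi, integral_Iic_eq_integral_Iio, ← integral_const_mul, ← integral_indicator measurableSet_Iio,
      ← integral_indicator measurableSet_Ioi, ← integral_sub_left_eq_self _ volume (2 * h)]
    refine integral_congr_ae (.of_forall fun ξ => ?_)
    by_cases hξ : h < ξ
    · have hm : 2 * h - ξ ∈ Set.Iio h := by simp; linarith
      beta_reduce
      rw [Set.indicator_of_mem hm, Set.indicator_of_mem (show ξ ∈ Set.Ioi h from hξ), ← Complex.exp_add]
      congr 1; rw [show 2 * h - (2 * h - ξ) = ξ by ring]; push_cast; ring
    · have hm : 2 * h - ξ ∉ Set.Iio h := by simp at hξ ⊢; linarith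
      beta_reduce
      rw [Set.indicator_of_notMem hm, Set.indicator_of_notMem (show ξ ∉ Set.Ioi h from hξ)]
  rw [← h4, h5]
  have h6 := h1.add h2
  have h7 : ∀ a b c d e : ℂ, b + c * d = 0 → a + b + c * (e + d) = a + c * e := by
    intro a b c d e hh; linear_combination hh
  rw [h7 _ _ _ _ _ h3] at h6
  refine HasSum.cg h6 fun k => ?_
  rw [show (s + k) * ((2 * h : ℝ) : ℂ) = 2 * h * s + 2 * h * k by push_cast; ring, Complex.exp_add,
    show (k : ℂ) * ((2 * h : ℝ) : ℂ) = 2 * h * k by push_cast; ring]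
  ring

open Classical in
/-- residue of the Gamma function -/
def Rr (z : ℂ) : ℂ := if h : ∃ j : ℕ, z = -j then (-1) ^ h.choose / (h.choose.factorial : ℂ) else 0

lemma Rr_neg (j : ℕ) : Rr (-(j : ℂ)) = (-1) ^ j / (j.factorial : ℂ) := by
  have h : ∃ i : ℕ, (-(j : ℂ)) = -i := ⟨j, rfl⟩
  rw [Rr, dif_pos h]
  have : h.choose = j := by have := h.choose_spec; simpa using this.symm
  rw [this]

lemma Rr_zero {z : ℂ} (h : ∀ j : ℕ, z ≠ -j) : Rr z = 0 := by
  rw [Rr, dif_neg]; push Not; exact h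

lemma Rr_NI {z : ℂ} (h : NI z) : Rr z = 0 := Rr_zero fun j => by simpa using h (-(j : ℤ))

def rho (x y : ℂ) : ℂ := Complex.Gamma x * Rr y + Rr x * Complex.Gamma y

lemma rho_comm (x y : ℂ) : rho x y = rho y x := by simp [rho]; ring

lemma Rr_succ (z : ℂ) : Rr (z + 1) = z * Rr z := by
  by_cases h : ∃ j : ℕ, z = -j
  · obtain ⟨j, rfl⟩ := h
    cases j with
    | zero =>
      simp only [Nat.cast_zero, neg_zero, zero_add, zero_mul]
      exact Rr_zero fun j hj => by
        have : (1 : ℂ) + j = 0 := by rw [hj]; ring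
        have h2 : ((1 + j : ℕ) : ℂ) = 0 := by push_cast; exact this
        rw [Nat.cast_eq_zero] at h2; omega
    | succ j =>
      rw [Rr_neg, show -((j + 1 : ℕ) : ℂ) + 1 = -(j : ℂ) by push_cast; ring, Rr_neg, Nat.factorial_succ]
      have h1 : ((j : ℂ) + 1) ≠ 0 := by exact_mod_cast Nat.succ_ne_zero j
      have h2 : (j.factorial : ℂ) ≠ 0 := by exact_mod_cast Nat.factorial_ne_zero j
      push_cast
      field_simp
      ring
  · push Not at h
    rw [Rr_zero h, mul_zero]
    exact Rr_zero fun j hj => h (j + 1) (by push_cast; linear_combination hj)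

/-- Gamma recursion away from poles -/
lemma rho_succ_left {x y : ℂ} (h : NI (x - y)) : rho (x + 1) y = x * rho x y := by
  simp only [rho]
  rw [Rr_succ]
  by_cases hx : x = 0
  · subst hx
    have : Rr y = 0 := Rr_NI (by simpa using h.neg)
    rw [this]; ring
  · rw [Complex.Gamma_add_one _ hx]; ring

lemma rho_succ_right {x y : ℂ} (h : NI (x - y)) : rho x (y + 1) = y * rho x y := by
  rw [rho_comm, rho_succ_left (by simpa using h.neg), rho_comm]

lemma rho_ne {x y : ℂ} (h : rho x y ≠ 0) : (∃ j : ℕ, x = -j) ∨ ∃ j : ℕ, y = -j := by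
  by_contra hh
  push Not at hh
  exact h (by simp [rho, Rr_zero hh.1, Rr_zero hh.2])

/-- one family of the Bessel coefficients -/
def b1 (l : ℝ) (α β η b : ℂ) : ℂ :=
  Complex.Gamma (α - b) * Rr (β - b) * Complex.exp ((2 * b - α - β) * Real.log l + b * η)

def bes (l : ℝ) (α β η b : ℂ) : ℂ :=
  rho (α - b) (β - b) * Complex.exp ((2 * b - α - β) * Real.log l + b * η)

lemma bes_eq (l : ℝ) (α β η b : ℂ) : bes l α β η b = b1 l α β η b + b1 l β α η b := by
  simp only [bes, b1, rho]
  rw [show 2 * b - β - α = 2 * b - α - β by ring]; ring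

lemma b1_apply (l : ℝ) (α β η : ℂ) (j : ℕ) :
    b1 l α β η (β + j) = Complex.Gamma (α - β - j) * ((-1) ^ j / (j.factorial : ℂ)) *
      Complex.exp ((β - α + 2 * j) * Real.log l + (β + j) * η) := by
  rw [b1, show β - (β + j) = -(j : ℂ) by ring, Rr_neg, show α - (β + j) = α - β - j by ring]
  congr 3; ring

lemma b1_inj (β : ℂ) : Function.Injective fun j : ℕ => β + (j : ℂ) := fun a b h => by simpa using h

lemma b1_zero (l : ℝ) (α β η b : ℂ) (hb : b ∉ Set.range fun j : ℕ => β + (j : ℂ)) : b1 l α β η b = 0 := by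
  have : Rr (β - b) = 0 := Rr_zero fun j hj => hb ⟨j, by linear_combination hj⟩
  simp [b1, this]

lemma b1_norm {z : ℂ} (hz : NI z) : ∃ K : ℝ, 1 ≤ K ∧ ∀ (l D : ℝ) (σ : ℂ), 1 ≤ l → 0 ≤ D → ∃ C : ℝ, 0 ≤ C ∧
    ∀ (k k' : ℕ) (α β : ℂ), β = σ + k → α = σ + z + k' →
      Summable (fun b => ‖b1 l α β 0 b‖ * Real.exp (‖b‖ * D)) ∧
      ∑' b, ‖b1 l α β 0 b‖ * Real.exp (‖b‖ * D) ≤ C * (K ^ (k + k') * (k'.factorial / k.factorial * (l ^ k / l ^ k' * Real.exp (D * k)))) := by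
  obtain ⟨K, hK, hb⟩ := hz.gamma_bd
  refine ⟨K, hK, fun l D σ hl hD => ?_⟩
  have hl0 : 0 < l := by linarith
  set P := K * l ^ 2 * Real.exp D with hP
  refine ⟨K * Real.exp (-z.re * Real.log l) * Real.exp (‖σ‖ * D) * Real.exp P, by positivity, fun k k' α β hβ hα => ?_⟩
  have key : ∀ j : ℕ, ‖b1 l α β 0 (β + j)‖ * Real.exp (‖β + j‖ * D) ≤ K * Real.exp (-z.re * Real.log l) * Real.exp (‖σ‖ * D) *
      (K ^ (k + k') * (k'.factorial / k.factorial * (l ^ k / l ^ k' * Real.exp (D * k)))) * (P ^ j / j.factorial) := by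
    intro j
    rw [b1_apply, norm_mul, norm_mul, mul_assoc]
    have g1 : ‖Complex.Gamma (α - β - j)‖ ≤ K ^ (k + k') * K * K ^ j * (k'.factorial / k.factorial) := by
      have := hb k' (k + j)
      rw [show α - β - j = z + k' - (k + j : ℕ) by rw [hα, hβ]; push_cast; ring]
      have f1 : (0 : ℝ) < (k.factorial : ℝ) := by exact_mod_cast Nat.factorial_pos k
      have f2 : (k.factorial : ℝ) ≤ ((k + j).factorial : ℝ) := by exact_mod_cast Nat.factorial_le (by omega)
      rw [← mul_div_assoc, le_div_iff₀ f1]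
      refine (mul_le_mul_of_nonneg_left f2 (norm_nonneg _)).trans (this.trans (le_of_eq ?_))
      rw [show k' + (k + j) + 1 = (k + k') + 1 + j by ring, pow_add, pow_add]; ring
    have g2 : ‖((-1 : ℂ) ^ j / (j.factorial : ℂ))‖ = 1 / j.factorial := by simp
    have g3 : ‖Complex.exp ((β - α + 2 * j) * Real.log l + (β + j) * 0)‖ * Real.exp (‖β + j‖ * D) ≤
        Real.exp (-z.re * Real.log l) * (l ^ k / l ^ k' * (l ^ 2) ^ j) * (Real.exp (‖σ‖ * D) * Real.exp (D * k) * Real.exp D ^ j) := by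
      rw [mul_zero, add_zero]
      refine mul_le_mul ?_ ?_ (by positivity) (by positivity)
      · rw [Complex.norm_exp]
        have : ((β - α + 2 * j) * (Real.log l : ℂ)).re = -z.re * Real.log l + (k * Real.log l - k' * Real.log l) + j * (2 * Real.log l) := by
          rw [hα, hβ]; simp; ring
        rw [this, Real.exp_add, Real.exp_add, Real.exp_sub, Real.exp_nat_mul, Real.exp_nat_mul, Real.exp_nat_mul, Real.exp_log hl0,
          show 2 * Real.log l = ((2 : ℕ) : ℝ) * Real.log l by norm_num, Real.exp_nat_mul, Real.exp_log hl0]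
        exact le_of_eq (by ring)
      · rw [← Real.exp_nat_mul, ← Real.exp_add, ← Real.exp_add]
        refine Real.exp_le_exp.2 ?_
        have : ‖β + j‖ ≤ ‖σ‖ + k + j := by
          rw [hβ]
          refine (norm_add_le _ _).trans (add_le_add ((norm_add_le _ _).trans ?_) ?_) <;> simp
        refine (mul_le_mul_of_nonneg_right this hD).trans (le_of_eq (by ring))
    rw [g2]
    refine (mul_le_mul (mul_le_mul_of_nonneg_right g1 (by positivity)) g3 (by positivity) (by positivity)).trans (le_of_eq ?_)
    rw [hP, mul_pow, mul_pow]
    ring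
  have hs : Summable fun j : ℕ => ‖b1 l α β 0 (β + j)‖ * Real.exp (‖β + j‖ * D) :=
    Summable.of_nonneg_of_le (fun _ => by positivity) key ((Real.summable_pow_div_factorial P).mul_left _)
  have hz0 : ∀ b ∉ Set.range fun j : ℕ => β + (j : ℂ), ‖b1 l α β 0 b‖ * Real.exp (‖b‖ * D) = 0 := fun b hb => by
    rw [b1_zero _ _ _ _ _ hb, norm_zero, zero_mul]
  refine ⟨((b1_inj β).summable_iff hz0).1 hs, ?_⟩
  have e1 : ∑' b, ‖b1 l α β 0 b‖ * Real.exp (‖b‖ * D) = ∑' j : ℕ, ‖b1 l α β 0 (β + j)‖ * Real.exp (‖β + j‖ * D) :=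
    ((b1_inj β).tsum_eq (f := fun b => ‖b1 l α β 0 b‖ * Real.exp (‖b‖ * D)) (by
      intro b hb; by_contra hh; exact hb (hz0 b hh))).symm
  rw [e1]
  refine (hs.tsum_le_tsum key ((Real.summable_pow_div_factorial P).mul_left _)).trans ?_
  rw [tsum_mul_left, show ∑' j : ℕ, P ^ j / (j.factorial : ℝ) = Real.exp P by
    rw [Real.exp_eq_exp_ℝ, NormedSpace.exp_eq_tsum_div]]
  exact le_of_eq (by ring)

lemma b1_le (l : ℝ) (α β η b : ℂ) : ‖b1 l α β η b‖ ≤ ‖b1 l α β 0 b‖ * Real.exp (‖b‖ * ‖η‖) := by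
  have : b1 l α β η b = b1 l α β 0 b * Complex.exp (b * η) := by
    simp only [b1]; rw [mul_zero, add_zero, Complex.exp_add]; ring
  rw [this, norm_mul]
  refine mul_le_mul_of_nonneg_left ((Complex.norm_exp_le_exp_norm _).trans ?_) (norm_nonneg _)
  rw [norm_mul]

/-- Bessel expansion in coefficient form -/
lemma bes_hasSum {l : ℝ} (hl : 1 ≤ l) {α β : ℂ} (h : NI (α - β)) (η : ℝ) :
    HasSum (fun b => bes l α β η b)
      (∫ ξ : ℝ, Complex.exp (α * ξ + β * (η - ξ) - l * Real.exp ξ - l * Real.exp (η - ξ))) := by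
  have hl0 : 0 < l := by linarith
  set L := Real.log l with hL
  have heL : Real.exp L = l := Real.exp_log hl0
  have h1 := bessel (α - β) h (η + 2 * L)
  have s1 : Summable fun b => b1 l α β η b := by
    obtain ⟨K, -, hh⟩ := b1_norm h
    obtain ⟨C, -, hh⟩ := hh l ‖(η : ℂ)‖ β hl (norm_nonneg _)
    exact Summable.of_norm_bounded (hh 0 0 α β (by simp) (by simp)).1 fun b => b1_le _ _ _ _ _
  have s2 : Summable fun b => b1 l β α η b := by
    obtain ⟨K, -, hh⟩ := b1_norm h.neg
    obtain ⟨C, -, hh⟩ := hh l ‖(η : ℂ)‖ α hl (norm_nonneg _)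
    exact Summable.of_norm_bounded (hh 0 0 β α (by simp) (by simp)).1 fun b => b1_le _ _ _ _ _
  have t1 := ((b1_inj β).hasSum_iff (fun b hb => b1_zero l α β η b hb)).2 s1.hasSum
  have t2 := ((b1_inj α).hasSum_iff (fun b hb => b1_zero l β α η b hb)).2 s2.hasSum
  have t3 := t1.add t2
  have hintg : ∫ ξ : ℝ, Complex.exp (α * ξ + β * (η - ξ) - l * Real.exp ξ - l * Real.exp (η - ξ)) =
      Complex.exp (β * η + (β - α) * L) * ∫ ξ : ℝ, Complex.exp ((α - β) * ξ - Real.exp ξ - Real.exp (η + 2 * L - ξ)) := by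
    rw [← integral_const_mul, ← integral_sub_right_eq_self _ L]
    refine integral_congr_ae (.of_forall fun ξ => ?_)
    beta_reduce
    rw [← Complex.exp_add]
    have e1 : Real.exp (ξ - L) = Real.exp ξ / l := by rw [Real.exp_sub, heL]
    have e2 : Real.exp (η + 2 * L - ξ) = l * (l * Real.exp (η - ξ)) := by
      rw [show η + 2 * L - ξ = L + (L + (η - ξ)) by ring, Real.exp_add, Real.exp_add, heL]
    have e3 : Real.exp (η - (ξ - L)) = l * Real.exp (η - ξ) := by
      rw [show η - (ξ - L) = L + (η - ξ) by ring, Real.exp_add, heL]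
    rw [e1, e2, e3]
    have : (l : ℂ) ≠ 0 := by exact_mod_cast hl0.ne'
    congr 1
    push_cast
    field_simp
    ring
  rw [hintg]
  have h2 := h1.mul_left (Complex.exp (β * η + (β - α) * L))
  have h3 : HasSum (fun j : ℕ => ((fun b => b1 l α β η b) ∘ fun j : ℕ => β + (j : ℂ)) j +
      ((fun b => b1 l β α η b) ∘ fun j : ℕ => α + (j : ℂ)) j)
      (Complex.exp (β * η + (β - α) * L) * ∫ ξ : ℝ, Complex.exp ((α - β) * ξ - Real.exp ξ - Real.exp (η + 2 * L - ξ))) := by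
    refine HasSum.cg h2 fun j => ?_
    simp only [Function.comp]
    rw [b1_apply, b1_apply]
    have e1 : ((β - α + 2 * j) * (Real.log l : ℂ) + (β + j) * η) = (β * η + (β - α) * L) + j * ((η + 2 * L : ℝ) : ℂ) := by
      push_cast; ring
    have e2 : ((α - β + 2 * j) * (Real.log l : ℂ) + (α + j) * η) = (β * η + (β - α) * L) + (α - β + j) * ((η + 2 * L : ℝ) : ℂ) := by
      push_cast; ring
    rw [e1, e2, Complex.exp_add (β * η + (β - α) * L) (j * _), Complex.exp_add (β * η + (β - α) * L) ((α - β + j) * _), show β - α - j = -(α - β) - j by ring]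
    ring
  have h4 := h3.unique t3
  rw [h4]
  refine HasSum.cg (s1.hasSum.add s2.hasSum) fun b => bes_eq _ _ _ _ _

def prv {α : Type*} [Zero α] {N : ℕ} (A : Fin N → α) : Fin (N + 1) → α := Fin.cons 0 A

@[simp] lemma prv_zero {α : Type*} [Zero α] {N : ℕ} (A : Fin N → α) : prv A 0 = 0 := rfl
@[simp] lemma prv_succ {α : Type*} [Zero α] {N : ℕ} (A : Fin N → α) (i : Fin N) : prv A i.succ = A i := rfl

lemma prv_last {α : Type*} [Zero α] {M : ℕ} (A : Fin (M + 1) → α) : prv A (Fin.last (M + 1)) = A (Fin.last M) := by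
  rw [← Fin.succ_last]; rfl

lemma prv_prod {N : ℕ} (k : Fin N → ℕ) (w : ℕ → ℝ) :
    (∏ i : Fin N, w (prv k i.castSucc)) * w (prv k (Fin.last N)) = w 0 * ∏ i, w (k i) := by
  rw [← Fin.prod_univ_castSucc (fun j => w (prv k j)), Fin.prod_univ_succ]; rfl

lemma sum_exponent {N : ℕ} (A : Fin N → ℂ) (ξ ω : Fin N → ℂ) (t : ℂ) :
    ∑ i, A i * (ω i + sh ξ t i) = (∑ i : Fin N, (prv A i.castSucc * ξ i + A i * ω i)) + prv A (Fin.last N) * t := by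
  have h1 := Fin.sum_univ_succ (fun j : Fin (N + 1) => prv A j * (Fin.snoc ξ t : Fin (N + 1) → ℂ) j)
  have h2 := Fin.sum_univ_castSucc (fun j : Fin (N + 1) => prv A j * (Fin.snoc ξ t : Fin (N + 1) → ℂ) j)
  simp only [Fin.snoc_castSucc, Fin.snoc_last, prv_zero, zero_mul, zero_add, prv_succ] at h1 h2
  simp only [mul_add, sum_add_distrib]
  have h3 : ∑ i, A i * sh ξ t i = ∑ i : Fin N, A i * (Fin.snoc ξ t : Fin (N + 1) → ℂ) i.succ := rfl
  rw [h3, ← h1, h2]; ring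

lemma th_prod {N : ℕ} (k : Fin N → ℕ) :
    ∏ i, ((k i).factorial : ℝ) ^ th N i = ∏ i : Fin N, ((k i).factorial * (prv k i.castSucc).factorial : ℝ) := by
  have h1 := prv_prod k (fun n => (n.factorial : ℝ))
  have h2 : (∏ i, ((k i).factorial : ℝ) ^ th N i) * ((prv k (Fin.last N)).factorial : ℝ) = ∏ i, ((k i).factorial : ℝ) ^ 2 := by
    cases N with
    | zero => simp [prv]
    | succ M =>
      rw [Fin.prod_univ_castSucc, Fin.prod_univ_castSucc (fun i => ((k i).factorial : ℝ) ^ 2), prv_last]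
      have : ∀ i : Fin M, th (M + 1) i.castSucc = 2 := fun i => by simp [th, i.2.ne]
      have h3 : th (M + 1) (Fin.last M) = 1 := by simp [th]
      simp only [this, h3]; ring
  have h0 : ((prv k (Fin.last N)).factorial : ℝ) ≠ 0 := by exact_mod_cast Nat.factorial_ne_zero _
  refine mul_right_cancel₀ h0 ?_
  rw [h2, prod_mul_distrib, mul_assoc, h1]
  simp only [Nat.factorial_zero, Nat.cast_one, one_mul, sq, prod_mul_distrib]

/-- uniform coefficient decay -/
def Dcy (S : Finset ℂ) {N : ℕ} (f : (Fin N → ℂ) → ℂ) (c : ℂ) : Prop :=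
  ∃ K : ℝ, 1 ≤ K ∧ ∀ D : ℝ, 0 ≤ D → ∃ C : ℝ, 0 ≤ C ∧ ∀ (σ : Fin N → ℂ) (k : Fin N → ℕ), (∀ i, σ i ∈ S) →
    ‖f (fun i => σ i + k i)‖ * Real.exp (‖c‖ * D * ‖prv (fun i => σ i + (k i : ℂ)) (Fin.last N)‖) ≤
      C * ∏ i : Fin N, (K ^ (k i) / ((k i).factorial * (prv k i.castSucc).factorial : ℝ))

lemma Expn.dcyO {S : Finset ℂ} {N : ℕ} {f F : (Fin N → ℂ) → ℂ} (h : Expn S f F) (hF : Continuous F)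
    (hg : GrO N F) : Dcy S f 0 := by
  obtain ⟨C0, K, hC0, hK, hb⟩ := h.decay hF hg
  refine ⟨K, hK, fun D _ => ⟨C0, hC0, fun σ k hσ => ?_⟩⟩
  rw [norm_zero, zero_mul, zero_mul, Real.exp_zero, mul_one]
  refine (hb σ k hσ).trans (le_of_eq ?_)
  rw [prod_div_distrib, prod_div_distrib, th_prod]

lemma Expn.dcyH {S : Finset ℂ} {N : ℕ} {f F : (Fin N → ℂ) → ℂ} (h : Expn S f F) (hF : Continuous F)
    (hg : GrH N F) : Dcy S f 1 := by
  obtain ⟨C0, K, hC0, hK, hb⟩ := h.decayH hF hg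
  refine ⟨K, hK, fun D hD => ⟨C0 * (Real.exp (D * ∑ s ∈ S, ‖s‖) * Real.exp (Real.exp D)), by positivity, fun σ k hσ => ?_⟩⟩
  rw [norm_one, one_mul]
  have e1 : ‖prv (fun i => σ i + (k i : ℂ)) (Fin.last N)‖ ≤ (∑ s ∈ S, ‖s‖) + prv k (Fin.last N) := by
    cases N with
    | zero =>
      have : prv (fun i => σ i + (k i : ℂ)) (Fin.last 0) = 0 := rfl
      rw [this, norm_zero]; positivity
    | succ M =>
      rw [prv_last, prv_last]
      refine (norm_add_le _ _).trans (add_le_add ?_ (by simp))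
      exact single_le_sum (f := fun s : ℂ => ‖s‖) (fun _ _ => norm_nonneg _) (hσ _)
  have e2 : Real.exp (D * ‖prv (fun i => σ i + (k i : ℂ)) (Fin.last N)‖) ≤
      Real.exp (D * ∑ s ∈ S, ‖s‖) * (Real.exp (Real.exp D) * (prv k (Fin.last N)).factorial) := by
    refine (Real.exp_le_exp.2 (mul_le_mul_of_nonneg_left e1 hD)).trans ?_
    rw [mul_add, Real.exp_add]
    refine mul_le_mul_of_nonneg_left ?_ (by positivity)
    rw [mul_comm D, Real.exp_nat_mul]
    have := Real.pow_div_factorial_le_exp (Real.exp D) (Real.exp_pos _).le (prv k (Fin.last N))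
    rwa [div_le_iff₀ (by positivity)] at this
  refine (mul_le_mul (hb σ k hσ) e2 (by positivity) (by positivity)).trans (le_of_eq ?_)
  rw [prod_div_distrib, prod_div_distrib]
  have h1 := prv_prod k (fun n => (n.factorial : ℝ))
  have h0 : ∀ n : ℕ, (n.factorial : ℝ) ≠ 0 := fun n => by exact_mod_cast Nat.factorial_ne_zero _
  have h2 : (∏ i, ((k i).factorial : ℝ) ^ 2) = (∏ i : Fin N, ((k i).factorial * (prv k i.castSucc).factorial : ℝ)) * (prv k (Fin.last N)).factorial := by
    rw [prod_mul_distrib, mul_assoc, h1]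
    simp [sq, prod_mul_distrib]
  rw [h2]
  have h3 : (∏ i : Fin N, ((k i).factorial * (prv k i.castSucc).factorial : ℝ)) ≠ 0 :=
    prod_ne_zero_iff.2 fun i _ => mul_ne_zero (h0 _) (h0 _)
  have h4 := h0 (prv k (Fin.last N))
  field_simp

lemma InC_countable (S : Finset ℂ) (M : ℕ) : {A : Fin M → ℂ | InC S A}.Countable := by
  have : {A : Fin M → ℂ | InC S A} ⊆ Set.range fun p : Fin M → S × ℕ => fun i => ((p i).1 : ℂ) + (p i).2 := by
    intro A hA
    choose σ hσ k hk using hA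
    exact ⟨fun i => (⟨σ i, hσ i⟩, k i), by ext i; exact (hk i).symm⟩
  exact (Set.countable_range _).mono this

lemma sum_InC' (S : Finset ℂ) (M : ℕ) {v : (Fin M → ℂ) → ℝ} (hv0 : ∀ A, 0 ≤ v A) (hsup : ∀ A, v A ≠ 0 → InC S A)
    (hv : ∀ σ : Fin M → ℂ, (∀ i, σ i ∈ S) → Summable fun k : Fin M → ℕ => v (fun i => σ i + k i)) :
    Summable v := by
  classical
  have h : ∀ σ ∈ Fintype.piFinset (fun _ : Fin M => S),
      Summable fun A : Fin M → ℂ => if ∃ k : Fin M → ℕ, A = fun i => σ i + (k i : ℂ) then v A else 0 := by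
    intro σ hσ
    have inj : Function.Injective fun k : Fin M → ℕ => (fun i => σ i + (k i : ℂ)) := fun a b h => by
      funext i; have := congrFun h i; simpa using this
    rw [← inj.summable_iff]
    · refine (hv σ (fun i => Fintype.mem_piFinset.1 hσ i)).congr fun k => ?_
      simp only [Function.comp]
      rw [if_pos ⟨k, rfl⟩]
    · intro b hb
      rw [if_neg]
      rintro ⟨k, hk⟩
      exact hb ⟨k, hk.symm⟩
  refine Summable.of_nonneg_of_le hv0 (fun A => ?_) (summable_sum h)
  by_cases hA : v A = 0
  · rw [hA]
    exact sum_nonneg fun σ _ => by split_ifs <;> simp [hv0]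
  · choose σ hσ k hk using hsup A hA
    have := single_le_sum (f := fun σ : Fin M → ℂ => if ∃ k : Fin M → ℕ, A = fun i => σ i + (k i : ℂ) then v A else 0)
      (s := Fintype.piFinset (fun _ : Fin M => S)) (fun σ _ => by split_ifs <;> simp [hv0]) (a := σ)
      (Fintype.mem_piFinset.2 fun i => hσ i)
    refine le_trans (le_of_eq ?_) this
    beta_reduce
    rw [if_pos ⟨k, funext hk⟩]

lemma sum_dcy {S : Finset ℂ} {N : ℕ} {f : (Fin N → ℂ) → ℂ} (hs : ∀ A, f A ≠ 0 → InC S A) {E : (Fin N → ℂ) → ℝ} (hE : ∀ A, 0 ≤ E A)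
    {C0 K : ℝ} (hC0 : 0 ≤ C0)
    (hd : ∀ (σ : Fin N → ℂ) (k : Fin N → ℕ), (∀ i, σ i ∈ S) → ‖f (fun i => σ i + k i)‖ * E (fun i => σ i + k i) ≤
      C0 * ∏ i : Fin N, (K ^ (k i) / ((k i).factorial * (prv k i.castSucc).factorial : ℝ)))
    {φ : ℕ → ℝ} (hφ : Summable φ) {C : ℝ} (M : Fin N → (Fin N → ℂ) → ℝ) (hM0 : ∀ i A, 0 ≤ M i A) (hK : 0 ≤ K)
    (hM : ∀ (σ : Fin N → ℂ) (k : Fin N → ℕ), (∀ i, σ i ∈ S) → f (fun i => σ i + k i) ≠ 0 → ∀ i : Fin N,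
      K ^ (k i) / ((k i).factorial * (prv k i.castSucc).factorial : ℝ) * M i (fun i => σ i + k i) ≤ C * φ (k i)) :
    Summable fun A => ‖f A‖ * E A * ∏ i, M i A := by
  refine sum_InC' S N (fun A => mul_nonneg (mul_nonneg (norm_nonneg _) (hE A)) (prod_nonneg fun i _ => hM0 i A))
    (fun A hA => hs A fun h => hA (by rw [h, norm_zero, zero_mul, zero_mul])) fun σ hσ => ?_
  have h1 := (sum_pi (fun (_ : Fin N) (k : ℕ) => ((C * φ k : ℝ) : ℂ)) (fun i => by
    simpa using (hφ.mul_left C).norm)).1.mul_left C0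
  refine Summable.of_nonneg_of_le (fun k => mul_nonneg (mul_nonneg (norm_nonneg _) (hE _)) (prod_nonneg fun i _ => hM0 i _))
    (fun k => ?_) h1
  rw [← Complex.ofReal_prod, Complex.norm_real]
  by_cases hf : f (fun i => σ i + k i) = 0
  · rw [hf, norm_zero, zero_mul, zero_mul]; exact mul_nonneg hC0 (norm_nonneg _)
  refine (mul_le_mul_of_nonneg_right (hd σ k hσ) (prod_nonneg fun i _ => hM0 i _)).trans ?_
  rw [mul_assoc, ← prod_mul_distrib]
  refine mul_le_mul_of_nonneg_left (le_trans ?_ (le_abs_self _)) hC0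
  exact prod_le_prod (fun i _ => mul_nonneg (by positivity) (hM0 i _)) fun i _ => hM σ k hσ hf i

lemma bes_le (l : ℝ) (α β η b : ℂ) : ‖bes l α β η b‖ ≤ ‖bes l α β 0 b‖ * Real.exp (‖b‖ * ‖η‖) := by
  have : bes l α β η b = bes l α β 0 b * Complex.exp (b * η) := by
    simp only [bes]; rw [mul_zero, add_zero, Complex.exp_add, mul_assoc]
  rw [this, norm_mul]
  refine mul_le_mul_of_nonneg_left ((Complex.norm_exp_le_exp_norm _).trans ?_) (norm_nonneg _)
  rw [norm_mul]

def besN (l D : ℝ) (α β : ℂ) : ℂ → ℝ := fun b => ‖bes l α β 0 b‖ * Real.exp (‖b‖ * D)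

def besQ (K l D : ℝ) (k k' : ℕ) : ℝ :=
  K ^ (k + k') * (k'.factorial / k.factorial * (l ^ k / l ^ k' * Real.exp (D * k)) +
    k.factorial / k'.factorial * (l ^ k' / l ^ k * Real.exp (D * k')))

lemma bes_norm1 (ν σ' σ : ℂ) : ∃ K : ℝ, 1 ≤ K ∧ ∀ l D : ℝ, 1 ≤ l → 0 ≤ D → ∃ C : ℝ, 0 ≤ C ∧
    (NI (ν + σ' - σ) → ∀ k k' : ℕ, Summable (besN l D (ν + (σ' + k')) (σ + k)) ∧
      ∑' b, besN l D (ν + (σ' + k')) (σ + k) b ≤ C * besQ K l D k k') := by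
  by_cases hz : NI (ν + σ' - σ)
  swap
  · exact ⟨1, le_rfl, fun l D _ _ => ⟨0, le_rfl, fun h => absurd h hz⟩⟩
  obtain ⟨K1, hK1, h1⟩ := b1_norm hz
  obtain ⟨K2, hK2, h2⟩ := b1_norm hz.neg
  refine ⟨K1 + K2, by linarith, fun l D hl hD => ?_⟩
  obtain ⟨C1, hC1, h1⟩ := h1 l D σ hl hD
  obtain ⟨C2, hC2, h2⟩ := h2 l D (ν + σ') hl hD
  refine ⟨C1 + C2, by positivity, fun _ k k' => ?_⟩
  obtain ⟨s1, t1⟩ := h1 k k' (ν + (σ' + k')) (σ + k) rfl (by ring)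
  obtain ⟨s2, t2⟩ := h2 k' k (σ + k) (ν + (σ' + k')) (by ring) (by ring)
  have hle : ∀ b, besN l D (ν + (σ' + k')) (σ + k) b ≤ ‖b1 l (ν + (σ' + k')) (σ + k) 0 b‖ * Real.exp (‖b‖ * D) +
      ‖b1 l (σ + k) (ν + (σ' + k')) 0 b‖ * Real.exp (‖b‖ * D) := fun b => by
    rw [besN, bes_eq, ← add_mul]
    exact mul_le_mul_of_nonneg_right (norm_add_le _ _) (by positivity)
  have hs : Summable (besN l D (ν + (σ' + k')) (σ + k)) :=
    Summable.of_nonneg_of_le (fun b => by unfold besN; positivity) hle (s1.add s2)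
  refine ⟨hs, (hs.tsum_le_tsum hle (s1.add s2)).trans ?_⟩
  rw [s1.tsum_add s2]
  refine (add_le_add t1 t2).trans ?_
  have hl0 : 0 < l := by linarith
  have p1 : K1 ^ (k + k') ≤ (K1 + K2) ^ (k + k') := pow_le_pow_left₀ (by linarith) (by linarith) _
  have p2 : K2 ^ (k' + k) ≤ (K1 + K2) ^ (k + k') := by
    rw [add_comm k' k]; exact pow_le_pow_left₀ (by linarith) (by linarith) _
  rw [besQ, mul_add, mul_add]
  exact add_le_add (mul_le_mul (by linarith) (mul_le_mul_of_nonneg_right p1 (by positivity)) (by positivity) (by positivity))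
    (mul_le_mul (by linarith) (mul_le_mul_of_nonneg_right p2 (by positivity)) (by positivity) (by positivity))

lemma bes_norm (ν : ℂ) (P : Finset (ℂ × ℂ)) : ∃ K : ℝ, 1 ≤ K ∧ ∀ l D : ℝ, 1 ≤ l → 0 ≤ D → ∃ C : ℝ, 0 ≤ C ∧
    ∀ p ∈ P, (NI (ν + p.1 - p.2) → ∀ k k' : ℕ, Summable (besN l D (ν + (p.1 + k')) (p.2 + k)) ∧
      ∑' b, besN l D (ν + (p.1 + k')) (p.2 + k) b ≤ C * besQ K l D k k') := by
  choose K hK h using fun p : ℂ × ℂ => bes_norm1 ν p.1 p.2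
  refine ⟨1 + ∑ p ∈ P, K p, by
    have := sum_nonneg (s := P) (f := K) (fun p _ => by linarith [hK p]); linarith, fun l D hl hD => ?_⟩
  choose C hC h using fun p => h p l D hl hD
  refine ⟨∑ p ∈ P, C p, sum_nonneg fun p _ => hC p, fun p hp hni k k' => ?_⟩
  refine ⟨(h p hni k k').1, (h p hni k k').2.trans ?_⟩
  have e1 : C p ≤ ∑ p ∈ P, C p := single_le_sum (fun p _ => hC p) hp
  have e2 : K p ≤ ∑ p ∈ P, K p := single_le_sum (f := K) (fun p _ => by linarith [hK p]) hp
  have hl0 : 0 < l := by linarith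
  have hk0 := hK p
  unfold besQ
  have e3 : K p ^ (k + k') ≤ (1 + ∑ p ∈ P, K p) ^ (k + k') := pow_le_pow_left₀ (by linarith) (by linarith) _
  exact mul_le_mul e1 (mul_le_mul_of_nonneg_right e3 (by positivity)) (by positivity) (by linarith [hC p])

lemma prv_add {N : ℕ} (σ : Fin N → ℂ) (k : Fin N → ℕ) (j : Fin (N + 1)) :
    prv (fun i => σ i + (k i : ℂ)) j = prv σ j + ((prv k j : ℕ) : ℂ) := by
  refine Fin.cases ?_ (fun i => ?_) j <;> simp

lemma prv_mem {N : ℕ} {S : Finset ℂ} {σ : Fin N → ℂ} (h : ∀ i, σ i ∈ S) (j : Fin (N + 1)) : prv σ j ∈ insert 0 S := by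
  refine Fin.cases ?_ (fun i => ?_) j
  · simp
  · exact Finset.mem_insert_of_mem (by simpa using h i)

lemma NI_base {ν σ' σ : ℂ} {k k' : ℕ} (h : NI (ν + (σ' + k') - (σ + k))) : NI (ν + σ' - σ) := by
  have := h.add_int ((k : ℤ) - k')
  convert this using 1
  push_cast; ring

def phi (X l D : ℝ) (k : ℕ) : ℝ := X ^ k * (1 / l ^ k + (l * Real.exp D) ^ k / (k.factorial : ℝ))

lemma phi_nonneg {X l D : ℝ} (hX : 0 ≤ X) (hl : 0 ≤ l) (k : ℕ) : 0 ≤ phi X l D k := by unfold phi; positivity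

lemma phi_summable {X l D : ℝ} (hX : 0 ≤ X) (hl : X < l) : Summable (phi X l D) := by
  have hl0 : 0 < l := by linarith
  have h1 : Summable fun k : ℕ => (X / l) ^ k := summable_geometric_of_lt_one (by positivity) ((div_lt_one hl0).2 hl)
  have h2 := Real.summable_pow_div_factorial (X * (l * Real.exp D))
  refine (h1.add h2).congr fun k => ?_
  rw [phi, mul_pow X, div_pow]; ring

lemma besQ_phi {K Kf l D : ℝ} (hK : 1 ≤ K) (hKf : 1 ≤ Kf) (hl : 1 ≤ l) (k k' : ℕ) :
    Kf ^ k / (k.factorial * k'.factorial : ℝ) * besQ K l D k k' ≤ phi (K * Kf) l D k * phi (K * Kf) l D k' := by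
  have hl0 : 0 < l := by linarith
  have f1 : (1 : ℝ) ≤ k.factorial := by exact_mod_cast Nat.factorial_pos k
  have f2 : (1 : ℝ) ≤ k'.factorial := by exact_mod_cast Nat.factorial_pos k'
  have e : Kf ^ k / (k.factorial * k'.factorial : ℝ) * besQ K l D k k' =
     (K * Kf) ^ k * K ^ k' * ((l * Real.exp D) ^ k / (k.factorial : ℝ) * (1 / l ^ k') * (1 / k.factorial) +
        1 / l ^ k * ((l * Real.exp D) ^ k' / (k'.factorial : ℝ)) * (1 / k'.factorial)) := by
    rw [besQ, mul_comm D, mul_comm D, Real.exp_nat_mul, Real.exp_nat_mul, mul_pow, mul_pow, mul_pow, pow_add]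
    field_simp
  rw [e]
  have e2 : phi (K * Kf) l D k * phi (K * Kf) l D k' = (K * Kf) ^ k * (K * Kf) ^ k' *
     ((1 / l ^ k + (l * Real.exp D) ^ k / (k.factorial : ℝ)) * (1 / l ^ k' + (l * Real.exp D) ^ k' / (k'.factorial : ℝ))) := by
    unfold phi; ring
  rw [e2]
  have g1 : K ^ k' ≤ (K * Kf) ^ k' := pow_le_pow_left₀ (by linarith) (by nlinarith) _
  have g2 : 1 / (k.factorial : ℝ) ≤ 1 := by rw [div_le_one (by linarith)]; exact f1
  have g3 : 1 / (k'.factorial : ℝ) ≤ 1 := by rw [div_le_one (by linarith)]; exact f2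
  refine mul_le_mul (mul_le_mul_of_nonneg_left g1 (by positivity)) ?_ (by positivity) (by positivity)
  set a := 1 / l ^ k with ha
  set a' := 1 / l ^ k' with ha'
  set b := (l * Real.exp D) ^ k / (k.factorial : ℝ) with hb
  set b' := (l * Real.exp D) ^ k' / (k'.factorial : ℝ) with hb'
  have a0 : 0 ≤ a := by positivity
  have a1 : 0 ≤ a' := by positivity
  have b0 : 0 ≤ b := by positivity
  have b1 : 0 ≤ b' := by positivity
  have := mul_le_mul_of_nonneg_left g2 (mul_nonneg b0 a1)
  have := mul_le_mul_of_nonneg_left g3 (mul_nonneg a0 b1)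
  nlinarith [mul_nonneg a0 a1, mul_nonneg b0 b1]

/-- summability of the double expansion -/
lemma sum_bes {S : Finset ℂ} {N : ℕ} {ν c : ℂ} {f : (Fin N → ℂ) → ℂ} (hs : ∀ A, f A ≠ 0 → InC S A) (hd : Dcy S f c)
    (hNI : ∀ A, f A ≠ 0 → ∀ i : Fin N, NI (ν + prv A i.castSucc - A i)) :
    ∃ Λ : ℝ, 1 ≤ Λ ∧ ∀ l, Λ < l → ∀ R : ℝ, 0 ≤ R →
      (∀ A, f A ≠ 0 → ∀ i : Fin N, Summable (besN l R (ν + prv A i.castSucc) (A i))) ∧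
      Summable fun A => ‖f A‖ * Real.exp (‖c‖ * R * ‖prv A (Fin.last N)‖) *
        ∏ i : Fin N, ∑' b, besN l R (ν + prv A i.castSucc) (A i) b := by
  obtain ⟨Kf, hKf, hd⟩ := hd
  obtain ⟨K, hK, hb⟩ := bes_norm ν ((insert 0 S) ×ˢ S)
  refine ⟨K * Kf, by nlinarith, fun l hl R hR => ?_⟩
  have hl1 : 1 ≤ l := by nlinarith
  have hl0 : 0 < l := by linarith
  obtain ⟨C0, hC0, hd⟩ := hd R hR
  obtain ⟨C, hC, hb⟩ := hb l R hl1 hR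
  have hps := phi_summable (D := R) (show 0 ≤ K * Kf by nlinarith) hl
  constructor
  · intro A hA i
    have hh := hNI A hA i
    choose σ hσ k hk using hs A hA
    obtain rfl : A = fun i => σ i + (k i : ℂ) := funext hk
    rw [prv_add] at hh ⊢
    exact (hb (prv σ i.castSucc, σ i) (Finset.mem_product.2 ⟨prv_mem hσ i.castSucc, hσ i⟩) (NI_base hh) _ _).1
  · refine sum_dcy hs (fun A => (Real.exp_pos _).le) hC0 hd hps (C := C * ∑' k, phi (K * Kf) l R k)
      (fun i A => ∑' b, besN l R (ν + prv A i.castSucc) (A i) b)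
      (fun i A => tsum_nonneg fun b => by unfold besN; positivity) (by linarith) ?_
    intro σ k hσ hf i
    have hh := hNI _ hf i
    beta_reduce
    rw [prv_add] at hh ⊢
    have h2 := (hb (prv σ i.castSucc, σ i) (Finset.mem_product.2 ⟨prv_mem hσ i.castSucc, hσ i⟩) (NI_base hh) (k i) (prv k i.castSucc)).2
    refine (mul_le_mul_of_nonneg_left h2 (by positivity)).trans ?_
    have h3 := besQ_phi (D := R) hK hKf hl1 (k i) (prv k i.castSucc)
    have h4 : phi (K * Kf) l R (prv k i.castSucc) ≤ ∑' k, phi (K * Kf) l R k :=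
      hps.le_tsum _ fun j _ => phi_nonneg (by nlinarith) hl0.le j
    have h5 := phi_nonneg (X := K * Kf) (D := R) (by nlinarith) hl0.le (k i)
    have h6 := mul_le_mul_of_nonneg_left h4 h5
    have h7 := mul_le_mul_of_nonneg_left (h3.trans h6) hC
    linarith

def gi (l : ℝ) (α β : ℂ) (η ξ : ℝ) : ℂ := Complex.exp (α * ξ + β * (η - ξ) - l * Real.exp ξ - l * Real.exp (η - ξ))

lemma gi_norm (l : ℝ) (α β : ℂ) (η ξ : ℝ) :
    ‖gi l α β η ξ‖ = Real.exp (α.re * ξ + β.re * (η - ξ) - l * Real.exp ξ - l * Real.exp (η - ξ)) := by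
  rw [gi, Complex.norm_exp]
  congr 1
  rw [← Complex.ofReal_sub]
  simp only [Complex.sub_re, Complex.add_re, Complex.re_mul_ofReal, Complex.ofReal_re]

lemma gi_integrable {l : ℝ} (hl : 1 / 2 ≤ l) (α β : ℂ) (η : ℝ) : Integrable (gi l α β η) := by
  refine (integrable_dc1 (‖α‖ + ‖β‖) η (by positivity)).mono' ?_ (Filter.Eventually.of_forall fun ξ => ?_)
  · refine Continuous.aestronglyMeasurable ?_
    unfold gi; fun_prop
  rw [gi_norm]
  refine Real.exp_le_exp.2 ?_
  simp only [dcE, Complex.ofReal_re, Complex.ofReal_im, if_true]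
  have e1 := Real.exp_pos ξ
  have e2 := Real.exp_pos (η - ξ)
  have e3 : α.re * ξ ≤ ‖α‖ * |ξ| := (le_abs_self _).trans (by
    rw [abs_mul]; exact mul_le_mul_of_nonneg_right (Complex.abs_re_le_norm _) (abs_nonneg _))
  have e4 : β.re * (η - ξ) ≤ ‖β‖ * |η - ξ| := (le_abs_self _).trans (by
    rw [abs_mul]; exact mul_le_mul_of_nonneg_right (Complex.abs_re_le_norm _) (abs_nonneg _))
  have e5 := mul_nonneg (norm_nonneg α) (abs_nonneg (η - ξ))
  have e6 := mul_nonneg (norm_nonneg β) (abs_nonneg ξ)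
  nlinarith

lemma gi_pow {l : ℝ} (hl : 0 < l) (k : ℕ) (s : ℝ) :
    Real.exp (k * s) ≤ k.factorial * (2 / l) ^ k * Real.exp (l / 2 * Real.exp s) := by
  have h := Real.pow_div_factorial_le_exp (l / 2 * Real.exp s) (by positivity) k
  rw [div_le_iff₀ (by positivity)] at h
  rw [Real.exp_nat_mul]
  have h2 : Real.exp s ^ k = (2 / l) ^ k * (l / 2 * Real.exp s) ^ k := by
    rw [← mul_pow]; congr 1; field_simp
  rw [h2]
  have := mul_le_mul_of_nonneg_left h (show 0 ≤ (2 / l) ^ k by positivity)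
  linarith

lemma gi_le {l : ℝ} (hl : 0 < l) (α β : ℂ) (k k' : ℕ) (η ξ : ℝ) :
    ‖gi l (α + k') (β + k) η ξ‖ ≤ k.factorial * k'.factorial * (2 / l) ^ (k + k') * ‖gi (l / 2) α β η ξ‖ := by
  rw [gi_norm, gi_norm]
  have e : Real.exp ((α + k').re * ξ + (β + k).re * (η - ξ) - l * Real.exp ξ - l * Real.exp (η - ξ)) =
      Real.exp (α.re * ξ + β.re * (η - ξ) - l * Real.exp ξ - l * Real.exp (η - ξ)) * (Real.exp (k' * ξ) * Real.exp (k * (η - ξ))) := by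
    rw [← Real.exp_add, ← Real.exp_add]; congr 1; simp; ring
  have e' : Real.exp (α.re * ξ + β.re * (η - ξ) - l / 2 * Real.exp ξ - l / 2 * Real.exp (η - ξ)) =
      Real.exp (α.re * ξ + β.re * (η - ξ) - l * Real.exp ξ - l * Real.exp (η - ξ)) *
        (Real.exp (l / 2 * Real.exp ξ) * Real.exp (l / 2 * Real.exp (η - ξ))) := by
    rw [← Real.exp_add, ← Real.exp_add]; congr 1; ring
  rw [e, e']
  have := mul_le_mul (gi_pow hl k' ξ) (gi_pow hl k (η - ξ)) (by positivity) (by positivity)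
  refine (mul_le_mul_of_nonneg_left this (by positivity)).trans (le_of_eq ?_)
  rw [pow_add]; ring

lemma sum_gi {S : Finset ℂ} {N : ℕ} {ν c : ℂ} {f : (Fin N → ℂ) → ℂ} (hs : ∀ A, f A ≠ 0 → InC S A) (hd : Dcy S f c) :
    ∃ Λ : ℝ, 1 ≤ Λ ∧ ∀ l, Λ < l → ∀ (η : Fin N → ℝ) (R : ℝ), 0 ≤ R →
      Summable fun A => ‖f A‖ * Real.exp (‖c‖ * R * ‖prv A (Fin.last N)‖) *
        ∏ i : Fin N, ∫ ξ, ‖gi l (ν + prv A i.castSucc) (A i) (η i) ξ‖ := by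
  obtain ⟨Kf, hKf, hd⟩ := hd
  refine ⟨2 * Kf, by linarith, fun l hl η R hR => ?_⟩
  have hl0 : 0 < l := by linarith
  obtain ⟨C0, hC0, hd⟩ := hd R hR
  have hg : Summable fun k : ℕ => (2 * Kf / l) ^ k :=
    summable_geometric_of_lt_one (by positivity) ((div_lt_one hl0).2 hl)
  set J : ℂ × ℂ → Fin N → ℝ := fun p i => ∫ ξ, ‖gi (l / 2) (ν + p.1) p.2 (η i) ξ‖ with hJ
  have J0 : ∀ p i, 0 ≤ J p i := fun p i => integral_nonneg fun _ => norm_nonneg _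
  refine sum_dcy hs (fun A => (Real.exp_pos _).le) hC0 hd hg (C := ∑ p ∈ (insert 0 S) ×ˢ S, ∑ i, J p i)
    (fun i A => ∫ ξ, ‖gi l (ν + prv A i.castSucc) (A i) (η i) ξ‖)
    (fun i A => integral_nonneg fun _ => norm_nonneg _) (by linarith) ?_
  intro σ k hσ hf i
  beta_reduce
  rw [prv_add]
  generalize hk' : prv k i.castSucc = k'
  have h1 : ∫ ξ, ‖gi l (ν + (prv σ i.castSucc + (k' : ℂ))) (σ i + k i) (η i) ξ‖ ≤
      (k i).factorial * k'.factorial * (2 / l) ^ (k i + k') * J (prv σ i.castSucc, σ i) i := by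
    rw [hJ, ← integral_const_mul]
    refine integral_mono (gi_integrable (by linarith) _ _ _).norm ((gi_integrable (by linarith) _ _ _).norm.const_mul _) fun ξ => ?_
    have := gi_le hl0 (ν + prv σ i.castSucc) (σ i) (k i) k' (η i) ξ
    rwa [add_assoc ν] at this
  have hm : (prv σ i.castSucc, σ i) ∈ (insert 0 S) ×ˢ S := Finset.mem_product.2 ⟨prv_mem hσ i.castSucc, hσ i⟩
  generalize (prv σ i.castSucc, σ i) = p at hm h1
  have h2a : J p i ≤ ∑ i, J p i := single_le_sum (f := fun i => J p i) (fun i _ => J0 _ i) (mem_univ i)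
  have h2b : ∑ i, J p i ≤ ∑ p ∈ (insert 0 S) ×ˢ S, ∑ i, J p i :=
    single_le_sum (f := fun p => ∑ i, J p i) (fun p _ => sum_nonneg fun i _ => J0 p i) hm
  have h2 := h2a.trans h2b
  refine (mul_le_mul_of_nonneg_left h1 (by positivity)).trans ?_
  have h3 : Kf ^ k i / ((k i).factorial * k'.factorial : ℝ) * ((k i).factorial * k'.factorial * (2 / l) ^ (k i + k') * J p i)
      = (2 * Kf / l) ^ (k i) * (2 / l) ^ k' * J p i := by
    have f1 : ((k i).factorial : ℝ) ≠ 0 := by exact_mod_cast Nat.factorial_ne_zero _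
    have f2 : (k'.factorial : ℝ) ≠ 0 := by exact_mod_cast Nat.factorial_ne_zero _
    rw [pow_add, show 2 * Kf / l = Kf * (2 / l) by ring, mul_pow]
    field_simp
  rw [h3]
  have h4 : (2 / l) ^ k' ≤ 1 := pow_le_one₀ (by positivity) (by rw [div_le_one hl0]; linarith)
  calc _ ≤ (2 * Kf / l) ^ (k i) * 1 * J p i := by
        refine mul_le_mul_of_nonneg_right (mul_le_mul_of_nonneg_left h4 (by positivity)) (J0 _ _)
    _ ≤ (2 * Kf / l) ^ (k i) * 1 * (∑ p ∈ (insert 0 S) ×ˢ S, ∑ i, J p i) := mul_le_mul_of_nonneg_left h2 (by positivity)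
    _ = _ := by ring

lemma sum_pi_real {ι : Type*} {M : ℕ} (r : Fin M → ι → ℝ) (h0 : ∀ i b, 0 ≤ r i b) (hr : ∀ i, Summable (r i)) :
    HasSum (fun B : Fin M → ι => ∏ i, r i (B i)) (∏ i, ∑' b, r i b) := by
  have h := (sum_pi (fun i b => ((r i b : ℝ) : ℂ)) fun i => by
    refine (hr i).congr fun b => ?_
    rw [Complex.norm_real, Real.norm_of_nonneg (h0 i b)]).2
  rw [← Complex.hasSum_ofReal]
  convert h using 1
  · funext B; push_cast; rfl
  · push_cast; rfl

def TT (N : ℕ) (ν : ℂ) (f : (Fin N → ℂ) → ℂ) (c : ℂ) (l : ℝ) (p : (Fin N → ℂ) × (Fin N → ℂ)) (η : Fin (N + 1) → ℂ) : ℂ :=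
  f p.1 * Complex.exp (c * (ν + prv p.1 (Fin.last N)) * η (Fin.last N)) *
    ∏ i : Fin N, bes l (ν + prv p.1 i.castSucc) (p.1 i) (η i.castSucc) (p.2 i)

lemma TT_diff (N : ℕ) (ν : ℂ) (f : (Fin N → ℂ) → ℂ) (c : ℂ) (l : ℝ) (p : (Fin N → ℂ) × (Fin N → ℂ)) :
    Differentiable ℂ (TT N ν f c l p) := by
  unfold TT bes
  fun_prop

lemma TT_summable {S : Finset ℂ} {N : ℕ} {ν c : ℂ} {f : (Fin N → ℂ) → ℂ} (hs : ∀ A, f A ≠ 0 → InC S A) (hd : Dcy S f c)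
    (hNI : ∀ A, f A ≠ 0 → ∀ i : Fin N, NI (ν + prv A i.castSucc - A i)) :
    ∃ Λ : ℝ, 1 ≤ Λ ∧ ∀ l, Λ < l → ∀ R : ℝ, ∃ u : (Fin N → ℂ) × (Fin N → ℂ) → ℝ, Summable u ∧
      ∀ p η, ‖η‖ ≤ R → ‖TT N ν f c l p η‖ ≤ u p := by
  obtain ⟨Λ, hΛ, h⟩ := sum_bes hs hd hNI
  refine ⟨Λ, hΛ, fun l hl R => ?_⟩
  by_cases hR : 0 ≤ R
  swap
  · exact ⟨fun _ => 0, summable_zero, fun p η hη => absurd ((norm_nonneg _).trans hη) hR⟩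
  obtain ⟨h1, h2⟩ := h l hl R hR
  set u : (Fin N → ℂ) × (Fin N → ℂ) → ℝ := fun p => Real.exp (‖c‖ * R * ‖ν‖) * (‖f p.1‖ *
      Real.exp (‖c‖ * R * ‖prv p.1 (Fin.last N)‖)) * ∏ i : Fin N, besN l R (ν + prv p.1 i.castSucc) (p.1 i) (p.2 i) with hu
  have b0 : ∀ l D α β b, 0 ≤ besN l D α β b := fun l D α β b => by unfold besN; positivity
  have u0 : ∀ p, 0 ≤ u p := fun p => mul_nonneg (by positivity) (prod_nonneg fun i _ => b0 _ _ _ _ _)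
  have hA : ∀ A, HasSum (fun B => u (A, B)) (Real.exp (‖c‖ * R * ‖ν‖) * (‖f A‖ *
      Real.exp (‖c‖ * R * ‖prv A (Fin.last N)‖)) * ∏ i : Fin N, ∑' b, besN l R (ν + prv A i.castSucc) (A i) b) := by
    intro A
    by_cases hf : f A = 0
    · have : ∀ B, u (A, B) = 0 := fun B => by simp [hu, hf]
      simp only [this, hf, norm_zero, zero_mul, mul_zero]
      exact hasSum_zero
    · exact (sum_pi_real _ (fun i b => b0 _ _ _ _ _) (h1 A hf)).mul_left _
  refine ⟨u, ?_, fun p η hη => ?_⟩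
  · rw [summable_prod_of_nonneg u0]
    refine ⟨fun A => (hA A).summable, ?_⟩
    simp only [(hA _).tsum_eq, mul_assoc]
    simp only [mul_assoc] at h2
    exact h2.mul_left _
  · rw [TT, norm_mul, norm_mul, norm_prod]
    have hn : ∀ i, ‖η i‖ ≤ R := fun i => (norm_le_pi_norm η i).trans hη
    refine mul_le_mul ?_ (prod_le_prod (fun i _ => norm_nonneg _) fun i _ => (bes_le _ _ _ _ _).trans ?_)
      (by positivity) (by positivity)
    · rw [show Real.exp (‖c‖ * R * ‖ν‖) * (‖f p.1‖ * Real.exp (‖c‖ * R * ‖prv p.1 (Fin.last N)‖)) =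
        ‖f p.1‖ * (Real.exp (‖c‖ * R * ‖ν‖) * Real.exp (‖c‖ * R * ‖prv p.1 (Fin.last N)‖)) by ring, ← Real.exp_add]
      refine mul_le_mul_of_nonneg_left ((Complex.norm_exp_le_exp_norm _).trans (Real.exp_le_exp.2 ?_)) (norm_nonneg _)
      rw [norm_mul, norm_mul]
      calc _ ≤ ‖c‖ * (‖ν‖ + ‖prv p.1 (Fin.last N)‖) * R := by
            gcongr
            · exact norm_add_le _ _
            · exact hn _
        _ = _ := by ring
    · unfold besN
      gcongr
      exact hn _

set_option maxHeartbeats 1000000 in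
lemma TT_real {S : Finset ℂ} {N : ℕ} {ν c : ℂ} {f F : (Fin N → ℂ) → ℂ} (hE : Expn S f F) (hd : Dcy S f c)
    (hNI : ∀ A, f A ≠ 0 → ∀ i : Fin N, NI (ν + prv A i.castSucc - A i)) :
    ∃ Λ : ℝ, 1 ≤ Λ ∧ ∀ l, Λ < l → ∀ η : Fin (N + 1) → ℝ,
      HasSum (fun p => TT N ν f c l p (fun i => (η i : ℂ)))
      (Complex.exp (ν * (c * η (Fin.last N))) * ∫ ξ : Fin N → ℝ,
        Complex.exp (-(l : ℂ) * XX fun i => ((ξ i : ℂ), (η i.castSucc : ℂ) - ξ i)) *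
          Psi N ν F c (η (Fin.last N)) fun i => ((ξ i : ℂ), (η i.castSucc : ℂ) - ξ i)) := by
  obtain ⟨Λ1, hΛ1, h1⟩ := TT_summable hE.supp hd hNI
  obtain ⟨Λ2, hΛ2, h2⟩ := sum_gi (ν := ν) hE.supp hd
  refine ⟨max Λ1 Λ2, hΛ1.trans (le_max_left _ _), fun l hl η => ?_⟩
  have hlA := (le_max_left _ _).trans_lt hl
  have hlB := (le_max_right _ _).trans_lt hl
  have hl1 : 1 ≤ l := by linarith
  obtain ⟨u, hu, hb⟩ := h1 l hlA ‖fun i => (η i : ℂ)‖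
  have hsum : Summable (fun p => TT N ν f c l p (fun i => (η i : ℂ))) := Summable.of_norm_bounded hu fun p => hb p _ le_rfl
  set E : (Fin N → ℂ) → ℂ := fun A => Complex.exp (c * (ν + prv A (Fin.last N)) * η (Fin.last N)) with hEd
  have hfib : ∀ A, HasSum (fun B => TT N ν f c l (A, B) (fun i => (η i : ℂ)))
      (f A * E A * ∏ i : Fin N, ∫ ξ, gi l (ν + prv A i.castSucc) (A i) (η i.castSucc) ξ) := by
    intro A
    by_cases hf : f A = 0
    · simp only [TT, hf, zero_mul]; exact hasSum_zero
    · have hs := fun i => bes_hasSum hl1 (hNI A hf i) (η i.castSucc)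
      have := (sum_pi (fun i b => bes l (ν + prv A i.castSucc) (A i) (η i.castSucc) b) fun i => (hs i).summable.norm).2
      have e : ∀ i, ∑' b, bes l (ν + prv A i.castSucc) (A i) (η i.castSucc) b = ∫ ξ, gi l (ν + prv A i.castSucc) (A i) (η i.castSucc) ξ :=
        fun i => (hs i).tsum_eq
      simp only [e] at this
      exact HasSum.cg (this.mul_left (f A * E A)) fun B => by simp only [TT, hEd]
  have hA := hsum.hasSum.prod_fiberwise hfib
  suffices hV : HasSum (fun A => f A * E A * ∏ i : Fin N, ∫ ξ, gi l (ν + prv A i.castSucc) (A i) (η i.castSucc) ξ)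
      (Complex.exp (ν * (c * η (Fin.last N))) * ∫ ξ : Fin N → ℝ,
        Complex.exp (-(l : ℂ) * XX fun i => ((ξ i : ℂ), (η i.castSucc : ℂ) - ξ i)) *
          Psi N ν F c (η (Fin.last N)) fun i => ((ξ i : ℂ), (η i.castSucc : ℂ) - ξ i)) by
    have := hsum.hasSum
    rwa [hA.unique hV] at this
  have hsupp : ∀ g : (Fin N → ℂ) → ℂ, Function.support (fun A => f A * g A) ⊆ {A | InC S A} := fun g A hA =>
    hE.supp A fun h => hA (by simp [h])
  haveI : Countable {A : Fin N → ℂ | InC S A} := (InC_countable S N).to_subtype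
  have hi := hasSum_integral_of_summable_integral_norm (ι := {A : Fin N → ℂ | InC S A})
    (F := fun A (ξ : Fin N → ℝ) => f A.1 * E A.1 * ∏ i : Fin N, gi l (ν + prv A.1 i.castSucc) (A.1 i) (η i.castSucc) (ξ i))
    (μ := volume) (fun A => (Integrable.fintype_prod (μ := fun _ => volume) (f := fun (i : Fin N) => gi l (ν + prv A.1 i.castSucc) (A.1 i) (η i.castSucc))
      fun i => gi_integrable (by linarith) _ _ _).const_mul _) (by
    have hq := h2 l hlB (fun i => η i.castSucc) |η (Fin.last N)| (abs_nonneg _)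
    have hq2 := (hq.comp_injective (Subtype.val_injective (p := fun A => InC S A))).mul_left (Real.exp (‖c‖ * ‖ν‖ * |η (Fin.last N)|))
    refine Summable.of_nonneg_of_le (fun A => integral_nonneg fun _ => norm_nonneg _) (fun A => ?_) hq2
    simp only [norm_mul, norm_prod]
    rw [integral_const_mul, integral_fintype_prod_volume_eq_prod (fun (i : Fin N) ξ => ‖gi l (ν + prv A.1 i.castSucc) (A.1 i) (η i.castSucc) ξ‖)]
    simp only [Function.comp]
    rw [← mul_assoc]
    refine mul_le_mul_of_nonneg_right ?_ (prod_nonneg fun i _ => integral_nonneg fun _ => norm_nonneg _)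
    rw [mul_left_comm]
    refine mul_le_mul_of_nonneg_left ?_ (norm_nonneg _)
    rw [← Real.exp_add]
    refine (Complex.norm_exp_le_exp_norm _).trans (Real.exp_le_exp.2 ?_)
    rw [norm_mul, norm_mul, Complex.norm_real, Real.norm_eq_abs]
    calc _ ≤ ‖c‖ * (‖ν‖ + ‖prv A.1 (Fin.last N)‖) * |η (Fin.last N)| := by
            gcongr
            exact norm_add_le _ _
        _ = _ := by ring)
  have e1 : ∀ ξ : Fin N → ℝ, ∑' A : {A : Fin N → ℂ | InC S A}, f A.1 * E A.1 * ∏ i : Fin N, gi l (ν + prv A.1 i.castSucc) (A.1 i) (η i.castSucc) (ξ i) =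
      Complex.exp (ν * (c * η (Fin.last N))) * (Complex.exp (-(l : ℂ) * XX fun i => ((ξ i : ℂ), (η i.castSucc : ℂ) - ξ i)) *
          Psi N ν F c (η (Fin.last N)) fun i => ((ξ i : ℂ), (η i.castSucc : ℂ) - ξ i)) := by
    intro ξ
    have g1 := hE.hs (fun i => (η i.castSucc : ℂ) - ξ i + sh (fun i => (ξ i : ℂ)) (c * η (Fin.last N)) i)
    have g2 := (g1.mul_left (Complex.exp (ν * (c * η (Fin.last N))) * (Complex.exp (-(l : ℂ) * XX fun i => ((ξ i : ℂ), (η i.castSucc : ℂ) - ξ i)) * Complex.exp (ν * ∑ i, (ξ i : ℂ)))))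
    have g3 : HasSum (fun A => f A * (E A * ∏ i : Fin N, gi l (ν + prv A i.castSucc) (A i) (η i.castSucc) (ξ i))) _ := HasSum.cg g2 fun A => by
      rw [sum_exponent]
      simp only [gi, hEd]
      rw [← Complex.exp_sum, ← Complex.exp_add, ← Complex.exp_add, ← Complex.exp_add, mul_left_comm, ← Complex.exp_add]
      congr 2
      simp only [XX, Complex.ofReal_exp, Complex.ofReal_sub]
      simp only [sum_sub_distrib, sum_add_distrib, add_mul, mul_sub, ← mul_sum]
      ring
    have g4 := (hasSum_subtype_iff_of_support_subset (hsupp _)).2 g3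
    have g5 := g4.tsum_eq
    simp only [Function.comp, ← mul_assoc] at g5
    rw [g5, Psi]
    ring
  have e2 : ∀ A : {A : Fin N → ℂ | InC S A}, ∫ ξ : Fin N → ℝ, f A.1 * E A.1 * ∏ i : Fin N, gi l (ν + prv A.1 i.castSucc) (A.1 i) (η i.castSucc) (ξ i) =
      f A.1 * (E A.1 * ∏ i : Fin N, ∫ ξ, gi l (ν + prv A.1 i.castSucc) (A.1 i) (η i.castSucc) ξ) := fun A => by
    rw [integral_const_mul, integral_fintype_prod_volume_eq_prod (fun (i : Fin N) ξ => gi l (ν + prv A.1 i.castSucc) (A.1 i) (η i.castSucc) ξ), mul_assoc]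
  simp only [e1, e2] at hi
  rw [integral_const_mul] at hi
  have h5 := (hasSum_subtype_iff_of_support_subset (f := fun A => f A * (E A * ∏ i : Fin N, ∫ ξ, gi l (ν + prv A i.castSucc) (A i) (η i.castSucc) ξ)) (hsupp _)).1 hi
  simpa only [mul_assoc] using h5

/-- entire functions agreeing at real points agree -/
lemma ident_real {M : ℕ} {f g : (Fin M → ℂ) → ℂ} (hf : Differentiable ℂ f) (hg : Differentiable ℂ g)
    (h : ∀ x : Fin M → ℝ, f (fun i => (x i : ℂ)) = g (fun i => (x i : ℂ))) : f = g := by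
  funext η
  have hd : Differentiable ℂ (fun s : ℂ => fun i => ((η i).re : ℂ) + s * ((η i).im : ℂ)) := by
    rw [differentiable_pi]; intro i; fun_prop
  have := ident (r := 2) (δ := 1) one_pos one_le_two (f := fun s => f (fun i => ((η i).re : ℂ) + s * ((η i).im : ℂ)))
    (h := fun s => g (fun i => ((η i).re : ℂ) + s * ((η i).im : ℂ)))
    (Differentiable.comp (g := f) hf hd).differentiableOn (Differentiable.comp (g := g) hg hd).differentiableOn
    (fun x _ _ => by
      have := h (fun i => (η i).re + x * (η i).im)
      push_cast at this
      exact this) Complex.I (by simp)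
  have e : (fun i => ((η i).re : ℂ) + Complex.I * ((η i).im : ℂ)) = η := by
    funext i; rw [mul_comm]; exact Complex.re_add_im _
  simpa only [e] using this

lemma TT_cx {S : Finset ℂ} {N : ℕ} {ν c : ℂ} {f F : (Fin N → ℂ) → ℂ} (hE : Expn S f F) (hd : Dcy S f c)
    (hNI : ∀ A, f A ≠ 0 → ∀ i : Fin N, NI (ν + prv A i.castSucc - A i)) (hc : ‖c‖ ≤ 1) (hF : Differentiable ℂ F) (h : PsiB N ν F c) :
    ∃ Λ : ℝ, 1 ≤ Λ ∧ ∀ l, Λ < l → ∀ l0 : ℝ, |l0 - l| < l0 - 3 / 4 → ∀ η : Fin (N + 1) → ℂ,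
      HasSum (fun p => TT N ν f c l p η) (∑' k, ((l0 - l : ℝ) : ℂ) ^ k * Gk N ν F c l0 k η) := by
  obtain ⟨Λ1, hΛ1, h1⟩ := TT_summable hE.supp hd hNI
  obtain ⟨Λ2, hΛ2, h2⟩ := TT_real hE hd hNI
  refine ⟨max Λ1 Λ2, hΛ1.trans (le_max_left _ _), fun l hl l0 hll η => ?_⟩
  have hlA := (le_max_left _ _).trans_lt hl
  have hlB := (le_max_right _ _).trans_lt hl
  have h34 : 3 / 4 < l0 := by linarith [abs_nonneg (l0 - l)]
  have d1 : Differentiable ℂ fun η => ∑' p, TT N ν f c l p η :=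
    diff_tsum (fun p => TT_diff N ν f c l p) fun R => h1 l hlA R
  have d2 : Differentiable ℂ fun η => ∑' k, ((l0 - l : ℝ) : ℂ) ^ k * Gk N ν F c l0 k η :=
    diff_tsum (fun k => (Gk_diff hF h h34 k).const_mul _) fun R => by
      obtain ⟨A, hA, hb⟩ := Gk_loc hc hF h h34 R
      exact ⟨fun k => A * (|l0 - l| / (l0 - 3 / 4)) ^ k, geo_summable A (by linarith) (abs_nonneg _) hll, fun k η hη => by
        beta_reduce; rw [norm_mul, norm_pow, Complex.norm_real, Real.norm_eq_abs, div_eq_mul_inv, mul_pow]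
        have := mul_le_mul_of_nonneg_left (hb k η hη) (show 0 ≤ |l0 - l| ^ k by positivity)
        linarith⟩
  have e := ident_real d1 d2 fun x => by rw [(h2 l hlB x).tsum_eq, (Gk_hasSum_real hF h h34 hll x).tsum_eq]
  obtain ⟨u, hu, hb⟩ := h1 l hlA ‖η‖
  have hs : Summable fun p => TT N ν f c l p η := Summable.of_norm_bounded hu fun p => hb p η le_rfl
  have := hs.hasSum
  rwa [congrFun e η] at this

def kt (l : ℝ) (x y : ℂ) : ℂ := rho x y * Complex.exp (-(x + y) * Real.log l)

def kk {N : ℕ} (l : ℝ) (ν : ℂ) (A B : Fin N → ℂ) : ℂ := ∏ i : Fin N, kt l (ν + prv A i.castSucc - B i) (A i - B i)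

def pi' {N : ℕ} (ν c : ℂ) (p : (Fin N → ℂ) × (Fin N → ℂ)) : Fin (N + 1) → ℂ :=
  Fin.snoc p.2 (c * (ν + prv p.1 (Fin.last N)))

open Classical in
def gL (N : ℕ) (ν : ℂ) (f : (Fin N → ℂ) → ℂ) (c : ℂ) (l : ℝ) (B' : Fin (N + 1) → ℂ) : ℂ :=
  ∑' p : (Fin N → ℂ) × (Fin N → ℂ), if pi' ν c p = B' then f p.1 * kk l ν p.1 p.2 else 0

lemma TT_eq (N : ℕ) (ν : ℂ) (f : (Fin N → ℂ) → ℂ) (c : ℂ) (l : ℝ) (p : (Fin N → ℂ) × (Fin N → ℂ)) (η : Fin (N + 1) → ℂ) :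
    TT N ν f c l p η = f p.1 * kk l ν p.1 p.2 * Complex.exp (∑ i, pi' ν c p i * η i) := by
  rw [Fin.sum_univ_castSucc, Complex.exp_add, Complex.exp_sum, TT, kk]
  simp only [pi', Fin.snoc_castSucc, Fin.snoc_last]
  have : ∀ i : Fin N, bes l (ν + prv p.1 i.castSucc) (p.1 i) (η i.castSucc) (p.2 i) =
      kt l (ν + prv p.1 i.castSucc - p.2 i) (p.1 i - p.2 i) * Complex.exp (p.2 i * η i.castSucc) := fun i => by
    rw [bes, kt, Complex.exp_add, ← mul_assoc]
    congr 3; ring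
  simp only [this, prod_mul_distrib]
  ring

def Snew (ν c : ℂ) (S : Finset ℂ) : Finset ℂ := S ∪ (insert 0 S).image (fun s => ν + s) ∪ (insert 0 S).image (fun s => c * (ν + s))

lemma kk_ne {N : ℕ} {l : ℝ} {ν : ℂ} {A B : Fin N → ℂ} (h : kk l ν A B ≠ 0) (i : Fin N) :
    (∃ j : ℕ, B i = ν + prv A i.castSucc + j) ∨ ∃ j : ℕ, B i = A i + j := by
  have h1 := prod_ne_zero_iff.1 h i (mem_univ i)
  have h2 : rho (ν + prv A i.castSucc - B i) (A i - B i) ≠ 0 := fun h => h1 (by rw [kt, h, zero_mul])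
  rcases rho_ne h2 with ⟨j, hj⟩ | ⟨j, hj⟩
  · exact Or.inl ⟨j, by linear_combination -hj⟩
  · exact Or.inr ⟨j, by linear_combination -hj⟩

lemma InC.prv_mem {N : ℕ} {S : Finset ℂ} {A : Fin N → ℂ} (h : InC S A) (j : Fin (N + 1)) :
    ∃ σ ∈ insert 0 S, ∃ k : ℕ, prv A j = σ + k := by
  refine Fin.cases ⟨0, by simp, 0, by simp⟩ (fun i => ?_) j
  obtain ⟨σ, hσ, k, hk⟩ := h i
  exact ⟨σ, Finset.mem_insert_of_mem hσ, k, by simpa using hk⟩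

lemma pi'_InC {N : ℕ} {l : ℝ} {ν c : ℂ} (hc : c = 0 ∨ c = 1) {S : Finset ℂ} {A B : Fin N → ℂ} (hA : InC S A) (h : kk l ν A B ≠ 0) :
    InC (Snew ν c S) (pi' ν c (A, B)) := by
  intro i
  refine Fin.lastCases ?_ (fun i => ?_) i
  · simp only [pi', Fin.snoc_last]
    obtain ⟨σ, hσ, k, hk⟩ := hA.prv_mem (Fin.last N)
    rcases hc with rfl | rfl
    · exact ⟨0, by
        refine Finset.mem_union_right _ (Finset.mem_image.2 ⟨0, by simp, by simp⟩), 0, by simp⟩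
    · exact ⟨1 * (ν + σ), Finset.mem_union_right _ (Finset.mem_image.2 ⟨σ, hσ, rfl⟩), k, by rw [hk]; ring⟩
  · simp only [pi', Fin.snoc_castSucc]
    rcases kk_ne h i with ⟨j, hj⟩ | ⟨j, hj⟩
    · obtain ⟨σ, hσ, k, hk⟩ := hA.prv_mem i.castSucc
      exact ⟨ν + σ, Finset.mem_union_left _ (Finset.mem_union_right _ (Finset.mem_image.2 ⟨σ, hσ, rfl⟩)), k + j, by
        rw [hj, hk]; push_cast; ring⟩
    · obtain ⟨σ, hσ, k, hk⟩ := hA i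
      exact ⟨σ, Finset.mem_union_left _ (Finset.mem_union_left _ hσ), k + j, by rw [hj, hk]; push_cast; ring⟩

lemma gL_ne {N : ℕ} {ν : ℂ} {f : (Fin N → ℂ) → ℂ} {c : ℂ} {l : ℝ} {B' : Fin (N + 1) → ℂ} (h : gL N ν f c l B' ≠ 0) :
    ∃ A B, f A ≠ 0 ∧ kk l ν A B ≠ 0 ∧ pi' ν c (A, B) = B' := by
  by_contra hh
  push Not at hh
  refine h ?_
  rw [gL]
  convert tsum_zero with p
  split_ifs with hp
  · by_contra h3
    exact hh p.1 p.2 (left_ne_zero_of_mul h3) (right_ne_zero_of_mul h3) hp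
  · rfl

/-- the hypotheses for one step -/
structure UH (S : Finset ℂ) (N : ℕ) (ν c : ℂ) (f F : (Fin N → ℂ) → ℂ) : Prop where
  hE : Expn S f F
  hd : Dcy S f c
  hNI : ∀ A, f A ≠ 0 → ∀ i : Fin N, NI (ν + prv A i.castSucc - A i)
  hc : c = 0 ∨ c = 1
  hF : Differentiable ℂ F
  hP : PsiB N ν F c

lemma UH.c1 {S : Finset ℂ} {N : ℕ} {ν c : ℂ} {f F : (Fin N → ℂ) → ℂ} (h : UH S N ν c f F) : ‖c‖ ≤ 1 := by
  rcases h.hc with hc | hc <;> simp [hc]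

lemma UH.sum {S : Finset ℂ} {N : ℕ} {ν c : ℂ} {f F : (Fin N → ℂ) → ℂ} (h : UH S N ν c f F) :
    ∃ Λ : ℝ, 1 ≤ Λ ∧ ∀ l, Λ < l → (Summable fun p : (Fin N → ℂ) × (Fin N → ℂ) => f p.1 * kk l ν p.1 p.2) ∧
      ∀ l0 : ℝ, |l0 - l| < l0 - 3 / 4 →
        Expn (Snew ν c S) (gL N ν f c l) (fun η => ∑' k, ((l0 - l : ℝ) : ℂ) ^ k * Gk N ν F c l0 k η) := by
  obtain ⟨Λ, hΛ, hh⟩ := TT_cx h.hE h.hd h.hNI h.c1 h.hF h.hP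
  refine ⟨Λ, hΛ, fun l hl => ⟨?_, fun l0 hl0 => ⟨fun B hB => ?_, fun η => ?_⟩⟩⟩
  · have hl0 : |l - l| < l - 3 / 4 := by rw [sub_self, abs_zero]; linarith
    have := (hh l hl l hl0 0).summable
    refine this.congr fun p => ?_
    rw [TT_eq]; simp
  · obtain ⟨A, B0, h1, h2, h3⟩ := gL_ne hB
    rw [← h3]
    exact pi'_InC h.hc (h.hE.supp A h1) h2
  · have h1 := (hh l hl l0 hl0 η).tsum_fiberwise (pi' ν c)
    refine HasSum.cg h1 fun B => ?_
    classical
    rw [tsum_subtype (pi' ν c ⁻¹' {B}) (fun p => TT N ν f c l p η), gL, ← tsum_mul_right]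
    refine tsum_congr fun p => ?_
    by_cases hp : pi' ν c p = B
    · rw [if_pos hp, Set.indicator_of_mem (by exact hp), TT_eq, hp]
    · rw [if_neg hp, Set.indicator_of_notMem (by exact hp), zero_mul]

def gg (S : Finset ℂ) (N : ℕ) (ν c : ℂ) (F : (Fin N → ℂ) → ℂ) (l0 : ℝ) (z : ℂ) : (Fin (N + 1) → ℂ) → ℂ :=
  cont (Snew ν c S) (Gk N ν F c l0) z

lemma UH.step {S : Finset ℂ} {N : ℕ} {ν c : ℂ} {f F : (Fin N → ℂ) → ℂ} (h : UH S N ν c f F) :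
    ∃ Λ : ℝ, 1 ≤ Λ ∧ (∀ l, Λ < l → (Summable fun p : (Fin N → ℂ) × (Fin N → ℂ) => f p.1 * kk l ν p.1 p.2)) ∧
      ∀ l0 : ℝ, Λ + 1 < l0 →
      (∀ B, DifferentiableOn ℂ (fun z => gg S N ν c F l0 z B) (Metric.ball 0 (l0 - 3 / 4))) ∧
      (∀ x : ℝ, 0 < x → x < 1 → gg S N ν c F l0 x = gL N ν f c (l0 - x)) ∧
      Expn (Snew ν c S) (gg S N ν c F l0 ((l0 - 1 : ℝ) : ℂ)) (fun η => ∑' k, ((l0 - 1 : ℝ) : ℂ) ^ k * Gk N ν F c l0 k η) := by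
  obtain ⟨Λ, hΛ, hh⟩ := h.sum
  refine ⟨Λ, hΛ, fun l hl => (hh l hl).1, fun l0 hl0 => ?_⟩
  have h34 : 3 / 4 < l0 := by linarith
  obtain ⟨h1, h2, h3⟩ := cont_spec (S := Snew ν c S) (G := Gk N ν F c l0) (r := l0 - 3 / 4) (δ := 1)
    (fun k => Gk_diff h.hF h.hP h34 k) one_pos (by linarith) (Gk_loc h.c1 h.hF h.hP h34) (g := fun x => gL N ν f c (l0 - x))
    (fun x hx0 hx1 => by
      have := (hh (l0 - x) (by linarith)).2 l0 (by rw [sub_sub_cancel, abs_of_pos hx0]; linarith)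
      rwa [sub_sub_cancel] at this)
  refine ⟨h1, h2, h3 _ ?_⟩
  rw [mem_ball_zero_iff, Complex.norm_real, Real.norm_of_nonneg (by linarith)]; linarith

lemma exp_log_shift {l : ℝ} (hl : 0 < l) (s : ℂ) :
    Complex.exp (-(s + 1) * Real.log l) = Complex.exp (-s * Real.log l) / l := by
  have : (l : ℂ) = Complex.exp (Real.log l) := by rw [← Complex.ofReal_exp, Real.exp_log hl]
  rw [this]
  rw [← Complex.exp_sub]; congr 1; ring

lemma kt_left {l : ℝ} (hl : 0 < l) {x y : ℂ} (h : NI (x - y)) : kt l (x + 1) y = x / l * kt l x y := by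
  rw [kt, kt, rho_succ_left h, show x + 1 + y = x + y + 1 by ring, exp_log_shift hl]; ring

lemma kt_right {l : ℝ} (hl : 0 < l) {x y : ℂ} (h : NI (x - y)) : kt l x (y + 1) = y / l * kt l x y := by
  rw [kt, kt, rho_succ_right h, show x + (y + 1) = x + y + 1 by ring, exp_log_shift hl]; ring

/-- unit vectors -/
def ev {N : ℕ} (i : Fin N) : Fin N → ℂ := Pi.single i 1

lemma ev_apply {N : ℕ} (i j : Fin N) : ev i j = if j = i then 1 else 0 := by
  simp [ev, Pi.single_apply]

lemma prv_ev {N : ℕ} (A : Fin N → ℂ) (i : Fin N) (j : Fin (N + 1)) :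
    prv (A + ev i) j = prv A j + if j = i.succ then 1 else 0 := by
  refine Fin.cases ?_ (fun j => ?_) j
  · rw [if_neg (by exact fun h => (Fin.succ_ne_zero i) h.symm)]; simp
  · simp [ev_apply]

lemma kk_B {N : ℕ} {l : ℝ} (hl : 0 < l) {ν : ℂ} {A : Fin N → ℂ} (B : Fin N → ℂ)
    (h : ∀ i : Fin N, NI (ν + prv A i.castSucc - A i)) (i : Fin N) :
    kk l ν A (B - ev i) = (ν + prv A i.castSucc - B i) * (A i - B i) / l ^ 2 * kk l ν A B := by
  have e : ∀ j : Fin N, kt l (ν + prv A j.castSucc - (B - ev i) j) (A j - (B - ev i) j) =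
      (if j = i then (ν + prv A j.castSucc - B j) * (A j - B j) / l ^ 2 else 1) *
        kt l (ν + prv A j.castSucc - B j) (A j - B j) := fun j => by
    rw [Pi.sub_apply, ev_apply]
    split_ifs with hj
    · rw [show ν + prv A j.castSucc - (B j - 1) = ν + prv A j.castSucc - B j + 1 by ring,
        show A j - (B j - 1) = A j - B j + 1 by ring, kt_left hl, kt_right hl]
      · ring
      · convert h j using 1; ring
      · convert (h j).add_int (-1) using 1; push_cast; ring
    · simp
  rw [kk, prod_congr rfl fun j _ => e j, prod_mul_distrib, prod_ite_eq']
  simp [kk]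

lemma kk_A {M : ℕ} {l : ℝ} (hl : 0 < l) {ν : ℂ} {A : Fin (M + 1) → ℂ} (B : Fin (M + 1) → ℂ)
    (h : ∀ i : Fin (M + 1), NI (ν + prv A i.castSucc - A i)) (i : Fin M) :
    kk l ν (A + ev i.castSucc) B = (A i.castSucc - B i.castSucc) * (ν + prv A i.succ.castSucc - B i.succ) / l ^ 2 * kk l ν A B := by
  have e : ∀ j : Fin (M + 1), kt l (ν + prv (A + ev i.castSucc) j.castSucc - B j) ((A + ev i.castSucc) j - B j) =
      (if j = i.castSucc then (A j - B j) / l else 1) * ((if j = i.succ then (ν + prv A j.castSucc - B j) / l else 1) *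
        kt l (ν + prv A j.castSucc - B j) (A j - B j)) := fun j => by
    have hj : (j.castSucc = i.castSucc.succ) ↔ j = i.succ := by
      simp only [Fin.ext_iff]; simp
    rw [prv_ev, Pi.add_apply, ev_apply]
    simp only [hj]
    by_cases h1 : j = i.castSucc
    · have h2 : ¬ j = i.succ := by rw [h1]; simp [Fin.ext_iff]
      rw [if_pos h1, if_neg h2, if_pos h1, if_neg h2, add_zero, show A j + 1 - B j = A j - B j + 1 by ring, kt_right hl, one_mul]
      convert h j using 1; ring
    · by_cases h2 : j = i.succ
      · rw [if_neg h1, if_pos h2, if_neg h1, if_pos h2, add_zero, show ν + (prv A j.castSucc + 1) - B j = ν + prv A j.castSucc - B j + 1 by ring,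
          kt_left hl, one_mul]
        convert h j using 1; ring
      · rw [if_neg h1, if_neg h2, if_neg h1, if_neg h2]; simp
  rw [kk, prod_congr rfl fun j _ => e j, prod_mul_distrib, prod_mul_distrib, prod_ite_eq', prod_ite_eq']
  simp only [mem_univ, if_true, kk]
  ring

lemma kk_last {M : ℕ} {l : ℝ} (hl : 0 < l) {ν : ℂ} {A : Fin (M + 1) → ℂ} (B : Fin (M + 1) → ℂ)
    (h : ∀ i : Fin (M + 1), NI (ν + prv A i.castSucc - A i)) :
    kk l ν (A + ev (Fin.last M)) B = (A (Fin.last M) - B (Fin.last M)) / l * kk l ν A B := by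
  have e : ∀ j : Fin (M + 1), kt l (ν + prv (A + ev (Fin.last M)) j.castSucc - B j) ((A + ev (Fin.last M)) j - B j) =
      (if j = Fin.last M then (A j - B j) / l else 1) * 
        kt l (ν + prv A j.castSucc - B j) (A j - B j) := fun j => by
    have hj : ¬ (j.castSucc = (Fin.last M).succ) := by
      simp only [Fin.ext_iff]; simp; omega
    rw [prv_ev, Pi.add_apply, ev_apply, if_neg hj, add_zero]
    by_cases h1 : j = Fin.last M
    · rw [if_pos h1, if_pos h1, show A j + 1 - B j = A j - B j + 1 by ring, kt_right hl]
      convert h j using 1; ring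
    · rw [if_neg h1, if_neg h1]; simp
  rw [kk, prod_congr rfl fun j _ => e j, prod_mul_distrib, prod_ite_eq']
  simp only [mem_univ, if_true, kk]

lemma NI_shift {N : ℕ} {ν : ℂ} {A : Fin N → ℂ} (h : ∀ i : Fin N, NI (ν + prv A i.castSucc - A i)) (k : Fin N) (i : Fin N) :
    NI (ν + prv (A + ev k) i.castSucc - (A + ev k) i) := by
  rw [prv_ev, Pi.add_apply, ev_apply]
  convert (h i).add_int ((if i.castSucc = k.succ then 1 else 0) - (if i = k then 1 else 0)) using 1
  push_cast; ring

/-- the quadratic form -/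
def Qf {N : ℕ} (A : Fin N → ℂ) : ℂ := 1 / 2 * ∑ i : Fin N, (A i - prv A i.castSucc) ^ 2

lemma Qf_id {N : ℕ} (ν : ℂ) (A B : Fin N → ℂ) :
    Qf B + 1 / 2 * (ν + prv A (Fin.last N) - prv B (Fin.last N)) ^ 2 - 1 / 2 * ν ^ 2 - Qf A =
      ∑ i : Fin N, ((ν + prv A i.castSucc - B i) * (A i - B i)
        - (ν + prv A i.castSucc - B i) * (prv A i.castSucc - prv B i.castSucc)) := by
  have e : ∀ i : Fin N, (ν + prv A i.castSucc - B i) * (A i - B i)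
        - (ν + prv A i.castSucc - B i) * (prv A i.castSucc - prv B i.castSucc) =
      1 / 2 * (B i - prv B i.castSucc) ^ 2 - 1 / 2 * (A i - prv A i.castSucc) ^ 2 +
      (1 / 2 * (ν + prv A i.succ - prv B i.succ) ^ 2 - 1 / 2 * (ν + prv A i.castSucc - prv B i.castSucc) ^ 2) := fun i => by
    simp only [prv_succ]; ring
  rw [sum_congr rfl fun i _ => e i, sum_add_distrib, sum_sub_distrib, sum_sub_distrib, Qf, Qf,
    mul_sum, mul_sum]
  have h1 := Fin.sum_univ_succ (fun j : Fin (N + 1) => 1 / 2 * (ν + prv A j - prv B j) ^ 2)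
  have h2 := Fin.sum_univ_castSucc (fun j : Fin (N + 1) => 1 / 2 * (ν + prv A j - prv B j) ^ 2)
  simp only [prv_zero] at h1
  linear_combination h1 - h2

lemma Qf_id' {M : ℕ} (ν : ℂ) (A B : Fin (M + 1) → ℂ) :
    Qf B + 1 / 2 * (ν + A (Fin.last M) - B (Fin.last M)) ^ 2 - 1 / 2 * ν ^ 2 - Qf A =
      ∑ i : Fin (M + 1), (ν + prv A i.castSucc - B i) * (A i - B i)
        - ∑ i : Fin M, (A i.castSucc - B i.castSucc) * (ν + prv A i.succ.castSucc - B i.succ) := by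
  have := Qf_id ν A B
  rw [prv_last, prv_last, sum_sub_distrib] at this
  rw [this]; congr 1
  rw [Fin.sum_univ_succ]
  simp only [Fin.castSucc_zero, prv_zero, sub_self, mul_zero, zero_add]
  refine sum_congr rfl fun i _ => ?_
  rw [← Fin.succ_castSucc, prv_succ, prv_succ]; ring

lemma Qf_snoc {N : ℕ} (B : Fin N → ℂ) (b : ℂ) :
    Qf (Fin.snoc B b : Fin (N + 1) → ℂ) = Qf B + 1 / 2 * (b - prv B (Fin.last N)) ^ 2 := by
  have hp : ∀ j : Fin (N + 1), prv (Fin.snoc B b : Fin (N + 1) → ℂ) j.castSucc = prv B j := fun j => by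
    refine Fin.cases rfl (fun j => ?_) j
    rw [← Fin.succ_castSucc, prv_succ, prv_succ, Fin.snoc_castSucc]
  rw [Qf, Qf, Fin.sum_univ_castSucc]
  simp only [hp, Fin.snoc_castSucc, Fin.snoc_last]
  ring

lemma sum_shift_le {N : ℕ} (a b : Fin N → ℝ) (r : ℝ) (k : Fin N) (h : ∀ i, a i ≤ b i) (hk : a k + r ≤ b k) :
    r + ∑ i, a i ≤ ∑ i, b i := by
  have : ∑ i, (a i + if i = k then r else 0) ≤ ∑ i, b i := sum_le_sum fun i _ => by
    split_ifs with hi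
    · rw [hi]; exact hk
    · simpa using h i
  rw [sum_add_distrib, sum_ite_eq' univ k] at this
  simp only [mem_univ, if_true] at this
  linarith

lemma hfE_add_re (C : ℝ) (z : ℂ) : hfE C z + |z.re| ≤ hfE (C + 1) z := by
  have := Real.exp_pos (z.re / 2)
  simp only [hfE]; split_ifs <;> nlinarith

lemma preE_add_re (C : ℝ) (z : ℂ) : preE C z + |z.re| ≤ preE (C + 1) z := by
  have := Real.exp_pos z.re
  simp only [preE]; split_ifs <;> nlinarith

lemma exp_shift_bd {z w : ℂ} {A a b : ℝ} (hA : 0 ≤ A) (hw : ‖w‖ ≤ A * Real.exp a) (h : |z.re| + a ≤ b) :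
    ‖Complex.exp z * w‖ ≤ A * Real.exp b := by
  rw [norm_mul, Complex.norm_exp]
  calc Real.exp z.re * ‖w‖ ≤ Real.exp |z.re| * (A * Real.exp a) :=
        mul_le_mul (Real.exp_le_exp.2 (le_abs_self _)) hw (norm_nonneg _) (Real.exp_pos _).le
    _ = A * Real.exp (|z.re| + a) := by rw [Real.exp_add]; ring
    _ ≤ _ := mul_le_mul_of_nonneg_left (Real.exp_le_exp.2 h) hA

lemma GrH.shift {N : ℕ} {F : (Fin N → ℂ) → ℂ} (h : GrH N F) (k : Fin N) : GrH N fun η => Complex.exp (η k) * F η := fun T => by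
  obtain ⟨A, C, hA, hC, hb⟩ := h T
  refine ⟨A, C + 1, hA, by linarith, fun ζ hζ => exp_shift_bd hA (hb ζ hζ) (sum_shift_le _ _ _ k (fun i => ?_) (hfE_add_re _ _))⟩
  linarith [hfE_add_re C (ζ i), abs_nonneg (ζ i).re]

lemma GrO.shift {N : ℕ} {F : (Fin N → ℂ) → ℂ} (h : GrO N F) (k : Fin N) : GrO N fun η => Complex.exp (η k) * F η := fun T => by
  obtain ⟨A, C, hA, hC, hb⟩ := h T
  have key : ∀ (i : Fin N) z, gE N C i z + |z.re| ≤ gE N (C + 1) i z := fun i z => by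
    simp only [gE]; split_ifs
    · exact preE_add_re _ _
    · exact hfE_add_re _ _
  refine ⟨A, C + 1, hA, by linarith, fun ζ hζ => exp_shift_bd hA (hb ζ hζ) (sum_shift_le _ _ _ k (fun i => ?_) (key _ _))⟩
  linarith [key i (ζ i), abs_nonneg (ζ i).re]

lemma Expn.shift {S : Finset ℂ} {N : ℕ} {f F : (Fin N → ℂ) → ℂ} (h : Expn S f F) (k : Fin N) :
    Expn S (fun A => f (A - ev k)) (fun η => Complex.exp (η k) * F η) := by
  refine ⟨fun B hB i => ?_, fun η => ?_⟩
  · obtain ⟨σ, hσ, m, hm⟩ := h.supp _ hB i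
    rw [Pi.sub_apply, ev_apply] at hm
    split_ifs at hm with hi
    · exact ⟨σ, hσ, m + 1, by push_cast; linear_combination hm⟩
    · exact ⟨σ, hσ, m, by linear_combination hm⟩
  · have h1 := (h.hs η).mul_left (Complex.exp (η k))
    rw [← (Equiv.subRight (ev k)).hasSum_iff] at h1
    refine HasSum.cg h1 fun B => ?_
    simp only [Function.comp, Equiv.subRight_apply]
    rw [mul_left_comm, ← Complex.exp_add]
    congr 2
    simp only [Pi.sub_apply, sub_mul, sum_sub_distrib, ev_apply, ite_mul, one_mul, zero_mul, sum_ite_eq',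
      mem_univ, if_true]
    ring

lemma NI_sub {N : ℕ} {ν : ℂ} {f : (Fin N → ℂ) → ℂ} (h : ∀ A, f A ≠ 0 → ∀ i : Fin N, NI (ν + prv A i.castSucc - A i)) (k : Fin N) :
    ∀ A, f (A - ev k) ≠ 0 → ∀ i : Fin N, NI (ν + prv A i.castSucc - A i) := fun A hA i => by
  have := NI_shift (h _ hA) k i
  rwa [sub_add_cancel] at this

lemma diff_shift {N : ℕ} {F : (Fin N → ℂ) → ℂ} (h : Differentiable ℂ F) (k : Fin N) :
    Differentiable ℂ fun η => Complex.exp (η k) * F η := by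
  have : Differentiable ℂ fun η : Fin N → ℂ => η k := by fun_prop
  exact this.cexp.mul h

structure UHH (S : Finset ℂ) (N : ℕ) (ν : ℂ) (f F : (Fin N → ℂ) → ℂ) : Prop where
  hE : Expn S f F
  hNI : ∀ A, f A ≠ 0 → ∀ i : Fin N, NI (ν + prv A i.castSucc - A i)
  hF : Differentiable ℂ F
  hG : GrH N F

structure UHO (S : Finset ℂ) (N : ℕ) (ν : ℂ) (f F : (Fin N → ℂ) → ℂ) : Prop where
  hE : Expn S f F
  hNI : ∀ A, f A ≠ 0 → ∀ i : Fin N, NI (ν + prv A i.castSucc - A i)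
  hF : Differentiable ℂ F
  hG : GrO N F

lemma UHH.shift {S : Finset ℂ} {N : ℕ} {ν : ℂ} {f F : (Fin N → ℂ) → ℂ} (h : UHH S N ν f F) (k : Fin N) :
    UHH S N ν (fun A => f (A - ev k)) (fun η => Complex.exp (η k) * F η) :=
  ⟨h.hE.shift k, NI_sub h.hNI k, diff_shift h.hF k, h.hG.shift k⟩

lemma UHO.shift {S : Finset ℂ} {N : ℕ} {ν : ℂ} {f F : (Fin N → ℂ) → ℂ} (h : UHO S N ν f F) (k : Fin N) :
    UHO S N ν (fun A => f (A - ev k)) (fun η => Complex.exp (η k) * F η) :=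
  ⟨h.hE.shift k, NI_sub h.hNI k, diff_shift h.hF k, h.hG.shift k⟩

lemma UHH.uh {S : Finset ℂ} {N : ℕ} {ν : ℂ} {f F : (Fin N → ℂ) → ℂ} (h : UHH S N ν f F) : UH S N ν 1 f F :=
  ⟨h.hE, h.hE.dcyH h.hF.continuous h.hG, h.hNI, Or.inr rfl, h.hF, h.hG.psiB ν⟩

lemma UHO.uh {S : Finset ℂ} {N : ℕ} {ν : ℂ} {f F : (Fin N → ℂ) → ℂ} (h : UHO S N ν f F) : UH S N ν 0 f F :=
  ⟨h.hE, h.hE.dcyO h.hF.continuous h.hG, h.hNI, Or.inl rfl, h.hF, h.hG.psiB ν⟩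

def Poss {N : ℕ} (ν : ℂ) (A B : Fin N → ℂ) : Prop :=
  ∀ i : Fin N, (∃ j : ℕ, B i = ν + prv A i.castSucc + j) ∨ ∃ j : ℕ, B i = A i + j

/-- everything one needs to know about one step except for the recurrence -/
structure Out (N : ℕ) (ν c : ℂ) (f F : (Fin N → ℂ) → ℂ) (g G : (Fin (N + 1) → ℂ) → ℂ) : Prop where
  dif : Differentiable ℂ G
  bd : ∀ T : ℝ, 0 ≤ T → ∃ A C : ℝ, 0 ≤ A ∧ 0 ≤ C ∧ ∀ η : Fin (N + 1) → ℂ, (∀ i, |(η i).im| ≤ T) →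
      ‖G η‖ ≤ A * Real.exp (preE C (η (Fin.last N)) + ∑ i : Fin N, hfE C (η i.castSucc))
  re : ∀ η : Fin (N + 1) → ℝ, G (fun i => (η i : ℂ)) = Complex.exp (ν * (c * η (Fin.last N))) * ∫ ξ : Fin N → ℝ,
        Complex.exp (-((1 : ℝ) : ℂ) * XX fun i => ((ξ i : ℂ), (η i.castSucc : ℂ) - ξ i)) *
          Psi N ν F c (η (Fin.last N)) fun i => ((ξ i : ℂ), (η i.castSucc : ℂ) - ξ i)
  ex : ∃ S', Expn S' g G
  supp : ∀ B', g B' ≠ 0 → ∃ A B, f A ≠ 0 ∧ Poss ν A B ∧ pi' ν c (A, B) = B'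
  single : ∀ A0 B0, (∀ A B, f A ≠ 0 → Poss ν A B → pi' ν c (A, B) = pi' ν c (A0, B0) → A = A0 ∧ B = B0) →
    g (pi' ν c (A0, B0)) = f A0 * ∏ i : Fin N, rho (ν + prv A0 i.castSucc - B0 i) (A0 i - B0 i)

lemma kk_eq {N : ℕ} (l : ℝ) (ν : ℂ) (A B : Fin N → ℂ) :
    kk l ν A B = (∏ i : Fin N, rho (ν + prv A i.castSucc - B i) (A i - B i)) *
      Complex.exp (-(∑ i : Fin N, (ν + prv A i.castSucc - B i + (A i - B i))) * Real.log l) := by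
  simp only [kk, kt]
  rw [prod_mul_distrib, ← Complex.exp_sum, ← sum_mul, sum_neg_distrib]

lemma gL_single {N : ℕ} {ν : ℂ} {f : (Fin N → ℂ) → ℂ} {c : ℂ} {l : ℝ} {A0 B0 : Fin N → ℂ}
    (h : ∀ A B, f A ≠ 0 → Poss ν A B → pi' ν c (A, B) = pi' ν c (A0, B0) → A = A0 ∧ B = B0) :
    gL N ν f c l (pi' ν c (A0, B0)) = f A0 * kk l ν A0 B0 := by
  rw [gL, tsum_eq_single (A0, B0), if_pos rfl]
  rintro ⟨A, B⟩ hne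
  split_ifs with hp
  · by_contra h3
    obtain ⟨rfl, rfl⟩ := h A B (left_ne_zero_of_mul h3) (fun i => kk_ne (right_ne_zero_of_mul h3) i) hp
    exact hne rfl
  · rfl

lemma gg_ident {l0 : ℝ} (h2 : 2 < l0)
    {P Q : ℂ → ℂ} (hP : DifferentiableOn ℂ P (Metric.ball 0 (l0 - 3 / 4))) (hQ : DifferentiableOn ℂ Q (Metric.ball 0 (l0 - 3 / 4)))
    (h : ∀ x : ℝ, 0 < x → x < 1 → P x = Q x) : P ((l0 - 1 : ℝ) : ℂ) = Q ((l0 - 1 : ℝ) : ℂ) :=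
  ident one_pos (by linarith) hP hQ h _ (by
    rw [mem_ball_zero_iff, Complex.norm_real, Real.norm_of_nonneg (by linarith)]; linarith)

lemma UH.out {S : Finset ℂ} {N : ℕ} {ν c : ℂ} {f F : (Fin N → ℂ) → ℂ} (h : UH S N ν c f F) {l0 : ℝ} (hl0 : 2 < l0)
    (hg1 : ∀ B, DifferentiableOn ℂ (fun z => gg S N ν c F l0 z B) (Metric.ball 0 (l0 - 3 / 4)))
    (hg2 : ∀ x : ℝ, 0 < x → x < 1 → gg S N ν c F l0 x = gL N ν f c (l0 - x))
    (hg3 : Expn (Snew ν c S) (gg S N ν c F l0 ((l0 - 1 : ℝ) : ℂ)) (fun η => ∑' k, ((l0 - 1 : ℝ) : ℂ) ^ k * Gk N ν F c l0 k η)) :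
    Out N ν c f F (gg S N ν c F l0 ((l0 - 1 : ℝ) : ℂ)) (fun η => ∑' k, ((l0 - 1 : ℝ) : ℂ) ^ k * Gk N ν F c l0 k η) := by
  have h34 : 3 / 4 < l0 := by linarith
  have hr : 0 < l0 - 3 / 4 := by linarith
  have hn : ‖((l0 - 1 : ℝ) : ℂ)‖ ≤ l0 - 1 := by
    rw [Complex.norm_real, Real.norm_of_nonneg (by linarith)]
  have hlt : l0 - 1 < l0 - 3 / 4 := by linarith
  refine ⟨?_, fun T hT => ?_, fun η => ?_, ⟨_, hg3⟩, fun B' hB' => ?_, fun A0 B0 hs => ?_⟩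
  · refine diff_tsum (fun k => (Gk_diff h.hF h.hP h34 k).const_mul _) fun R => ?_
    obtain ⟨A, hA, hb⟩ := Gk_loc h.c1 h.hF h.hP h34 R
    exact ⟨fun k => A * ((l0 - 1) / (l0 - 3 / 4)) ^ k, geo_summable A hr (by linarith) hlt, fun k η hη =>
      geo_bound (a := fun k => Gk N ν F c l0 k η) (fun k => hb k η hη) hn k⟩
  · obtain ⟨A, C, hA, hC, hb⟩ := Gk_bd h.c1 h.hF h.hP h34 hT
    refine ⟨A * ∑' k : ℕ, ((l0 - 1) / (l0 - 3 / 4)) ^ k, C, ?_, hC, fun η hη => ?_⟩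
    · refine mul_nonneg hA (tsum_nonneg fun k => ?_)
      have : 0 ≤ l0 - 1 := by linarith
      positivity
    · have h1 := fun k => geo_bound (a := fun k => Gk N ν F c l0 k η) (fun k => hb k η hη) hn k
      have h2 := tsum_of_norm_bounded (geo_summable _ hr (by linarith) hlt).hasSum h1
      rw [tsum_mul_left] at h2
      refine h2.trans (le_of_eq (by ring))
  · exact (Gk_hasSum_real h.hF h.hP h34 (l := 1) (by rw [abs_of_pos (by linarith)]; linarith) η).tsum_eq
  · by_contra hh
    refine hB' (gg_ident hl0 (hg1 B') (differentiableOn_const 0) fun x hx0 hx1 => ?_)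
    rw [hg2 x hx0 hx1]
    by_contra h0
    obtain ⟨A, B, h1, h2, h3⟩ := gL_ne h0
    exact hh ⟨A, B, h1, fun i => kk_ne h2 i, h3⟩
  · set s := ∑ i : Fin N, (ν + prv A0 i.castSucc - B0 i + (A0 i - B0 i)) with hs'
    set r := ∏ i : Fin N, rho (ν + prv A0 i.castSucc - B0 i) (A0 i - B0 i) with hr'
    have := gg_ident hl0 (hg1 (pi' ν c (A0, B0)))
      (Q := fun z => f A0 * (r * Complex.exp (-s * Complex.log (l0 - z)))) ?_ ?_
    · rw [this]; simp
    · intro z hz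
      rw [mem_ball_zero_iff] at hz
      have hz' : (l0 : ℂ) - z ∈ Complex.slitPlane := Or.inl (by
        have := (Complex.re_le_norm z).trans_lt hz
        simp; linarith)
      refine DifferentiableAt.differentiableWithinAt ?_
      refine DifferentiableAt.const_mul (DifferentiableAt.const_mul (DifferentiableAt.cexp (DifferentiableAt.const_mul ?_ _)) _) _
      exact DifferentiableAt.clog (by fun_prop) hz'
    · intro x hx0 hx1
      rw [hg2 x hx0 hx1, gL_single hs, kk_eq, Complex.ofReal_log (by linarith)]
      push_cast; rfl

lemma init_sub_cast {N : ℕ} (B : Fin (N + 1) → ℂ) (i : Fin N) :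
    (fun j : Fin N => (B - ev i.castSucc) j.castSucc) = (fun j : Fin N => B j.castSucc) - ev i := by
  funext j; simp [ev_apply]

lemma init_sub_last {N : ℕ} (B : Fin (N + 1) → ℂ) :
    (fun j : Fin N => (B - ev (Fin.last N)) j.castSucc) = (fun j : Fin N => B j.castSucc) := by
  funext j; simp [ev_apply, Fin.castSucc_ne_last]

lemma last_sub_cast {N : ℕ} (B : Fin (N + 1) → ℂ) (i : Fin N) : (B - ev i.castSucc) (Fin.last N) = B (Fin.last N) := by
  simp [ev_apply, (Fin.castSucc_ne_last i).symm]

lemma last_sub_last {N : ℕ} (B : Fin (N + 1) → ℂ) : (B - ev (Fin.last N)) (Fin.last N) = B (Fin.last N) - 1 := by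
  simp [ev_apply]

open Classical in
lemma hasSum_gL {N : ℕ} {ν : ℂ} {f : (Fin N → ℂ) → ℂ} {c : ℂ} {l : ℝ}
    (h : Summable fun p : (Fin N → ℂ) × (Fin N → ℂ) => f p.1 * kk l ν p.1 p.2) (B' : Fin (N + 1) → ℂ) :
    HasSum (fun A => if c * (ν + prv A (Fin.last N)) = B' (Fin.last N) then f A * kk l ν A (fun j => B' j.castSucc) else 0)
      (gL N ν f c l B') := by
  have hp : ∀ p : (Fin N → ℂ) × (Fin N → ℂ), pi' ν c p = B' ↔ c * (ν + prv p.1 (Fin.last N)) = B' (Fin.last N) ∧ p.2 = fun j => B' j.castSucc := fun p => by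
    constructor
    · intro h
      rw [← h]
      refine ⟨by simp [pi'], by funext j; simp [pi']⟩
    · rintro ⟨h1, h2⟩
      rw [pi', h1, h2]
      funext j
      refine Fin.lastCases ?_ (fun j => ?_) j <;> simp
  have hs : Summable fun p : (Fin N → ℂ) × (Fin N → ℂ) => if pi' ν c p = B' then f p.1 * kk l ν p.1 p.2 else 0 :=
    (h.indicator {p | pi' ν c p = B'}).congr fun p => by simp [Set.indicator_apply]
  have h1 := hs.hasSum
  have hinj : Function.Injective (fun A : Fin N → ℂ => (A, fun j : Fin N => B' j.castSucc)) := fun A A' h => (Prod.ext_iff.1 h).1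
  rw [← hinj.hasSum_iff] at h1
  · refine HasSum.cg h1 fun A => ?_
    simp only [Function.comp, hp, and_true]
  · rintro ⟨A, B⟩ hA
    rw [if_neg]
    rw [hp]
    rintro ⟨_, h2⟩
    refine hA ⟨A, ?_⟩
    simp only at h2
    rw [h2]

def wt (N : ℕ) (i : Fin N) : ℂ := if i.val + 1 = N then 1 / 2 else 1

def Rec (N : ℕ) (E : ℂ) (f : (Fin N → ℂ) → ℂ) : Prop := ∀ A, (Qf A - E) * f A = ∑ i, wt N i * f (A - ev i)

def RecV (N : ℕ) (ν E : ℂ) (g : (Fin (N + 1) → ℂ) → ℂ) : Prop := ∀ B, (Qf B - E) * g B =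
  ∑ i : Fin N, g (B - ev i.castSucc) + 1 / 2 * (B (Fin.last N) - prv B (Fin.last N).castSucc - 1 - ν) * g (B - ev (Fin.last N))

lemma wt_sum {M : ℕ} (g : Fin (M + 1) → ℂ) : ∑ i, wt (M + 1) i * g i = ∑ i : Fin M, g i.castSucc + 1 / 2 * g (Fin.last M) := by
  rw [Fin.sum_univ_castSucc]
  congr 1
  · refine sum_congr rfl fun i _ => ?_
    have : ¬ (i.val + 1 = M + 1) := by omega
    simp [wt, this]
    intro h; omega
  · simp [wt]

lemma snoc_init {N : ℕ} (B : Fin (N + 1) → ℂ) : (Fin.snoc (fun j : Fin N => B j.castSucc) (B (Fin.last N)) : Fin (N + 1) → ℂ) = B :=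
  Fin.snoc_init_self B

lemma prv_init {M : ℕ} (B : Fin (M + 2) → ℂ) : prv B (Fin.last (M + 1)).castSucc = B (Fin.last M).castSucc := by
  rw [← Fin.succ_last, ← Fin.succ_castSucc, prv_succ]

lemma rec1_large {M : ℕ} {ν E : ℂ} {f : (Fin (M + 1) → ℂ) → ℂ} (hR : Rec (M + 1) E f)
    (hNI : ∀ A, f A ≠ 0 → ∀ i : Fin (M + 1), NI (ν + prv A i.castSucc - A i)) {l : ℝ} (hl : 0 < l)
    (h0 : Summable fun p : (Fin (M + 1) → ℂ) × (Fin (M + 1) → ℂ) => f p.1 * kk l ν p.1 p.2)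
    (hj : ∀ j : Fin M, Summable fun p : (Fin (M + 1) → ℂ) × (Fin (M + 1) → ℂ) => f (p.1 - ev j.castSucc) * kk l ν p.1 p.2)
    (B' : Fin (M + 2) → ℂ) :
    l * ((Qf B' - (E + 1 / 2 * ν ^ 2)) * gL (M + 1) ν f 1 l B') = l ^ 3 * ∑ i : Fin (M + 1), gL (M + 1) ν f 1 l (B' - ev i.castSucc)
      + (l - l ^ 3) * ∑ j : Fin M, gL (M + 1) ν (fun A => f (A - ev j.castSucc)) 1 l B'
      + 1 / 2 * (B' (Fin.last _) - prv B' (Fin.last _).castSucc - 1 - ν) * gL (M + 1) ν f 1 l (B' - ev (Fin.last _)) := by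
  classical
  have hlc : (l : ℂ) ≠ 0 := by exact_mod_cast hl.ne'
  set B : Fin (M + 1) → ℂ := fun j => B' j.castSucc with hB
  set b := B' (Fin.last (M + 1)) with hb
  have H0 := hasSum_gL (c := 1) h0 B'
  have Hi := fun i : Fin (M + 1) => hasSum_gL (c := 1) h0 (B' - ev i.castSucc)
  simp only [init_sub_cast, last_sub_cast] at Hi
  have Hj := fun j : Fin M => hasSum_gL (c := 1) (f := fun A => f (A - ev j.castSucc)) (hj j) B'
  have Hj' := Hj
  have HL := hasSum_gL (c := 1) h0 (B' - ev (Fin.last _))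
  simp only [init_sub_last, last_sub_last, prv_last] at HL
  rw [← (Equiv.subRight (ev (Fin.last M))).hasSum_iff] at HL
  replace Hj' := fun j => (Equiv.hasSum_iff (Equiv.addRight (ev j.castSucc))).2 (Hj' j)
  simp only [Function.comp_def, Equiv.subRight_apply, Equiv.coe_addRight, add_sub_cancel_right, prv_last, ← hB, ← hb, one_mul] at H0 Hi Hj Hj' HL
  have HB := (hasSum_sum fun i (_ : i ∈ univ) => Hi i).mul_left (l ^ 3 : ℂ)
  have HJ := (hasSum_sum fun i (_ : i ∈ univ) => Hj i).mul_left (l : ℂ)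
  have HJ' := (hasSum_sum fun i (_ : i ∈ univ) => Hj' i).mul_left (l ^ 3 : ℂ)
  have HT := ((HB.add HJ).sub HJ').add (HL.mul_left (1 / 2 * (b - prv B' (Fin.last _).castSucc - 1 - ν)))
  have H0' := (H0.mul_left (Qf B' - (E + 1 / 2 * ν ^ 2))).mul_left (l : ℂ)
  have := H0'.unique (HasSum.cg HT fun A => ?_)
  · rw [this]; ring
  · have e1 : ∀ j : Fin M, (A + ev j.castSucc) (Fin.last M) = A (Fin.last M) := fun j => by
      simp [ev_apply, (Fin.castSucc_ne_last j).symm]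
    have e2 : (A - ev (Fin.last M)) (Fin.last M) = A (Fin.last M) - 1 := last_sub_last A
    have e3 : (ν + (A (Fin.last M) - 1) = b - 1) ↔ ν + A (Fin.last M) = b := by
      constructor <;> intro h <;> linear_combination h
    simp only [e1, e2, e3]
    by_cases hχ : ν + A (Fin.last M) = b
    · simp only [if_pos hχ]
      have k1 : ∀ i : Fin (M + 1), f A * kk l ν A (B - ev i) = f A * ((ν + prv A i.castSucc - B i) * (A i - B i) / l ^ 2 * kk l ν A B) := fun i => by
        by_cases hf : f A = 0
        · simp [hf]
        · rw [kk_B hl B (hNI A hf)]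
      have k2 : ∀ i : Fin M, f A * kk l ν (A + ev i.castSucc) B = f A * ((A i.castSucc - B i.castSucc) * (ν + prv A i.succ.castSucc - B i.succ) / l ^ 2 * kk l ν A B) := fun i => by
        by_cases hf : f A = 0
        · simp [hf]
        · rw [kk_A hl B (hNI A hf)]
      have k3 : f (A - ev (Fin.last M)) * kk l ν A B = f (A - ev (Fin.last M)) * ((b - ν - 1 - B (Fin.last M)) / l * kk l ν (A - ev (Fin.last M)) B) := by
        by_cases hf : f (A - ev (Fin.last M)) = 0
        · simp [hf]
        · have := kk_last hl B (hNI _ hf)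
          rw [sub_add_cancel, e2] at this
          rw [this, ← hχ]; ring
      have hq := Qf_id' ν A B
      have hq2 : Qf B' = Qf B + 1 / 2 * (b - B (Fin.last M)) ^ 2 := by
        rw [← prv_last B, ← Qf_snoc, ← snoc_init B']
      have hr := hR A
      rw [wt_sum (fun i => f (A - ev i))] at hr
      have hp : prv B' (Fin.last (M + 1)).castSucc = B (Fin.last M) := prv_init B'
      rw [sum_congr rfl fun i _ => k1 i, sum_congr rfl fun i _ => k2 i, hp]
      have s1 : ∑ i : Fin (M + 1), f A * ((ν + prv A i.castSucc - B i) * (A i - B i) / l ^ 2 * kk l ν A B) =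
          f A * kk l ν A B / l ^ 2 * ∑ i : Fin (M + 1), (ν + prv A i.castSucc - B i) * (A i - B i) := by
        rw [mul_sum]; exact sum_congr rfl fun i _ => by ring
      have s2 : ∑ i : Fin M, f A * ((A i.castSucc - B i.castSucc) * (ν + prv A i.succ.castSucc - B i.succ) / l ^ 2 * kk l ν A B) =
          f A * kk l ν A B / l ^ 2 * ∑ i : Fin M, (A i.castSucc - B i.castSucc) * (ν + prv A i.succ.castSucc - B i.succ) := by
        rw [mul_sum]; exact sum_congr rfl fun i _ => by ring
      rw [s1, s2, ← sum_mul]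
      rw [hq2, ← hχ]
      rw [← hχ] at k3
      set X := ∑ i : Fin (M + 1), (ν + prv A i.castSucc - B i) * (A i - B i)
      set Y := ∑ i : Fin M, (A i.castSucc - B i.castSucc) * (ν + prv A i.succ.castSucc - B i.succ)
      set Z := ∑ i : Fin M, f (A - ev i.castSucc)
      have t1 : (l : ℂ) ^ 3 * (f A * kk l ν A B / l ^ 2 * X) = l * (f A * kk l ν A B * X) := by field_simp
      have t2 : (l : ℂ) ^ 3 * (f A * kk l ν A B / l ^ 2 * Y) = l * (f A * kk l ν A B * Y) := by field_simp
      have t3 : (l : ℂ) * (f (A - ev (Fin.last M)) * kk l ν A B) = (A (Fin.last M) - 1 - B (Fin.last M)) * (f (A - ev (Fin.last M)) * kk l ν (A - ev (Fin.last M)) B) := by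
        rw [k3]; field_simp; ring
      rw [t1, t2]
      linear_combination (l * f A * kk l ν A B) * hq + l * kk l ν A B * hr + 1 / 2 * t3
    · simp [if_neg hχ]

lemma step1_succ {S : Finset ℂ} {M : ℕ} {ν E : ℂ} {f F : (Fin (M + 1) → ℂ) → ℂ} (h : UHH S (M + 1) ν f F) (hR : Rec (M + 1) E f) :
    ∃ g G, Out (M + 1) ν 1 f F g G ∧ RecV (M + 1) ν (E + 1 / 2 * ν ^ 2) g := by
  obtain ⟨Λ, hΛ, h1, h2⟩ := h.uh.step
  have hsh := fun j : Fin M => (h.shift j.castSucc).uh.step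
  choose L hL hL1 hL2 using hsh
  obtain ⟨l0, hl0, hlj⟩ : ∃ l0 : ℝ, Λ + 1 + 1 < l0 ∧ ∀ j, L j + 1 + 1 < l0 := by
    refine ⟨Λ + ∑ j, L j + 3, ?_, fun j => ?_⟩
    · have : 0 ≤ ∑ j, L j := sum_nonneg fun j _ => by linarith [hL j]
      linarith
    · have : L j ≤ ∑ j, L j := single_le_sum (fun j _ => by linarith [hL j]) (mem_univ j)
      linarith
  obtain ⟨a1, a2, a3⟩ := h2 l0 (by linarith)
  have b1 := fun j => (hL2 j l0 (by linarith [hlj j])).1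
  have b2 := fun j => (hL2 j l0 (by linarith [hlj j])).2.1
  refine ⟨_, _, h.uh.out (by linarith) a1 a2 a3, fun B => ?_⟩
  have key := gg_ident (l0 := l0) (by linarith)
    (P := fun z => (l0 - z) * ((Qf B - (E + 1 / 2 * ν ^ 2)) * gg S (M + 1) ν 1 F l0 z B))
    (Q := fun z => (l0 - z) ^ 3 * ∑ i : Fin (M + 1), gg S (M + 1) ν 1 F l0 z (B - ev i.castSucc)
      + ((l0 - z) - (l0 - z) ^ 3) * ∑ j : Fin M, gg S (M + 1) ν 1 (fun η => Complex.exp (η j.castSucc) * F η) l0 z B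
      + 1 / 2 * (B (Fin.last _) - prv B (Fin.last _).castSucc - 1 - ν) * gg S (M + 1) ν 1 F l0 z (B - ev (Fin.last _)))
    ?_ ?_ ?_
  · have e : (l0 : ℂ) - ((l0 - 1 : ℝ) : ℂ) = 1 := by push_cast; ring
    rw [e] at key
    linear_combination key
  · refine DifferentiableOn.mul (by fun_prop) (DifferentiableOn.mul (by fun_prop) (a1 B))
  · refine DifferentiableOn.add (DifferentiableOn.add (DifferentiableOn.mul (by fun_prop) ?_) (DifferentiableOn.mul (by fun_prop) ?_))
      (DifferentiableOn.mul (by fun_prop) (a1 _))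
    · exact DifferentiableOn.fun_sum fun i _ => a1 _
    · exact DifferentiableOn.fun_sum fun i _ => b1 i B
  · intro x hx0 hx1
    have hl : Λ < l0 - x := by linarith
    have := rec1_large hR h.hNI (l := l0 - x) (by linarith) (h1 _ hl) (fun j => hL1 j _ (by linarith [hlj j])) B
    simp only [a2 x hx0 hx1, b2 _ x hx0 hx1]
    push_cast at this
    exact this

lemma step1_zero {S : Finset ℂ} {ν E : ℂ} {f F : (Fin 0 → ℂ) → ℂ} (h : UHH S 0 ν f F) (hR : Rec 0 E f) :
    ∃ g G, Out 0 ν 1 f F g G ∧ RecV 0 ν (E + 1 / 2 * ν ^ 2) g := by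
  obtain ⟨Λ, hΛ, h1, h2⟩ := h.uh.step
  obtain ⟨a1, a2, a3⟩ := h2 (Λ + 2) (by linarith)
  have ho := h.uh.out (by linarith) a1 a2 a3
  refine ⟨_, _, ho, fun B => ?_⟩
  generalize gg S 0 ν 1 F (Λ + 2) ((Λ + 2 - 1 : ℝ) : ℂ) = g at ho ⊢
  have key : ∀ B, g B ≠ 0 → E = 0 ∧ B (Fin.last 0) = ν := fun B hB => by
    obtain ⟨A, B0, hA, -, hp⟩ := ho.supp B hB
    refine ⟨?_, ?_⟩
    · have := hR A
      simp [Qf, hA] at this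
      exact this
    · rw [← hp]; simp only [pi', Fin.snoc_last, one_mul]
      show ν + prv A 0 = ν
      simp
  have hp : prv B (Fin.last 0).castSucc = 0 := by
    show prv B 0 = 0
    simp
  have e1 : (Qf B - (E + 1 / 2 * ν ^ 2)) * g B = 0 := by
    by_cases hB : g B = 0
    · simp [hB]
    · obtain ⟨e, hb⟩ := key B hB
      have : B 0 = ν := hb
      simp [Qf, e, this]
  have e2 : (B (Fin.last 0) - prv B (Fin.last 0).castSucc - 1 - ν) * g (B - ev (Fin.last 0)) = 0 := by
    by_cases hB : g (B - ev (Fin.last 0)) = 0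
    · rw [hB, mul_zero]
    · have hb := (key _ hB).2
      rw [last_sub_last] at hb
      rw [hp, ← hb]; ring
  rw [e1, mul_assoc, e2]; simp

lemma step1 {S : Finset ℂ} {N : ℕ} {ν E : ℂ} {f F : (Fin N → ℂ) → ℂ} (h : UHH S N ν f F) (hR : Rec N E f) :
    ∃ g G, Out N ν 1 f F g G ∧ RecV N ν (E + 1 / 2 * ν ^ 2) g := by
  cases N with
  | zero => exact step1_zero h hR
  | succ M => exact step1_succ h hR

lemma rec2_large {M : ℕ} {ν E : ℂ} {f : (Fin (M + 1) → ℂ) → ℂ} (hR : RecV M (-ν) E f)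
    (hNI : ∀ A, f A ≠ 0 → ∀ i : Fin (M + 1), NI (ν + prv A i.castSucc - A i)) {l : ℝ} (hl : 0 < l)
    (h0 : Summable fun p : (Fin (M + 1) → ℂ) × (Fin (M + 1) → ℂ) => f p.1 * kk l ν p.1 p.2)
    (hj : ∀ j : Fin (M + 1), Summable fun p : (Fin (M + 1) → ℂ) × (Fin (M + 1) → ℂ) => f (p.1 - ev j) * kk l ν p.1 p.2)
    (hj2 : Summable fun p : (Fin (M + 1) → ℂ) × (Fin (M + 1) → ℂ) => f (p.1 - ev (Fin.last M) - ev (Fin.last M)) * kk l ν p.1 p.2)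
    (B' : Fin (M + 2) → ℂ) (hB0 : B' (Fin.last _) = 0) :
    (Qf (fun j : Fin (M + 1) => B' j.castSucc) - E) * gL (M + 1) ν f 0 l B' = l ^ 2 * ∑ i : Fin (M + 1), gL (M + 1) ν f 0 l (B' - ev i.castSucc)
      + (1 - l ^ 2) * ∑ j : Fin M, gL (M + 1) ν (fun A => f (A - ev j.castSucc)) 0 l B'
      + 1 / 2 * (l * gL (M + 1) ν (fun A => f (A - ev (Fin.last M) - ev (Fin.last M))) 0 l B' - gL (M + 1) ν (fun A => f (A - ev (Fin.last M))) 0 l B'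
        - l * gL (M + 1) ν f 0 l (B' - ev (Fin.last M).castSucc) + 2 * ν * gL (M + 1) ν (fun A => f (A - ev (Fin.last M))) 0 l B')
      - 1 / 2 * (l ^ 2 * gL (M + 1) ν (fun A => f (A - ev (Fin.last M) - ev (Fin.last M))) 0 l B' - l * gL (M + 1) ν (fun A => f (A - ev (Fin.last M))) 0 l B')
      - ν * l * gL (M + 1) ν (fun A => f (A - ev (Fin.last M))) 0 l B' := by
  have hlc : (l : ℂ) ≠ 0 := by exact_mod_cast hl.ne'
  set B : Fin (M + 1) → ℂ := fun j => B' j.castSucc with hB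
  have H0 := hasSum_gL (c := 0) h0 B'
  have Hi := fun i : Fin (M + 1) => hasSum_gL (c := 0) h0 (B' - ev i.castSucc)
  simp only [init_sub_cast, last_sub_cast] at Hi
  have Hj := fun j : Fin M => hasSum_gL (c := 0) (f := fun A => f (A - ev j.castSucc)) (hj j.castSucc) B'
  have Hj' := Hj
  have H1 := hasSum_gL (c := 0) (f := fun A => f (A - ev (Fin.last M))) (hj (Fin.last M)) B'
  have H2 := hasSum_gL (c := 0) (f := fun A => f (A - ev (Fin.last M) - ev (Fin.last M))) hj2 B'
  rw [← (Equiv.addRight (ev (Fin.last M))).hasSum_iff] at H1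
  rw [← ((Equiv.addRight (ev (Fin.last M))).trans (Equiv.addRight (ev (Fin.last M)))).hasSum_iff] at H2
  replace Hj' := fun j => (Equiv.hasSum_iff (Equiv.addRight (ev j.castSucc))).2 (Hj' j)
  simp only [Function.comp_def, Equiv.coe_trans, Equiv.coe_addRight, add_sub_cancel_right, ← hB, hB0, zero_mul, if_true] at H0 Hi Hj Hj' H1 H2
  -- kernel identities
  have k1 : ∀ A, ∀ i : Fin (M + 1), f A * kk l ν A (B - ev i) = f A * ((ν + prv A i.castSucc - B i) * (A i - B i) / l ^ 2 * kk l ν A B) := fun A i => by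
    by_cases hf : f A = 0
    · simp [hf]
    · rw [kk_B hl B (hNI A hf)]
  have k2 : ∀ A, ∀ i : Fin M, f A * kk l ν (A + ev i.castSucc) B = f A * ((A i.castSucc - B i.castSucc) * (ν + prv A i.succ.castSucc - B i.succ) / l ^ 2 * kk l ν A B) := fun A i => by
    by_cases hf : f A = 0
    · simp [hf]
    · rw [kk_A hl B (hNI A hf)]
  have k3 : ∀ A, f A * kk l ν (A + ev (Fin.last M)) B = f A * ((A (Fin.last M) - B (Fin.last M)) / l * kk l ν A B) := fun A => by
    by_cases hf : f A = 0
    · simp [hf]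
    · rw [kk_last hl B (hNI A hf)]
  have k4 : ∀ A, f A * kk l ν (A + ev (Fin.last M) + ev (Fin.last M)) B =
      f A * ((A (Fin.last M) - B (Fin.last M) + 1) / l * ((A (Fin.last M) - B (Fin.last M)) / l * kk l ν A B)) := fun A => by
    by_cases hf : f A = 0
    · simp [hf]
    · rw [kk_last hl B (NI_shift (hNI A hf) (Fin.last M)), kk_last hl B (hNI A hf)]
      simp only [Pi.add_apply, ev_apply, if_true]
      ring
  have HR := ((((H2.mul_left (l : ℂ)).sub H1).sub ((Hi (Fin.last M)).mul_left (l : ℂ))).add (H1.mul_left (2 * ν)))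
  have HR' : HasSum (fun A => (A (Fin.last M) - prv A (Fin.last M).castSucc + ν) * f A * kk l ν (A + ev (Fin.last M)) B) _ :=
    HasSum.cg HR fun A => by
      rw [k4, k3, k1, mul_assoc, k3]
      field_simp
      ring
  rw [← (Equiv.subRight (ev (Fin.last M))).hasSum_iff] at HR'
  simp only [Function.comp_def, Equiv.subRight_apply, sub_add_cancel] at HR'
  have HB := (hasSum_sum fun i (_ : i ∈ univ) => Hi i).mul_left (l ^ 2 : ℂ)
  have HJ := (hasSum_sum fun i (_ : i ∈ univ) => Hj i)
  have HJ' := (hasSum_sum fun i (_ : i ∈ univ) => Hj' i).mul_left (l ^ 2 : ℂ)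
  have HT := (((((HB.add HJ).sub HJ').add (HR'.mul_left (1 / 2))).sub (((H2.mul_left (l ^ 2 : ℂ)).sub (H1.mul_left (l : ℂ))).mul_left (1 / 2))).sub
    (H1.mul_left (ν * l)))
  have := (H0.mul_left (Qf B - E)).unique (HasSum.cg HT fun A => ?_)
  · rw [this]; ring
  · have e2 : (A - ev (Fin.last M)) (Fin.last M) = A (Fin.last M) - 1 := last_sub_last A
    have e3 : prv (A - ev (Fin.last M)) (Fin.last M).castSucc = prv A (Fin.last M).castSucc := by
      have := prv_ev (A - ev (Fin.last M)) (Fin.last M) (Fin.last M).castSucc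
      rw [sub_add_cancel, if_neg (by simp [Fin.ext_iff])] at this
      simpa using this.symm
    have hq := Qf_id' ν A B
    have hr := hR A
    rw [sum_congr rfl fun i _ => k1 A i, sum_congr rfl fun i _ => k2 A i, k3, k4, e2, e3]
    have s1 : ∑ i : Fin (M + 1), f A * ((ν + prv A i.castSucc - B i) * (A i - B i) / l ^ 2 * kk l ν A B) =
        f A * kk l ν A B / l ^ 2 * ∑ i : Fin (M + 1), (ν + prv A i.castSucc - B i) * (A i - B i) := by
      rw [mul_sum]; exact sum_congr rfl fun i _ => by ring
    have s2 : ∑ i : Fin M, f A * ((A i.castSucc - B i.castSucc) * (ν + prv A i.succ.castSucc - B i.succ) / l ^ 2 * kk l ν A B) =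
        f A * kk l ν A B / l ^ 2 * ∑ i : Fin M, (A i.castSucc - B i.castSucc) * (ν + prv A i.succ.castSucc - B i.succ) := by
      rw [mul_sum]; exact sum_congr rfl fun i _ => by ring
    rw [s1, s2, ← sum_mul]
    set X := ∑ i : Fin (M + 1), (ν + prv A i.castSucc - B i) * (A i - B i)
    set Y := ∑ i : Fin M, (A i.castSucc - B i.castSucc) * (ν + prv A i.succ.castSucc - B i.succ)
    set Z := ∑ i : Fin M, f (A - ev i.castSucc)
    have t1 : (l : ℂ) ^ 2 * (f A * kk l ν A B / l ^ 2 * X) = (f A * kk l ν A B * X) := by field_simp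
    have t2 : (l : ℂ) ^ 2 * (f A * kk l ν A B / l ^ 2 * Y) = (f A * kk l ν A B * Y) := by field_simp
    set v := A (Fin.last M) - B (Fin.last M) with hv
    have t3 : (l : ℂ) ^ 2 * (f A * ((v + 1) / l * (v / l * kk l ν A B))) = f A * kk l ν A B * (v * (v + 1)) := by field_simp
    have t4 : (l : ℂ) * (f A * (v / l * kk l ν A B)) = f A * kk l ν A B * v := by field_simp
    have t5 : ν * (l : ℂ) * (f A * (v / l * kk l ν A B)) = ν * (f A * kk l ν A B * v) := by field_simp
    rw [t1, t2, t3, t4, t5]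
    linear_combination (f A * kk l ν A B) * hq + kk l ν A B * hr

lemma snoc_sub {N : ℕ} (B : Fin N → ℂ) (b : ℂ) (i : Fin N) :
    (Fin.snoc B b : Fin (N + 1) → ℂ) - ev i.castSucc = Fin.snoc (B - ev i) b := by
  funext j
  refine Fin.lastCases ?_ (fun j => ?_) j
  · rw [last_sub_cast]; simp
  · simp [ev_apply]

lemma diff_combo {U : Set ℂ} {l ν : ℂ} {p1 p2 p3 p4 p5 : ℂ → ℂ} (h1 : DifferentiableOn ℂ p1 U) (h2 : DifferentiableOn ℂ p2 U)
    (h3 : DifferentiableOn ℂ p3 U) (h4 : DifferentiableOn ℂ p4 U) (h5 : DifferentiableOn ℂ p5 U) :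
    DifferentiableOn ℂ (fun z => (l - z) ^ 2 * p4 z + (1 - (l - z) ^ 2) * p5 z
      + 1 / 2 * ((l - z) * p3 z - p2 z - (l - z) * p1 z + 2 * ν * p2 z)
      - 1 / 2 * ((l - z) ^ 2 * p3 z - (l - z) * p2 z) - ν * (l - z) * p2 z) U := by
  fun_prop

lemma step2 {S : Finset ℂ} {M : ℕ} {ν E : ℂ} {f F : (Fin (M + 1) → ℂ) → ℂ} (h : UHO S (M + 1) ν f F) (hR : RecV M (-ν) E f) :
    ∃ g G, Out (M + 1) ν 0 f F g G ∧ Rec (M + 1) E (fun B => g (Fin.snoc B 0 : Fin (M + 2) → ℂ)) := by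
  obtain ⟨Λ, hΛ, h1, h2⟩ := h.uh.step
  have hsh := fun j : Fin (M + 1) => (h.shift j).uh.step
  choose L hL hL1 hL2 using hsh
  obtain ⟨Λ', hΛ', h1', h2'⟩ := ((h.shift (Fin.last M)).shift (Fin.last M)).uh.step
  obtain ⟨l0, hl0, hl0', hlj⟩ : ∃ l0 : ℝ, Λ + 1 + 1 < l0 ∧ Λ' + 1 + 1 < l0 ∧ ∀ j, L j + 1 + 1 < l0 := by
    have : 0 ≤ ∑ j, L j := sum_nonneg fun j _ => by linarith [hL j]
    refine ⟨Λ + Λ' + ∑ j, L j + 3, ?_, ?_, fun j => ?_⟩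
    · linarith
    · linarith
    · have : L j ≤ ∑ j, L j := single_le_sum (fun j _ => by linarith [hL j]) (mem_univ j)
      linarith
  obtain ⟨a1, a2, a3⟩ := h2 l0 (by linarith)
  obtain ⟨c1, c2, -⟩ := h2' l0 (by linarith)
  have b1 := fun j => (hL2 j l0 (by linarith [hlj j])).1
  have b2 := fun j => (hL2 j l0 (by linarith [hlj j])).2.1
  refine ⟨_, _, h.uh.out (by linarith) a1 a2 a3, fun B0 => ?_⟩
  set B : Fin (M + 2) → ℂ := Fin.snoc B0 0 with hB
  have key := gg_ident (l0 := l0) (by linarith)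
    (P := fun z => (Qf B0 - E) * gg S (M + 1) ν 0 F l0 z B)
    (Q := fun z => (l0 - z) ^ 2 * ∑ i : Fin (M + 1), gg S (M + 1) ν 0 F l0 z (B - ev i.castSucc)
      + (1 - (l0 - z) ^ 2) * ∑ j : Fin M, gg S (M + 1) ν 0 (fun η => Complex.exp (η j.castSucc) * F η) l0 z B
      + 1 / 2 * ((l0 - z) * gg S (M + 1) ν 0 (fun η => Complex.exp (η (Fin.last M)) * (Complex.exp (η (Fin.last M)) * F η)) l0 z B
        - gg S (M + 1) ν 0 (fun η => Complex.exp (η (Fin.last M)) * F η) l0 z B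
        - (l0 - z) * gg S (M + 1) ν 0 F l0 z (B - ev (Fin.last M).castSucc)
        + 2 * ν * gg S (M + 1) ν 0 (fun η => Complex.exp (η (Fin.last M)) * F η) l0 z B)
      - 1 / 2 * ((l0 - z) ^ 2 * gg S (M + 1) ν 0 (fun η => Complex.exp (η (Fin.last M)) * (Complex.exp (η (Fin.last M)) * F η)) l0 z B
        - (l0 - z) * gg S (M + 1) ν 0 (fun η => Complex.exp (η (Fin.last M)) * F η) l0 z B)
      - ν * (l0 - z) * gg S (M + 1) ν 0 (fun η => Complex.exp (η (Fin.last M)) * F η) l0 z B)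
    ?_ ?_ ?_
  · have e : (l0 : ℂ) - ((l0 - 1 : ℝ) : ℂ) = 1 := by push_cast; ring
    rw [e] at key
    rw [wt_sum (fun i => gg S (M + 1) ν 0 F l0 ((l0 - 1 : ℝ) : ℂ) (Fin.snoc (B0 - ev i) 0 : Fin (M + 2) → ℂ))]
    simp only [← snoc_sub, ← hB]
    rw [Fin.sum_univ_castSucc] at key
    linear_combination key
  · exact DifferentiableOn.mul (by fun_prop) (a1 B)
  · have d1 := a1 (B - ev (Fin.last M).castSucc)
    have d2 := b1 (Fin.last M) B
    have d3 := c1 B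
    have d4 : DifferentiableOn ℂ (fun z => ∑ i : Fin (M + 1), gg S (M + 1) ν 0 F l0 z (B - ev i.castSucc)) (Metric.ball 0 (l0 - 3 / 4)) :=
      DifferentiableOn.fun_sum fun i _ => a1 _
    have d5 : DifferentiableOn ℂ (fun z => ∑ j : Fin M, gg S (M + 1) ν 0 (fun η => Complex.exp (η j.castSucc) * F η) l0 z B)
      (Metric.ball 0 (l0 - 3 / 4)) := DifferentiableOn.fun_sum fun i _ => b1 _ _
    exact diff_combo d1 d2 d3 d4 d5
  · intro x hx0 hx1
    have hl : Λ < l0 - x := by linarith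
    have := rec2_large hR h.hNI (l := l0 - x) (by linarith) (h1 _ hl) (fun j => hL1 j _ (by linarith [hlj j])) (h1' _ (by linarith)) B (by simp [hB])
    have eB : (fun j : Fin (M + 1) => B j.castSucc) = B0 := by funext j; simp [hB]
    rw [eB] at this
    simp only [a2 x hx0 hx1, b2 _ x hx0 hx1, c2 x hx0 hx1]
    push_cast at this
    exact this

lemma Out.grO {N : ℕ} {ν : ℂ} {f F : (Fin N → ℂ) → ℂ} {g G : (Fin (N + 1) → ℂ) → ℂ} {c : ℂ} (h : Out N ν c f F g G) : GrO (N + 1) G := fun T => by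
  by_cases hT : 0 ≤ T
  · obtain ⟨A, C, hA, hC, hb⟩ := h.bd T hT
    refine ⟨A, C, hA, hC, fun η hη => (hb η hη).trans (le_of_eq ?_)⟩
    rw [Fin.sum_univ_castSucc, add_comm]
    congr 3
    · refine sum_congr rfl fun i _ => ?_
      rw [gE, if_neg]; simp; omega
    · rw [gE, if_pos]; simp
  · exact ⟨0, 0, le_rfl, le_rfl, fun η hη => absurd ((abs_nonneg _).trans (hη 0)) hT⟩

lemma snoc_diff {N : ℕ} (b : ℂ) : Differentiable ℂ (fun η : Fin N → ℂ => (Fin.snoc η b : Fin (N + 1) → ℂ)) := by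
  rw [differentiable_pi]; intro j
  refine Fin.lastCases ?_ (fun j => ?_) j
  · simp
  · simp only [Fin.snoc_castSucc]; fun_prop

lemma Out.restrict_diff {N : ℕ} {ν : ℂ} {f F : (Fin N → ℂ) → ℂ} {g G : (Fin (N + 1) → ℂ) → ℂ} {c : ℂ} (h : Out N ν c f F g G) :
    Differentiable ℂ (fun η : Fin N → ℂ => G (Fin.snoc η 0 : Fin (N + 1) → ℂ)) :=
  Differentiable.comp (g := G) h.dif (snoc_diff 0)

lemma Out.grH {N : ℕ} {ν : ℂ} {f F : (Fin N → ℂ) → ℂ} {g G : (Fin (N + 1) → ℂ) → ℂ} {c : ℂ} (h : Out N ν c f F g G) :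
    GrH N (fun η : Fin N → ℂ => G (Fin.snoc η 0 : Fin (N + 1) → ℂ)) := fun T => by
  obtain ⟨A, C, hA, hC, hb⟩ := h.bd (max T 0) (le_max_right _ _)
  refine ⟨A * Real.exp (preE C 0), C, by positivity, hC, fun η hη => (hb (Fin.snoc η 0 : Fin (N + 1) → ℂ) fun i => ?_).trans (le_of_eq ?_)⟩
  · refine Fin.lastCases ?_ (fun j => ?_) i
    · simp
    · simp [hη j]
  · simp only [Fin.snoc_last, Fin.snoc_castSucc]
    rw [Real.exp_add]; ring

lemma Out.restrict {N : ℕ} {ν : ℂ} {f F : (Fin N → ℂ) → ℂ} {g G : (Fin (N + 1) → ℂ) → ℂ} (h : Out N ν 0 f F g G) :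
    ∃ S', Expn S' (fun B : Fin N → ℂ => g (Fin.snoc B 0 : Fin (N + 1) → ℂ)) (fun η : Fin N → ℂ => G (Fin.snoc η 0 : Fin (N + 1) → ℂ)) := by
  obtain ⟨S', hS⟩ := h.ex
  refine ⟨S', fun B hB i => ?_, fun η => ?_⟩
  · simpa using hS.supp _ hB i.castSucc
  · have h1 := hS.hs (Fin.snoc η 0 : Fin (N + 1) → ℂ)
    have hinj : Function.Injective (fun B : Fin N → ℂ => (Fin.snoc B 0 : Fin (N + 1) → ℂ)) := fun B B' hh => by
      funext j
      have := congrFun hh j.castSucc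
      simpa using this
    rw [← hinj.hasSum_iff] at h1
    · refine HasSum.cg h1 fun B => ?_
      simp only [Function.comp]
      rw [Fin.sum_univ_castSucc]
      simp
    · intro B' hB'
      have : g B' = 0 := by
        by_contra hg
        obtain ⟨A, B, -, -, hp⟩ := h.supp B' hg
        refine hB' ⟨B, ?_⟩
        rw [← hp]; simp [pi']
      rw [this, zero_mul]

/-- partial sums -/
def sF {n : ℕ} (v : Fin n → ℂ) : Fin n → ℂ := fun i => ∑ j ∈ Finset.Iic i, v j

def wA {n : ℕ} (w : SignedPerm n) (v : Fin n → ℂ) : Fin n → ℂ := fun i => (if w.2 i then -1 else 1) * v (w.1 i)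

def GammaF {n : ℕ} (v : Fin n → ℂ) : ℂ :=
  (∏ i, ∏ j, if i < j then Complex.Gamma (-v i - v j) * Complex.Gamma (-v i + v j) else 1) * ∏ i, Complex.Gamma (-(2 * v i))

lemma sF_sub {n : ℕ} (v : Fin n → ℂ) (i : Fin n) : sF v i - prv (sF v) i.castSucc = v i := by
  have h : prv (sF v) i.castSucc = ∑ j ∈ Finset.Iio i, v j := by
    cases n with
    | zero => exact i.elim0
    | succ n =>
      refine Fin.cases ?_ (fun i => ?_) i
      · have : Finset.Iio (0 : Fin (n + 1)) = ∅ := by ext j; simp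
        rw [this]; simp
      · rw [← Fin.succ_castSucc, prv_succ, sF]
        refine sum_congr ?_ fun _ _ => rfl
        ext j; simp [Fin.le_def, Fin.lt_def]
  rw [h, sF, ← Finset.Iio_insert, sum_insert (by simp)]; ring

lemma prv_ext {n : ℕ} {A B : Fin n → ℂ} (h : ∀ i, A i - prv A i.castSucc = B i - prv B i.castSucc) : A = B := by
  have : ∀ j : Fin (n + 1), prv A j = prv B j := by
    intro j
    induction j using Fin.induction with
    | zero => rfl
    | succ i ih =>
      have := h i
      rw [ih] at this
      simpa using this
  funext i
  simpa using this i.succ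

lemma sF_unique {n : ℕ} {v A : Fin n → ℂ} (h : ∀ i, A i - prv A i.castSucc = v i) : A = sF v :=
  prv_ext fun i => by rw [h, sF_sub]

lemma gen_eval {n : ℕ} {v : Fin n → ℂ} (hv : AlgebraicIndependent ℚ v) (P : MvPolynomial (Fin n) ℚ)
    (h : MvPolynomial.aeval v P = 0) (x : Fin n → ℚ) : MvPolynomial.eval x P = 0 := by
  have : P = 0 := by
    apply hv
    rw [h, map_zero]
  rw [this, map_zero]

lemma sq_one_int {n : ℕ} {r : Fin n → ℤ} (h : ∑ j, r j ^ 2 = 1) : ∃ j, (r j = 1 ∨ r j = -1) ∧ ∀ k, k ≠ j → r k = 0 := by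
  obtain ⟨j, -, hj⟩ : ∃ j ∈ univ, r j ^ 2 ≠ 0 := Finset.exists_ne_zero_of_sum_ne_zero (by rw [h]; norm_num)
  have h1 := Finset.add_sum_erase univ (fun j => r j ^ 2) (mem_univ j)
  rw [h] at h1
  have h2 : 0 < r j ^ 2 := lt_of_le_of_ne (sq_nonneg _) (Ne.symm hj)
  have h3 : 0 ≤ ∑ x ∈ univ.erase j, r x ^ 2 := sum_nonneg fun _ _ => sq_nonneg _
  have h4 : r j ^ 2 = 1 := by omega
  have h5 : ∑ x ∈ univ.erase j, r x ^ 2 = 0 := by omega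
  refine ⟨j, mul_self_eq_one_iff.mp (by rw [← sq]; exact h4), fun k hk => ?_⟩
  have := (sum_eq_zero_iff_of_nonneg (fun _ _ => sq_nonneg _)).mp h5 k (by simp [hk])
  simpa using this

lemma gen_quad {n : ℕ} {v : Fin n → ℂ} (hv : AlgebraicIndependent ℚ v) (m0 : Fin n → ℤ) (m : Fin n → Fin n → ℤ)
    (h : ∑ i, ((m0 i : ℂ) + ∑ j, (m i j : ℂ) * v j) ^ 2 = ∑ j, v j ^ 2) :
    (∀ i, m0 i = 0) ∧ ∃ w : SignedPerm n, ∀ i, (m0 i : ℂ) + ∑ j, (m i j : ℂ) * v j = wA w v i := by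
  have key := gen_eval hv (∑ i, (MvPolynomial.C (m0 i : ℚ) + ∑ j, MvPolynomial.C (m i j : ℚ) * MvPolynomial.X j) ^ 2
    - ∑ j, MvPolynomial.X j ^ 2) (by simp [h])
  simp only [map_sub, map_sum, map_pow, map_add, map_mul, MvPolynomial.eval_C, MvPolynomial.eval_X] at key
  have hx : ∀ x : Fin n → ℤ, ∑ i, (m0 i + ∑ j, m i j * x j) ^ 2 = ∑ j, x j ^ 2 := fun x => by
    have := sub_eq_zero.mp (key fun j => (x j : ℚ))
    exact_mod_cast this
  have h0 : ∀ i, m0 i = 0 := by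
    have := hx 0
    simp only [Pi.zero_apply, mul_zero, sum_const_zero, add_zero] at this
    rw [show ∑ j : Fin n, (0 : ℤ) ^ 2 = 0 by simp] at this
    intro i
    have := (sum_eq_zero_iff_of_nonneg (fun _ _ => sq_nonneg _)).mp this i (by simp)
    simpa using this
  refine ⟨h0, ?_⟩
  simp only [h0, zero_add] at hx
  have hd : ∀ a, ∑ i, m i a ^ 2 = 1 := fun a => by
    have := hx (Pi.single a 1)
    simpa [Pi.single_apply, ite_pow] using this
  have ho : ∀ a b, a ≠ b → ∑ i, m i a * m i b = 0 := fun a b hab => by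
    have := hx (Pi.single a 1 + Pi.single b 1)
    have e1 : ∀ i, ∑ j, m i j * (Pi.single a 1 + Pi.single b 1 : Fin n → ℤ) j = m i a + m i b := fun i => by
      simp [Pi.single_apply, mul_add, sum_add_distrib]
    have e2 : ∑ j, (Pi.single a 1 + Pi.single b 1 : Fin n → ℤ) j ^ 2 = 2 := by
      have : ∀ j, (Pi.single a 1 + Pi.single b 1 : Fin n → ℤ) j ^ 2 = (if j = a then 1 else 0) + (if j = b then 1 else 0) := fun j => by
        by_cases h1 : j = a
        · subst h1; simp [hab]
        · by_cases h2 : j = b <;> simp [h1, h2, Ne.symm hab]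
      simp only [this, sum_add_distrib]; simp
    simp only [e1, e2] at this
    simp only [add_sq, sum_add_distrib, hd, mul_assoc, ← mul_sum] at this
    omega
  have hM : (Matrix.of m).transpose * Matrix.of m = 1 := by
    ext a b
    rw [Matrix.mul_apply]
    by_cases hab : a = b
    · subst hab; simp only [Matrix.transpose_apply, Matrix.of_apply, Matrix.one_apply_eq, ← sq, hd]
    · rw [Matrix.one_apply_ne hab]; exact ho a b hab
  have hM' := mul_eq_one_comm.mp hM
  have hr : ∀ i i', ∑ j, m i j * m i' j = if i = i' then 1 else 0 := fun i i' => by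
    have := congrFun (congrFun hM' i) i'
    rw [Matrix.mul_apply, Matrix.one_apply] at this
    exact this
  have hs : ∀ i, ∃ j, (m i j = 1 ∨ m i j = -1) ∧ ∀ k, k ≠ j → m i k = 0 := fun i => by
    refine sq_one_int ?_
    have := hr i i
    simpa [← sq] using this
  choose σ h1 h2 using hs
  have hinj : Function.Injective σ := fun i i' hii => by
    by_contra hne
    have := hr i i'
    rw [if_neg hne, sum_eq_single (σ i)] at this
    · rcases mul_eq_zero.mp this with h | h
      · rcases h1 i with h' | h' <;> omega
      · rw [hii] at h
        rcases h1 i' with h' | h' <;> omega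
    · intro j _ hj; rw [h2 i j hj, zero_mul]
    · simp
  refine ⟨(Equiv.ofBijective σ (Finite.injective_iff_bijective.mp hinj), fun i => decide (m i (σ i) = -1)), fun i => ?_⟩
  rw [h0, wA, sum_eq_single (σ i)]
  · simp only [Equiv.ofBijective_apply, Int.cast_zero, zero_add]
    rcases h1 i with h | h <;> simp [h]
  · intro j _ hj; rw [h2 i j hj]; simp
  · simp

lemma gen_dual {n : ℕ} {v : Fin n → ℂ} (hv : AlgebraicIndependent ℚ v) : ∃ φ : Fin n → (ℂ →ₗ[ℚ] ℚ),
    (∀ j, φ j 1 = 0) ∧ ∀ j k, φ j (v k) = if j = k then 1 else 0 := by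
  have hli : LinearIndependent ℚ (Fin.cons 1 v : Fin (n + 1) → ℂ) := by
    rw [Fintype.linearIndependent_iff]
    intro g hg
    have key := gen_eval hv (MvPolynomial.C (g 0) + ∑ j : Fin n, MvPolynomial.C (g j.succ) * MvPolynomial.X j) (by
      rw [Fin.sum_univ_succ] at hg
      simp only [Fin.cons_zero, Fin.cons_succ, Algebra.smul_def, mul_one] at hg
      simp [← hg])
    simp only [map_sum, map_add, map_mul, MvPolynomial.eval_C, MvPolynomial.eval_X] at key
    have h0 : g 0 = 0 := by simpa using key 0
    intro i
    refine Fin.cases h0 (fun j => ?_) i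
    have := key (Pi.single j 1)
    simpa [h0, Pi.single_apply] using this
  have : ∀ j : Fin n, ∃ φ : ℂ →ₗ[ℚ] ℚ, φ 1 = 0 ∧ ∀ k, φ (v k) = if j = k then 1 else 0 := fun j => by
    obtain ⟨φ, hφ⟩ := LinearMap.exists_extend ((Finsupp.lapply j.succ : (Fin (n + 1) →₀ ℚ) →ₗ[ℚ] ℚ) ∘ₗ hli.repr)
    have hh : ∀ i : Fin (n + 1), φ ((Fin.cons 1 v : Fin (n + 1) → ℂ) i) = if i = j.succ then 1 else 0 := fun i => by
      have := congrArg (fun f => f ⟨_, Submodule.subset_span ⟨i, rfl⟩⟩) hφ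
      simp only [LinearMap.comp_apply, Submodule.subtype_apply] at this
      rw [this, hli.repr_eq_single i _ rfl]
      simp [Finsupp.single_apply]
    refine ⟨φ, ?_, fun k => ?_⟩
    · have := hh 0
      rw [if_neg (by exact fun h => (Fin.succ_ne_zero j) h.symm)] at this
      simpa using this
    · have := hh k.succ
      simpa [eq_comm] using this
  choose φ h1 h2 using this
  exact ⟨φ, h1, h2⟩

lemma phi_nat {φ : ℂ →ₗ[ℚ] ℚ} (h : φ 1 = 0) (k : ℕ) : φ (k : ℂ) = 0 := by
  have := φ.map_smul (k : ℚ) 1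
  rw [h, smul_zero, Algebra.smul_def] at this
  simpa using this

lemma phi_int {φ : ℂ →ₗ[ℚ] ℚ} (h : φ 1 = 0) (k : ℤ) : φ (k : ℂ) = 0 := by
  have := φ.map_smul (k : ℚ) 1
  rw [h, smul_zero, Algebra.smul_def] at this
  simpa using this

lemma phi_NI {φ : ℂ →ₗ[ℚ] ℚ} (h : φ 1 = 0) {z : ℂ} (hz : φ z ≠ 0) : NI z := fun k hk => hz (by rw [hk, phi_int h])

lemma phi_prv {φ : ℂ →ₗ[ℚ] ℚ} {n : ℕ} {A : Fin n → ℂ} (h : ∀ i, φ (A i) = 0) (j : Fin (n + 1)) : φ (prv A j) = 0 := by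
  refine Fin.cases ?_ (fun i => ?_) j
  · simp
  · simpa using h i

lemma phi_snoc {φ : ℂ →ₗ[ℚ] ℚ} {n : ℕ} {A : Fin n → ℂ} (h : ∀ i, φ (A i) = 0) (j : Fin (n + 1)) : φ ((Fin.snoc A 0 : Fin (n + 1) → ℂ) j) = 0 := by
  refine Fin.lastCases ?_ (fun i => ?_) j
  · simp
  · simpa using h i

/-- relation between a support point of the first step and its source -/
def Rel1 {n : ℕ} (x : ℂ) (A : Fin n → ℂ) (A' : Fin (n + 1) → ℂ) : Prop :=
  ∀ i, (∃ k : ℕ, A' i = x + prv A i + k) ∨ (i ≠ Fin.last n ∧ ∃ k : ℕ, A' i = (Fin.snoc A 0 : Fin (n + 1) → ℂ) i + k)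

lemma rel1_of_poss {n : ℕ} {x : ℂ} {A B : Fin n → ℂ} (h : Poss x A B) : Rel1 x A (pi' x 1 (A, B)) := fun i => by
  refine Fin.lastCases ?_ (fun i => ?_) i
  · exact Or.inl ⟨0, by simp [pi']⟩
  · rcases h i with ⟨j, hj⟩ | ⟨j, hj⟩
    · exact Or.inl ⟨j, by simp [pi', hj]⟩
    · exact Or.inr ⟨by simp, j, by simp [pi', hj]⟩

lemma rel1_phi {φ : ℂ →ₗ[ℚ] ℚ} (h1 : φ 1 = 0) {x : ℂ} (hx : φ x = 1) {n : ℕ} {A : Fin n → ℂ} {A' : Fin (n + 1) → ℂ}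
    (hA : ∀ i, φ (A i) = 0) (h : Rel1 x A A') (i : Fin (n + 1)) :
    (φ (A' i) = 1 ∧ ∃ k : ℕ, A' i = x + prv A i + k) ∨
    (φ (A' i) = 0 ∧ i ≠ Fin.last n ∧ ∃ k : ℕ, A' i = (Fin.snoc A 0 : Fin (n + 1) → ℂ) i + k) := by
  rcases h i with ⟨k, hk⟩ | ⟨hl, k, hk⟩
  · exact Or.inl ⟨by rw [hk, map_add, map_add, hx, phi_prv hA, phi_nat h1]; ring, k, hk⟩
  · exact Or.inr ⟨by rw [hk, map_add, phi_snoc hA, phi_nat h1]; ring, hl, k, hk⟩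

lemma below {φ : ℂ →ₗ[ℚ] ℚ} (h1 : φ 1 = 0) {x : ℂ} (hx : φ x = 1) {N : ℕ} {A' B : Fin N → ℂ}
    (h2 : Poss (-x) A' B) (l : ℕ) (hB : ∀ i : Fin N, i.val < l → φ (B i) = 0) :
    (∀ j : Fin (N + 1), j.val ≤ l → φ (prv A' j) = 0) ∧ ∀ i : Fin N, i.val < l → ∃ k : ℕ, B i = A' i + k := by
  have key : ∀ i : Fin N, i.val < l → φ (prv A' i.castSucc) = 0 → (∃ k : ℕ, B i = A' i + k) ∧ φ (A' i) = 0 := fun i hi h0 => by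
    rcases h2 i with ⟨k, hk⟩ | ⟨k, hk⟩
    · have := hB i hi
      rw [hk, map_add, map_add, map_neg, hx, h0, phi_nat h1] at this
      norm_num at this
    · have := hB i hi
      rw [hk, map_add, phi_nat h1, add_zero] at this
      exact ⟨⟨k, hk⟩, this⟩
  have h : ∀ j : Fin (N + 1), j.val ≤ l → φ (prv A' j) = 0 := by
    intro j
    induction j using Fin.induction with
    | zero => simp
    | succ i ih =>
      intro hi
      have hi' : i.val < l := by simp at hi; omega
      rw [prv_succ]
      exact (key i hi' (ih (by simp; omega))).2
  exact ⟨h, fun i hi => (key i hi (h i.castSucc (by simp; omega))).1⟩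

lemma plus_case {φ : ℂ →ₗ[ℚ] ℚ} (h1 : φ 1 = 0) {x : ℂ} (hx : φ x = 1) {n : ℕ} {A : Fin n → ℂ} {A' B : Fin (n + 1) → ℂ}
    (hA : ∀ i, φ (A i) = 0) (hR : Rel1 x A A') (h2 : Poss (-x) A' B) (l : Fin (n + 1))
    (hB : ∀ i, φ (B i) = if i < l then 0 else 1) (i : Fin (n + 1)) :
    (∃ k : ℕ, B i = A' i + k) ∧ (i < l → ∃ k : ℕ, A' i = (Fin.snoc A 0 : Fin (n + 1) → ℂ) i + k) ∧
      (l ≤ i → ∃ k : ℕ, A' i = x + prv A i + k) := by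
  have hr := rel1_phi h1 hx hA hR
  have hb := below h1 hx h2 l.val (fun i hi => by rw [hB, if_pos (by exact hi)])
  rcases lt_or_ge i l with hi | hi
  · refine ⟨hb.2 i hi, fun _ => ?_, fun h => absurd hi (not_lt.mpr h)⟩
    have h0 : φ (A' i) = 0 := by
      have := hb.1 i.succ (by simpa using hi)
      simpa using this
    rcases hr i with h | h
    · rw [h0] at h; norm_num at h
    · exact h.2.2
  · have hBi := hB i
    rw [if_neg (not_lt.mpr hi)] at hBi
    have hp : φ (prv A' i.castSucc) ≤ 1 := by
      refine Fin.cases (by simp) (fun j => ?_) i.castSucc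
      rw [prv_succ]
      rcases hr j with h | h <;> rw [h.1]; norm_num
    obtain ⟨k, hk⟩ : ∃ k : ℕ, B i = A' i + k := by
      rcases h2 i with ⟨k, hk⟩ | h
      · rw [hk, map_add, map_add, map_neg, hx, phi_nat h1] at hBi
        linarith
      · exact h
    refine ⟨⟨k, hk⟩, fun h => absurd h (not_lt.mpr hi), fun _ => ?_⟩
    rcases hr i with h | h
    · exact h.2
    · rw [hk, map_add, phi_nat h1, h.1] at hBi; norm_num at hBi

lemma minus_case {φ : ℂ →ₗ[ℚ] ℚ} (h1 : φ 1 = 0) {x : ℂ} (hx : φ x = 1) {n : ℕ} {A : Fin n → ℂ} {A' B : Fin (n + 1) → ℂ}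
    (hA : ∀ i, φ (A i) = 0) (hR : Rel1 x A A') (h2 : Poss (-x) A' B) (l : Fin (n + 1))
    (hB : ∀ i, φ (B i) = if i < l then 0 else -1) :
    (∀ i, i < l → ∃ k : ℕ, B i = A' i + k) ∧ (∀ i, l ≤ i → ∃ k : ℕ, B i = -x + prv A' i.castSucc + k) ∧
      ∀ i : Fin n, ∃ k : ℕ, A' i.castSucc = A i + k := by
  have hr := rel1_phi h1 hx hA hR
  have hb := below h1 hx h2 l.val (fun i hi => by rw [hB, if_pos (by exact hi)])
  have hc : ∀ i, l ≤ i → (∃ k : ℕ, B i = -x + prv A' i.castSucc + k) ∧ φ (prv A' i.castSucc) = 0 := fun i hi => by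
    have hBi := hB i
    rw [if_neg (not_lt.mpr hi)] at hBi
    rcases h2 i with ⟨k, hk⟩ | ⟨k, hk⟩
    · refine ⟨⟨k, hk⟩, ?_⟩
      rw [hk, map_add, map_add, map_neg, hx, phi_nat h1] at hBi
      linarith
    · rw [hk, map_add, phi_nat h1] at hBi
      rcases hr i with h | h <;> rw [h.1] at hBi <;> norm_num at hBi
  refine ⟨fun i hi => hb.2 i hi, fun i hi => (hc i hi).1, fun i => ?_⟩
  have h0 : φ (A' i.castSucc) = 0 := by
    rcases lt_or_ge i.castSucc l with hi | hi
    · have := hb.1 i.castSucc.succ (by simpa [Fin.lt_def] using hi)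
      simpa using this
    · have := (hc i.succ (hi.trans (by simp [Fin.le_def]))).2
      rwa [← Fin.succ_castSucc, prv_succ] at this
  rcases hr i.castSucc with h | h
  · rw [h0] at h; norm_num at h
  · simpa using h.2.2

lemma sF_ins {n : ℕ} (l : Fin (n + 1)) (a : ℂ) (μ : Fin n → ℂ) (i : Fin (n + 1)) :
    sF (l.insertNth a μ : Fin (n + 1) → ℂ) i = if i < l then (Fin.snoc (sF μ) 0 : Fin (n + 1) → ℂ) i else a + prv (sF μ) i := by
  have : (fun i => if i < l then (Fin.snoc (sF μ) 0 : Fin (n + 1) → ℂ) i else a + prv (sF μ) i) = sF (l.insertNth a μ : Fin (n + 1) → ℂ) := by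
    refine sF_unique fun i => ?_
    have hlt : ∀ i : Fin n, i.castSucc < l → (l.insertNth a μ : Fin (n + 1) → ℂ) i.castSucc = μ i := fun i hi => by
      conv_lhs => rw [← Fin.succAbove_of_castSucc_lt l i hi]
      simp
    have hge : ∀ i : Fin n, l ≤ i.castSucc → (l.insertNth a μ : Fin (n + 1) → ℂ) i.succ = μ i := fun i hi => by
      conv_lhs => rw [← Fin.succAbove_of_le_castSucc l i hi]
      simp
    rcases lt_trichotomy i l with hi | hi | hi
    · rw [if_pos hi]
      obtain ⟨j, rfl⟩ : ∃ j : Fin n, i = j.castSucc := ⟨i.castLT (by omega), rfl⟩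
      rw [hlt j hi, Fin.snoc_castSucc, ← sF_sub μ j]
      congr 1
      cases n with
      | zero => exact j.elim0
      | succ n =>
        revert hi
        refine Fin.cases ?_ (fun j => ?_) j
        · intro _; rfl
        · intro hi
          have e1 : j.succ.castSucc.castSucc = j.castSucc.castSucc.succ := rfl
          have e2 : j.succ.castSucc = j.castSucc.succ := rfl
          rw [e1, e2, prv_succ, prv_succ, if_pos, Fin.snoc_castSucc]
          refine lt_trans ?_ hi
          simp [Fin.lt_def]
    · subst hi
      rw [if_neg (lt_irrefl _), Fin.insertNth_apply_same]
      have : prv (fun k => if k < i then (Fin.snoc (sF μ) 0 : Fin (n + 1) → ℂ) k else a + prv (sF μ) k) i.castSucc = prv (sF μ) i := by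
        refine Fin.cases rfl (fun j => ?_) i
        rw [← Fin.succ_castSucc, prv_succ, prv_succ, if_pos (by simp [Fin.lt_def]), Fin.snoc_castSucc]
      rw [this]; ring
    · rw [if_neg (not_lt.mpr hi.le)]
      obtain ⟨j, rfl⟩ : ∃ j : Fin n, i = j.succ := ⟨i.pred (by rintro rfl; exact absurd hi (by simp)), by simp⟩
      have hj : l ≤ j.castSucc := by rw [Fin.le_def]; rw [Fin.lt_def] at hi; simp at hi ⊢; omega
      rw [hge j hj, ← Fin.succ_castSucc, prv_succ, prv_succ, if_neg (not_lt.mpr hj), ← sF_sub μ j]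
      ring
  exact (congrFun this i).symm

lemma rho_z {x : ℂ} (h : NI x) : rho x 0 = Complex.Gamma x := by
  have : Rr 0 = 1 := by simpa using Rr_neg 0
  rw [rho, this, Rr_NI h]; simp

lemma rho_z' {x : ℂ} (h : NI x) : rho 0 x = Complex.Gamma x := by rw [rho_comm, rho_z h]

lemma GammaF_ins {n : ℕ} (l : Fin (n + 1)) (a : ℂ) (μ : Fin n → ℂ) :
    GammaF (l.insertNth a μ : Fin (n + 1) → ℂ) = GammaF μ * Complex.Gamma (-(2 * a)) *
      ∏ i : Fin n, (if i.castSucc < l then Complex.Gamma (-μ i - a) * Complex.Gamma (-μ i + a)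
        else Complex.Gamma (-a - μ i) * Complex.Gamma (-a + μ i)) := by
  simp only [GammaF]
  rw [Fin.prod_univ_succAbove _ l, Fin.prod_univ_succAbove (fun i => Complex.Gamma (-(2 * _))) l]
  simp only [Fin.prod_univ_succAbove _ l, Fin.insertNth_apply_same, Fin.insertNth_apply_succAbove, lt_irrefl, if_false, one_mul,
    Fin.succAbove_lt_succAbove_iff, prod_mul_distrib]
  have : ∀ i : Fin n, (if i.castSucc < l then Complex.Gamma (-μ i - a) * Complex.Gamma (-μ i + a)
        else Complex.Gamma (-a - μ i) * Complex.Gamma (-a + μ i)) =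
      (if l < l.succAbove i then Complex.Gamma (-a - μ i) * Complex.Gamma (-a + μ i) else 1) *
      (if l.succAbove i < l then Complex.Gamma (-μ i - a) * Complex.Gamma (-μ i + a) else 1) := fun i => by
    simp only [Fin.lt_succAbove_iff_le_castSucc, Fin.succAbove_lt_iff_castSucc_lt]
    by_cases h : i.castSucc < l
    · rw [if_pos h, if_pos h, if_neg (not_le.mpr h), one_mul]
    · rw [if_neg h, if_neg h, if_pos (not_lt.mp h), mul_one]
  simp only [this, prod_mul_distrib]
  ring

lemma wA_ins {n : ℕ} (w : SignedPerm (n + 1)) (v : Fin (n + 1) → ℂ) : ∃ (l : Fin (n + 1)) (w' : SignedPerm n) (a : ℂ),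
    (a = v (Fin.last n) ∨ a = -v (Fin.last n)) ∧ wA w v = (l.insertNth a (wA w' (Fin.init v)) : Fin (n + 1) → ℂ) := by
  set l := w.1.symm (Fin.last n) with hl
  have hne : ∀ i, w.1 (l.succAbove i) ≠ Fin.last n := fun i h => by
    have : l.succAbove i = l := w.1.injective (h.trans (by rw [hl, Equiv.apply_symm_apply]))
    exact Fin.succAbove_ne _ _ this
  have hinj : Function.Injective (fun i => (w.1 (l.succAbove i)).castPred (hne i)) := fun i j hij => by
    simpa using hij
  refine ⟨l, (Equiv.ofBijective _ (Finite.injective_iff_bijective.mp hinj), fun i => w.2 (l.succAbove i)), wA w v l, ?_, ?_⟩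
  · simp only [wA, hl, Equiv.apply_symm_apply]
    split_ifs <;> simp
  · rw [Fin.eq_insertNth_iff]
    refine ⟨rfl, ?_⟩
    funext i
    simp [wA, Fin.init, Fin.removeNth]

lemma phi_wA {n : ℕ} {v : Fin n → ℂ} {φ : ℂ →ₗ[ℚ] ℚ} (w : SignedPerm n) (i : Fin n) :
    φ (wA w v i) = (if w.2 i then -1 else 1) * φ (v (w.1 i)) := by
  unfold wA
  split_ifs <;> simp

lemma wA_sep {n : ℕ} {v : Fin n → ℂ} (hv : AlgebraicIndependent ℚ v) {w w' : SignedPerm n}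
    (h : ∀ i, ∃ k : ℤ, wA w v i - wA w' v i = k) : w = w' := by
  obtain ⟨φ, h1, h2⟩ := gen_dual hv
  have key : ∀ i, w.1 i = w'.1 i ∧ w.2 i = w'.2 i := fun i => by
    obtain ⟨k, hk⟩ := h i
    have := congrArg (φ (w.1 i)) hk
    rw [phi_int (h1 _), map_sub, phi_wA, phi_wA, h2, h2, if_pos rfl] at this
    by_cases hc : w.1 i = w'.1 i
    · refine ⟨hc, ?_⟩
      rw [if_pos hc] at this
      cases h3 : w.2 i <;> cases h4 : w'.2 i <;> simp [h3, h4] at this ⊢ <;> norm_num at this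
    · rw [if_neg hc] at this
      cases h3 : w.2 i <;> simp [h3] at this
  refine Prod.ext (Equiv.ext fun i => (key i).1) (funext fun i => (key i).2)

lemma sF_sep {n : ℕ} {v : Fin n → ℂ} (hv : AlgebraicIndependent ℚ v) {w w' : SignedPerm n} {m m' : Fin n → ℕ}
    (h : ∀ i, sF (wA w v) i + m i = sF (wA w' v) i + m' i) : w = w' ∧ m = m' := by
  have hw : w = w' := by
    refine wA_sep hv fun i => ⟨(m' i : ℤ) - (prv m' i.castSucc : ℕ) - m i + (prv m i.castSucc : ℕ), ?_⟩
    have h2 := congrArg (fun A => prv A i.castSucc) (funext h)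
    simp only [prv_add] at h2
    have := h i
    rw [← sF_sub (wA w v) i, ← sF_sub (wA w' v) i]
    push_cast
    linear_combination this - h2
  subst hw
  refine ⟨rfl, funext fun i => ?_⟩
  have := h i
  exact_mod_cast add_left_cancel this

def Lv {n : ℕ} (v : Fin n → ℂ) : AddSubgroup ℂ := AddSubgroup.closure (insert 1 (Set.range v))

lemma Lv_one {n : ℕ} (v : Fin n → ℂ) : (1 : ℂ) ∈ Lv v := AddSubgroup.subset_closure (by simp)
lemma Lv_v {n : ℕ} (v : Fin n → ℂ) (i : Fin n) : v i ∈ Lv v := AddSubgroup.subset_closure (by simp)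
lemma Lv_nat {n : ℕ} (v : Fin n → ℂ) (k : ℕ) : (k : ℂ) ∈ Lv v := by
  have := (Lv v).nsmul_mem (Lv_one v) k
  simpa using this

lemma Lv_prv {n N : ℕ} {v : Fin n → ℂ} {A : Fin N → ℂ} (h : ∀ i, A i ∈ Lv v) (j : Fin (N + 1)) : prv A j ∈ Lv v := by
  refine Fin.cases ?_ (fun i => ?_) j
  · exact (Lv v).zero_mem
  · exact h i

lemma Lv_poss {n N : ℕ} {v : Fin n → ℂ} {x : ℂ} (hx : x ∈ Lv v) {A B : Fin N → ℂ} (h : ∀ i, A i ∈ Lv v) (hP : Poss x A B) (i : Fin N) : B i ∈ Lv v := by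
  rcases hP i with ⟨k, hk⟩ | ⟨k, hk⟩
  · rw [hk]; exact (Lv v).add_mem ((Lv v).add_mem hx (Lv_prv h _)) (Lv_nat v k)
  · rw [hk]; exact (Lv v).add_mem (h i) (Lv_nat v k)

lemma Lv_exp {n : ℕ} {v : Fin n → ℂ} {z : ℂ} (h : z ∈ Lv v) : ∃ (m0 : ℤ) (m : Fin n → ℤ), z = m0 + ∑ j, (m j : ℂ) * v j := by
  refine AddSubgroup.closure_induction ?_ ?_ ?_ ?_ h
  · rintro x (rfl | ⟨i, rfl⟩)
    · exact ⟨1, 0, by simp⟩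
    · exact ⟨0, Pi.single i 1, by simp [Pi.single_apply, ite_mul]⟩
  · exact ⟨0, 0, by simp⟩
  · rintro x y - - ⟨a, b, rfl⟩ ⟨c, d, rfl⟩
    exact ⟨a + c, b + d, by simp [add_mul, sum_add_distrib]; ring⟩
  · rintro x - ⟨a, b, rfl⟩
    exact ⟨-a, -b, by simp; ring⟩

lemma Lv_wA {n : ℕ} (v : Fin n → ℂ) (w : SignedPerm n) (i : Fin n) : wA w v i ∈ Lv v := by
  unfold wA
  split_ifs
  · simpa using (Lv v).neg_mem (Lv_v v _)
  · simpa using Lv_v v _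

lemma Lv_sF {n : ℕ} (v : Fin n → ℂ) (w : SignedPerm n) (i : Fin n) : sF (wA w v) i ∈ Lv v :=
  (Lv v).sum_mem fun j _ => Lv_wA v w j

lemma Lv_init {n : ℕ} (v : Fin (n + 1) → ℂ) : Lv (Fin.init v) ≤ Lv v := by
  refine AddSubgroup.closure_mono ?_
  rintro x (rfl | ⟨i, rfl⟩)
  · simp
  · exact Or.inr ⟨i.castSucc, rfl⟩

/-- support points are in the orbit lattice -/
lemma supp_orb {n : ℕ} {v : Fin n → ℂ} (hv : AlgebraicIndependent ℚ v) {S : Finset ℂ} {f : (Fin n → ℂ) → ℂ}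
    (hS : ∀ B, f B ≠ 0 → InC S B) (hL : ∀ B, f B ≠ 0 → ∀ i, B i ∈ Lv v) (hR : Rec n (1 / 2 * ∑ i, v i ^ 2) f) :
    ∀ B, f B ≠ 0 → ∃ (w : SignedPerm n) (m : Fin n → ℕ), B = fun i => sF (wA w v) i + m i := by
  set R : ℝ := ∑ σ ∈ S, |σ.re| with hRd
  have hre : ∀ B, f B ≠ 0 → -(n * R) ≤ ∑ i, (B i).re := fun B hB => by
    have : ∀ i, -R ≤ (B i).re := fun i => by
      obtain ⟨σ, hσ, k, hk⟩ := hS B hB i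
      have h1 : |σ.re| ≤ R := single_le_sum (f := fun σ : ℂ => |σ.re|) (fun _ _ => abs_nonneg _) hσ
      rw [hk]; simp
      have := neg_abs_le σ.re
      have : (0 : ℝ) ≤ k := by positivity
      linarith
    calc -(n * R) = ∑ i : Fin n, -R := by simp
      _ ≤ _ := sum_le_sum fun i _ => this i
  have key : ∀ N : ℕ, ∀ B, f B ≠ 0 → ∑ i, (B i).re < N - n * R → ∃ (w : SignedPerm n) (m : Fin n → ℕ), B = fun i => sF (wA w v) i + m i := by
    intro N
    induction N with
    | zero =>
      intro B hB h
      have := hre B hB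
      simp at h; linarith
    | succ N ih =>
      intro B hB h
      by_cases hz : ∃ i, f (B - ev i) ≠ 0
      · obtain ⟨i, hi⟩ := hz
        obtain ⟨w, m, hm⟩ := ih _ hi (by
          have : ∑ j, ((B - ev i) j).re = ∑ j, (B j).re - 1 := by
            simp only [Pi.sub_apply, Complex.sub_re, sum_sub_distrib, ev_apply]
            congr 1
            rw [sum_eq_single i] <;> simp +contextual
          rw [this]; push_cast at h; linarith)
        refine ⟨w, m + Pi.single i 1, ?_⟩
        funext j
        have := congrFun hm j
        simp only [Pi.sub_apply, ev_apply] at this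
        simp only [Pi.add_apply, Pi.single_apply]
        push_cast
        linear_combination this
      · push Not at hz
        have := hR B
        simp only [hz, mul_zero, sum_const_zero] at this
        have hQ : Qf B = 1 / 2 * ∑ i, v i ^ 2 := by
          rcases mul_eq_zero.mp this with h | h
          · exact sub_eq_zero.mp h
          · exact absurd h hB
        have hd : ∀ i, ∃ (m0 : ℤ) (m : Fin n → ℤ), B i - prv B i.castSucc = m0 + ∑ j, (m j : ℂ) * v j := fun i =>
          Lv_exp ((Lv v).sub_mem (hL B hB i) (Lv_prv (hL B hB) _))
        choose m0 m hm using hd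
        have hq : ∑ i, ((m0 i : ℂ) + ∑ j, (m i j : ℂ) * v j) ^ 2 = ∑ j, v j ^ 2 := by
          simp only [Qf, hm] at hQ
          exact mul_left_cancel₀ (by norm_num) hQ
        obtain ⟨-, w, hw⟩ := gen_quad hv m0 m hq
        refine ⟨w, 0, ?_⟩
        rw [sF_unique (v := wA w v) (A := B) fun i => by rw [hm, hw]]
        simp
  intro B hB
  obtain ⟨N, hN⟩ := exists_nat_gt (∑ i, (B i).re + n * R)
  exact key N B hB (by linarith)

structure Ind (n : ℕ) (v : Fin n → ℂ) (f G : (Fin n → ℂ) → ℂ) : Prop where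
  ex : ∃ S, Expn S f G
  dif : Differentiable ℂ G
  gr : GrH n G
  rc : Rec n (1 / 2 * ∑ i, v i ^ 2) f
  val : ∀ w : SignedPerm n, f (sF (wA w v)) = GammaF (wA w v)
  su : ∀ A, f A ≠ 0 → ∃ (w : SignedPerm n) (m : Fin n → ℕ), A = fun i => sF (wA w v) i + m i

lemma Ind.zero (v : Fin 0 → ℂ) : Ind 0 v (fun _ => 1) (fun _ => 1) := by
  refine ⟨⟨∅, fun B _ i => i.elim0, fun η => ?_⟩, by fun_prop, fun T => ⟨1, 0, by simp, le_rfl, fun ζ _ => by simp⟩, fun A => by simp [Qf], fun w => by simp [GammaF],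
    fun A _ => ⟨1, 0, funext fun i => i.elim0⟩⟩
  have := hasSum_fintype (fun B : Fin 0 → ℂ => (1 : ℂ) * Complex.exp (∑ i, B i * η i))
  simpa using this

/-- one step of the integral recursion, on real arguments -/
def UR (N : ℕ) (ν : ℂ) (c : ℝ) (F : (Fin N → ℝ) → ℂ) (η : Fin (N + 1) → ℝ) : ℂ :=
  Complex.exp (ν * (c * η (Fin.last N) : ℝ)) * ∫ ξ : Fin N → ℝ,
    Complex.exp (-(∑ i, (Real.exp (ξ i) + Real.exp (η i.castSucc - ξ i)) : ℝ)) *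
      (Complex.exp (ν * (∑ i, ξ i : ℝ)) *
        F fun i => η i.castSucc - ξ i + (Fin.snoc ξ (c * η (Fin.last N)) : Fin (N + 1) → ℝ) i.succ)

lemma ofReal_snoc {N : ℕ} (ξ : Fin N → ℝ) (t : ℝ) (i : Fin (N + 1)) :
    (((Fin.snoc ξ t : Fin (N + 1) → ℝ) i : ℝ) : ℂ) = (Fin.snoc (fun i => (ξ i : ℂ)) (t : ℂ) : Fin (N + 1) → ℂ) i := by
  refine Fin.lastCases ?_ (fun i => ?_) i <;> simp

lemma Out.ur {N : ℕ} {ν cc : ℂ} {c : ℝ} (hc : cc = c) {f F : (Fin N → ℂ) → ℂ} {g G : (Fin (N + 1) → ℂ) → ℂ} (h : Out N ν cc f F g G)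
    (η : Fin (N + 1) → ℝ) : G (fun i => (η i : ℂ)) = UR N ν c (fun ζ => F fun i => (ζ i : ℂ)) η := by
  rw [h.re, UR, hc]
  congr 2
  · push_cast; ring
  · funext ξ
    simp only [XX, Psi, sh]
    congr 2
    · push_cast; ring
    · congr 2
      push_cast; ring
    · congr 1
      funext i
      rw [Complex.ofReal_add, ofReal_snoc]
      push_cast
      rfl

lemma phi_wA0 {n : ℕ} {v : Fin (n + 1) → ℂ} {φ : ℂ →ₗ[ℚ] ℚ} (h0 : ∀ i : Fin n, φ (v i.castSucc) = 0) (w : SignedPerm n) (i : Fin n) :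
    φ (wA w (Fin.init v) i) = 0 := by
  rw [phi_wA, show Fin.init v (w.1 i) = v (w.1 i).castSucc from rfl, h0, mul_zero]

lemma phi_sF0 {n : ℕ} {v : Fin (n + 1) → ℂ} {φ : ℂ →ₗ[ℚ] ℚ} (h0 : ∀ i : Fin n, φ (v i.castSucc) = 0) (w : SignedPerm n) (i : Fin n) :
    φ (sF (wA w (Fin.init v)) i) = 0 := by
  rw [sF, map_sum]
  exact sum_eq_zero fun j _ => phi_wA0 h0 w j

lemma Ind.phi0 {n : ℕ} {v : Fin (n + 1) → ℂ} {φ : ℂ →ₗ[ℚ] ℚ} (h1 : φ 1 = 0) (h0 : ∀ i : Fin n, φ (v i.castSucc) = 0)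
    {f G : (Fin n → ℂ) → ℂ} (h : Ind n (Fin.init v) f G) {A : Fin n → ℂ} (hA : f A ≠ 0) (i : Fin n) : φ (A i) = 0 := by
  obtain ⟨w, m, rfl⟩ := h.su A hA
  beta_reduce
  rw [map_add, phi_nat h1, phi_sF0 h0, add_zero]

lemma Ind.max {n : ℕ} {v : Fin n → ℂ} (hv : AlgebraicIndependent ℚ v) {f G : (Fin n → ℂ) → ℂ} (h : Ind n v f G) {A : Fin n → ℂ} (hA : f A ≠ 0)
    (w : SignedPerm n) (hk : ∀ i, ∃ k : ℕ, sF (wA w v) i = A i + k) : A = sF (wA w v) := by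
  obtain ⟨w', m, rfl⟩ := h.su A hA
  choose k hk using hk
  obtain ⟨rfl, hm⟩ := sF_sep (m := 0) (m' := fun i => m i + k i) hv (w := w) (w' := w') fun i => by
    rw [hk]; simp; ring
  funext i
  have := congrFun hm i
  simp only [Pi.zero_apply] at this
  have : m i = 0 := by omega
  simp [this]

lemma NI_two {n : ℕ} {v : Fin n → ℂ} (hv : AlgebraicIndependent ℚ v) (w : SignedPerm n) {i j : Fin n} (hij : i ≠ j) :
    NI (wA w v i + wA w v j) := by
  obtain ⟨φ, h1, h2⟩ := gen_dual hv
  refine phi_NI (h1 (w.1 i)) ?_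
  rw [map_add, phi_wA, phi_wA, h2, h2, if_pos rfl, if_neg (show ¬ w.1 i = w.1 j by simpa using hij)]
  split_ifs <;> simp

lemma step_NI2 {n : ℕ} {v : Fin (n + 1) → ℂ} (hv : AlgebraicIndependent ℚ (Fin.init v : Fin n → ℂ)) {φ : ℂ →ₗ[ℚ] ℚ} (h1 : φ 1 = 0)
    (hx : φ (v (Fin.last n)) = 1) (h0 : ∀ i : Fin n, φ (v i.castSucc) = 0)
    {f G : (Fin n → ℂ) → ℂ} (h : Ind n (Fin.init v) f G) {A : Fin n → ℂ} (hA : f A ≠ 0) {A' : Fin (n + 1) → ℂ}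
    (hR : Rel1 (v (Fin.last n)) A A') (i : Fin (n + 1)) : NI (-v (Fin.last n) + prv A' i.castSucc - A' i) := by
  have hA0 := h.phi0 h1 h0 hA
  have hr := rel1_phi h1 hx hA0 hR
  have hgen : φ (prv A' i.castSucc) = 0 → NI (-v (Fin.last n) + prv A' i.castSucc - A' i) := fun hp => by
    refine phi_NI h1 ?_
    rw [map_sub, map_add, map_neg, hx, hp]
    rcases hr i with hh | hh <;> rw [hh.1] <;> norm_num
  revert hgen
  refine Fin.cases ?_ (fun j => ?_) i
  · intro hgen; exact hgen (by simp)
  · intro hgen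
    rw [← Fin.succ_castSucc, prv_succ] at hgen ⊢
    rcases hr j.castSucc with hj | hj
    · rcases hr j.succ with hj' | hj'
      · refine phi_NI h1 ?_
        rw [map_sub, map_add, map_neg, hx, hj.1, hj'.1]
        norm_num
      · obtain ⟨-, hl, k', hk'⟩ := hj'
        obtain ⟨-, k, hk⟩ := hj
        obtain ⟨w, m, hm⟩ := h.su A hA
        have hval : j.val + 1 < n := by
          have := j.isLt
          by_contra hc
          apply hl
          ext; simp; omega
        set j' : Fin n := ⟨j.val + 1, hval⟩ with hj'
        have e1 : j.succ = j'.castSucc := rfl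
        have hdiff : ∃ K : ℤ, -v (Fin.last n) + A' j.castSucc - A' j.succ = -(wA w (Fin.init v) j + wA w (Fin.init v) j') + K := by
          have hs1 := sF_sub (wA w (Fin.init v)) j
          have hs2 := sF_sub (wA w (Fin.init v)) j'
          have hp : prv (sF (wA w (Fin.init v))) j'.castSucc = sF (wA w (Fin.init v)) j := by
            rw [← e1, prv_succ]
          rw [hp] at hs2
          have hpA : prv A j.castSucc = prv (sF (wA w (Fin.init v))) j.castSucc + (prv m j.castSucc : ℕ) := by rw [hm, prv_add]
          have hA2 : A j' = sF (wA w (Fin.init v)) j' + m j' := by rw [hm]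
          refine ⟨(prv m j.castSucc : ℕ) + k - m j' - k', ?_⟩
          rw [hk, hk', hpA, e1, Fin.snoc_castSucc, hA2]
          push_cast
          linear_combination -hs1 - hs2
        obtain ⟨K, hK⟩ := hdiff
        rw [hK]
        refine NI.add_int (NI.neg (NI_two hv w ?_)) K
        intro hjj
        have := congrArg Fin.val hjj
        simp [hj'] at this
    · exact hgen hj.1

lemma snoc_inj {n : ℕ} {A B : Fin n → ℂ} {a b : ℂ} (h : (Fin.snoc A a : Fin (n + 1) → ℂ) = Fin.snoc B b) : A = B ∧ a = b := by
  refine ⟨funext fun i => ?_, ?_⟩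
  · simpa using congrFun h i.castSucc
  · simpa using congrFun h (Fin.last n)

lemma natsum_zero {z : ℂ} {k k' : ℕ} (h : z = z + k + k') : k = 0 ∧ k' = 0 := by
  have : ((k + k' : ℕ) : ℂ) = 0 := by push_cast; linear_combination -h
  have : k + k' = 0 := by exact_mod_cast this
  omega

lemma snoc_init_sF {n : ℕ} (l : Fin (n + 1)) (a : ℂ) (μ : Fin n → ℂ) :
    (Fin.snoc (Fin.init (sF (l.insertNth a μ : Fin (n + 1) → ℂ))) (a + prv (sF μ) (Fin.last n)) : Fin (n + 1) → ℂ) =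
      sF (l.insertNth a μ : Fin (n + 1) → ℂ) := by
  funext i
  refine Fin.lastCases ?_ (fun i => ?_) i
  · rw [Fin.snoc_last, sF_ins, if_neg (not_lt.mpr (Fin.le_last l))]
  · simp [Fin.init]

lemma val_plus {n : ℕ} {v : Fin (n + 1) → ℂ} (hv : AlgebraicIndependent ℚ (Fin.init v : Fin n → ℂ)) {φ : ℂ →ₗ[ℚ] ℚ} (h1 : φ 1 = 0)
    (hx : φ (v (Fin.last n)) = 1) (h0 : ∀ i : Fin n, φ (v i.castSucc) = 0)
    {f G : (Fin n → ℂ) → ℂ} (h : Ind n (Fin.init v) f G) {g1 G1 : (Fin (n + 1) → ℂ) → ℂ} (o1 : Out n (v (Fin.last n)) 1 f G g1 G1)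
    {g2 G2 : (Fin (n + 2) → ℂ) → ℂ} (o2 : Out (n + 1) (-v (Fin.last n)) 0 g1 G1 g2 G2) (l : Fin (n + 1)) (w : SignedPerm n) :
    g2 (Fin.snoc (sF (l.insertNth (v (Fin.last n)) (wA w (Fin.init v)) : Fin (n + 1) → ℂ)) 0 : Fin (n + 2) → ℂ) =
      GammaF (l.insertNth (v (Fin.last n)) (wA w (Fin.init v)) : Fin (n + 1) → ℂ) := by
  set x := v (Fin.last n) with hxd
  set μ := wA w (Fin.init v) with hμ
  set B : Fin (n + 1) → ℂ := sF (l.insertNth x μ : Fin (n + 1) → ℂ) with hB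
  have hμ0 : ∀ i, φ (μ i) = 0 := phi_wA0 h0 w
  have hs0 : ∀ i, φ (sF μ i) = 0 := phi_sF0 h0 w
  have hφB : ∀ i, φ (B i) = if i < l then 0 else 1 := fun i => by
    rw [hB, sF_ins]
    split_ifs
    · exact phi_snoc hs0 i
    · rw [map_add, hx, phi_prv hs0, add_zero]
  have main : ∀ A A' B', f A ≠ 0 → Rel1 x A A' → Poss (-x) A' B' → B' = B → A = sF μ ∧ A' = B := fun A A' B' hA hR hP hBB => by
    subst hBB
    have hpl := plus_case h1 hx (h.phi0 h1 h0 hA) hR hP l hφB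
    have hAs : A = sF μ := by
      refine h.max hv hA w fun i => ?_
      rcases lt_or_ge i.castSucc l with hi | hi
      · obtain ⟨⟨k, hk⟩, hb, -⟩ := hpl i.castSucc
        obtain ⟨k', hk'⟩ := hb hi
        rw [hB, sF_ins, if_pos hi, hk', Fin.snoc_castSucc, Fin.snoc_castSucc] at hk
        exact ⟨k' + k, by rw [hk]; push_cast; ring⟩
      · have hi' : l ≤ i.succ := hi.trans (by simp [Fin.le_def])
        obtain ⟨⟨k, hk⟩, -, hb⟩ := hpl i.succ
        obtain ⟨k', hk'⟩ := hb hi'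
        rw [hB, sF_ins, if_neg (not_lt.mpr hi'), hk', prv_succ, prv_succ] at hk
        exact ⟨k' + k, by push_cast; linear_combination hk⟩
    refine ⟨hAs, funext fun i => ?_⟩
    obtain ⟨⟨k, hk⟩, hb, hc⟩ := hpl i
    have : k = 0 := by
      have hBi : B i = _ := sF_ins l x μ i
      rcases lt_or_ge i l with hi | hi
      · obtain ⟨k', hk'⟩ := hb hi
        rw [if_pos hi, ← hAs] at hBi
        exact (natsum_zero (z := B i) (k := k') (k' := k) (by linear_combination hk + hk' - hBi)).2
      · obtain ⟨k', hk'⟩ := hc hi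
        rw [if_neg (not_lt.mpr hi), ← hAs] at hBi
        exact (natsum_zero (z := B i) (k := k') (k' := k) (by linear_combination hk + hk' - hBi)).2
    rw [hk, this]; simp
  have hself : Poss (-x) B B := fun i => Or.inr ⟨0, by simp⟩
  have e1 : pi' x 1 (sF μ, Fin.init B) = B := by
    have := snoc_init_sF l x μ
    rw [← hB] at this
    conv_rhs => rw [← this]
    simp [pi']
  have v1 := o1.single (sF μ) (Fin.init B) fun A B1 hA hP hpi => by
    have := main A _ B hA (rel1_of_poss hP) (by rw [hpi, e1]; exact hself) rfl
    refine ⟨this.1, ?_⟩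
    have h2 := this.2
    rw [← e1] at h2
    exact (snoc_inj h2).1
  have v2 := o2.single B B fun A' B' hA' hP hpi => by
    obtain ⟨A, B1, hA, hP1, rfl⟩ := o1.supp A' hA'
    have hBB : B' = B := (snoc_inj hpi).1
    exact ⟨(main A _ B' hA (rel1_of_poss hP1) hP hBB).2, hBB⟩
  rw [e1] at v1
  have e2 : pi' (-x) 0 (B, B) = (Fin.snoc B 0 : Fin (n + 2) → ℂ) := by simp [pi']
  rw [e2, v1, h.val] at v2
  rw [v2, GammaF_ins]
  have p1 : ∏ i : Fin n, rho (x + prv (sF μ) i.castSucc - (Fin.init B : Fin n → ℂ) i) (sF μ i - (Fin.init B : Fin n → ℂ) i) =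
      ∏ i : Fin n, if i.castSucc < l then Complex.Gamma (-μ i + x) else Complex.Gamma (-x + μ i) := by
    refine prod_congr rfl fun i _ => ?_
    have hBi : (Fin.init B : Fin n → ℂ) i = _ := sF_ins l x μ i.castSucc
    have hss := sF_sub μ i
    split_ifs with hi
    · rw [if_pos hi, Fin.snoc_castSucc] at hBi
      rw [hBi, sub_self, show x + prv (sF μ) i.castSucc - sF μ i = -μ i + x by linear_combination -hss, rho_z]
      refine phi_NI h1 ?_
      rw [map_add, map_neg, hμ0, hx]; norm_num
    · rw [if_neg hi] at hBi
      rw [hBi, sub_self, show sF μ i - (x + prv (sF μ) i.castSucc) = -x + μ i by linear_combination hss, rho_z']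
      refine phi_NI h1 ?_
      rw [map_add, map_neg, hμ0, hx]; norm_num
  have p2 : ∏ i : Fin (n + 1), rho (-x + prv B i.castSucc - B i) (B i - B i) =
      Complex.Gamma (-(2 * x)) * ∏ i : Fin n, Complex.Gamma (-x - μ i) := by
    have : ∀ i, rho (-x + prv B i.castSucc - B i) (B i - B i) = Complex.Gamma (-x - (l.insertNth x μ : Fin (n + 1) → ℂ) i) := fun i => by
      have hss := sF_sub (l.insertNth x μ : Fin (n + 1) → ℂ) i
      rw [← hB] at hss
      rw [sub_self, show -x + prv B i.castSucc - B i = -x - (l.insertNth x μ : Fin (n + 1) → ℂ) i by linear_combination -hss, rho_z]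
      refine phi_NI h1 ?_
      refine Fin.succAboveCases l ?_ (fun j => ?_) i
      · rw [Fin.insertNth_apply_same, map_sub, map_neg, hx]; norm_num
      · rw [Fin.insertNth_apply_succAbove, map_sub, map_neg, hx, hμ0]; norm_num
    simp only [this]
    rw [Fin.prod_univ_succAbove _ l]
    simp only [Fin.insertNth_apply_same, Fin.insertNth_apply_succAbove]
    congr 2; ring
  rw [p1, p2]
  have p3 : ∀ i : Fin n, (if i.castSucc < l then Complex.Gamma (-μ i - x) * Complex.Gamma (-μ i + x)
        else Complex.Gamma (-x - μ i) * Complex.Gamma (-x + μ i)) =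
      (if i.castSucc < l then Complex.Gamma (-μ i + x) else Complex.Gamma (-x + μ i)) * Complex.Gamma (-x - μ i) := fun i => by
    split_ifs
    · rw [mul_comm, show -μ i - x = -x - μ i by ring]
    · rw [mul_comm]
  simp only [p3, prod_mul_distrib]
  rw [← hμ]
  ring

lemma val_minus {n : ℕ} {v : Fin (n + 1) → ℂ} (hv : AlgebraicIndependent ℚ (Fin.init v : Fin n → ℂ)) {φ : ℂ →ₗ[ℚ] ℚ} (h1 : φ 1 = 0)
    (hx : φ (v (Fin.last n)) = 1) (h0 : ∀ i : Fin n, φ (v i.castSucc) = 0)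
    {f G : (Fin n → ℂ) → ℂ} (h : Ind n (Fin.init v) f G) {g1 G1 : (Fin (n + 1) → ℂ) → ℂ} (o1 : Out n (v (Fin.last n)) 1 f G g1 G1)
    {g2 G2 : (Fin (n + 2) → ℂ) → ℂ} (o2 : Out (n + 1) (-v (Fin.last n)) 0 g1 G1 g2 G2) (l : Fin (n + 1)) (w : SignedPerm n) :
    g2 (Fin.snoc (sF (l.insertNth (-v (Fin.last n)) (wA w (Fin.init v)) : Fin (n + 1) → ℂ)) 0 : Fin (n + 2) → ℂ) =
      GammaF (l.insertNth (-v (Fin.last n)) (wA w (Fin.init v)) : Fin (n + 1) → ℂ) := by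
  set x := v (Fin.last n) with hxd
  set μ := wA w (Fin.init v) with hμ
  set B : Fin (n + 1) → ℂ := sF (l.insertNth (-x) μ : Fin (n + 1) → ℂ) with hB
  have hμ0 : ∀ i, φ (μ i) = 0 := phi_wA0 h0 w
  have hs0 : ∀ i, φ (sF μ i) = 0 := phi_sF0 h0 w
  have hφB : ∀ i, φ (B i) = if i < l then 0 else -1 := fun i => by
    rw [hB, sF_ins]
    split_ifs
    · exact phi_snoc hs0 i
    · rw [map_add, map_neg, hx, phi_prv hs0, add_zero]
  set A'0 : Fin (n + 1) → ℂ := pi' x 1 (sF μ, sF μ) with hA'0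
  have hA'c : ∀ i : Fin n, A'0 i.castSucc = sF μ i := fun i => by simp [hA'0, pi']
  have hA'l : A'0 (Fin.last n) = x + prv (sF μ) (Fin.last n) := by simp [hA'0, pi']
  have hA'p : ∀ i : Fin (n + 1), prv A'0 i.castSucc = prv (sF μ) i := fun i => by
    refine Fin.cases rfl (fun j => ?_) i
    rw [← Fin.succ_castSucc, prv_succ, prv_succ, hA'c]
  have v1 := o1.single (sF μ) (sF μ) fun A B1 hA hP hpi => by
    have hB1 : B1 = sF μ := (snoc_inj hpi).1
    refine ⟨h.max hv hA w fun i => ?_, hB1⟩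
    rw [← hμ, ← hB1]
    rcases hP i with ⟨k, hk⟩ | hk
    · have := congrArg φ hk
      rw [hB1, hs0, map_add, map_add, hx, phi_prv (h.phi0 h1 h0 hA), phi_nat h1] at this
      norm_num at this
    · exact hk
  have v2 := o2.single A'0 B fun A' B' hA' hP hpi => by
    obtain ⟨A, B1, hA, hP1, hpi1⟩ := o1.supp A' hA'
    have hBB : B' = B := (snoc_inj hpi).1
    refine ⟨?_, hBB⟩
    subst hBB
    obtain ⟨ha, hb, hc⟩ := minus_case h1 hx (h.phi0 h1 h0 hA) (by rw [← hpi1]; exact rel1_of_poss hP1) hP l hφB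
    have hAs : A = sF μ := by
      refine h.max hv hA w fun i => ?_
      obtain ⟨k', hk'⟩ := hc i
      rcases lt_or_ge i.castSucc l with hi | hi
      · obtain ⟨k, hk⟩ := ha _ hi
        rw [hB, sF_ins, if_pos hi, hk', Fin.snoc_castSucc] at hk
        exact ⟨k' + k, by rw [hk]; push_cast; ring⟩
      · have hi' : l ≤ i.succ := hi.trans (by simp [Fin.le_def])
        obtain ⟨k, hk⟩ := hb _ hi'
        rw [hB, sF_ins, if_neg (not_lt.mpr hi'), ← Fin.succ_castSucc, prv_succ, prv_succ, hk'] at hk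
        exact ⟨k' + k, by push_cast; linear_combination hk⟩
    funext i
    refine Fin.lastCases ?_ (fun i => ?_) i
    · rw [hA'l, ← hpi1, ← hAs]; simp [pi']
    · obtain ⟨k', hk'⟩ := hc i
      have : k' = 0 := by
        rcases lt_or_ge i.castSucc l with hi | hi
        · obtain ⟨k, hk⟩ := ha _ hi
          rw [hB, sF_ins, if_pos hi, hk', Fin.snoc_castSucc, ← hAs] at hk
          exact (natsum_zero (z := A i) (k := k') (k' := k) hk).1
        · have hi' : l ≤ i.succ := hi.trans (by simp [Fin.le_def])
          obtain ⟨k, hk⟩ := hb _ hi'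
          rw [hB, sF_ins, if_neg (not_lt.mpr hi'), ← Fin.succ_castSucc, prv_succ, prv_succ, hk', ← hAs] at hk
          exact (natsum_zero (z := A i) (k := k') (k' := k) (by linear_combination hk)).1
      rw [hA'c, hk', this, hAs]; simp
  have e2 : pi' (-x) 0 (A'0, B) = (Fin.snoc B 0 : Fin (n + 2) → ℂ) := by simp [pi']
  rw [← hA'0] at v1
  rw [e2, v1, h.val] at v2
  rw [v2, GammaF_ins]
  have p1 : ∏ i : Fin n, rho (x + prv (sF μ) i.castSucc - sF μ i) (sF μ i - sF μ i) =
      ∏ i : Fin n, Complex.Gamma (-μ i + x) := by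
    refine prod_congr rfl fun i _ => ?_
    have hss := sF_sub μ i
    rw [sub_self, show x + prv (sF μ) i.castSucc - sF μ i = -μ i + x by linear_combination -hss, rho_z]
    refine phi_NI h1 ?_
    rw [map_add, map_neg, hμ0, hx]; norm_num
  have p2 : ∏ i : Fin (n + 1), rho (-x + prv A'0 i.castSucc - B i) (A'0 i - B i) =
      Complex.Gamma (2 * x) * ∏ i : Fin n, if i.castSucc < l then Complex.Gamma (-μ i - x) else Complex.Gamma (x + μ i) := by
    rw [Fin.prod_univ_castSucc, mul_comm]
    congr 1
    · rw [hA'p, hA'l, hB, sF_ins, if_neg (not_lt.mpr (Fin.le_last l)), sub_self, rho_z']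
      · congr 1; ring
      · refine phi_NI h1 ?_
        rw [show x + prv (sF μ) (Fin.last n) - (-x + prv (sF μ) (Fin.last n)) = x + x by ring, map_add, hx]; norm_num
    · refine prod_congr rfl fun i _ => ?_
      have hss := sF_sub μ i
      rw [hA'p, hA'c, hB, sF_ins]
      split_ifs with hi
      · rw [Fin.snoc_castSucc, sub_self, show -x + prv (sF μ) i.castSucc - sF μ i = -μ i - x by linear_combination -hss, rho_z]
        refine phi_NI h1 ?_
        rw [map_sub, map_neg, hμ0, hx]; norm_num
      · rw [sub_self, show sF μ i - (-x + prv (sF μ) i.castSucc) = x + μ i by linear_combination hss, rho_z']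
        refine phi_NI h1 ?_
        rw [map_add, hμ0, hx]; norm_num
  rw [p1, p2]
  have p3 : ∀ i : Fin n, (if i.castSucc < l then Complex.Gamma (-μ i - -x) * Complex.Gamma (-μ i + -x)
        else Complex.Gamma (- -x - μ i) * Complex.Gamma (- -x + μ i)) =
      (if i.castSucc < l then Complex.Gamma (-μ i - x) else Complex.Gamma (x + μ i)) * Complex.Gamma (-μ i + x) := fun i => by
    split_ifs
    · rw [mul_comm, show -μ i - -x = -μ i + x by ring, show -μ i + -x = -μ i - x by ring]
    · rw [mul_comm, neg_neg, show x - μ i = -μ i + x by ring]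
  simp only [p3, prod_mul_distrib]
  rw [← hμ, show -(2 * -x) = 2 * x by ring]
  ring

theorem Ind.step {n : ℕ} {v : Fin (n + 1) → ℂ} (hv : AlgebraicIndependent ℚ v) {f G : (Fin n → ℂ) → ℂ} (h : Ind n (Fin.init v) f G) :
    ∃ f' G', Ind (n + 1) v f' G' ∧ ∀ η : Fin (n + 1) → ℝ, G' (fun i => (η i : ℂ)) =
      UR (n + 1) (-v (Fin.last n)) 0 (UR n (v (Fin.last n)) 1 (fun ζ => G fun i => (ζ i : ℂ))) (Fin.snoc η 0) := by
  have hv' : AlgebraicIndependent ℚ (Fin.init v : Fin n → ℂ) := hv.comp Fin.castSucc (Fin.castSucc_injective n)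
  obtain ⟨φ', h1', h2'⟩ := gen_dual hv
  obtain ⟨φ, h1, hx, h0⟩ : ∃ φ : ℂ →ₗ[ℚ] ℚ, φ 1 = 0 ∧ φ (v (Fin.last n)) = 1 ∧ ∀ i : Fin n, φ (v i.castSucc) = 0 :=
    ⟨φ' (Fin.last n), h1' _, by rw [h2', if_pos rfl], fun i => by rw [h2', if_neg (Fin.castSucc_lt_last i).ne']⟩
  obtain ⟨S, hS⟩ := h.ex
  obtain ⟨g1, G1, o1, r1⟩ := step1 (ν := v (Fin.last n)) ⟨hS, fun A hA i => phi_NI h1 (by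
    rw [map_sub, map_add, hx, phi_prv (h.phi0 h1 h0 hA), h.phi0 h1 h0 hA]; norm_num), h.dif, h.gr⟩ h.rc
  obtain ⟨S1, hS1⟩ := o1.ex
  obtain ⟨g2, G2, o2, r2⟩ := step2 (ν := -v (Fin.last n)) ⟨hS1, fun A' hA' i => by
    obtain ⟨A, B, hA, hP, rfl⟩ := o1.supp A' hA'
    exact step_NI2 hv' h1 hx h0 h hA (rel1_of_poss hP) i, o1.dif, o1.grO⟩ (by rw [neg_neg]; exact r1)
  obtain ⟨S2, hS2⟩ := o2.restrict
  have hE : 1 / 2 * ∑ i, (Fin.init v : Fin n → ℂ) i ^ 2 + 1 / 2 * v (Fin.last n) ^ 2 = 1 / 2 * ∑ i, v i ^ 2 := by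
    rw [Fin.sum_univ_castSucc]; simp only [Fin.init]; ring
  rw [hE] at r2
  refine ⟨_, _, ⟨⟨S2, hS2⟩, o2.restrict_diff, o2.grH, r2, fun w => ?_, supp_orb hv hS2.supp (fun B hB => ?_) r2⟩, fun η => ?_⟩
  · obtain ⟨l, w', a, ha, hw⟩ := wA_ins w v
    rw [hw]
    rcases ha with rfl | rfl
    · exact val_plus hv' h1 hx h0 h o1 o2 l w'
    · exact val_minus hv' h1 hx h0 h o1 o2 l w'
  · obtain ⟨A', B', hA', hP', hpi'⟩ := o2.supp _ hB
    obtain ⟨A, B1, hA, hP, rfl⟩ := o1.supp _ hA'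
    obtain rfl : B' = B := (snoc_inj hpi').1
    have hAL : ∀ i, A i ∈ Lv v := fun i => by
      obtain ⟨w, m, rfl⟩ := h.su A hA
      exact (Lv v).add_mem (Lv_init v (Lv_sF _ w i)) (Lv_nat v _)
    refine Lv_poss ((Lv v).neg_mem (Lv_v v _)) (fun i => ?_) hP'
    refine Fin.lastCases ?_ (fun i => ?_) i
    · simp only [pi', Fin.snoc_last, one_mul]
      exact (Lv v).add_mem (Lv_v v _) (Lv_prv hAL _)
    · simp only [pi', Fin.snoc_castSucc]
      exact Lv_poss (Lv_v v _) hAL hP i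
  · have e := o2.ur (c := 0) (by simp) (Fin.snoc η 0)
    have e1 : (fun ζ : Fin (n + 1) → ℝ => G1 fun i => (ζ i : ℂ)) = UR n (v (Fin.last n)) 1 (fun ζ => G fun i => (ζ i : ℂ)) :=
      funext fun ζ => o1.ur (c := 1) (by simp) ζ
    rw [e1] at e
    rw [← e]
    congr 1
    funext i
    rw [ofReal_snoc]; simp

lemma sumI {R : Type*} [AddCommMonoid R] (n : ℕ) (g : ℕ → R) : ∑ i ∈ Icc 1 n, g i = ∑ i : Fin n, g (i.val + 1) := by
  rw [Fin.sum_univ_eq_sum_range (fun i => g (i + 1)), Finset.range_eq_Ico, sum_Ico_add' (fun i => g i) 0 n 1]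
  rfl

lemma prodI {R : Type*} [CommMonoid R] (n : ℕ) (g : ℕ → R) : ∏ i ∈ Icc 1 n, g i = ∏ i : Fin n, g (i.val + 1) := by
  have := sumI (R := Additive R) n g
  exact this

/-- the first `n` coordinates of a `1`-based vector -/
def rs (n : ℕ) (ν : ℕ → ℂ) : Fin n → ℂ := fun i => ν (i.val + 1)

lemma extN_fin {n : ℕ} (m : Fin n → ℕ) (i : Fin n) : extN n m (i.val + 1) = m i := by
  have : 1 ≤ i.val + 1 ∧ i.val + 1 ≤ n := ⟨by omega, i.2⟩
  simp [extN, this]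

lemma extR_fin {n : ℕ} (m : Fin n → ℝ) (i : Fin n) : extR n m (i.val + 1) = m i := by
  have : 1 ≤ i.val + 1 ∧ i.val + 1 ≤ n := ⟨by omega, i.2⟩
  simp [extR, this]

lemma rs_wAct (n : ℕ) (w : SignedPerm n) (ν : ℕ → ℂ) : rs n (wAct n w ν) = wA w (rs n ν) := by
  funext i
  have : 1 ≤ i.val + 1 ∧ i.val + 1 ≤ n := ⟨by omega, i.2⟩
  simp [rs, wAct, this, wA]

lemma GammaN_eq (n : ℕ) (ν : ℕ → ℂ) : GammaN n ν = GammaF (rs n ν) := by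
  unfold GammaN GammaF
  rw [prodI, prodI]
  congr 1
  refine prod_congr rfl fun i _ => ?_
  have : Icc (i.val + 1 + 1) n = (Icc 1 n).filter (fun j => i.val + 1 < j) := by
    ext j; simp; omega
  rw [this, prod_filter, prodI]
  refine prod_congr rfl fun j _ => ?_
  simp only [Nat.add_lt_add_iff_right, Fin.lt_def, rs]

/-- differences -/
def dm {n : ℕ} (m : Fin n → ℕ) (i : Fin n) : ℤ := m i - (prv m i.castSucc : ℕ)

def qF {n : ℕ} (m : Fin n → ℕ) (v : Fin n → ℂ) : ℂ := 1 / 2 * ∑ i, (dm m i : ℂ) ^ 2 + ∑ i, v i * dm m i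

lemma prv_val {n : ℕ} (m : ℕ → ℕ) (hm : m 0 = 0) (j : Fin (n + 1)) : prv (fun i : Fin n => m (i.val + 1)) j = m j.val := by
  refine Fin.cases ?_ (fun i => ?_) j
  · simp [hm]
  · simp

lemma qB_aux (k : ℕ) (m : ℕ → ℕ) (hm : m 0 = 0) (ν : ℕ → ℂ) : qB (k + 1) m ν =
    qF (fun i : Fin (k + 1) => m (i.val + 1)) (rs (k + 1) ν) := by
  have h2 : ∀ n, qF (fun i : Fin n => m (i.val + 1)) (rs n ν) =
      1 / 2 * ∑ i ∈ Finset.range n, ((m (i + 1) : ℂ) - m i) ^ 2 + ∑ i ∈ Finset.range n, ν (i + 1) * ((m (i + 1) : ℂ) - m i) := by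
    intro n
    rw [← Fin.sum_univ_eq_sum_range (fun i => ((m (i + 1) : ℂ) - m i) ^ 2), ← Fin.sum_univ_eq_sum_range (fun i => ν (i + 1) * ((m (i + 1) : ℂ) - m i))]
    simp only [qF, dm, prv_val m hm, rs]
    push_cast
    rfl
  rw [h2]
  induction k with
  | zero => simp [qB, hm]
  | succ k ih =>
    rw [sum_range_succ _ (k + 1), sum_range_succ _ (k + 1)]
    simp only [qB, Nat.add_sub_cancel] at ih ⊢
    rw [sum_Icc_succ_top (by omega), sum_Icc_succ_top (by omega), sum_Icc_succ_top (by omega)]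
    linear_combination ih

lemma qB_eq (n : ℕ) (hn : 1 ≤ n) (m : Fin n → ℕ) (ν : ℕ → ℂ) : qB n (extN n m) ν = qF m (rs n ν) := by
  obtain ⟨k, rfl⟩ : ∃ k, n = k + 1 := ⟨n - 1, by omega⟩
  rw [qB_aux k _ (by simp [extN])]
  simp only [extN_fin]

lemma Qf_sF {n : ℕ} (m : Fin n → ℕ) (v : Fin n → ℂ) : Qf (fun i => sF v i + m i) - 1 / 2 * ∑ i, v i ^ 2 = qF m v := by
  unfold Qf qF
  rw [mul_sum, mul_sum, mul_sum, ← sum_sub_distrib, ← sum_add_distrib]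
  refine sum_congr rfl fun i _ => ?_
  have h := sF_sub v i
  rw [prv_add, ← h]
  simp only [dm]
  push_cast
  ring

lemma wA_sq {n : ℕ} (w : SignedPerm n) (v : Fin n → ℂ) : ∑ i, wA w v i ^ 2 = ∑ i, v i ^ 2 := by
  rw [← Equiv.sum_comp w.1 (fun i => v i ^ 2)]
  refine sum_congr rfl fun i _ => ?_
  unfold wA; split_ifs <;> ring

lemma extN_sub {n : ℕ} (m : Fin n → ℕ) (i : Fin n) : dec (extN n m) (i.val + 1) = extN n (m - Pi.single i 1) := by
  funext j
  unfold dec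
  rw [Function.update_apply]
  split_ifs with h
  · subst h; rw [extN_fin, extN_fin]; simp
  · unfold extN
    split_ifs with h2
    · rw [Pi.sub_apply, Pi.single_apply, if_neg, Nat.sub_zero]
      intro h3
      apply h
      rw [← h3]; simp; omega
    · rfl

lemma sum_sub_single {n : ℕ} (m : Fin n → ℕ) (i : Fin n) (hi : m i ≠ 0) : ∑ j, (m - Pi.single i 1 : Fin n → ℕ) j + 1 = ∑ j, m j := by
  have : m = (m - Pi.single i 1) + Pi.single i 1 := by
    funext j
    simp only [Pi.add_apply, Pi.sub_apply, Pi.single_apply]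
    split_ifs with h
    · subst h; omega
    · simp
  conv_rhs => rw [this]
  simp [sum_add_distrib]

lemma sum_extN {n : ℕ} (m : Fin n → ℕ) : ∑ i ∈ Icc 1 n, extN n m i = ∑ i, m i := by
  rw [sumI]; simp only [extN_fin]

/-- coefficients, with finite index type -/
def cF (n : ℕ) (ν : ℕ → ℂ) (m : Fin n → ℕ) : ℂ := cB n ν (extN n m)

lemma cF_zero (n : ℕ) (ν : ℕ → ℂ) : cF n ν 0 = 1 := by
  have := sum_extN (0 : Fin n → ℕ)
  simp only [Pi.zero_apply, sum_const_zero] at this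
  rw [cF, cB, this, cAux]

lemma cF_rec {n : ℕ} (hn : 1 ≤ n) (ν : ℕ → ℂ) (m : Fin n → ℕ) (hm : m ≠ 0) :
    cF n ν m = (∑ i, wt n i * (if m i = 0 then 0 else cF n ν (m - Pi.single i 1))) / qF m (rs n ν) := by
  obtain ⟨k, rfl⟩ : ∃ k, n = k + 1 := ⟨n - 1, by omega⟩
  obtain ⟨d, hd⟩ : ∃ d, ∑ i, m i = d + 1 := by
    refine ⟨∑ i, m i - 1, ?_⟩
    have : ∑ i, m i ≠ 0 := fun h => hm (funext fun i => by
      have := (sum_eq_zero_iff.mp h) i (mem_univ i)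
      simpa using this)
    omega
  have hc : ∀ i : Fin (k + 1), (if extN (k + 1) m (i.val + 1) = 0 then (0 : ℂ) else cAux (k + 1) ν d (dec (extN (k + 1) m) (i.val + 1))) =
      if m i = 0 then 0 else cF (k + 1) ν (m - Pi.single i 1) := fun i => by
    rw [extN_fin]
    split_ifs with h
    · rfl
    · rw [cF, cB, sum_extN, extN_sub]
      have := sum_sub_single m i h
      rw [show ∑ j, (m - Pi.single i 1 : Fin (k + 1) → ℕ) j = d by omega]
  rw [wt_sum, cF, cB, sum_extN, hd, cAux, qB_eq _ hn]
  congr 2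
  · rw [Nat.add_sub_cancel, sumI]
    exact sum_congr rfl fun i _ => hc i.castSucc
  · congr 1
    exact hc (Fin.last k)

/-- the Whittaker function in logarithmic coordinates -/
def WW : (n : ℕ) → (Fin n → ℂ) → (Fin n → ℝ) → ℂ
  | 0, _, _ => 1
  | n + 1, v, η => UR (n + 1) (-v (Fin.last n)) 0 (UR n (v (Fin.last n)) 1 (WW n (Fin.init v))) (Fin.snoc η 0)

lemma WW_ind (n : ℕ) (v : Fin n → ℂ) (hv : AlgebraicIndependent ℚ v) :
    ∃ f G, Ind n v f G ∧ ∀ η : Fin n → ℝ, G (fun i => (η i : ℂ)) = WW n v η := by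
  induction n with
  | zero => exact ⟨_, _, Ind.zero v, fun η => rfl⟩
  | succ n ih =>
    obtain ⟨f, G, h, hG⟩ := ih (Fin.init v) (hv.comp _ (Fin.castSucc_injective n))
    obtain ⟨f', G', h', hG'⟩ := Ind.step hv h
    refine ⟨f', G', h', fun η => ?_⟩
    rw [hG', WW]
    congr 3
    funext ζ
    exact hG ζ

lemma Ind.coef {n : ℕ} (hn : 1 ≤ n) {ν : ℕ → ℂ} (hv : AlgebraicIndependent ℚ (rs n ν)) {f G : (Fin n → ℂ) → ℂ}
    (h : Ind n (rs n ν) f G) (w : SignedPerm n) (hq : ∀ m : Fin n → ℕ, m ≠ 0 → qF m (wA w (rs n ν)) ≠ 0) (m : Fin n → ℕ) :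
    f (fun i => sF (wA w (rs n ν)) i + m i) = GammaF (wA w (rs n ν)) * cF n (wAct n w ν) m := by
  induction hd : ∑ i, m i generalizing m with
  | zero =>
    obtain rfl : m = 0 := funext fun i => (sum_eq_zero_iff.mp hd) i (mem_univ i)
    rw [cF_zero, mul_one, ← h.val]
    simp
  | succ d ih =>
    have hm : m ≠ 0 := by rintro rfl; simp at hd
    have hr := h.rc (fun i => sF (wA w (rs n ν)) i + m i)
    rw [← wA_sq w, Qf_sF] at hr
    rw [cF_rec hn _ _ hm, rs_wAct, mul_div_assoc', eq_div_iff (hq m hm), mul_comm, hr, mul_sum]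
    refine sum_congr rfl fun i _ => ?_
    split_ifs with hi
    · by_contra hne
      have h0 : f ((fun i => sF (wA w (rs n ν)) i + (m i : ℂ)) - ev i) ≠ 0 := fun h0 => hne (by rw [h0]; simp)
      obtain ⟨w', m', e⟩ := h.su _ h0
      have e2 : ∀ j, sF (wA w (rs n ν)) j + m j = sF (wA w' (rs n ν)) j + (m' + Pi.single i 1 : Fin n → ℕ) j := fun j => by
        have := congrFun e j
        simp only [Pi.sub_apply, ev_apply] at this
        simp only [Pi.add_apply, Pi.single_apply]
        push_cast
        linear_combination this
      have := congrFun (sF_sep hv e2).2 i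
      simp [hi] at this
    · have hs := sum_sub_single m i hi
      have := ih (m - Pi.single i 1) (by omega)
      rw [← mul_assoc, mul_comm _ (wt n i), mul_assoc, ← this]
      congr 2
      funext j
      simp only [Pi.sub_apply, ev_apply, Pi.single_apply]
      split_ifs with hj
      · subst hj
        rw [Nat.cast_sub (by omega)]; push_cast; ring
      · simp

/-- the fundamental series in logarithmic coordinates -/
def MF (n : ℕ) (ν : ℕ → ℂ) (η : Fin n → ℝ) : ℂ :=
  ∑' m : Fin n → ℕ, cF n ν m * Complex.exp (∑ i, (sF (rs n ν) i + m i) * η i)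

lemma gen_main {n : ℕ} (hn : 1 ≤ n) {ν : ℕ → ℂ} (hv : AlgebraicIndependent ℚ (rs n ν))
    (hq : ∀ (w : SignedPerm n) (m : Fin n → ℕ), m ≠ 0 → qF m (wA w (rs n ν)) ≠ 0) (η : Fin n → ℝ) :
    WW n (rs n ν) η = ∑ w : SignedPerm n, GammaF (wA w (rs n ν)) * MF n (wAct n w ν) η := by
  obtain ⟨f, G, h, hG⟩ := WW_ind n _ hv
  obtain ⟨S, hS⟩ := h.ex
  have hs := hS.hs (fun i => (η i : ℂ))
  rw [hG] at hs
  let φ : SignedPerm n × (Fin n → ℕ) → (Fin n → ℂ) := fun p i => sF (wA p.1 (rs n ν)) i + p.2 i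
  have hφ : Function.Injective φ := fun p p' e => by
    obtain ⟨h1, h2⟩ := sF_sep hv (congrFun e)
    exact Prod.ext h1 h2
  rw [← hφ.hasSum_iff] at hs
  · have e : ((fun B : Fin n → ℂ => f B * Complex.exp (∑ i, B i * (η i : ℂ))) ∘ φ) = fun p : SignedPerm n × (Fin n → ℕ) => GammaF (wA p.1 (rs n ν)) *
        (cF n (wAct n p.1 ν) p.2 * Complex.exp (∑ i, (sF (rs n (wAct n p.1 ν)) i + p.2 i) * η i)) := by
      funext p
      simp only [Function.comp, φ]
      rw [h.coef hn hv p.1 (hq p.1) p.2, rs_wAct]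
      ring
    rw [e] at hs
    rw [← hs.tsum_eq, hs.summable.tsum_prod, tsum_fintype]
    refine sum_congr rfl fun w _ => ?_
    rw [MF]
    have := tsum_mul_left (α := ℂ) (L := SummationFilter.unconditional (Fin n → ℕ)) (a := GammaF (wA w (rs n ν)))
      (f := fun m : Fin n → ℕ => cF n (wAct n w ν) m * Complex.exp (∑ i, (sF (rs n (wAct n w ν)) i + m i) * η i))
    exact this
  · intro B hB
    have : f B = 0 := by
      by_contra hne
      obtain ⟨w, m, e⟩ := h.su B hne
      exact hB ⟨(w, m), e.symm⟩
    rw [this, zero_mul]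

lemma Mt_eq {n : ℕ} (ν : ℕ → ℂ) {y : ℕ → ℝ} (hy : ∀ i ∈ Icc 1 n, 0 < y i) :
    Mt n ν y = MF n ν (fun i => 2 * Real.log (Real.pi * y (i.val + 1))) := by
  unfold Mt MF
  refine tsum_congr fun m => ?_
  rw [cF, prodI, Complex.exp_sum]
  congr 1
  refine prod_congr rfl fun i _ => ?_
  have h1 : 0 < y (i.val + 1) := hy _ (by simp)
  have h2 : 0 < Real.pi * y (i.val + 1) := mul_pos Real.pi_pos h1
  rw [Complex.cpow_def_of_ne_zero (by exact_mod_cast h2.ne'), ← Complex.ofReal_log h2.le, extN_fin]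
  have h3 : ∑ j ∈ Icc 1 (i.val + 1), ν j = sF (rs n ν) i := by
    have : Icc 1 (i.val + 1) = (Icc 1 n).filter (fun j => j ≤ i.val + 1) := by
      ext j; simp; omega
    rw [this, sum_filter, sumI, sF, ← sum_filter]
    have h4 : univ.filter (fun j : Fin n => j.val + 1 ≤ i.val + 1) = Finset.Iic i := by
      ext j; simp
    rw [h4]; rfl
  rw [h3]
  push_cast
  ring_nf

lemma exp_cov (n : ℕ) (f : (Fin n → ℝ) → ℂ) :
    ∫ t in posSet n, f t = ∫ x : Fin n → ℝ, ((∏ i, Real.exp (x i) : ℝ) : ℂ) * f (fun i => Real.exp (x i)) := by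
  let E : (Fin n → ℝ) → (Fin n → ℝ) := fun x i => Real.exp (x i)
  let E' : (Fin n → ℝ) → ((Fin n → ℝ) →L[ℝ] (Fin n → ℝ)) := fun x =>
    ContinuousLinearMap.pi fun i => Real.exp (x i) • ContinuousLinearMap.proj (R := ℝ) (φ := fun _ : Fin n => ℝ) i
  have hd : ∀ x ∈ Set.univ, HasFDerivWithinAt E (E' x) Set.univ x := fun x _ => by
    refine HasFDerivAt.hasFDerivWithinAt ?_
    rw [hasFDerivAt_pi]
    intro i
    exact (ContinuousLinearMap.proj (R := ℝ) (φ := fun _ : Fin n => ℝ) i).hasFDerivAt.exp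
  have hi : Set.InjOn E Set.univ := fun x _ y _ h => funext fun i => Real.exp_injective (congrFun h i)
  have him : E '' Set.univ = posSet n := by
    ext t
    constructor
    · rintro ⟨x, -, rfl⟩ i
      exact Real.exp_pos _
    · intro h
      exact ⟨fun i => Real.log (t i), trivial, funext fun i => Real.exp_log (h i)⟩
  have hdet : ∀ x, (E' x).det = ∏ i, Real.exp (x i) := fun x => by
    have : (E' x : (Fin n → ℝ) →ₗ[ℝ] (Fin n → ℝ)) = Matrix.toLin' (Matrix.diagonal fun i => Real.exp (x i)) := by
      refine LinearMap.ext fun z => funext fun i => ?_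
      simp [E', Matrix.mulVec_diagonal]
    rw [ContinuousLinearMap.det, this, LinearMap.det_toLin', Matrix.det_diagonal]
  have := integral_image_eq_integral_abs_det_fderiv_smul volume MeasurableSet.univ hd hi f
  rw [him, setIntegral_univ] at this
  rw [this]
  refine integral_congr_ae (.of_forall fun x => ?_)
  beta_reduce
  rw [hdet, abs_of_nonneg (prod_nonneg fun i _ => (Real.exp_pos _).le), Complex.real_smul]

lemma cpow_rexp (x : ℝ) (s : ℂ) : ((Real.exp x : ℝ) : ℂ) ^ s = Complex.exp (s * x) := by
  rw [Complex.cpow_def_of_ne_zero (by exact_mod_cast (Real.exp_pos x).ne'), ← Complex.ofReal_log (Real.exp_pos x).le,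
    Real.log_exp, mul_comm]

lemma extR_succ {n : ℕ} (t : Fin (n + 1) → ℝ) (i : Fin n) : extR (n + 1) t (i.val + 1 + 1) = t i.succ := extR_fin t i.succ
lemma extR_cast {n : ℕ} (t : Fin (n + 1) → ℝ) (i : Fin n) : extR (n + 1) t (i.val + 1) = t i.castSucc := extR_fin t i.castSucc

/-- intermediate coordinates -/
def zt {n : ℕ} (η ξ : Fin n → ℝ) (i : Fin n) : ℝ := η i - ξ i + (Fin.snoc ξ 0 : Fin (n + 1) → ℝ) i.succ

lemma zt_cast {n : ℕ} (η ξ : Fin (n + 1) → ℝ) (i : Fin n) : zt η ξ i.castSucc = η i.castSucc - ξ i.castSucc + ξ i.succ := by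
  rw [zt, Fin.succ_castSucc, Fin.snoc_castSucc]

lemma zt_last {n : ℕ} (η ξ : Fin (n + 1) → ℝ) : zt η ξ (Fin.last n) = η (Fin.last n) - ξ (Fin.last n) := by
  rw [zt, Fin.succ_last, Fin.snoc_last, add_zero]

lemma zt_sum {n : ℕ} (η ξ : Fin (n + 1) → ℝ) : ∑ i : Fin n, zt η ξ i.castSucc = ∑ i : Fin n, η i.castSucc - ξ 0 + ξ (Fin.last n) := by
  simp only [zt_cast, sum_add_distrib, sum_sub_distrib]
  have h1 := Fin.sum_univ_succ ξ
  have h2 := Fin.sum_univ_castSucc ξ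
  linarith

/-- arguments of the inner function -/
def zarg (N : ℕ) (y : ℕ → ℝ) (t : Fin N → ℝ) (u : Fin (N - 1) → ℝ) : ℕ → ℝ :=
  fun j => if j = N - 1 then y N * Real.sqrt (extR N t N / extR (N - 1) u (N - 1))
        else y (j + 1) * Real.sqrt (extR N t (j + 1) * extR (N - 1) u (j + 1) /
          (extR N t (j + 2) * extR (N - 1) u j))

lemma zarg_eq (n : ℕ) (y : ℕ → ℝ) (t : Fin (n + 2) → ℝ) (u : Fin (n + 1) → ℝ) (j : ℕ) : zarg (n + 2) y t u j =
    if j = n + 1 then y (n + 2) * Real.sqrt (extR (n + 2) t (n + 2) / extR (n + 1) u (n + 1))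
        else y (j + 1) * Real.sqrt (extR (n + 2) t (j + 1) * extR (n + 1) u (j + 1) /
          (extR (n + 2) t (j + 2) * extR (n + 1) u j)) := rfl

lemma sqrt_exp (x : ℝ) : Real.sqrt (Real.exp x) = Real.exp (x / 2) := by
  rw [Real.sqrt_eq_rpow, ← Real.exp_mul]; ring_nf

lemma ker_pt {n : ℕ} (ν : ℕ → ℂ) {y : ℕ → ℝ} (η : Fin (n + 2) → ℝ) (hη : ∀ i : Fin (n + 2), Real.pi * y (i.val + 1) = Real.exp (η i / 2)) (W : (ℕ → ℝ) → ℂ)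
    (ξ : Fin (n + 2) → ℝ) (ξ' : Fin (n + 1) → ℝ) :
    ((∏ i, Real.exp (-ξ i) : ℝ) : ℂ) * (((∏ i : Fin (n + 1), Real.exp (ξ' i - zt η ξ i.castSucc) : ℝ) : ℂ) *
      WtKernel (n + 2) ν y W (fun i => Real.exp (-ξ i)) (fun i : Fin (n + 1) => Real.exp (ξ' i - zt η ξ i.castSucc))) =
    Complex.exp (-(∑ i, (Real.exp (ξ i) + Real.exp (η i - ξ i)) : ℝ)) * (Complex.exp (-ν (n + 2) * (∑ i, ξ i : ℝ)) *
      (Complex.exp (ν (n + 2) * (zt η ξ (Fin.last (n + 1)) : ℝ)) *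
      (Complex.exp (-(∑ i : Fin (n + 1), (Real.exp (ξ' i) + Real.exp (zt η ξ i.castSucc - ξ' i)) : ℝ)) *
      (Complex.exp (ν (n + 2) * (∑ i, ξ' i : ℝ)) * W (zarg (n + 2) y (fun i => Real.exp (-ξ i)) (fun i : Fin (n + 1) => Real.exp (ξ' i - zt η ξ i.castSucc))))))) := by
  unfold WtKernel
  change _ * (_ * (_ * W (zarg (n + 2) y (fun i => Real.exp (-ξ i)) (fun i : Fin (n + 1) => Real.exp (ξ' i - zt η ξ i.castSucc))) * _ * _)) = _
  generalize W _ = w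
  simp only [show n + 2 - 1 = n + 1 from rfl, prodI, extR_fin]
  have hy2 : ∀ i : Fin (n + 2), (Real.pi * y (i.val + 1)) ^ 2 = Real.exp (η i) := fun i => by
    rw [hη, ← Real.exp_nat_mul]; congr 1; push_cast; ring
  have hy1 : ∀ i : Fin (n + 1), (Real.pi * y (i.val + 1)) ^ 2 = Real.exp (η i.castSucc) := fun i => hy2 i.castSucc
  have e1 : (∏ i : Fin (n + 2), Real.exp (-(Real.pi * y (i.val + 1)) ^ 2 * Real.exp (-ξ i) - 1 / Real.exp (-ξ i))) =
      Real.exp (-(∑ i, (Real.exp (ξ i) + Real.exp (η i - ξ i)))) := by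
    rw [← Real.exp_sum, ← sum_neg_distrib]
    congr 1
    refine sum_congr rfl fun i _ => ?_
    rw [hy2, neg_mul, ← Real.exp_add, one_div, ← Real.exp_neg, neg_neg]
    ring_nf
  have e2 : (∏ i : Fin (n + 1), Real.exp (-(Real.pi * y (i.val + 1)) ^ 2 * (extR (n + 2) (fun i => Real.exp (-ξ i)) (i.val + 1) / extR (n + 2) (fun i => Real.exp (-ξ i)) (i.val + 1 + 1)) *
        Real.exp (ξ' i - zt η ξ i.castSucc) - 1 / Real.exp (ξ' i - zt η ξ i.castSucc))) =
      Real.exp (-(∑ i : Fin (n + 1), (Real.exp (ξ' i) + Real.exp (zt η ξ i.castSucc - ξ' i)))) := by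
    rw [← Real.exp_sum, ← sum_neg_distrib]
    congr 1
    refine sum_congr rfl fun i _ => ?_
    rw [extR_succ, extR_cast, hy1, ← Real.exp_sub, neg_mul, ← Real.exp_add, neg_mul, ← Real.exp_add, one_div, ← Real.exp_neg,
      neg_sub, zt_cast]
    ring_nf
  have e3 : (∏ i : Fin (n + 2), ((Real.pi * y (i.val + 1) : ℝ) : ℂ) ^ (2 * ν (n + 2))) = Complex.exp (ν (n + 2) * (∑ i, η i : ℝ)) := by
    push_cast
    rw [mul_sum, Complex.exp_sum]
    refine prod_congr rfl fun i _ => ?_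
    rw [← Complex.ofReal_mul, hη, cpow_rexp]
    push_cast
    congr 1; ring
  have e4 : (∏ i : Fin (n + 1), ((extR (n + 2) (fun i => Real.exp (-ξ i)) (i.val + 1 + 1) * Real.exp (ξ' i - zt η ξ i.castSucc) : ℝ) : ℂ) ^ (ν (n + 2))) =
      Complex.exp (ν (n + 2) * (∑ i : Fin (n + 1), (-ξ i.succ + (ξ' i - zt η ξ i.castSucc)) : ℝ)) := by
    rw [Complex.ofReal_sum, mul_sum, Complex.exp_sum]
    refine prod_congr rfl fun i _ => ?_
    rw [extR_succ, ← Real.exp_add, cpow_rexp]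
  have e5 : ((extR (n + 2) (fun i => Real.exp (-ξ i)) 1 : ℝ) : ℂ) ^ (2 * ν (n + 2)) = Complex.exp (ν (n + 2) * (-2 * ξ 0 : ℝ)) := by
    have : extR (n + 2) (fun i => Real.exp (-ξ i)) 1 = Real.exp (-ξ 0) := extR_fin (fun i => Real.exp (-ξ i)) 0
    rw [this, cpow_rexp]
    push_cast
    congr 1; ring
  rw [e1, e2, e3, e4, e5]
  have p1 : (∏ i : Fin (n + 2), Real.exp (-ξ i)) ≠ 0 := (prod_pos fun i _ => Real.exp_pos _).ne'
  have p2 : (∏ i : Fin (n + 1), Real.exp (ξ' i - zt η ξ i.castSucc)) ≠ 0 := (prod_pos fun i _ => Real.exp_pos _).ne'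
  generalize (∏ i : Fin (n + 2), Real.exp (-ξ i)) = P1 at *
  generalize (∏ i : Fin (n + 1), Real.exp (ξ' i - zt η ξ i.castSucc)) = P2 at *
  have key : Complex.exp (ν (n + 2) * (∑ i, η i : ℝ)) * Complex.exp (ν (n + 2) * (-2 * ξ 0 : ℝ)) *
      Complex.exp (ν (n + 2) * (∑ i : Fin (n + 1), (-ξ i.succ + (ξ' i - zt η ξ i.castSucc)) : ℝ)) =
      Complex.exp (-ν (n + 2) * (∑ i, ξ i : ℝ)) * Complex.exp (ν (n + 2) * (zt η ξ (Fin.last (n + 1)) : ℝ)) * Complex.exp (ν (n + 2) * (∑ i, ξ' i : ℝ)) := by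
    rw [← Complex.exp_add, ← Complex.exp_add, ← Complex.exp_add, ← Complex.exp_add]
    congr 1
    have : (∑ i, η i) + (-2 * ξ 0) + (∑ i : Fin (n + 1), (-ξ i.succ + (ξ' i - zt η ξ i.castSucc))) =
        -(∑ i, ξ i) + zt η ξ (Fin.last (n + 1)) + ∑ i, ξ' i := by
      rw [sum_add_distrib, sum_sub_distrib, zt_sum, zt_last, sum_neg_distrib, Fin.sum_univ_castSucc η, Fin.sum_univ_succ ξ]
      ring
    have := congrArg (fun x : ℝ => ν (n + 2) * (x : ℂ)) this
    push_cast at this ⊢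
    linear_combination this
  have p1' : (P1 : ℂ) ≠ 0 := by exact_mod_cast p1
  have p2' : (P2 : ℂ) ≠ 0 := by exact_mod_cast p2
  rw [Complex.ofReal_inv, Complex.ofReal_inv, Complex.ofReal_exp, Complex.ofReal_exp, Complex.ofReal_neg, Complex.ofReal_neg]
  have q1 : (P1 : ℂ) * (P1 : ℂ)⁻¹ = 1 := mul_inv_cancel₀ p1'
  have q2 : (P2 : ℂ) * (P2 : ℂ)⁻¹ = 1 := mul_inv_cancel₀ p2'
  generalize Complex.exp (-((∑ i, (Real.exp (ξ i) + Real.exp (η i - ξ i)) : ℝ) : ℂ)) = X1 at *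
  generalize Complex.exp (-((∑ i : Fin (n + 1), (Real.exp (ξ' i) + Real.exp (zt η ξ i.castSucc - ξ' i)) : ℝ) : ℂ)) = X2 at *
  generalize Complex.exp (ν (n + 2) * (∑ i, η i : ℝ)) = X3 at *
  generalize Complex.exp (ν (n + 2) * (-2 * ξ 0 : ℝ)) = X4 at *
  generalize Complex.exp (ν (n + 2) * (∑ i : Fin (n + 1), (-ξ i.succ + (ξ' i - zt η ξ i.castSucc)) : ℝ)) = X5 at *
  calc _ = ((P1 : ℂ) * (P1 : ℂ)⁻¹) * ((P2 : ℂ) * (P2 : ℂ)⁻¹) * X1 * X2 * w * (X3 * X4 * X5) := by ring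
    _ = _ := by rw [q1, q2, key]; ring

lemma zarg_pt {n : ℕ} {y : ℕ → ℝ} (η : Fin (n + 2) → ℝ) (hη : ∀ i : Fin (n + 2), Real.pi * y (i.val + 1) = Real.exp (η i / 2))
    (ξ : Fin (n + 2) → ℝ) (ξ' : Fin (n + 1) → ℝ) (i : Fin (n + 1)) :
    Real.pi * zarg (n + 2) y (fun i => Real.exp (-ξ i)) (fun i : Fin (n + 1) => Real.exp (ξ' i - zt η ξ i.castSucc)) (i.val + 1) =
      Real.exp ((zt η ξ i.castSucc - ξ' i + (Fin.snoc ξ' (zt η ξ (Fin.last (n + 1))) : Fin (n + 2) → ℝ) i.succ) / 2) := by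
  rw [zarg_eq]
  have hy' : ∀ i : Fin (n + 1), Real.pi * y (i.val + 1 + 1) = Real.exp (η i.succ / 2) := fun i => hη i.succ
  refine Fin.lastCases ?_ (fun i => ?_) i
  · have h1 : extR (n + 2) (fun i => Real.exp (-ξ i)) (n + 2) = Real.exp (-ξ (Fin.last (n + 1))) := extR_fin (fun i => Real.exp (-ξ i)) (Fin.last (n + 1))
    have h2 : extR (n + 1) (fun i : Fin (n + 1) => Real.exp (ξ' i - zt η ξ i.castSucc)) (n + 1) = Real.exp (ξ' (Fin.last n) - zt η ξ (Fin.last n).castSucc) :=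
      extR_fin (fun i : Fin (n + 1) => Real.exp (ξ' i - zt η ξ i.castSucc)) (Fin.last n)
    have h3 : Real.pi * y (n + 2) = Real.exp (η (Fin.last (n + 1)) / 2) := hη (Fin.last (n + 1))
    rw [if_pos (by simp), h1, h2, ← mul_assoc, h3, ← Real.exp_sub, sqrt_exp, ← Real.exp_add, Fin.succ_last, Fin.snoc_last, zt_last]
    congr 1; ring
  · have h1 : extR (n + 2) (fun i => Real.exp (-ξ i)) (i.val + 1 + 1) = Real.exp (-ξ i.succ.castSucc) := extR_fin (fun i => Real.exp (-ξ i)) i.succ.castSucc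
    have h1' : extR (n + 2) (fun i => Real.exp (-ξ i)) (i.val + 1 + 2) = Real.exp (-ξ i.succ.succ) := extR_fin (fun i => Real.exp (-ξ i)) i.succ.succ
    have h2 := extR_succ (fun i : Fin (n + 1) => Real.exp (ξ' i - zt η ξ i.castSucc)) i
    have h2' := extR_cast (fun i : Fin (n + 1) => Real.exp (ξ' i - zt η ξ i.castSucc)) i
    have h3 : Real.pi * y (i.val + 1 + 1) = Real.exp (η i.succ.castSucc / 2) := hη i.succ.castSucc
    rw [if_neg (by simp; omega), Fin.val_castSucc, h1, h1', h2, h2', ← mul_assoc, h3, ← Real.exp_add, ← Real.exp_add, ← Real.exp_sub, sqrt_exp,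
      ← Real.exp_add, Fin.succ_castSucc, Fin.snoc_castSucc, zt_cast η ξ i.succ]
    congr 1; ring

lemma Wt_one (ν : ℕ → ℂ) (y : ℕ → ℝ) (η : Fin 1 → ℝ) (hη : ∀ i : Fin 1, Real.pi * y (i.val + 1) = Real.exp (η i / 2)) :
    Wt 1 ν y = WW 1 (rs 1 ν) η := by
  have h1 : Real.pi * y 1 = Real.exp (η 0 / 2) := hη 0
  have hL : Wt 1 ν y = ∫ s : ℝ, Complex.exp (-(Real.exp (η 0 / 2 + s) + Real.exp (η 0 / 2 - s) : ℝ)) * Complex.exp (2 * ν 1 * s) := by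
    have him : Real.exp '' Set.univ = Set.Ioi 0 := by rw [Set.image_univ, Real.range_exp]
    rw [Wt, besselK, ← mul_assoc, show (2 : ℂ) * (1 / 2) = 1 by norm_num, one_mul, ← him,
      integral_image_eq_integral_abs_deriv_smul (f := Real.exp) (f' := Real.exp) MeasurableSet.univ
      (fun x _ => (Real.hasDerivAt_exp x).hasDerivWithinAt) Real.exp_injective.injOn, setIntegral_univ]
    refine integral_congr_ae (.of_forall fun s => ?_)
    beta_reduce
    rw [cpow_rexp, abs_of_pos (Real.exp_pos s), Complex.real_smul]
    have e1 : -(2 * (Real.pi : ℂ) * y 1 / 2) * ((Real.exp s : ℝ) + 1 / (Real.exp s : ℝ)) = -(Real.exp (η 0 / 2 + s) + Real.exp (η 0 / 2 - s) : ℝ) := by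
      rw [Real.exp_add, Real.exp_sub, ← h1]
      push_cast
      ring
    rw [e1]
    have : ((Real.exp s : ℝ) : ℂ) ≠ 0 := by exact_mod_cast (Real.exp_pos s).ne'
    rw [mul_div_cancel₀ _ this]
  have hR : WW 1 (rs 1 ν) η = ∫ ξ : ℝ, Complex.exp (-(Real.exp (η 0 / 2 + (η 0 / 2 - ξ)) + Real.exp (η 0 / 2 - (η 0 / 2 - ξ)) : ℝ)) *
      Complex.exp (2 * ν 1 * (η 0 / 2 - ξ : ℝ)) := by
    rw [← (volume_preserving_funUnique (Fin 1) ℝ).integral_comp' (g := fun ξ : ℝ => Complex.exp (-(Real.exp (η 0 / 2 + (η 0 / 2 - ξ)) + Real.exp (η 0 / 2 - (η 0 / 2 - ξ)) : ℝ)) *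
      Complex.exp (2 * ν 1 * (η 0 / 2 - ξ : ℝ)))]
    rw [WW, UR, zero_mul, Complex.ofReal_zero, mul_zero, Complex.exp_zero, one_mul]
    refine integral_congr_ae (.of_forall fun ξ => ?_)
    beta_reduce
    rw [UR, Measure.volume_pi_eq_dirac, integral_dirac]
    simp only [WW, Fin.snoc_castSucc, Finset.univ_eq_empty, sum_empty, MeasurableEquiv.funUnique_apply, Fin.default_eq_zero]
    have e2 : (Fin.snoc ξ 0 : Fin 2 → ℝ) (Fin.last 0).succ = 0 := Fin.snoc_last (α := fun _ => ℝ) _ _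
    have e3 : rs 1 ν (Fin.last 0) = ν 1 := rfl
    rw [e2, e3]
    have e4 : ξ (Fin.last 0) = ξ 0 := rfl
    have e5 : η (Fin.last 0) = η 0 := rfl
    rw [e4, e5]
    simp only [Complex.ofReal_zero, mul_zero, neg_zero, Complex.exp_zero, one_mul, mul_one]
    rw [← Complex.exp_add, show η 0 / 2 + (η 0 / 2 - ξ 0) = η 0 - ξ 0 by ring, show η 0 / 2 - (η 0 / 2 - ξ 0) = ξ 0 by ring]
    have hs : ∀ g : Fin (0 + 1) → ℝ, ∑ x, g x = g 0 := fun g => Fin.sum_univ_one g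
    rw [hs, hs, add_comm (Real.exp (ξ 0))]
    congr 2
    push_cast
    ring
  rw [hL, hR, integral_sub_left_eq_self (fun s : ℝ => Complex.exp (-(Real.exp (η 0 / 2 + s) + Real.exp (η 0 / 2 - s) : ℝ)) * Complex.exp (2 * ν 1 * s)) volume]

lemma Wt_eq (n : ℕ) (ν : ℕ → ℂ) (y : ℕ → ℝ) (η : Fin (n + 1) → ℝ) (hη : ∀ i : Fin (n + 1), Real.pi * y (i.val + 1) = Real.exp (η i / 2)) :
    Wt (n + 1) ν y = WW (n + 1) (rs (n + 1) ν) η := by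
  induction n generalizing y with
  | zero => exact Wt_one ν y η hη
  | succ n ih =>
    have hl : rs (n + 2) ν (Fin.last (n + 1)) = ν (n + 2) := rfl
    have hi : Fin.init (rs (n + 2) ν) = rs (n + 1) ν := rfl
    rw [Wt, WW, hl, hi, UR, zero_mul, Complex.ofReal_zero, mul_zero, Complex.exp_zero, one_mul]
    simp only [exp_cov]
    rw [← integral_neg_eq_self]
    refine integral_congr_ae (.of_forall fun ξ => ?_)
    beta_reduce
    rw [← integral_sub_right_eq_self _ (fun i : Fin (n + 1) => zt η ξ i.castSucc), UR, ← integral_const_mul, ← integral_const_mul, ← integral_const_mul, ← integral_const_mul]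
    refine integral_congr_ae (.of_forall fun ξ' => ?_)
    beta_reduce
    simp only [Fin.snoc_castSucc, Pi.neg_apply, Pi.sub_apply, one_mul]
    have := ker_pt ν η hη (fun z => Wt (n + 1) ν z) ξ ξ'
    rw [ih _ _ (zarg_pt η hη ξ ξ')] at this
    exact this

section
open Filter Topology

lemma m_le {n : ℕ} (m : Fin n → ℕ) (i : Fin n) : (m i : ℝ) ≤ ∑ j, |(dm m j : ℝ)| := by
  have : ∀ j : Fin (n + 1), ((prv m j : ℕ) : ℝ) ≤ ∑ i : Fin n, if i.castSucc < j then |(dm m i : ℝ)| else 0 := by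
    intro j
    induction j using Fin.induction with
    | zero => simp
    | succ i ih =>
      have h1 : ((prv m i.succ : ℕ) : ℝ) = (prv m i.castSucc : ℕ) + (dm m i : ℝ) := by
        simp [dm]
      have h2 : (∑ k : Fin n, if k.castSucc < i.succ then |(dm m k : ℝ)| else 0) =
          (∑ k : Fin n, if k.castSucc < i.castSucc then |(dm m k : ℝ)| else 0) + |(dm m i : ℝ)| := by
        have : |(dm m i : ℝ)| = ∑ k : Fin n, if k = i then |(dm m k : ℝ)| else 0 := by simp
        rw [this, ← sum_add_distrib]
        refine sum_congr rfl fun k _ => ?_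
        by_cases hk : k = i
        · subst hk; simp
        · have : k.castSucc < i.succ ↔ k.castSucc < i.castSucc := by
            simp only [Fin.lt_def, Fin.val_castSucc, Fin.val_succ]
            have : k.val ≠ i.val := fun h => hk (Fin.ext h)
            omega
          simp [this, hk]
      rw [h1, h2]
      exact add_le_add ih (le_abs_self _)
  have h := this i.succ
  rw [prv_succ] at h
  refine h.trans (sum_le_sum fun k _ => ?_)
  split_ifs <;> simp

lemma q_large {n : ℕ} (m : Fin n → ℕ) (v : Fin n → ℂ) {R : ℝ} (hv : ∀ i, ‖v i‖ ≤ R) (hT : 2 * n * (R + 1) ≤ ∑ i, |(dm m i : ℝ)|) :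
    ∑ i, |(dm m i : ℝ)| ≤ ‖qF m v‖ := by
  rcases Nat.eq_zero_or_pos n with rfl | hn
  · simp
  set T := ∑ i, |(dm m i : ℝ)| with hTd
  have hn' : (0 : ℝ) < n := by exact_mod_cast hn
  have h1 : ‖∑ i, v i * (dm m i : ℂ)‖ ≤ R * T := by
    rw [hTd, mul_sum]
    refine (norm_sum_le _ _).trans (sum_le_sum fun i _ => ?_)
    rw [norm_mul, Complex.norm_intCast]
    exact mul_le_mul_of_nonneg_right (hv i) (abs_nonneg _)
  have h2 : T ^ 2 ≤ n * ∑ i, (dm m i : ℝ) ^ 2 := by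
    have := sq_sum_le_card_mul_sum_sq (s := univ) (f := fun i => |(dm m i : ℝ)|)
    simpa using this
  have h3 : ‖(1 / 2 * ∑ i, (dm m i : ℂ) ^ 2 : ℂ)‖ = 1 / 2 * ∑ i, (dm m i : ℝ) ^ 2 := by
    have : (1 / 2 * ∑ i, (dm m i : ℂ) ^ 2 : ℂ) = ((1 / 2 * ∑ i, (dm m i : ℝ) ^ 2 : ℝ) : ℂ) := by push_cast; rfl
    rw [this, Complex.norm_real, Real.norm_of_nonneg (by positivity)]
  have h4 := norm_sub_le_norm_add (1 / 2 * ∑ i, (dm m i : ℂ) ^ 2 : ℂ) (∑ i, v i * (dm m i : ℂ))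
  have hT0 : 0 ≤ T := by positivity
  have h5 : (R + 1) * T ≤ 1 / 2 * ∑ i, (dm m i : ℝ) ^ 2 := by
    have : n * (2 * ((R + 1) * T)) ≤ n * ∑ i, (dm m i : ℝ) ^ 2 := by nlinarith
    have := le_of_mul_le_mul_left this hn'
    linarith
  unfold qF
  rw [h3] at h4
  linarith

lemma qF_cont {n : ℕ} (m : Fin n → ℕ) : Continuous (qF m) := by
  unfold qF; fun_prop

lemma q_low {n : ℕ} {v0 : Fin n → ℂ} (h : ∀ m : Fin n → ℕ, m ≠ 0 → qF m v0 ≠ 0) :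
    ∃ δ : ℝ, 0 < δ ∧ ∀ᶠ v in 𝓝 v0, ∀ m : Fin n → ℕ, m ≠ 0 → δ * (∑ i, m i : ℕ) ≤ ‖qF m v‖ := by
  set R := ‖v0‖ + 1 with hR
  have hR0 : 0 ≤ R := by positivity
  obtain ⟨K, hK⟩ := exists_nat_ge (2 * n * (R + 1))
  have hfin : ∀ F : Finset (Fin n → ℕ), ∃ δ : ℝ, 0 < δ ∧ ∀ᶠ v in 𝓝 v0, ∀ m ∈ F, m ≠ 0 → δ * (∑ i, m i : ℕ) ≤ ‖qF m v‖ := by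
    intro F
    induction F using Finset.induction_on with
    | empty => exact ⟨1, one_pos, by simp⟩
    | insert a F ha ih =>
      obtain ⟨δ, hδ, hF⟩ := ih
      by_cases ha0 : a = 0
      · refine ⟨δ, hδ, hF.mono fun v hv m hm hm0 => ?_⟩
        rcases Finset.mem_insert.mp hm with rfl | hm
        · exact absurd ha0 hm0
        · exact hv m hm hm0
      · have h1 : 0 < ‖qF a v0‖ := norm_pos_iff.mpr (h a ha0)
        have h2 : ∀ᶠ v in 𝓝 v0, ‖qF a v0‖ / 2 < ‖qF a v‖ :=
          ((qF_cont a).norm.tendsto v0).eventually (lt_mem_nhds (half_lt_self h1))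
        have hS : (0 : ℝ) < (∑ i, a i : ℕ) + 1 := by positivity
        refine ⟨min δ (‖qF a v0‖ / 2 / ((∑ i, a i : ℕ) + 1)), lt_min hδ (by positivity), ?_⟩
        filter_upwards [hF, h2] with v hv hv2 m hm hm0
        rcases Finset.mem_insert.mp hm with rfl | hm
        · refine le_trans ?_ hv2.le
          refine (mul_le_mul_of_nonneg_right (min_le_right _ _) (Nat.cast_nonneg _)).trans ?_
          rw [div_mul_eq_mul_div, div_le_iff₀ hS]
          exact mul_le_mul_of_nonneg_left (by linarith) (by positivity)
        · exact (mul_le_mul_of_nonneg_right (min_le_left _ _) (Nat.cast_nonneg _)).trans (hv m hm hm0)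
  obtain ⟨δ, hδ, hF⟩ := hfin (Fintype.piFinset fun _ => Finset.range (K + 1))
  refine ⟨min δ (1 / (n + 1)), lt_min hδ (by positivity), ?_⟩
  have hb : ∀ᶠ v in 𝓝 v0, ‖v‖ < R := (continuous_norm.tendsto v0).eventually (gt_mem_nhds (by rw [hR]; linarith))
  filter_upwards [hF, hb] with v hv hvR m hm0
  by_cases hm : m ∈ Fintype.piFinset fun _ : Fin n => Finset.range (K + 1)
  · exact (mul_le_mul_of_nonneg_right (min_le_left _ _) (Nat.cast_nonneg _)).trans (hv m hm hm0)
  · rw [Fintype.mem_piFinset] at hm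
    push Not at hm
    obtain ⟨i, hi⟩ := hm
    have hi' : K < m i := by simpa using hi
    have hi2 : (K : ℝ) ≤ m i := by exact_mod_cast hi'.le
    have h1 := q_large m v (R := R) (fun i => (norm_le_pi_norm v i).trans hvR.le) (by
      have := m_le m i
      linarith)
    refine le_trans ?_ h1
    refine (mul_le_mul_of_nonneg_right (min_le_right _ _) (Nat.cast_nonneg _)).trans ?_
    rw [div_mul_eq_mul_div, one_mul, div_le_iff₀ (by positivity)]
    have h2 : ((∑ i, m i : ℕ) : ℝ) ≤ n * ∑ j, |(dm m j : ℝ)| := by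
      push_cast
      calc ∑ i, (m i : ℝ) ≤ ∑ i : Fin n, ∑ j, |(dm m j : ℝ)| := sum_le_sum fun i _ => m_le m i
        _ = _ := by simp
    have h3 : 0 ≤ ∑ j, |(dm m j : ℝ)| := by positivity
    linarith

lemma c_bound {n : ℕ} (hn : 1 ≤ n) (ν : ℕ → ℂ) {δ : ℝ} (hδ : 0 < δ)
    (h : ∀ m : Fin n → ℕ, m ≠ 0 → δ * (∑ i, m i : ℕ) ≤ ‖qF m (rs n ν)‖) (m : Fin n → ℕ) :
    ‖cF n ν m‖ ≤ (n / δ) ^ (∑ i, m i) / (∑ i, m i).factorial := by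
  induction hd : ∑ i, m i generalizing m with
  | zero =>
    obtain rfl : m = 0 := funext fun i => (sum_eq_zero_iff.mp hd) i (mem_univ i)
    simp [cF_zero]
  | succ d ih =>
    have hm : m ≠ 0 := by rintro rfl; simp at hd
    have hq := h m hm
    rw [hd] at hq
    have hd0 : (0 : ℝ) < δ * (d + 1 : ℕ) := by positivity
    rw [cF_rec hn _ _ hm, norm_div, div_le_iff₀ (lt_of_lt_of_le hd0 hq)]
    have h1 : ‖∑ i, wt n i * (if m i = 0 then 0 else cF n ν (m - Pi.single i 1))‖ ≤ n * ((n / δ) ^ d / d.factorial) := by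
      refine (norm_sum_le _ _).trans ?_
      calc _ ≤ ∑ i : Fin n, ((n / δ) ^ d / d.factorial : ℝ) := sum_le_sum fun i _ => by
            rw [norm_mul]
            have hw : ‖wt n i‖ ≤ 1 := by unfold wt; split_ifs <;> norm_num
            have hp : (0 : ℝ) ≤ (n / δ) ^ d / d.factorial := by positivity
            split_ifs with hi
            · simpa using hp
            · have := sum_sub_single m i hi
              refine (mul_le_mul hw (ih (m - Pi.single i 1) (by omega)) (norm_nonneg _) zero_le_one).trans (by rw [one_mul])
        _ = _ := by simp
    refine h1.trans ?_
    calc _ = (n / δ) ^ (d + 1) / (d + 1).factorial * (δ * (d + 1 : ℕ)) := by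
          rw [Nat.factorial_succ, pow_succ]
          push_cast
          have : (d.factorial : ℝ) ≠ 0 := by positivity
          field_simp
      _ ≤ _ := mul_le_mul_of_nonneg_left hq (by positivity)

lemma rs_cont (n : ℕ) : Continuous (rs n) := by unfold rs; fun_prop

lemma c_cont {n : ℕ} (hn : 1 ≤ n) {ν0 : ℕ → ℂ} (h : ∀ m : Fin n → ℕ, m ≠ 0 → qF m (rs n ν0) ≠ 0) (m : Fin n → ℕ) :
    ContinuousAt (fun ν => cF n ν m) ν0 := by
  induction hd : ∑ i, m i generalizing m with
  | zero =>
    obtain rfl : m = 0 := funext fun i => (sum_eq_zero_iff.mp hd) i (mem_univ i)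
    simp only [cF_zero]
    exact continuousAt_const
  | succ d ih =>
    have hm : m ≠ 0 := by rintro rfl; simp at hd
    simp only [cF_rec hn _ _ hm]
    refine ContinuousAt.div ?_ ((qF_cont m).comp (rs_cont n)).continuousAt (h m hm)
    refine tendsto_finsetSum _ fun i _ => ?_
    refine tendsto_const_nhds.mul ?_
    split_ifs with hi
    · exact tendsto_const_nhds
    · have := sum_sub_single m i hi
      exact ih (m - Pi.single i 1) (by omega)

lemma MF_cont {n : ℕ} (hn : 1 ≤ n) {ν0 : ℕ → ℂ} (h : ∀ m : Fin n → ℕ, m ≠ 0 → qF m (rs n ν0) ≠ 0) (η : Fin n → ℝ) :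
    ContinuousAt (fun ν => MF n ν η) ν0 := by
  obtain ⟨δ, hδ, hq⟩ := q_low h
  have hq' : ∀ᶠ ν in 𝓝 ν0, ∀ m : Fin n → ℕ, m ≠ 0 → δ * (∑ i, m i : ℕ) ≤ ‖qF m (rs n ν)‖ := (rs_cont n).continuousAt.eventually hq
  let g : (ℕ → ℂ) → ℂ := fun ν => ∑ i, sF (rs n ν) i * η i
  have hg : Continuous g := by
    have : ∀ i, Continuous fun ν : ℕ → ℂ => sF (rs n ν) i := fun i => by unfold sF rs; fun_prop
    exact continuous_finsetSum _ fun i _ => (this i).mul continuous_const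
  have hb : ∀ᶠ ν in 𝓝 ν0, (g ν).re < (g ν0).re + 1 :=
    ((Complex.continuous_re.comp hg).tendsto ν0).eventually (gt_mem_nhds (by simp))
  let C := Real.exp ((g ν0).re + 1)
  let r : Fin n → ℕ → ℝ := fun i k => (n / δ * Real.exp (η i)) ^ k / k.factorial
  have hr : Summable fun m : Fin n → ℕ => C * ∏ i, r i (m i) :=
    (sum_pi_real r (fun i b => by positivity) fun i => Real.summable_pow_div_factorial _).summable.mul_left C
  refine tendsto_tsum_of_dominated_convergence hr (fun m => ?_) ?_
  · refine (c_cont hn h m).tendsto.mul ?_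
    refine Continuous.tendsto (f := fun ν : ℕ → ℂ => Complex.exp (∑ i, (sF (rs n ν) i + m i) * η i)) ?_ ν0
    refine Complex.continuous_exp.comp ?_
    have : ∀ i, Continuous fun ν : ℕ → ℂ => sF (rs n ν) i := fun i => by unfold sF rs; fun_prop
    exact continuous_finsetSum _ fun i _ => ((this i).add continuous_const).mul continuous_const
  · filter_upwards [hq', hb] with ν h1 h2 m
    rw [norm_mul, Complex.norm_exp]
    have e1 : (∑ i, (sF (rs n ν) i + m i) * η i : ℂ).re = (g ν).re + ∑ i, (m i : ℝ) * η i := by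
      simp only [add_mul, sum_add_distrib, Complex.add_re, g]
      congr 1
      have : (∑ i, (m i : ℂ) * η i) = ((∑ i, (m i : ℝ) * η i : ℝ) : ℂ) := by push_cast; rfl
      rw [this, Complex.ofReal_re]
    rw [e1, Real.exp_add]
    have e2 : ∏ i, r i (m i) = (n / δ) ^ (∑ i, m i) / (∏ i, (m i).factorial : ℕ) * Real.exp (∑ i, (m i : ℝ) * η i) := by
      simp only [r, mul_pow, prod_div_distrib, prod_mul_distrib, prod_pow_eq_pow_sum, Real.exp_sum, ← Real.exp_nat_mul]
      push_cast
      ring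
    have h3 := c_bound hn ν hδ h1 m
    have h4 : ((∏ i, (m i).factorial : ℕ) : ℝ) ≤ (∑ i, m i).factorial := by
      exact_mod_cast Nat.le_of_dvd (Nat.factorial_pos _) (Nat.prod_factorial_dvd_factorial_sum univ m)
    have h5 : (0 : ℝ) < (∏ i, (m i).factorial : ℕ) := by
      exact_mod_cast prod_pos fun i _ => Nat.factorial_pos _
    have h6 : ‖cF n ν m‖ ≤ (n / δ) ^ (∑ i, m i) / (∏ i, (m i).factorial : ℕ) :=
      h3.trans (div_le_div_of_nonneg_left (by positivity) h5 h4)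
    rw [e2]
    calc _ ≤ (n / δ) ^ (∑ i, m i) / (∏ i, (m i).factorial : ℕ) * (C * Real.exp (∑ i, (m i : ℝ) * η i)) := by
          refine mul_le_mul h6 ?_ (by positivity) (by positivity)
          exact mul_le_mul_of_nonneg_right (Real.exp_le_exp.mpr h2.le) (Real.exp_pos _).le
      _ = _ := by ring

end

section
open Filter Topology

lemma ker_bd (K : ℕ) (h x : ℝ) : Real.exp (-(Real.exp x + Real.exp (h - x))) * Real.exp (K * |x|) ≤
    (K + 1).factorial * Real.exp ((K + 1) * |h|) * Real.exp (-|x|) := by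
  have key : ∀ t : ℝ, Real.exp (-Real.exp t) ≤ (K + 1).factorial * Real.exp (-((K + 1) * t)) := fun t => by
    have := Real.pow_div_factorial_le_exp (Real.exp t) (Real.exp_pos t).le (K + 1)
    rw [← Real.exp_nat_mul, div_le_iff₀ (by positivity)] at this
    push_cast at this
    rw [Real.exp_neg, Real.exp_neg, inv_le_iff_one_le_mul₀ (Real.exp_pos _), mul_assoc, mul_comm,
      mul_assoc, ← div_eq_inv_mul, le_div_iff₀ (Real.exp_pos _), one_mul]
    linarith
  have hf : (0 : ℝ) < (K + 1).factorial := by positivity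
  rcases le_or_gt 0 x with hx | hx
  · rw [abs_of_nonneg hx]
    calc Real.exp (-(Real.exp x + Real.exp (h - x))) * Real.exp (K * x)
        ≤ Real.exp (-Real.exp x) * Real.exp (K * x) := by
          gcongr; linarith [Real.exp_pos (h - x)]
      _ ≤ ((K + 1).factorial * Real.exp (-((K + 1) * x))) * Real.exp (K * x) := by
          gcongr; exact key x
      _ = (K + 1).factorial * 1 * Real.exp (-x) := by
          rw [mul_assoc, ← Real.exp_add, mul_one]; ring_nf
      _ ≤ _ := by
          gcongr; exact Real.one_le_exp (by positivity)
  · rw [abs_of_neg hx]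
    calc Real.exp (-(Real.exp x + Real.exp (h - x))) * Real.exp (K * -x)
        ≤ Real.exp (-Real.exp (h - x)) * Real.exp (K * -x) := by
          gcongr; linarith [Real.exp_pos x]
      _ ≤ ((K + 1).factorial * Real.exp (-((K + 1) * (h - x)))) * Real.exp (K * -x) := by
          gcongr; exact key _
      _ = (K + 1).factorial * Real.exp ((K + 1) * (-h)) * Real.exp (-(-x)) := by
          rw [mul_assoc, ← Real.exp_add, mul_assoc, ← Real.exp_add]; ring_nf
      _ ≤ _ := by
          gcongr; exact neg_le_abs h

lemma int_exp_abs : Integrable fun x : ℝ => Real.exp (-|x|) := by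
  rw [← integrableOn_univ, ← Set.Iic_union_Ioi (a := (0 : ℝ))]
  refine IntegrableOn.union ((integrableOn_exp_Iic 0).congr_fun (fun x hx => ?_) measurableSet_Iic)
    ((exp_neg_integrableOn_Ioi 0 one_pos).congr_fun (fun x hx => ?_) measurableSet_Ioi)
  · simp [abs_of_nonpos (Set.mem_Iic.1 hx)]
  · simp [abs_of_pos (Set.mem_Ioi.1 hx)]

/-- families depending continuously on a parameter, with locally uniform exponential bounds -/
structure Fam (k N : ℕ) (F : (Fin k → ℂ) → (Fin N → ℝ) → ℂ) : Prop where
  ms : ∀ p, Measurable (F p)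
  bd : ∀ R : ℕ, ∃ A : ℝ, 0 ≤ A ∧ ∃ C : ℕ, ∀ p, ‖p‖ ≤ R → ∀ η, ‖F p η‖ ≤ A * Real.exp (C * ∑ i, |η i|)
  ct : ∀ η, Continuous fun p => F p η

/-- the integrand of `UR` -/
def URi (N : ℕ) (ν : ℂ) (c : ℝ) (F : (Fin N → ℝ) → ℂ) (η : Fin (N + 1) → ℝ) (ξ : Fin N → ℝ) : ℂ :=
    Complex.exp (-(∑ i, (Real.exp (ξ i) + Real.exp (η i.castSucc - ξ i)) : ℝ)) *
      (Complex.exp (ν * (∑ i, ξ i : ℝ)) *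
        F fun i => η i.castSucc - ξ i + (Fin.snoc ξ (c * η (Fin.last N)) : Fin (N + 1) → ℝ) i.succ)

lemma UR_URi (N : ℕ) (ν : ℂ) (c : ℝ) (F : (Fin N → ℝ) → ℂ) (η : Fin (N + 1) → ℝ) :
    UR N ν c F η = Complex.exp (ν * (c * η (Fin.last N) : ℝ)) * ∫ ξ : Fin N → ℝ, URi N ν c F η ξ := rfl

lemma sum_arg {N : ℕ} {c : ℝ} (hc : |c| ≤ 1) (η : Fin (N + 1) → ℝ) (ξ : Fin N → ℝ) :
    ∑ i : Fin N, |η i.castSucc - ξ i + (Fin.snoc ξ (c * η (Fin.last N)) : Fin (N + 1) → ℝ) i.succ| ≤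
      ∑ i, |η i| + 2 * ∑ i, |ξ i| := by
  have h1 : ∑ i : Fin N, |(Fin.snoc ξ (c * η (Fin.last N)) : Fin (N + 1) → ℝ) i.succ| ≤ ∑ i, |ξ i| + |η (Fin.last N)| := by
    have e1 := Fin.sum_univ_succ fun i => |(Fin.snoc ξ (c * η (Fin.last N)) : Fin (N + 1) → ℝ) i|
    have e2 := Fin.sum_univ_castSucc fun i => |(Fin.snoc ξ (c * η (Fin.last N)) : Fin (N + 1) → ℝ) i|
    simp only [Fin.snoc_castSucc, Fin.snoc_last] at e2
    have h3 : |c * η (Fin.last N)| ≤ |η (Fin.last N)| := by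
      rw [abs_mul]; exact mul_le_of_le_one_left (abs_nonneg _) hc
    have h4 := abs_nonneg ((Fin.snoc ξ (c * η (Fin.last N)) : Fin (N + 1) → ℝ) 0)
    linarith
  have h2 : ∀ i : Fin N, |η i.castSucc - ξ i + (Fin.snoc ξ (c * η (Fin.last N)) : Fin (N + 1) → ℝ) i.succ| ≤
      |η i.castSucc| + |ξ i| + |(Fin.snoc ξ (c * η (Fin.last N)) : Fin (N + 1) → ℝ) i.succ| := fun i =>
    (abs_add_le _ _).trans (by gcongr; exact abs_sub _ _)
  have h3 := sum_le_sum fun i (_ : i ∈ univ) => h2 i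
  rw [sum_add_distrib, sum_add_distrib] at h3
  rw [Fin.sum_univ_castSucc fun i => |η i|]
  linarith

lemma re_mul_bd {ν : ℂ} {R : ℝ} (h : ‖ν‖ ≤ R) (x : ℝ) : (ν * (x : ℂ)).re ≤ R * |x| := by
  refine (Complex.re_le_norm _).trans ?_
  rw [norm_mul, Complex.norm_real, Real.norm_eq_abs]
  gcongr

lemma URi_bd {N R C : ℕ} {ν : ℂ} (hν : ‖ν‖ ≤ R) {c : ℝ} (hc : |c| ≤ 1) {F : (Fin N → ℝ) → ℂ} {A : ℝ} (hA : 0 ≤ A)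
    (hF : ∀ η, ‖F η‖ ≤ A * Real.exp (C * ∑ i, |η i|)) (η : Fin (N + 1) → ℝ) (ξ : Fin N → ℝ) :
    ‖URi N ν c F η ξ‖ ≤ A * ((R + 2 * C + 1).factorial : ℝ) ^ N * Real.exp ((R + 3 * C + 1 : ℕ) * ∑ i, |η i|) *
      ∏ i, Real.exp (-|ξ i|) := by
  have h1 := hF fun i => η i.castSucc - ξ i + (Fin.snoc ξ (c * η (Fin.last N)) : Fin (N + 1) → ℝ) i.succ
  have h2 : ‖Complex.exp (ν * (∑ i, ξ i : ℝ))‖ ≤ Real.exp (R * ∑ i, |ξ i|) := by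
    rw [Complex.norm_exp, Real.exp_le_exp]
    refine (re_mul_bd hν _).trans ?_
    gcongr
    exact Finset.abs_sum_le_sum_abs _ _
  have h3 : ‖Complex.exp (-(∑ i, (Real.exp (ξ i) + Real.exp (η i.castSucc - ξ i)) : ℝ))‖ =
      ∏ i, Real.exp (-(Real.exp (ξ i) + Real.exp (η i.castSucc - ξ i))) := by
    rw [← Complex.ofReal_neg, Complex.norm_exp, Complex.ofReal_re, ← Real.exp_sum, sum_neg_distrib]
  rw [URi, norm_mul, norm_mul, h3]
  calc _ ≤ (∏ i, Real.exp (-(Real.exp (ξ i) + Real.exp (η i.castSucc - ξ i)))) *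
        (Real.exp (R * ∑ i, |ξ i|) * (A * Real.exp (C * (∑ i, |η i| + 2 * ∑ i, |ξ i|)))) := by
        refine mul_le_mul_of_nonneg_left (mul_le_mul h2 (h1.trans ?_) (norm_nonneg _) (by positivity)) (by positivity)
        gcongr
        exact sum_arg hc η ξ
    _ = A * Real.exp (C * ∑ i, |η i|) * ∏ i, (Real.exp (-(Real.exp (ξ i) + Real.exp (η i.castSucc - ξ i))) *
          Real.exp ((R + 2 * C : ℕ) * |ξ i|)) := by
        rw [prod_mul_distrib, ← Real.exp_sum (f := fun i => ((R + 2 * C : ℕ) : ℝ) * |ξ i|), ← mul_sum]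
        have : Real.exp (R * ∑ i, |ξ i|) * Real.exp (C * (∑ i, |η i| + 2 * ∑ i, |ξ i|)) =
            Real.exp (C * ∑ i, |η i|) * Real.exp ((R + 2 * C : ℕ) * ∑ i, |ξ i|) := by
          rw [← Real.exp_add, ← Real.exp_add]; push_cast; ring_nf
        linear_combination (A * ∏ i, Real.exp (-(Real.exp (ξ i) + Real.exp (η i.castSucc - ξ i)))) * this
    _ ≤ A * Real.exp (C * ∑ i, |η i|) * ∏ i, ((R + 2 * C + 1).factorial *
          Real.exp (((R + 2 * C : ℕ) + 1) * |η i.castSucc|) * Real.exp (-|ξ i|)) := by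
        refine mul_le_mul_of_nonneg_left (prod_le_prod (fun i _ => by positivity) fun i _ => ker_bd _ _ _) (by positivity)
    _ = A * ((R + 2 * C + 1).factorial : ℝ) ^ N * Real.exp (C * ∑ i, |η i|) *
          Real.exp ((R + 2 * C + 1 : ℕ) * ∑ i : Fin N, |η i.castSucc|) * ∏ i, Real.exp (-|ξ i|) := by
        rw [prod_mul_distrib, prod_mul_distrib, ← Real.exp_sum (f := fun i => (((R + 2 * C : ℕ) : ℝ) + 1) * |η (Fin.castSucc i)|),
          ← mul_sum, prod_const, Finset.card_univ, Fintype.card_fin]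
        push_cast
        ring
    _ ≤ A * ((R + 2 * C + 1).factorial : ℝ) ^ N * Real.exp (C * ∑ i, |η i|) *
          Real.exp ((R + 2 * C + 1 : ℕ) * ∑ i, |η i|) * ∏ i, Real.exp (-|ξ i|) := by
        gcongr
        rw [Fin.sum_univ_castSucc fun i => |η i|]
        linarith [abs_nonneg (η (Fin.last N))]
    _ = _ := by
        rw [mul_assoc (A * _), ← Real.exp_add]; push_cast; ring_nf

lemma int_prod (N : ℕ) : Integrable fun ξ : Fin N → ℝ => ∏ i, Real.exp (-|ξ i|) :=
  Integrable.fintype_prod fun _ => int_exp_abs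

lemma URi_meas (N : ℕ) (ν : ℂ) (c : ℝ) {F : (Fin N → ℝ) → ℂ} (hF : Measurable F) :
    Measurable fun x : (Fin (N + 1) → ℝ) × (Fin N → ℝ) => URi N ν c F x.1 x.2 := by
  unfold URi
  refine Measurable.mul (Continuous.measurable ?_) (Measurable.mul (Continuous.measurable ?_) (hF.comp (Continuous.measurable ?_)))
  · fun_prop
  · fun_prop
  · refine continuous_pi fun i => Continuous.add (by fun_prop) ?_
    have : Continuous fun x : (Fin (N + 1) → ℝ) × (Fin N → ℝ) => (Fin.snoc x.2 (c * x.1 (Fin.last N)) : Fin (N + 1) → ℝ) :=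
      Continuous.finSnoc continuous_snd (by fun_prop)
    exact (continuous_apply i.succ).comp this

lemma Fam.UR {k N : ℕ} {F : (Fin k → ℂ) → (Fin N → ℝ) → ℂ} (h : Fam k N F) {ν : (Fin k → ℂ) → ℂ} (hν : Continuous ν)
    (hb : ∀ p, ‖ν p‖ ≤ ‖p‖) {c : ℝ} (hc : |c| ≤ 1) : Fam k (N + 1) fun p => UR N (ν p) c (F p) where
  ms p := by
    simp only [funext fun η => UR_URi N (ν p) c (F p) η]
    refine Measurable.mul (Continuous.measurable (by fun_prop)) ?_
    exact (URi_meas N (ν p) c (h.ms p)).stronglyMeasurable.integral_prod_right.measurable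
  bd R := by
    obtain ⟨A, hA, C, hF⟩ := h.bd R
    refine ⟨A * ((R + 2 * C + 1).factorial : ℝ) ^ N * ∫ ξ : Fin N → ℝ, ∏ i, Real.exp (-|ξ i|), by positivity,
      R + (R + 3 * C + 1), fun p hp η => ?_⟩
    have hR := (hb p).trans hp
    rw [UR_URi, norm_mul]
    have h1 : ‖Complex.exp (ν p * (c * η (Fin.last N) : ℝ))‖ ≤ Real.exp (R * ∑ i, |η i|) := by
      rw [Complex.norm_exp, Real.exp_le_exp]
      refine (re_mul_bd hR _).trans ?_
      gcongr
      rw [abs_mul]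
      exact (mul_le_of_le_one_left (abs_nonneg _) hc).trans
        (single_le_sum (f := fun i => |η i|) (fun i _ => abs_nonneg _) (mem_univ _))
    have h2 := norm_integral_le_of_norm_le ((int_prod N).const_mul (A * ((R + 2 * C + 1).factorial : ℝ) ^ N *
      Real.exp ((R + 3 * C + 1 : ℕ) * ∑ i, |η i|))) (.of_forall (URi_bd hR hc hA (hF p hp) η))
    rw [integral_const_mul] at h2
    refine (mul_le_mul h1 h2 (norm_nonneg _) (Real.exp_pos _).le).trans (le_of_eq ?_)
    rw [Nat.cast_add R (R + 3 * C + 1), add_mul, Real.exp_add]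
    ring
  ct η := by
    rw [continuous_iff_continuousAt]
    intro p0
    obtain ⟨R, hR⟩ := exists_nat_gt ‖p0‖
    obtain ⟨A, hA, C, hF⟩ := h.bd R
    simp only [UR_URi]
    refine ContinuousAt.mul (by fun_prop) ?_
    refine continuousAt_of_dominated (bound := fun ξ : Fin N → ℝ => A * ((R + 2 * C + 1).factorial : ℝ) ^ N *
      Real.exp ((R + 3 * C + 1 : ℕ) * ∑ i, |η i|) * ∏ i, Real.exp (-|ξ i|)) (.of_forall fun p => ?_) ?_
      ((int_prod N).const_mul _) (.of_forall fun ξ => ?_)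
    · exact ((URi_meas N (ν p) c (h.ms p)).comp measurable_prodMk_left).aestronglyMeasurable
    · have : ∀ᶠ p in 𝓝 p0, ‖p‖ < R := (continuous_norm.tendsto p0).eventually (gt_mem_nhds hR)
      filter_upwards [this] with p hp
      exact .of_forall (URi_bd ((hb p).trans hp.le) hc hA (hF p hp.le) η)
    · unfold URi
      refine Continuous.continuousAt ?_
      exact continuous_const.mul (Continuous.mul (by fun_prop) (h.ct _))

lemma norm_init_le {n : ℕ} (v : Fin (n + 1) → ℂ) : ‖Fin.init v‖ ≤ ‖v‖ :=
  (pi_norm_le_iff_of_nonneg (norm_nonneg _)).2 fun i => norm_le_pi_norm v i.castSucc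

lemma WW_fam (n : ℕ) : Fam n n (WW n) := by
  induction n with
  | zero => exact ⟨fun p => measurable_const, fun R => ⟨1, zero_le_one, 0, fun p _ η => by simp [WW]⟩, fun η => continuous_const⟩
  | succ n ih =>
    have h0 : Fam (n + 1) n fun v => WW n (Fin.init v) :=
      ⟨fun p => ih.ms _, fun R => by
        obtain ⟨A, hA, C, hF⟩ := ih.bd R
        exact ⟨A, hA, C, fun p hp η => hF _ ((norm_init_le p).trans hp) η⟩, fun η => (ih.ct η).comp (by unfold Fin.init; fun_prop)⟩
    have h1 := h0.UR (ν := fun v => v (Fin.last n)) (by fun_prop) (fun p => norm_le_pi_norm p _) (c := 1) (by simp)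
    have h2 := h1.UR (ν := fun v => -v (Fin.last n)) (by fun_prop) (fun p => by rw [norm_neg]; exact norm_le_pi_norm p _) (c := 0) (by simp)
    refine ⟨fun p => (h2.ms p).comp (Continuous.measurable (f := fun η : Fin (n + 1) → ℝ => (Fin.snoc η 0 : Fin (n + 2) → ℝ)) ?_), fun R => ?_, fun η => h2.ct _⟩
    · exact Continuous.finSnoc continuous_id continuous_const
    · obtain ⟨A, hA, C, hF⟩ := h2.bd R
      refine ⟨A, hA, C, fun p hp η => (hF p hp _).trans (le_of_eq ?_)⟩
      rw [Fin.sum_univ_castSucc]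
      simp

end

section
open Filter Topology

lemma dense_ai (n : ℕ) : Dense {x : Fin n → ℂ | AlgebraicIndependent ℚ x} := by
  induction n with
  | zero =>
    have : {x : Fin 0 → ℂ | AlgebraicIndependent ℚ x} = Set.univ := by
      ext x
      simp only [Set.mem_ofPred_eq, Set.mem_univ, iff_true]
      exact algebraicIndependent_empty_type_iff.2 (algebraMap ℚ ℂ).injective
    rw [this]; exact dense_univ
  | succ n ih =>
    rw [Metric.dense_iff] at ih ⊢
    intro x r hr
    obtain ⟨x', hx', hi⟩ := ih (Fin.init x) r hr
    have hi : AlgebraicIndependent ℚ x' := hi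
    have hc : Countable (Algebra.adjoin ℚ (Set.range x')) := by
      have h : Countable (MvPolynomial (Fin n) ℚ) := by
        rw [← Cardinal.mk_le_aleph0_iff]
        refine MvPolynomial.cardinalMk_le_max.trans ?_
        simp
      rw [Algebra.adjoin_range_eq_range_aeval]
      exact (Set.countable_range (MvPolynomial.aeval x' : MvPolynomial (Fin n) ℚ →ₐ[ℚ] ℂ)).to_subtype
    have hd := (Algebraic.countable (Algebra.adjoin ℚ (Set.range x')) ℂ).dense_compl ℝ
    rw [Metric.dense_iff] at hd
    obtain ⟨a, ha, ht⟩ := hd (x (Fin.last n)) r hr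
    refine ⟨(Fin.snoc x' a : Fin (n + 1) → ℂ), ?_, ?_⟩
    · rw [Metric.mem_ball, dist_pi_lt_iff hr]
      intro i
      refine Fin.lastCases ?_ (fun i => ?_) i
      · simpa using ha
      · rw [Fin.snoc_castSucc]
        exact (dist_pi_lt_iff hr).1 hx' i
    · have h2 := (hi.option_iff_transcendental a).2 ht
      have h3 := h2.comp finSuccEquivLast finSuccEquivLast.injective
      suffices e : (Fin.snoc x' a : Fin (n + 1) → ℂ) = (fun o : Option (Fin n) => o.elim a x') ∘ finSuccEquivLast by
        rw [e]; exact h3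
      funext i
      refine Fin.lastCases ?_ (fun i => ?_) i
      · simp
      · simp

/-- second regularity condition -/
def Sep {n : ℕ} (x : Fin n → ℂ) : Prop :=
  ∀ w w' : SignedPerm n, w ≠ w' → ¬ ∀ i, ∃ k : ℤ, wA w x i - wA w' x i = k

lemma Sep.two {n : ℕ} {x : Fin n → ℂ} (h : Sep x) (w : SignedPerm n) (i : Fin n) (k : ℤ) : 2 * wA w x i ≠ k := by
  intro e
  refine h w (w.1, Function.update w.2 i (!w.2 i)) (fun e => ?_) fun j => ?_
  · have := congrFun (congrArg Prod.snd e) i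
    simp at this
  · by_cases hj : j = i
    · subst hj
      refine ⟨k, e ▸ ?_⟩
      cases hb : w.2 j <;> simp [wA, hb] <;> ring
    · exact ⟨0, by simp [wA, hj]⟩

lemma Sep.sub {n : ℕ} {x : Fin n → ℂ} (h : Sep x) (w : SignedPerm n) {i j : Fin n} (hij : i ≠ j) (k : ℤ) :
    wA w x i - wA w x j ≠ k := by
  intro e
  refine h w (w.1 * Equiv.swap i j, fun l => w.2 (Equiv.swap i j l)) (fun e => ?_) fun l => ?_
  · have := congrArg Prod.fst e
    have := congrArg (fun σ : Equiv.Perm (Fin n) => σ i) this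
    simp at this
    exact hij this
  · have e2 : wA (w.1 * Equiv.swap i j, fun l => w.2 (Equiv.swap i j l)) x l = wA w x (Equiv.swap i j l) := rfl
    rw [e2]
    by_cases hi : l = i
    · subst hi; exact ⟨k, by rw [Equiv.swap_apply_left, e]⟩
    by_cases hj : l = j
    · subst hj; exact ⟨-k, by rw [Equiv.swap_apply_right]; push_cast; rw [← e]; ring⟩
    · exact ⟨0, by rw [Equiv.swap_apply_of_ne_of_ne hi hj]; simp⟩

lemma Sep.add {n : ℕ} {x : Fin n → ℂ} (h : Sep x) (w : SignedPerm n) {i j : Fin n} (hij : i ≠ j) (k : ℤ) :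
    wA w x i + wA w x j ≠ k := by
  intro e
  refine h w (w.1 * Equiv.swap i j, fun l => if l = i ∨ l = j then !w.2 (Equiv.swap i j l) else w.2 l) (fun e => ?_) fun l => ?_
  · have := congrArg Prod.fst e
    have := congrArg (fun σ : Equiv.Perm (Fin n) => σ i) this
    simp at this
    exact hij this
  · by_cases hi : l = i
    · subst hi
      refine ⟨k, e ▸ ?_⟩
      cases hb : w.2 j <;> simp [wA, hb, sub_eq_add_neg]
    by_cases hj : l = j
    · subst hj
      refine ⟨k, e ▸ ?_⟩
      cases hb : w.2 i <;> simp [wA, hb] <;> ring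
    · exact ⟨0, by simp [wA, hi, hj, Equiv.swap_apply_of_ne_of_ne]⟩

lemma Gamma_cont {z : ℂ} (h : ∀ k : ℤ, z ≠ k) : ContinuousAt Complex.Gamma z :=
  (Complex.differentiableAt_Gamma z fun m => by simpa using h (-m)).continuousAt

lemma wA_cont {n : ℕ} (w : SignedPerm n) : Continuous (wA w) :=
  continuous_pi fun i => continuous_const.mul (continuous_apply _)

lemma GammaF_cont {n : ℕ} {x : Fin n → ℂ} (h : Sep x) (w : SignedPerm n) :
    ContinuousAt (fun x => GammaF (wA w x)) x := by
  refine ContinuousAt.comp (f := wA w) (g := GammaF) ?_ (wA_cont w).continuousAt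
  have G : ∀ {g : (Fin n → ℂ) → ℂ} (_ : Continuous g), (∀ k : ℤ, g (wA w x) ≠ k) →
      ContinuousAt (fun v => Complex.Gamma (g v)) (wA w x) := fun hg hk =>
    ContinuousAt.comp (Gamma_cont hk) hg.continuousAt
  unfold GammaF
  refine ContinuousAt.mul (tendsto_finsetProd _ fun i _ => tendsto_finsetProd _ fun j _ => ?_) (tendsto_finsetProd _ fun i _ => ?_)
  · split_ifs with hij
    · refine ContinuousAt.mul (G (by fun_prop) fun k e => ?_) (G (by fun_prop) fun k e => ?_)
      · exact h.add w hij.ne (-k) (by push_cast; rw [← e]; ring)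
      · exact h.sub w hij.ne (-k) (by push_cast; rw [← e]; ring)
    · exact tendsto_const_nhds
  · exact G (g := fun v => -(2 * v i)) (by fun_prop) fun k e => h.two w i (-k) (by push_cast; rw [← e]; ring)

/-- extend a vector to a `1`-based sequence -/
def ex (n : ℕ) (ν : ℕ → ℂ) (x : Fin n → ℂ) : ℕ → ℂ :=
  fun i => if h : 1 ≤ i ∧ i ≤ n then x ⟨i - 1, by omega⟩ else ν i

lemma rs_ex (n : ℕ) (ν : ℕ → ℂ) (x : Fin n → ℂ) : rs n (ex n ν x) = x := by
  funext i
  have : 1 ≤ i.val + 1 ∧ i.val + 1 ≤ n := ⟨by omega, i.2⟩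
  simp [rs, ex, this]

lemma ex_rs (n : ℕ) (ν : ℕ → ℂ) : ex n ν (rs n ν) = ν := by
  funext i
  by_cases h : 1 ≤ i ∧ i ≤ n
  · have : i - 1 + 1 = i := by omega
    simp [rs, ex, h, this]
  · simp [ex, h]

lemma ex_cont (n : ℕ) (ν : ℕ → ℂ) (w : SignedPerm n) : Continuous fun x => wAct n w (ex n ν x) := by
  have h : Continuous (ex n ν) := continuous_pi fun i => by
    unfold ex
    split_ifs <;> fun_prop
  refine continuous_pi fun i => ?_
  unfold wAct
  split_ifs <;> fun_prop

lemma main_id {n : ℕ} (hn : 1 ≤ n) {ν : ℕ → ℂ} (hq : ∀ (w : SignedPerm n) (m : Fin n → ℕ), m ≠ 0 → qF m (wA w (rs n ν)) ≠ 0)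
    (hs : Sep (rs n ν)) (η : Fin n → ℝ) :
    WW n (rs n ν) η = ∑ w : SignedPerm n, GammaF (wA w (rs n ν)) * MF n (wAct n w ν) η := by
  have hA : Tendsto (fun x => WW n x η) (𝓝 (rs n ν)) (𝓝 (WW n (rs n ν) η)) := ((WW_fam n).ct η).tendsto _
  have hB : Tendsto (fun x => ∑ w : SignedPerm n, GammaF (wA w x) * MF n (wAct n w (ex n ν x)) η) (𝓝 (rs n ν))
      (𝓝 (∑ w : SignedPerm n, GammaF (wA w (rs n ν)) * MF n (wAct n w (ex n ν (rs n ν))) η)) := by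
    refine tendsto_finsetSum _ fun w _ => (GammaF_cont hs w).tendsto.mul ?_
    refine ContinuousAt.comp (f := fun x => wAct n w (ex n ν x)) (g := fun ν => MF n ν η) ?_ (ex_cont n ν w).continuousAt
    refine MF_cont hn (fun m hm => ?_) η
    rw [rs_wAct, rs_ex]
    exact hq w m hm
  rw [ex_rs] at hB
  refine tendsto_nhds_unique_of_frequently_eq hA hB ?_
  have hf := mem_closure_iff_frequently.1 (dense_ai n (rs n ν))
  have he : ∀ᶠ x in 𝓝 (rs n ν), ∀ (w : SignedPerm n) (m : Fin n → ℕ), m ≠ 0 → qF m (wA w x) ≠ 0 := by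
    rw [eventually_all]
    intro w
    obtain ⟨δ, hδ, h⟩ := q_low (hq w)
    filter_upwards [(wA_cont w).continuousAt.eventually h] with x hx m hm e
    have h1 := hx m hm
    rw [e, norm_zero] at h1
    have h2 : 0 < ∑ i, m i := by
      rw [pos_iff_ne_zero]
      intro h0
      exact hm (funext fun i => (sum_eq_zero_iff.mp h0) i (mem_univ i))
    have h3 : (0 : ℝ) < (∑ i, m i : ℕ) := by exact_mod_cast h2
    nlinarith
  refine (hf.and_eventually he).mono fun x hx => ?_
  have := gen_main hn (ν := ex n ν x) (by rw [rs_ex]; exact hx.1) (by rw [rs_ex]; exact hx.2) η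
  rw [rs_ex] at this
  exact this

end

/-- expansion of the class one Whittaker function in terms of
fundamental Whittaker functions. -/
theorem stmt0 (n : ℕ) (hn : 1 ≤ n) (ν : ℕ → ℂ) (hreg : Regular n ν)
    (y : ℕ → ℝ) (hy : ∀ i ∈ Finset.Icc 1 n, 0 < y i) :
    Wt n ν y = ∑ w : SignedPerm n, GammaN n (wAct n w ν) * Mt n (wAct n w ν) y := by
  have hq : ∀ (w : SignedPerm n) (m : Fin n → ℕ), m ≠ 0 → qF m (wA w (rs n ν)) ≠ 0 := fun w m hm => by
    rw [← rs_wAct, ← qB_eq n hn]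
    refine hreg.1 w _ ?_
    rw [sum_extN, pos_iff_ne_zero]
    intro h0
    exact hm (funext fun i => (Finset.sum_eq_zero_iff.mp h0) i (Finset.mem_univ i))
  have hs : Sep (rs n ν) := fun w w' hw hc => by
    refine hreg.2 w w' hw fun i hi => ?_
    rw [Finset.mem_Icc] at hi
    obtain ⟨k, hk⟩ := hc ⟨i - 1, by omega⟩
    have e : i - 1 + 1 = i := by omega
    refine ⟨k, ?_⟩
    rw [← rs_wAct, ← rs_wAct] at hk
    simpa only [rs, e] using hk
  have hm := main_id hn hq hs fun i => 2 * Real.log (Real.pi * y (i.val + 1))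
  obtain ⟨k, rfl⟩ : ∃ k, n = k + 1 := ⟨n - 1, by omega⟩
  rw [Wt_eq k ν y _ fun i => ?_, hm]
  · refine Finset.sum_congr rfl fun w _ => ?_
    rw [GammaN_eq, rs_wAct, Mt_eq _ hy]
  · have h1 : 0 < y (i.val + 1) := hy _ (Finset.mem_Icc.2 ⟨by omega, i.2⟩)
    rw [mul_div_cancel_left₀ _ (two_ne_zero), Real.exp_log (by positivity)]

end SO
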